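/- Let Ω ⊂ ℝⁿ be a bounded John domain with n ≥ 3, 1 < p < ∞, and let Π : W^{1,p}(Ω, ℝⁿ) → Σ be a projection (a continuous linear operator with Π(w) = w for all w ∈ Σ), where Σ, the kernel of l, is endowed with the topology of L^p(Ω, ℝⁿ). Then there exists a constant C such that ‖v − Π(v)‖_{W^{1,p}(Ω)} ≤ C ‖l(v)‖_{L^p(Ω)} for all v ∈ W^{1,p}(Ω, ℝⁿ). -/

import Mathlib

open MeasureTheory Metric Set Matrix
open scoped BigOperators ENNReal

noncomputable section

abbrev Euc (n : ℕ) := EuclideanSpace ℝ (Fin n)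

/-- Differential matrix `(Dv)_{ij} = ∂v_i/∂x_j` (computed via the Fréchet derivative). -/
def Dmat {n : ℕ} (v : Euc n → Euc n) (x : Euc n) : Matrix (Fin n) (Fin n) ℝ :=
  fun i j => fderiv ℝ v x (EuclideanSpace.single j 1) i

/-- Symmetric part of the differential matrix. -/
def epsMat {n : ℕ} (v : Euc n → Euc n) (x : Euc n) : Matrix (Fin n) (Fin n) ℝ :=
  (1 / 2 : ℝ) • (Dmat v x + (Dmat v x)ᵀ)

/-- Trace-free part of the symmetric part of the differential matrix. -/
def lMat {n : ℕ} (v : Euc n → Euc n) (x : Euc n) : Matrix (Fin n) (Fin n) ℝ :=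
  epsMat v x - (Matrix.trace (Dmat v x) / (n : ℝ)) • (1 : Matrix (Fin n) (Fin n) ℝ)

/-- Frobenius (Euclidean) norm of a matrix. -/
def matNorm {n : ℕ} (M : Matrix (Fin n) (Fin n) ℝ) : ℝ :=
  Real.sqrt (∑ i, ∑ j, (M i j) ^ 2)

/-- `M : N = Σ_{ij} M_{ij} N_{ij}`. -/
def matDot {n : ℕ} (M N : Matrix (Fin n) (Fin n) ℝ) : ℝ := ∑ i, ∑ j, M i j * N i j

/-- Distance to the boundary of `Ω`. -/
def distBd {n : ℕ} (Ω : Set (Euc n)) (x : Euc n) : ℝ := Metric.infDist x (frontier Ω)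

/-- Open axis-parallel cube with center `c` and side length `h`. -/
def openCube {n : ℕ} (c : Euc n) (h : ℝ) : Set (Euc n) := {x | ∀ i, |x i - c i| < h / 2}

/-- Closed axis-parallel cube with center `c` and side length `h`. -/
def closedCube {n : ℕ} (c : Euc n) (h : ℝ) : Set (Euc n) := {x | ∀ i, |x i - c i| ≤ h / 2}

/-- Bounded John domain: there are `C > 1` and a distinguished point `x₀ ∈ Ω` such that
every point of `Ω` is joined to `x₀` by a rectifiable curve, parameterized by arc length
(hence 1-Lipschitz), along which the distance to the boundary grows linearly. -/
def IsJohnDomain {n : ℕ} (Ω : Set (Euc n)) : Prop :=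
  ∃ C > (1 : ℝ), ∃ x₀ ∈ Ω, ∀ y ∈ Ω, ∃ L : ℝ, 0 ≤ L ∧ ∃ γ : ℝ → Euc n,
    γ 0 = y ∧ γ L = x₀ ∧ (∀ t ∈ Icc 0 L, γ t ∈ Ω) ∧
    (∀ s ∈ Icc 0 L, ∀ t ∈ Icc 0 L, dist (γ s) (γ t) ≤ |s - t|) ∧
    (∀ t ∈ Icc 0 L, t / C ≤ Metric.infDist (γ t) (frontier Ω))

/-- The matrix-valued functions `H_i`. -/
def Hmat {n : ℕ} (i : Fin n) (z : Euc n) : Matrix (Fin n) (Fin n) ℝ :=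
  fun j k => if j = k then z i else if k = i then z j else if j = i then -z k else 0

/-- The finite-dimensional space `V = D(Σ)`:
`φ(x) = A + λ I + Σ_i b_i H_i(x − y)` with `A` skew-symmetric. -/
def Vset (n : ℕ) : Set (Euc n → Matrix (Fin n) (Fin n) ℝ) :=
  {φ | ∃ (A : Matrix (Fin n) (Fin n) ℝ) (lam : ℝ) (b : Fin n → ℝ) (y : Euc n),
    Aᵀ = -A ∧ ∀ x, φ x = A + lam • (1 : Matrix (Fin n) (Fin n) ℝ) + ∑ i, b i • Hmat i (x - y)}

/-- Membership in the (strong form of the) Sobolev space `W^{1,p}(Ω, ℝⁿ)`. -/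
def memW1p {n : ℕ} (Ω : Set (Euc n)) (p : ℝ) (v : Euc n → Euc n) : Prop :=
  (∀ x ∈ Ω, DifferentiableAt ℝ v x) ∧
  IntegrableOn (fun x => ‖v x‖ ^ p) Ω ∧
  IntegrableOn (fun x => matNorm (Dmat v x) ^ p) Ω

/-- `‖v‖_{L^p(Ω)}`. -/
def LpNorm {n : ℕ} (Ω : Set (Euc n)) (p : ℝ) (v : Euc n → Euc n) : ℝ :=
  (∫ x in Ω, ‖v x‖ ^ p) ^ (1 / p)

/-- `‖v‖_{W^{1,p}(Ω)} = (‖v‖_{L^p}^p + ‖Dv‖_{L^p}^p)^{1/p}`. -/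
def W1pNorm {n : ℕ} (Ω : Set (Euc n)) (p : ℝ) (v : Euc n → Euc n) : ℝ :=
  ((∫ x in Ω, ‖v x‖ ^ p) + ∫ x in Ω, matNorm (Dmat v x) ^ p) ^ (1 / p)

/-- `Σ`, the kernel of `l` inside `W^{1,p}(Ω, ℝⁿ)`. -/
def memSigma {n : ℕ} (Ω : Set (Euc n)) (p : ℝ) (w : Euc n → Euc n) : Prop :=
  memW1p Ω p w ∧ ∀ x ∈ Ω, lMat w x = 0

lemma exists_norm_rpow_le_re_rpow {p : ℝ} (hp1 : 1 < p) (hp2 : p ≤ 2) :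
    ∃ A B : ℝ, 0 ≤ A ∧ 0 ≤ B ∧ ∀ z : ℂ, 0 ≤ z.re →
      ‖z‖ ^ p ≤ A * z.re ^ p - B * (z ^ (p : ℂ)).re := by
  have hpi := Real.pi_pos
  set c : ℝ := -Real.cos (p * (Real.pi / 2)) with hc
  have hc0 : 0 < c := by
    rw [hc, neg_pos]
    apply Real.cos_neg_of_pi_div_two_lt_of_lt <;> nlinarith
  have hcont : ContinuousAt (fun θ : ℝ => -Real.cos (p * θ)) (Real.pi / 2) := by fun_prop
  have hev := hcont.eventually (lt_mem_nhds (show c / 2 < -Real.cos (p * (Real.pi / 2)) by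
    rw [← hc]; linarith))
  obtain ⟨δ, hδ, hball⟩ := Metric.eventually_nhds_iff.1 hev
  set θ₀ : ℝ := Real.pi / 2 - min (δ / 2) (Real.pi / 4) with hθ₀
  have hm0 : 0 < min (δ / 2) (Real.pi / 4) := by positivity
  have hm1 := min_le_left (δ / 2) (Real.pi / 4)
  have hm2 := min_le_right (δ / 2) (Real.pi / 4)
  have hcos0 : 0 < Real.cos θ₀ := by
    apply Real.cos_pos_of_mem_Ioo; constructor <;> linarith
  have hcp : 0 < Real.cos θ₀ ^ p := by positivity
  refine ⟨(1 + 2 / c) / Real.cos θ₀ ^ p, 2 / c, by positivity, by positivity, fun z hz => ?_⟩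
  have harg := Complex.abs_arg_le_pi_div_two_iff.2 hz
  have hre : z.re ^ p = ‖z‖ ^ p * Real.cos |z.arg| ^ p := by
    rw [Real.cos_abs, ← Real.mul_rpow (norm_nonneg z), Complex.norm_mul_cos_arg]
    exact Real.cos_nonneg_of_mem_Icc (abs_le.1 harg |>.imp (by intro h; linarith) (fun h => h))
  have hre2 : (z ^ (p : ℂ)).re = ‖z‖ ^ p * Real.cos (p * |z.arg|) := by
    rw [Complex.cpow_ofReal_re, mul_comm p]
    rcases abs_choice z.arg with h | h <;> rw [h]
    rw [neg_mul, Real.cos_neg]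
  rw [hre, hre2]
  set θ := |z.arg|
  have hθ0 : 0 ≤ θ := abs_nonneg _
  have hN : 0 ≤ ‖z‖ ^ p := by positivity
  suffices h : 1 ≤ (1 + 2 / c) / Real.cos θ₀ ^ p * Real.cos θ ^ p - 2 / c * Real.cos (p * θ) by
    calc ‖z‖ ^ p = ‖z‖ ^ p * 1 := by ring
      _ ≤ ‖z‖ ^ p * _ := mul_le_mul_of_nonneg_left h hN
      _ = _ := by ring
  have hcθ : 0 ≤ Real.cos θ := Real.cos_nonneg_of_mem_Icc ⟨by linarith, harg⟩
  rcases le_total θ₀ θ with h | h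
  · have h1 : c / 2 < -Real.cos (p * θ) := by
      apply hball
      rw [Real.dist_eq, abs_lt]; constructor <;> linarith
    have h2 : 2 / c * (c / 2) ≤ 2 / c * (-Real.cos (p * θ)) :=
      mul_le_mul_of_nonneg_left h1.le (by positivity)
    have h3 : 2 / c * (c / 2) = 1 := by field_simp
    have h4 : 0 ≤ (1 + 2 / c) / Real.cos θ₀ ^ p * Real.cos θ ^ p := by positivity
    linarith
  · have h1 : Real.cos θ₀ ≤ Real.cos θ :=
      Real.cos_le_cos_of_nonneg_of_le_pi hθ0 (by linarith) h
    have h2 : Real.cos θ₀ ^ p ≤ Real.cos θ ^ p := by gcongr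
    have h3 : (1 + 2 / c) ≤ (1 + 2 / c) / Real.cos θ₀ ^ p * Real.cos θ ^ p := by
      rw [div_mul_eq_mul_div, le_div_iff₀ hcp]; gcongr
    have h4 : 2 / c * Real.cos (p * θ) ≤ 2 / c * 1 :=
      mul_le_mul_of_nonneg_left (Real.cos_le_one _) (by positivity)
    linarith

lemma fourier_one_coe (x : ℝ) :
    (fourier 1 (x : UnitAddCircle) : ℂ) = circleMap 0 1 (2 * Real.pi * x) := by
  rw [fourier_coe_apply, circleMap]
  simp only [zero_add, Complex.ofReal_one, one_mul]
  congr 1; push_cast; ring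

lemma integral_comp_fourier_one {F : ℂ → ℂ} (hF : DiffContOnCl ℂ F (ball 0 1)) :
    ∫ t : UnitAddCircle, F (fourier 1 t) = F 0 := by
  have h := DiffContOnCl.circleAverage (f := F) (c := 0) (R := 1) (by simpa using hF)
  rw [← h, Real.circleAverage_def, ← UnitAddCircle.intervalIntegral_preimage 0]
  simp_rw [fourier_one_coe]
  rw [intervalIntegral.integral_comp_mul_left (fun y => F (circleMap 0 1 y)) (by positivity)]
  simp

lemma exists_integral_norm_rpow_le_of_re_pos {p : ℝ} (hp1 : 1 < p) (hp2 : p ≤ 2) :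
    ∃ A : ℝ, 0 ≤ A ∧ ∀ G : ℂ → ℂ, Differentiable ℂ G → (G 0).im = 0 →
      (∀ t : UnitAddCircle, 0 < (G (fourier 1 t)).re) →
      ∫ t : UnitAddCircle, ‖G (fourier 1 t)‖ ^ p ≤
        A * ∫ t : UnitAddCircle, (G (fourier 1 t)).re ^ p := by
  obtain ⟨A, B, hA, hB, h⟩ := exists_norm_rpow_le_re_rpow hp1 hp2
  refine ⟨A, hA, fun G hG h0 hpos => ?_⟩
  have hsph : ∀ z ∈ sphere (0 : ℂ) 1, 0 < (G z).re := by
    intro z hz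
    have : ∃ t : UnitAddCircle, (fourier 1 t : ℂ) = z := by
      refine ⟨((z.arg / (2 * Real.pi) : ℝ) : UnitAddCircle), ?_⟩
      rw [fourier_one_coe, circleMap]
      have hz1 : ‖z‖ = 1 := by simpa using hz
      conv_rhs => rw [← Complex.norm_mul_exp_arg_mul_I z, hz1]
      have : 2 * Real.pi * (z.arg / (2 * Real.pi)) = z.arg := by field_simp
      rw [this]; simp
    obtain ⟨t, rfl⟩ := this
    exact hpos t
  have hGc : Continuous G := hG.continuous
  obtain ⟨z₀, hz₀, hmin⟩ := (isCompact_sphere (0 : ℂ) 1).exists_isMinOn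
    (NormedSpace.sphere_nonempty.2 zero_le_one)
    ((Complex.continuous_re.comp hGc).continuousOn)
  have hmin' : ∀ z ∈ sphere (0 : ℂ) 1, (G z₀).re ≤ (G z).re := fun z hz => hmin hz
  have hcl : ∀ z ∈ closedBall (0 : ℂ) 1, 0 < (G z).re := by
    intro z hz
    refine (hsph z₀ hz₀).trans_le ?_
    have := Complex.norm_le_of_forall_mem_frontier_norm_le (U := ball (0 : ℂ) 1)
      (f := fun z => Complex.exp (-G z)) (C := Real.exp (-(G z₀).re)) isBounded_ball
      (hG.neg.cexp.diffContOnCl) (fun z hz => by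
        rw [frontier_ball _ one_ne_zero] at hz
        simpa [Complex.norm_exp] using hmin' z hz) (z := z)
      (by rwa [closure_ball _ one_ne_zero])
    simpa [Complex.norm_exp] using this
  have hdc : DiffContOnCl ℂ (fun z => G z ^ (p : ℂ)) (ball 0 1) := by
    apply DifferentiableOn.diffContOnCl
    rw [closure_ball _ one_ne_zero]
    intro z hz
    exact ((hG z).cpow_const (Or.inl (hcl z hz))).differentiableWithinAt
  have hmv := integral_comp_fourier_one hdc
  have hc1 : Continuous fun t : UnitAddCircle => G (fourier 1 t) :=
    hGc.comp (fourier 1).continuous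
  have hc2 : Continuous fun t : UnitAddCircle => G (fourier 1 t) ^ (p : ℂ) := by
    refine continuous_iff_continuousAt.2 fun t => ?_
    exact (hc1.continuousAt).cpow continuousAt_const (Or.inl (hpos t))
  have hInt {f : UnitAddCircle → ℝ} (hf : Continuous f) : Integrable f :=
    hf.integrable_of_hasCompactSupport (HasCompactSupport.of_compactSpace f)
  have hi1 : Integrable fun t : UnitAddCircle => ‖G (fourier 1 t)‖ ^ p :=
    hInt (hc1.norm.rpow_const fun _ => Or.inr (by linarith))
  have hi2 : Integrable fun t : UnitAddCircle => (G (fourier 1 t)).re ^ p :=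
    hInt ((Complex.continuous_re.comp hc1).rpow_const fun _ => Or.inr (by linarith))
  have hi3 : Integrable fun t : UnitAddCircle => G (fourier 1 t) ^ (p : ℂ) :=
    hc2.integrable_of_hasCompactSupport (HasCompactSupport.of_compactSpace _)
  have hre : ∫ t : UnitAddCircle, (G (fourier 1 t) ^ (p : ℂ)).re = (G 0 ^ (p : ℂ)).re := by
    rw [← hmv]; exact integral_re hi3
  have hG0 : 0 ≤ (G 0 ^ (p : ℂ)).re := by
    have h1 := hcl 0 (by simp)
    have h2 : G 0 = ((G 0).re : ℂ) := Complex.ext (by simp) (by simp [h0])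
    rw [h2, ← Complex.ofReal_cpow h1.le, Complex.ofReal_re]
    positivity
  calc ∫ t : UnitAddCircle, ‖G (fourier 1 t)‖ ^ p
      ≤ ∫ t : UnitAddCircle,
        (A * (G (fourier 1 t)).re ^ p - B * (G (fourier 1 t) ^ (p : ℂ)).re) :=
        integral_mono hi1 ((hi2.const_mul A).sub ((hi3.re).const_mul B))
          fun t => h _ (hpos t).le
    _ = A * (∫ t : UnitAddCircle, (G (fourier 1 t)).re ^ p) - B * (G 0 ^ (p : ℂ)).re := by
        have h5 : Integrable fun t : UnitAddCircle => (G (fourier 1 t) ^ (p : ℂ)).re := hi3.re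
        rw [integral_sub (hi2.const_mul A) (h5.const_mul B), integral_const_mul,
          integral_const_mul, hre]
    _ ≤ _ := by nlinarith [mul_nonneg hB hG0]

/-- The analytic polynomial on the disc whose real part on the unit circle is
`Re (a e^{2πimt})`, with real value at the origin. -/
def analyticTerm (m : ℤ) (a : ℂ) (z : ℂ) : ℂ :=
  if 0 < m then a * z ^ m.toNat else if m = 0 then (a.re : ℂ)
    else (starRingEnd ℂ) a * z ^ (-m).toNat

lemma differentiable_analyticTerm (m : ℤ) (a : ℂ) : Differentiable ℂ (analyticTerm m a) := by
  unfold analyticTerm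
  split_ifs <;> fun_prop

lemma analyticTerm_zero_im (m : ℤ) (a : ℂ) : (analyticTerm m a 0).im = 0 := by
  unfold analyticTerm
  split_ifs with h1 h2
  · have : m.toNat ≠ 0 := by omega
    simp [this]
  · simp
  · have : (-m).toNat ≠ 0 := by omega
    simp [this]

lemma fourier_eq_pow (m : ℤ) (hm : 0 ≤ m) (t : UnitAddCircle) :
    (fourier m t : ℂ) = (fourier 1 t : ℂ) ^ m.toNat := by
  obtain ⟨k, rfl⟩ := Int.eq_ofNat_of_zero_le hm
  simp [fourier_apply, AddCircle.toCircle_nsmul]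

lemma analyticTerm_re (m : ℤ) (a : ℂ) (t : UnitAddCircle) :
    (analyticTerm m a (fourier 1 t)).re = (a * fourier m t).re := by
  unfold analyticTerm
  split_ifs with h1 h2
  · rw [fourier_eq_pow m h1.le]
  · subst h2; simp
  · rw [← fourier_eq_pow (-m) (by omega), fourier_neg, ← map_mul, Complex.conj_re]

lemma analyticTerm_add_I_mul (m : ℤ) (a : ℂ) (t : UnitAddCircle) :
    analyticTerm m a (fourier 1 t) + Complex.I * analyticTerm m (-Complex.I * a) (fourier 1 t) =
      (1 + (m.sign : ℂ)) * (a * fourier m t) := by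
  unfold analyticTerm
  split_ifs with h1 h2
  · rw [fourier_eq_pow m h1.le, Int.sign_eq_one_of_pos h1]
    linear_combination (-a * (fourier 1 t : ℂ) ^ m.toNat) * Complex.I_mul_I
  · subst h2
    simp only [Int.sign_zero, fourier_zero]
    apply Complex.ext <;> simp
  · have : m < 0 := by omega
    rw [Int.sign_eq_neg_one_of_neg this]
    simp only [map_mul, map_neg, Complex.conj_I]
    push_cast
    linear_combination ((starRingEnd ℂ) a * (fourier 1 t : ℂ) ^ (-m).toNat) * Complex.I_mul_I

lemma exists_re_approx (h : C(UnitAddCircle, ℝ)) {δ : ℝ} (hδ : 0 < δ) :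
    ∃ K : ℂ → ℂ, Differentiable ℂ K ∧ (K 0).im = 0 ∧
      ∀ t : UnitAddCircle, |(K (fourier 1 t)).re - h t| < δ := by
  let H : C(UnitAddCircle, ℂ) := ⟨fun t => (h t : ℂ), by fun_prop⟩
  have hH : H ∈ (Submodule.span ℂ (range <| @fourier 1)).topologicalClosure := by
    rw [span_fourier_closure_eq_top]; trivial
  obtain ⟨f, hf, hfd⟩ := Metric.mem_closure_iff.1 hH δ hδ
  obtain ⟨c, rfl⟩ := Finsupp.mem_span_range_iff_exists_finsupp.1 hf
  refine ⟨fun z => ∑ m ∈ c.support, analyticTerm m (c m) z, ?_, ?_, fun t => ?_⟩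
  · exact Differentiable.fun_sum fun m _ => differentiable_analyticTerm m (c m)
  · simp [Complex.im_sum, analyticTerm_zero_im]
  · have h1 := (ContinuousMap.dist_lt_iff hδ).1 hfd t
    rw [dist_comm, Complex.dist_eq] at h1
    have h2 := (Complex.abs_re_le_norm _).trans_lt h1
    refine lt_of_eq_of_lt ?_ h2
    congr 1
    simp only [Complex.re_sum, analyticTerm_re, Complex.sub_re, Finsupp.sum,
      ContinuousMap.coe_sum, Finset.sum_apply, ContinuousMap.coe_smul, Pi.smul_apply, smul_eq_mul]
    rfl

lemma add_three_rpow_le {p a b c : ℝ} (hp : 0 ≤ p) (ha : 0 ≤ a) (hb : 0 ≤ b) (hc : 0 ≤ c) :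
    (a + b + c) ^ p ≤ 3 ^ p * (a ^ p + b ^ p + c ^ p) := by
  have ha' : 0 ≤ a ^ p := by positivity
  have hb' : 0 ≤ b ^ p := by positivity
  have hc' : 0 ≤ c ^ p := by positivity
  have key : ∀ x, 0 ≤ x → a + b + c ≤ 3 * x → x ^ p ≤ a ^ p + b ^ p + c ^ p →
      (a + b + c) ^ p ≤ 3 ^ p * (a ^ p + b ^ p + c ^ p) := fun x hx h1 h2 =>
    calc (a + b + c) ^ p ≤ (3 * x) ^ p := by gcongr
      _ = 3 ^ p * x ^ p := Real.mul_rpow (by norm_num) hx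
      _ ≤ _ := by gcongr
  rcases le_total a b with h1 | h1 <;> rcases le_total b c with h2 | h2 <;>
    rcases le_total a c with h3 | h3
  all_goals first
    | exact key a ha (by linarith) (by linarith)
    | exact key b hb (by linarith) (by linarith)
    | exact key c hc (by linarith) (by linarith)

lemma exists_integral_norm_rpow_le_re {p : ℝ} (hp1 : 1 < p) (hp2 : p ≤ 2) :
    ∃ A : ℝ, 0 ≤ A ∧ ∀ G : ℂ → ℂ, Differentiable ℂ G → (G 0).im = 0 →
      ∫ t : UnitAddCircle, ‖G (fourier 1 t)‖ ^ p ≤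
        A * ∫ t : UnitAddCircle, |(G (fourier 1 t)).re| ^ p := by
  obtain ⟨A, hA, h⟩ := exists_integral_norm_rpow_le_of_re_pos hp1 hp2
  have hp0 : 0 ≤ p := by linarith
  refine ⟨3 ^ p * (A + A), by positivity, fun G hG h0 => ?_⟩
  have hInt {f : UnitAddCircle → ℝ} (hf : Continuous f) : Integrable f :=
    hf.integrable_of_hasCompactSupport (HasCompactSupport.of_compactSpace f)
  have hcont {F : ℂ → ℂ} (hF : Differentiable ℂ F) :
      Continuous fun t : UnitAddCircle => F (fourier 1 t) := hF.continuous.comp (fourier 1).continuous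
  set u : UnitAddCircle → ℝ := fun t => (G (fourier 1 t)).re with hu
  have huc : Continuous u := Complex.continuous_re.comp (hcont hG)
  have hbd : ∀ ε : ℝ, 0 < ε → ∫ t : UnitAddCircle, ‖G (fourier 1 t)‖ ^ p ≤
      3 ^ p * (A + A) * ∫ t, |(|u t| + ε)| ^ p := by
    intro ε hε
    obtain ⟨K, hK, hK0, hKe⟩ := exists_re_approx ⟨fun t => |u t| + ε, by fun_prop⟩ hε
    have hKe' : ∀ t, |u t| < (K (fourier 1 t)).re ∧ (K (fourier 1 t)).re < |u t| + 2 * ε := by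
      intro t
      have := abs_lt.1 (hKe t)
      simp only [ContinuousMap.coe_mk] at this
      constructor <;> linarith
    have hpart : ∀ σ : ℝ, |σ| = 1 →
        ∫ t : UnitAddCircle, ‖(1 / 2 : ℂ) * (K (fourier 1 t) + σ * G (fourier 1 t))‖ ^ p ≤
          A * ∫ t, |(|u t| + ε)| ^ p := by
      intro σ hσ
      have hre : ∀ t : UnitAddCircle,
          ((1 / 2 : ℂ) * (K (fourier 1 t) + σ * G (fourier 1 t))).re
            = ((K (fourier 1 t)).re + σ * u t) / 2 := by
        intro t
        rw [show (1 / 2 : ℂ) = ((1 / 2 : ℝ) : ℂ) by norm_num, Complex.re_ofReal_mul,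
          Complex.add_re, Complex.re_ofReal_mul]
        ring
      have hσu : ∀ t, |σ * u t| = |u t| := fun t => by rw [abs_mul, hσ, one_mul]
      have hpos : ∀ t, 0 < ((K (fourier 1 t)).re + σ * u t) / 2 := fun t => by
        have := neg_abs_le (σ * u t)
        rw [hσu] at this
        linarith [(hKe' t).1]
      have hdiff : Differentiable ℂ fun z => (1 / 2 : ℂ) * (K z + σ * G z) := by fun_prop
      refine (h (fun z => (1 / 2 : ℂ) * (K z + σ * G z)) hdiff ?_
        (fun t => by rw [hre]; exact hpos t)).trans ?_
      · rw [show (1 / 2 : ℂ) = ((1 / 2 : ℝ) : ℂ) by norm_num, Complex.im_ofReal_mul,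
          Complex.add_im, Complex.im_ofReal_mul, hK0, h0]
        simp
      · refine mul_le_mul_of_nonneg_left (integral_mono (hInt ?_) (hInt ?_) fun t => ?_) hA
        · exact (Complex.continuous_re.comp (hcont hdiff)).rpow_const fun _ => Or.inr hp0
        · exact Continuous.rpow_const (by fun_prop) fun _ => Or.inr hp0
        · simp only [hre]
          have h1 := le_abs_self (σ * u t)
          rw [hσu] at h1
          have h2 := (hKe' t).2
          refine Real.rpow_le_rpow (hpos t).le ?_ hp0
          refine le_trans ?_ (le_abs_self _)
          linarith
    have h1 := hpart 1 (by simp)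
    have h2 := hpart (-1) (by simp)
    have hc1 : ∀ σ : ℝ, Integrable fun t : UnitAddCircle =>
        ‖(1 / 2 : ℂ) * (K (fourier 1 t) + σ * G (fourier 1 t))‖ ^ p := fun σ =>
      hInt ((hcont (F := fun z => (1 / 2 : ℂ) * (K z + σ * G z)) (by fun_prop)).norm.rpow_const
        fun _ => Or.inr hp0)
    calc ∫ t : UnitAddCircle, ‖G (fourier 1 t)‖ ^ p
        ≤ ∫ t : UnitAddCircle, 3 ^ p *
            (‖(1 / 2 : ℂ) * (K (fourier 1 t) + (1 : ℝ) * G (fourier 1 t))‖ ^ p +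
            ‖(1 / 2 : ℂ) * (K (fourier 1 t) + (-1 : ℝ) * G (fourier 1 t))‖ ^ p) := by
          refine integral_mono (hInt ((hcont hG).norm.rpow_const fun _ => Or.inr hp0))
            (((hc1 1).add (hc1 (-1))).const_mul _) fun t => ?_
          have h3 := add_three_rpow_le hp0
            (norm_nonneg ((1 / 2 : ℂ) * (K (fourier 1 t) + (1 : ℝ) * G (fourier 1 t))))
            (norm_nonneg ((1 / 2 : ℂ) * (K (fourier 1 t) + (-1 : ℝ) * G (fourier 1 t)))) le_rfl
          rw [Real.zero_rpow (by linarith), add_zero, add_zero] at h3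
          refine le_trans ?_ h3
          refine Real.rpow_le_rpow (norm_nonneg _) ?_ hp0
          refine le_trans (le_of_eq ?_) (norm_sub_le _ _)
          congr 1; push_cast; ring
      _ = 3 ^ p * (_ + _) := by rw [integral_const_mul, integral_add (hc1 1) (hc1 (-1))]
      _ ≤ 3 ^ p * (A * (∫ t, |(|u t| + ε)| ^ p) + A * ∫ t, |(|u t| + ε)| ^ p) := by gcongr
      _ = _ := by ring
  have hcts : Continuous fun ε : ℝ => 3 ^ p * (A + A) * ∫ t, |(|u t| + ε)| ^ p := by
    refine continuous_const.mul ?_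
    have := continuous_parametric_integral_of_continuous (μ := (volume : Measure UnitAddCircle))
      (f := fun (ε : ℝ) t => |(|u t| + ε)| ^ p) (by
        refine Continuous.rpow_const ?_ fun _ => Or.inr hp0
        fun_prop) isCompact_univ
    simpa using this
  have hlim := (hcts.tendsto 0).mono_left (nhdsWithin_le_nhds (s := Ioi 0))
  simp only [add_zero, abs_abs] at hlim
  exact ge_of_tendsto hlim (eventually_nhdsWithin_of_forall fun ε hε => hbd ε hε)

/-- M. Riesz's theorem for trigonometric polynomials on the circle, `1 < p ≤ 2`. -/
lemma exists_integral_sign_fourier_le {p : ℝ} (hp1 : 1 < p) (hp2 : p ≤ 2) :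
    ∃ C : ℝ, 0 ≤ C ∧ ∀ {ι : Type} (s : Finset ι) (m : ι → ℤ) (a : ι → ℂ),
      ∫ t : UnitAddCircle, ‖∑ k ∈ s, ((m k).sign : ℂ) * (a k * fourier (m k) t)‖ ^ p ≤
        C * ∫ t : UnitAddCircle, ‖∑ k ∈ s, a k * fourier (m k) t‖ ^ p := by
  obtain ⟨A, hA, h⟩ := exists_integral_norm_rpow_le_re hp1 hp2
  have hp0 : 0 ≤ p := by linarith
  refine ⟨3 ^ p * (A + A + 1), by positivity, fun {ι} s m a => ?_⟩
  have hInt {f : UnitAddCircle → ℂ} (hf : Continuous f) : Integrable fun t => ‖f t‖ ^ p :=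
    (hf.norm.rpow_const fun _ => Or.inr hp0).integrable_of_hasCompactSupport
      (HasCompactSupport.of_compactSpace _)
  set f : UnitAddCircle → ℂ := fun t => ∑ k ∈ s, a k * fourier (m k) t with hf
  have hfc : Continuous f := by fun_prop
  have hpart : ∀ c : ℂ, ‖c‖ = 1 →
      (∫ t : UnitAddCircle, ‖∑ k ∈ s, analyticTerm (m k) (c * a k) (fourier 1 t)‖ ^ p ≤
        A * ∫ t, ‖f t‖ ^ p) ∧ Integrable fun t : UnitAddCircle =>
          ‖∑ k ∈ s, analyticTerm (m k) (c * a k) (fourier 1 t)‖ ^ p := by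
    intro c hc
    have hd : Differentiable ℂ fun z => ∑ k ∈ s, analyticTerm (m k) (c * a k) z :=
      Differentiable.fun_sum fun k _ => differentiable_analyticTerm _ _
    have hdc : Continuous fun t : UnitAddCircle =>
      ∑ k ∈ s, analyticTerm (m k) (c * a k) (fourier 1 t) :=
        hd.continuous.comp (fourier 1).continuous
    refine ⟨(h _ hd (by simp [Complex.im_sum, analyticTerm_zero_im])).trans ?_, hInt hdc⟩
    refine mul_le_mul_of_nonneg_left (integral_mono ?_ (hInt hfc) fun t => ?_) hA
    · exact (((Complex.continuous_re.comp hdc).abs).rpow_const fun _ => Or.inr hp0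
        ).integrable_of_hasCompactSupport (HasCompactSupport.of_compactSpace _)
    · refine Real.rpow_le_rpow (abs_nonneg _) ?_ hp0
      have : (∑ k ∈ s, analyticTerm (m k) (c * a k) (fourier 1 t)).re = (c * f t).re := by
        rw [Complex.re_sum, hf, Finset.mul_sum, Complex.re_sum]
        refine Finset.sum_congr rfl fun k _ => ?_
        rw [analyticTerm_re, mul_assoc]
      rw [this]
      refine (Complex.abs_re_le_norm _).trans ?_
      rw [norm_mul, hc, one_mul]
  obtain ⟨h1, i1⟩ := hpart 1 (by simp)
  obtain ⟨h2, i2⟩ := hpart (-Complex.I) (by simp)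
  simp only [one_mul] at h1 i1
  calc ∫ t : UnitAddCircle, ‖∑ k ∈ s, ((m k).sign : ℂ) * (a k * fourier (m k) t)‖ ^ p
      ≤ ∫ t : UnitAddCircle, 3 ^ p *
          (‖∑ k ∈ s, analyticTerm (m k) (a k) (fourier 1 t)‖ ^ p +
          ‖∑ k ∈ s, analyticTerm (m k) (-Complex.I * a k) (fourier 1 t)‖ ^ p + ‖f t‖ ^ p) := by
        refine integral_mono (hInt (by fun_prop)) (((i1.add i2).add (hInt hfc)).const_mul _)
          fun t => ?_
        refine le_trans (Real.rpow_le_rpow (norm_nonneg _) ?_ hp0)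
          (add_three_rpow_le hp0 (norm_nonneg _) (norm_nonneg _) (norm_nonneg _))
        have : ∑ k ∈ s, ((m k).sign : ℂ) * (a k * fourier (m k) t) =
            ∑ k ∈ s, analyticTerm (m k) (a k) (fourier 1 t) +
            Complex.I * ∑ k ∈ s, analyticTerm (m k) (-Complex.I * a k) (fourier 1 t) - f t := by
          rw [hf, Finset.mul_sum, ← Finset.sum_add_distrib, ← Finset.sum_sub_distrib]
          refine Finset.sum_congr rfl fun k _ => ?_
          rw [analyticTerm_add_I_mul]; ring
        rw [this]
        refine (norm_sub_le _ _).trans ?_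
        gcongr
        refine (norm_add_le _ _).trans ?_
        rw [norm_mul, Complex.norm_I, one_mul]
    _ = 3 ^ p * (_ + _ + _) := by
        have i12 : Integrable fun t : UnitAddCircle =>
          ‖∑ k ∈ s, analyticTerm (m k) (a k) (fourier 1 t)‖ ^ p +
          ‖∑ k ∈ s, analyticTerm (m k) (-Complex.I * a k) (fourier 1 t)‖ ^ p := i1.add i2
        rw [integral_const_mul, integral_add i12 (hInt hfc), integral_add i1 i2]
    _ ≤ 3 ^ p * (A * (∫ t, ‖f t‖ ^ p) + A * (∫ t, ‖f t‖ ^ p) + ∫ t, ‖f t‖ ^ p) := by gcongr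
    _ = _ := by ring

section

/-- The circle carries its normalized Haar measure. -/
local instance : MeasureSpace UnitAddCircle := ⟨AddCircle.haarAddCircle⟩

local instance : Measure.IsAddHaarMeasure (volume : Measure UnitAddCircle) :=
  inferInstanceAs (Measure.IsAddHaarMeasure AddCircle.haarAddCircle)

local instance : IsProbabilityMeasure (volume : Measure UnitAddCircle) :=
  inferInstanceAs (IsProbabilityMeasure AddCircle.haarAddCircle)

open UnitAddTorus

/-- A trigonometric polynomial on the torus. -/
def trig {n : ℕ} (s : Finset (Fin n → ℤ)) (c : (Fin n → ℤ) → ℂ) : C(UnitAddTorus (Fin n), ℂ) :=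
  ∑ k ∈ s, c k • mFourier k

lemma trig_apply {n : ℕ} (s : Finset (Fin n → ℤ)) (c : (Fin n → ℤ) → ℂ) (x) :
    trig s c x = ∑ k ∈ s, c k * mFourier k x := by
  simp [trig]

lemma integral_sign_le {p : ℝ} (hp1 : 1 < p) (hp2 : p ≤ 2) :
    ∃ C : ℝ, 0 ≤ C ∧ ∀ {ι : Type} (s : Finset ι) (m : ι → ℤ) (a : ι → ℂ),
      ∫ t : UnitAddCircle, ‖∑ k ∈ s, ((m k).sign : ℂ) * (a k * fourier (m k) t)‖ ^ p ≤
        C * ∫ t : UnitAddCircle, ‖∑ k ∈ s, a k * fourier (m k) t‖ ^ p := by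
  obtain ⟨C, hC, h⟩ := exists_integral_sign_fourier_le hp1 hp2
  refine ⟨C, hC, fun s m a => ?_⟩
  have := h s m a
  rwa [AddCircle.volume_eq_smul_haarAddCircle, ENNReal.ofReal_one, one_smul] at this

lemma mFourier_add_smul {n : ℕ} (k N : Fin n → ℤ) (x : UnitAddTorus (Fin n))
    (t : UnitAddCircle) :
    mFourier k (x + fun i => N i • t) = mFourier k x * fourier (∑ i, k i * N i) t := by
  simp only [mFourier, ContinuousMap.coe_mk, Pi.add_apply]
  have h : (fourier (∑ i, k i * N i) t : ℂ) = ∏ i, fourier (k i) (N i • t) := by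
    simp only [fourier_apply, Finset.sum_smul, mul_smul]
    induction (Finset.univ : Finset (Fin n)) using Finset.induction_on with
    | empty => simp
    | insert a s ha ih => 
      rw [Finset.sum_insert ha, Finset.prod_insert ha, AddCircle.toCircle_add, Circle.coe_mul, ih]
  rw [h, ← Finset.prod_mul_distrib]
  refine Finset.prod_congr rfl fun i _ => ?_
  simp [fourier_apply, smul_add, AddCircle.toCircle_add]

lemma exists_integral_sign_mFourier_le {p : ℝ} (hp1 : 1 < p) (hp2 : p ≤ 2) :
    ∃ C : ℝ, 0 ≤ C ∧ ∀ {n : ℕ} (N : Fin n → ℤ) (s : Finset (Fin n → ℤ)) (c : (Fin n → ℤ) → ℂ),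
      ∫ x : UnitAddTorus (Fin n), ‖trig s (fun k => ((∑ i, k i * N i).sign : ℂ) * c k) x‖ ^ p ≤
        C * ∫ x : UnitAddTorus (Fin n), ‖trig s c x‖ ^ p := by
  obtain ⟨C, hC, h⟩ := integral_sign_le hp1 hp2
  have hp0 : 0 ≤ p := by linarith
  refine ⟨C, hC, fun {n} N s c => ?_⟩
  have hslice : ∀ F : C(UnitAddTorus (Fin n), ℂ), ∫ x, ‖F x‖ ^ p =
      ∫ x, ∫ t : UnitAddCircle, ‖F (x + fun i => N i • t)‖ ^ p := by
    intro F
    rw [integral_integral_swap]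
    · have : ∀ t : UnitAddCircle, ∫ x, ‖F (x + fun i => N i • t)‖ ^ p = ∫ x, ‖F x‖ ^ p :=
        fun t => integral_add_right_eq_self (fun x => ‖F x‖ ^ p) _
      simp [this]
    · refine Continuous.integrable_of_hasCompactSupport ?_ (HasCompactSupport.of_compactSpace _)
      simp only [Function.uncurry_def]
      exact (by fun_prop : Continuous _).norm.rpow_const fun _ => Or.inr hp0
  have hInt : ∀ F : C(UnitAddTorus (Fin n), ℂ),
      Integrable fun x => ∫ t : UnitAddCircle, ‖F (x + fun i => N i • t)‖ ^ p := by
    intro F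
    refine Continuous.integrable_of_hasCompactSupport ?_ (HasCompactSupport.of_compactSpace _)
    have := continuous_parametric_integral_of_continuous (μ := (volume : Measure UnitAddCircle))
      (f := fun (x : UnitAddTorus (Fin n)) t => ‖F (x + fun i => N i • t)‖ ^ p)
      ((by fun_prop : Continuous _).norm.rpow_const fun _ => Or.inr hp0) isCompact_univ
    simpa using this
  rw [hslice, hslice, ← integral_const_mul]
  refine integral_mono (hInt _) ((hInt _).const_mul _) fun x => ?_
  have := h s (fun k => ∑ i, k i * N i) (fun k => c k * mFourier k x)
  simp only [trig_apply, mFourier_add_smul]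
  simpa only [mul_assoc, mul_left_comm] using this

lemma toReal_ofReal_one_le {p : ℝ} (hp : 1 ≤ p) : (ENNReal.ofReal p).toReal = p :=
  ENNReal.toReal_ofReal (by linarith)

lemma norm_toLp_rpow {n : ℕ} {p : ℝ} (hp : 1 < p) [Fact (1 ≤ ENNReal.ofReal p)]
    (F : C(UnitAddTorus (Fin n), ℂ)) :
    ‖ContinuousMap.toLp (E := ℂ) (ENNReal.ofReal p) volume ℂ F‖ ^ p = ∫ x, ‖F x‖ ^ p := by
  have h0 : ENNReal.ofReal p ≠ 0 := by simp; linarith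
  rw [Lp.norm_def, eLpNorm_congr_ae (ContinuousMap.coeFn_toLp volume F),
    MemLp.eLpNorm_eq_integral_rpow_norm h0 ENNReal.ofReal_ne_top,
    ENNReal.toReal_ofReal (by positivity), toReal_ofReal_one_le hp.le, ← Real.rpow_mul (by positivity),
    inv_mul_cancel₀ (by linarith), Real.rpow_one]
  exact F.continuous.memLp_of_hasCompactSupport (HasCompactSupport.of_compactSpace _)

/-- `m` is a Fourier multiplier on `L^p` of the torus. -/
def IsMult {n : ℕ} (p : ℝ≥0∞) [Fact (1 ≤ p)] (m : (Fin n → ℤ) → ℂ) : Prop :=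
  ∃ C : ℝ, 0 ≤ C ∧ ∀ s c, ‖ContinuousMap.toLp (E := ℂ) p volume ℂ (trig s (fun k => m k * c k))‖ ≤
    C * ‖ContinuousMap.toLp (E := ℂ) p volume ℂ (trig s c)‖

lemma norm_toLp_sign_int_le {p : ℝ} (hp1 : 1 < p) (hp2 : p ≤ 2) [Fact (1 ≤ ENNReal.ofReal p)] :
    ∃ C : ℝ, 0 ≤ C ∧ ∀ {n : ℕ} (N : Fin n → ℤ) (s : Finset (Fin n → ℤ)) (c : (Fin n → ℤ) → ℂ),
      ‖ContinuousMap.toLp (E := ℂ) (ENNReal.ofReal p) volume ℂ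
        (trig s (fun k => ((∑ i, k i * N i).sign : ℂ) * c k))‖ ≤
      C * ‖ContinuousMap.toLp (E := ℂ) (ENNReal.ofReal p) volume ℂ (trig s c)‖ := by
  obtain ⟨C, hC, h⟩ := exists_integral_sign_mFourier_le hp1 hp2
  refine ⟨C ^ (1 / p), by positivity, fun N s c => ?_⟩
  refine (Real.rpow_le_rpow_iff (norm_nonneg _) (by positivity) (by linarith : 0 < p)).1 ?_
  rw [Real.mul_rpow (by positivity) (by positivity), ← Real.rpow_mul hC,
    one_div_mul_cancel (by linarith), Real.rpow_one, norm_toLp_rpow hp1, norm_toLp_rpow hp1]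
  exact h N s c

lemma tendsto_floor_mul_div (a : ℝ) :
    Filter.Tendsto (fun M : ℝ => (⌊a * M⌋ : ℝ) / M) Filter.atTop (nhds a) := by
  have h1 : Filter.Tendsto (fun M : ℝ => a - M⁻¹) Filter.atTop (nhds a) := by
    simpa using tendsto_const_nhds.sub (tendsto_inv_atTop_zero (𝕜 := ℝ))
  refine tendsto_of_tendsto_of_tendsto_of_le_of_le' h1 tendsto_const_nhds ?_ ?_
  · filter_upwards [Filter.eventually_gt_atTop 0] with M hM
    rw [le_div_iff₀ hM, sub_mul, inv_mul_cancel₀ hM.ne']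
    exact (Int.sub_one_lt_floor _).le
  · filter_upwards [Filter.eventually_gt_atTop 0] with M hM
    rw [div_le_iff₀ hM]
    exact Int.floor_le _

lemma exists_int_sign_eq {n : ℕ} (s : Finset (Fin n → ℤ)) (θ : Fin n → ℝ)
    (h : ∀ k ∈ s, k ≠ 0 → ∑ i, (k i : ℝ) * θ i ≠ 0) :
    ∃ N : Fin n → ℤ, ∀ k ∈ s, (((∑ i, k i * N i).sign : ℤ) : ℝ) =
      Real.sign (∑ i, (k i : ℝ) * θ i) := by
  have key : ∀ k ∈ s, ∀ᶠ M : ℝ in Filter.atTop, (((∑ i, k i * ⌊θ i * M⌋).sign : ℤ) : ℝ) =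
      Real.sign (∑ i, (k i : ℝ) * θ i) := by
    intro k hk
    rcases eq_or_ne k 0 with rfl | h0
    · simp
    have hlim : Filter.Tendsto (fun M : ℝ => ∑ i, (k i : ℝ) * ((⌊θ i * M⌋ : ℝ) / M)) Filter.atTop
        (nhds (∑ i, (k i : ℝ) * θ i)) :=
      tendsto_finsetSum _ fun i _ => (tendsto_floor_mul_div (θ i)).const_mul _
    rcases lt_or_gt_of_ne (h k hk h0) with h1 | h1
    · filter_upwards [hlim.eventually_lt_const h1, Filter.eventually_gt_atTop 0] with M h2 h3
      rw [Real.sign_of_neg h1]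
      have : ((∑ i, k i * ⌊θ i * M⌋ : ℤ) : ℝ) < 0 := by
        have : (∑ i, (k i : ℝ) * ((⌊θ i * M⌋ : ℝ) / M)) = (∑ i, (k i : ℝ) * ⌊θ i * M⌋) / M := by
          rw [Finset.sum_div]; simp only [mul_div_assoc]
        rw [this, div_lt_iff₀ h3, zero_mul] at h2
        push_cast; exact h2
      rw [Int.sign_eq_neg_one_of_neg (by exact_mod_cast this)]; simp
    · filter_upwards [hlim.eventually_const_lt h1, Filter.eventually_gt_atTop 0] with M h2 h3
      rw [Real.sign_of_pos h1]
      have : 0 < ((∑ i, k i * ⌊θ i * M⌋ : ℤ) : ℝ) := by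
        have : (∑ i, (k i : ℝ) * ((⌊θ i * M⌋ : ℝ) / M)) = (∑ i, (k i : ℝ) * ⌊θ i * M⌋) / M := by
          rw [Finset.sum_div]; simp only [mul_div_assoc]
        rw [this, lt_div_iff₀ h3, zero_mul] at h2
        push_cast; exact h2
      rw [Int.sign_eq_one_of_pos (by exact_mod_cast this)]; simp
  obtain ⟨M, hM⟩ := ((Filter.eventually_all_finset s).2 key).exists
  exact ⟨fun i => ⌊θ i * M⌋, hM⟩

/-- An integer frequency as a Euclidean vector. -/
def freq {n : ℕ} (k : Fin n → ℤ) : Euc n := WithLp.toLp 2 fun i => (k i : ℝ)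

lemma inner_freq {n : ℕ} (k : Fin n → ℤ) (θ : Euc n) :
    inner ℝ (freq k) θ = ∑ i, (k i : ℝ) * θ i := by
  simp [freq, PiLp.inner_apply, mul_comm]

lemma norm_toLp_sign_le {p : ℝ} (hp1 : 1 < p) (hp2 : p ≤ 2) [Fact (1 ≤ ENNReal.ofReal p)] :
    ∃ C : ℝ, 0 ≤ C ∧ ∀ {n : ℕ} (s : Finset (Fin n → ℤ)) (c : (Fin n → ℤ) → ℂ),
      ∀ᵐ θ : Euc n, ‖ContinuousMap.toLp (E := ℂ) (ENNReal.ofReal p) volume ℂ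
        (trig s (fun k => (Real.sign (inner ℝ (freq k) θ) : ℂ) * c k))‖ ≤
      C * ‖ContinuousMap.toLp (E := ℂ) (ENNReal.ofReal p) volume ℂ (trig s c)‖ := by
  obtain ⟨C, hC, h⟩ := norm_toLp_sign_int_le hp1 hp2
  refine ⟨C, hC, fun {n} s c => ?_⟩
  have hae : ∀ k ∈ s, ∀ᵐ θ : Euc n, k ≠ 0 → inner ℝ (freq k) θ ≠ 0 := by
    intro k hk
    rcases eq_or_ne k 0 with rfl | h0
    · simp
    have h1 : LinearMap.ker (innerSL ℝ (freq k)).toLinearMap ≠ ⊤ := by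
      intro h2
      have h3 : freq k ∈ LinearMap.ker (innerSL ℝ (freq k)).toLinearMap := h2 ▸ trivial
      have h4 : freq k = 0 := by simpa using h3
      exact h0 (funext fun i => by simpa [freq] using congrArg (fun v : Euc n => v i) h4)
    have h2 := Measure.addHaar_submodule (volume : Measure (Euc n)) _ h1
    rw [ae_iff]
    refine measure_mono_null (fun θ hθ => ?_) h2
    simp only [mem_ofPred_eq, Classical.not_imp, not_not] at hθ
    simpa using hθ.2
  filter_upwards [(Finset.eventually_all s).2 hae] with θ hθ
  obtain ⟨N, hN⟩ := exists_int_sign_eq s θ fun k hk h0 => by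
    rw [← inner_freq]; exact hθ k hk h0
  have heq : trig s (fun k => (Real.sign (inner ℝ (freq k) θ) : ℂ) * c k) =
      trig s (fun k => ((∑ i, k i * N i).sign : ℂ) * c k) := by
    simp only [trig]
    refine Finset.sum_congr rfl fun k hk => ?_
    rw [inner_freq, ← hN k hk]
    push_cast; rfl
  rw [heq]
  exact h N s c

lemma integral_sign_inner_smul_isometry {n : ℕ} (R : Euc n ≃ₗᵢ[ℝ] Euc n) (u : Euc n) :
    ∫ θ in ball (0 : Euc n) 1, Real.sign (inner ℝ (R u) θ) • θ =
      R (∫ θ in ball (0 : Euc n) 1, Real.sign (inner ℝ u θ) • θ) := by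
  have h1 : R ⁻¹' ball (0 : Euc n) 1 = ball 0 1 := by
    ext x; simp
  rw [← (R.measurePreserving).setIntegral_preimage_emb R.toMeasurableEquiv.measurableEmbedding, h1]
  have := R.toContinuousLinearEquiv.integral_comp_comm (μ := volume.restrict (ball (0 : Euc n) 1))
    (fun θ => Real.sign (inner ℝ u θ) • θ)
  refine Eq.trans (integral_congr_ae (Filter.Eventually.of_forall fun θ => ?_)) this
  simp

lemma measurable_sign : Measurable Real.sign := by
  unfold Real.sign
  exact Measurable.ite measurableSet_Iio measurable_const
    (Measurable.ite measurableSet_Ioi measurable_const measurable_const)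

lemma abs_sign_le (x : ℝ) : |Real.sign x| ≤ 1 := by
  rcases Real.sign_apply_eq x with h | h | h <;> simp [h]

lemma integrable_sign_inner_smul {n : ℕ} (u : Euc n) :
    IntegrableOn (fun θ => Real.sign (inner ℝ u θ) • θ) (ball (0 : Euc n) 1) := by
  refine Measure.integrableOn_of_bounded (M := 1) measure_ball_lt_top.ne ?_ ?_
  · exact ((measurable_sign.comp (by fun_prop)).smul measurable_id).aestronglyMeasurable
  · refine (ae_restrict_mem measurableSet_ball).mono fun θ hθ => ?_
    rw [norm_smul]
    rw [mem_ball_zero_iff] at hθ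
    calc _ ≤ 1 * ‖θ‖ := by gcongr; exact abs_sign_le _
      _ ≤ 1 := by linarith

lemma exists_integral_sign_inner_smul {n : ℕ} (hn : 0 < n) : ∃ a : ℝ, 0 < a ∧ ∀ u : Euc n,
    ∫ θ in ball (0 : Euc n) 1, Real.sign (inner ℝ u θ) • θ = (a * ‖u‖⁻¹) • u := by
  set e : Euc n := EuclideanSpace.single ⟨0, hn⟩ 1 with he
  have hne : ‖e‖ = 1 := by simp [he]
  set V : Euc n → Euc n := fun u => ∫ θ in ball (0 : Euc n) 1, Real.sign (inner ℝ u θ) • θ with hV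
  have hR : ∀ (R : Euc n ≃ₗᵢ[ℝ] Euc n) u, V (R u) = R (V u) := integral_sign_inner_smul_isometry
  obtain ⟨a, ha⟩ : ∃ a : ℝ, a • e = V e := by
    rw [← Submodule.mem_span_singleton, ← Submodule.reflection_eq_self_iff, ← hR,
      Submodule.reflection_mem_subspace_eq_self (Submodule.mem_span_singleton_self e)]
  have ha' : a = ∫ θ in ball (0 : Euc n) 1, |inner ℝ e θ| := by
    have h1 : inner ℝ e (V e) = a := by
      rw [← ha, inner_smul_right, real_inner_self_eq_norm_sq, hne]; ring
    rw [← h1]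
    have := (innerSL ℝ e).integral_comp_comm (integrable_sign_inner_smul e)
    simp only [innerSL_apply_apply] at this
    rw [← this]
    refine integral_congr_ae (Filter.Eventually.of_forall fun θ => ?_)
    simp only [inner_smul_right]
    rcases lt_trichotomy (inner ℝ e θ) 0 with h | h | h
    · rw [Real.sign_of_neg h, abs_of_neg h]; ring
    · simp [h]
    · rw [Real.sign_of_pos h, abs_of_pos h]; ring
  have hpos : 0 < a := by
    rw [ha', integral_pos_iff_support_of_nonneg (fun _ => abs_nonneg _)]
    · have hs : ball ((1 / 2 : ℝ) • e) (1 / 2) ⊆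
          Function.support (fun θ => |inner ℝ e θ|) ∩ ball (0 : Euc n) 1 := by
        intro θ hθ
        rw [mem_ball, dist_eq_norm] at hθ
        refine ⟨?_, ?_⟩
        · have h1 : |inner ℝ e (θ - (1 / 2 : ℝ) • e)| < 1 / 2 :=
            (abs_real_inner_le_norm _ _).trans_lt (by rw [hne, one_mul]; exact hθ)
          rw [inner_sub_right, inner_smul_right, real_inner_self_eq_norm_sq, hne] at h1
          simp only [Function.mem_support, ne_eq, abs_eq_zero]
          intro h
          rw [h] at h1
          norm_num at h1
        · rw [mem_ball_zero_iff]
          have := norm_le_norm_add_norm_sub' θ ((1 / 2 : ℝ) • e)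
          rw [norm_smul, hne] at this
          norm_num at this ⊢
          linarith
      rw [Measure.restrict_apply' measurableSet_ball]
      exact (measure_ball_pos volume _ (by norm_num)).trans_le (measure_mono hs)
    · have : Continuous fun θ : Euc n => |inner ℝ e θ| := by fun_prop
      exact (this.continuousOn.integrableOn_compact (isCompact_closedBall 0 1)).mono_set
        ball_subset_closedBall
  refine ⟨a, hpos, fun u => ?_⟩
  rcases eq_or_ne u 0 with rfl | hu
  · simp
  have hu' : 0 < ‖u‖ := norm_pos_iff.2 hu
  have hscale : V u = V (‖u‖⁻¹ • u) := by
    refine integral_congr_ae (Filter.Eventually.of_forall fun θ => ?_)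
    simp only [inner_smul_left, RCLike.conj_to_real]
    congr 1
    rcases lt_trichotomy (inner ℝ u θ) 0 with h | h | h
    · rw [Real.sign_of_neg h, Real.sign_of_neg (mul_neg_of_pos_of_neg (by positivity) h)]
    · simp [h]
    · rw [Real.sign_of_pos h, Real.sign_of_pos (by positivity)]
  have hnu : ‖e‖ = ‖‖u‖⁻¹ • u‖ := by
    rw [hne, norm_smul, norm_inv, norm_norm, inv_mul_cancel₀ hu'.ne']
  have := hR (Submodule.reflection (ℝ ∙ (e - ‖u‖⁻¹ • u))ᗮ) e
  rw [Submodule.reflection_sub hnu, ← ha, map_smul, Submodule.reflection_sub hnu, ← hscale,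
    smul_smul] at this
  exact this

/-- The symbol of the Riesz transform. -/
def riesz {n : ℕ} (j : Fin n) (k : Fin n → ℤ) : ℂ := ((freq k j * ‖freq k‖⁻¹ : ℝ) : ℂ)

lemma toLp_trig {n : ℕ} (p : ℝ≥0∞) [Fact (1 ≤ p)] (s : Finset (Fin n → ℤ))
    (c : (Fin n → ℤ) → ℂ) : ContinuousMap.toLp (E := ℂ) p volume ℂ (trig s c) =
      ∑ k ∈ s, c k • mFourierLp p k := by
  simp [trig]

lemma isMult_riesz_of_le_two {n : ℕ} (hn : 0 < n) {p : ℝ} (hp1 : 1 < p) (hp2 : p ≤ 2)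
    [Fact (1 ≤ ENNReal.ofReal p)] (j : Fin n) :
    IsMult (ENNReal.ofReal p) (riesz (n := n) j) := by
  obtain ⟨C, hC, h⟩ := norm_toLp_sign_le hp1 hp2
  obtain ⟨a, ha, hav⟩ := exists_integral_sign_inner_smul hn
  set B := volume.real (ball (0 : Euc n) 1) with hB
  refine ⟨a⁻¹ * (C * B), by positivity, fun s c => ?_⟩
  set T : Euc n → Lp ℂ (ENNReal.ofReal p) (volume : Measure (UnitAddTorus (Fin n))) := fun θ =>
    ContinuousMap.toLp (E := ℂ) (ENNReal.ofReal p) volume ℂ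
        (trig s (fun k => (Real.sign (inner ℝ (freq k) θ) : ℂ) * c k)) with hT
  have hcoord : ∀ k : Fin n → ℤ, Integrable (fun θ : Euc n => θ j * Real.sign (inner ℝ (freq k) θ))
      (volume.restrict (ball 0 1)) ∧
      ∫ θ in ball (0 : Euc n) 1, θ j * Real.sign (inner ℝ (freq k) θ) =
        a * (freq k j * ‖freq k‖⁻¹) := by
    intro k
    have h1 := integrable_sign_inner_smul (freq k)
    have h2 : ∫ θ in ball (0 : Euc n) 1, Real.sign (inner ℝ (freq k) θ) * θ j =
        a * ‖freq k‖⁻¹ * freq k j := by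
      have := (EuclideanSpace.proj (𝕜 := ℝ) j).integral_comp_comm h1
      rw [hav] at this
      exact this
    have h3 : Integrable (fun θ : Euc n => Real.sign (inner ℝ (freq k) θ) * θ j)
        (volume.restrict (ball 0 1)) := (EuclideanSpace.proj (𝕜 := ℝ) j).integrable_comp h1
    refine ⟨by simpa only [mul_comm] using h3, ?_⟩
    rw [show a * (freq k j * ‖freq k‖⁻¹) = a * ‖freq k‖⁻¹ * freq k j by ring, ← h2]
    simp only [mul_comm]
  have hTs : ∀ θ, θ j • T θ =
      ∑ k ∈ s, (θ j * Real.sign (inner ℝ (freq k) θ)) • (c k • mFourierLp (ENNReal.ofReal p) k) := by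
    intro θ
    simp only [hT, toLp_trig, Finset.smul_sum]
    refine Finset.sum_congr rfl fun k _ => ?_
    rw [← smul_smul (_ : ℂ) (c k), Complex.coe_smul]
    exact smul_smul _ _ _
  have hInt : ∫ θ in ball (0 : Euc n) 1, θ j • T θ =
      a • ContinuousMap.toLp (E := ℂ) (ENNReal.ofReal p) volume ℂ
        (trig s (fun k => riesz j k * c k)) := by
    simp only [hTs]
    rw [integral_finsetSum _ fun k _ => (hcoord k).1.smul_const _, toLp_trig, Finset.smul_sum]
    refine Finset.sum_congr rfl fun k _ => ?_
    rw [integral_smul_const, (hcoord k).2, riesz, ← smul_smul (_ : ℂ) (c k), Complex.coe_smul]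
    exact (smul_smul _ _ _).symm
  have hbd : ‖∫ θ in ball (0 : Euc n) 1, θ j • T θ‖ ≤
      (C * ‖ContinuousMap.toLp (E := ℂ) (ENNReal.ofReal p) volume ℂ (trig s c)‖) * B := by
    refine norm_setIntegral_le_of_norm_le_const_ae' measure_ball_lt_top ?_
    filter_upwards [h s c] with θ hθ hb
    rw [norm_smul]
    calc ‖θ j‖ * ‖T θ‖ ≤ 1 * ‖T θ‖ := by
          gcongr
          exact (PiLp.norm_apply_le θ j).trans (mem_ball_zero_iff.1 hb).le
      _ ≤ _ := by rw [one_mul]; exact hθ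
  rw [hInt, norm_smul, Real.norm_of_nonneg ha.le] at hbd
  rw [mul_assoc, inv_mul_eq_div, le_div_iff₀ ha]
  linarith

lemma memLp_continuousMap {n : ℕ} (p : ℝ≥0∞) (F : C(UnitAddTorus (Fin n), ℂ)) :
    MemLp F p volume :=
  F.continuous.memLp_of_hasCompactSupport (HasCompactSupport.of_compactSpace _)

lemma norm_toLp_eq {n : ℕ} {p : ℝ} (hp : 1 < p) [Fact (1 ≤ ENNReal.ofReal p)]
    (F : C(UnitAddTorus (Fin n), ℂ)) :
    ‖ContinuousMap.toLp (E := ℂ) (ENNReal.ofReal p) volume ℂ F‖ = (∫ x, ‖F x‖ ^ p) ^ (1 / p) := by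
  rw [← norm_toLp_rpow hp, ← Real.rpow_mul (norm_nonneg _), mul_one_div_cancel (by linarith),
    Real.rpow_one]

lemma dense_trig {n : ℕ} {q : ℝ} [Fact (1 ≤ ENNReal.ofReal q)]
    (φ : Lp ℂ (ENNReal.ofReal q) (volume : Measure (UnitAddTorus (Fin n)))) {ε : ℝ} (hε : 0 < ε) :
    ∃ s c, ‖φ - ContinuousMap.toLp (E := ℂ) (ENNReal.ofReal q) volume ℂ (trig s c)‖ < ε := by
  have hH : φ ∈ (Submodule.span ℂ (range (@mFourierLp (Fin n) _ (ENNReal.ofReal q) _))).topologicalClosure := by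
    rw [span_mFourierLp_closure_eq_top ENNReal.ofReal_ne_top]; trivial
  obtain ⟨f, hf, hfd⟩ := Metric.mem_closure_iff.1 hH ε hε
  obtain ⟨c, rfl⟩ := Finsupp.mem_span_range_iff_exists_finsupp.1 hf
  refine ⟨c.support, c, ?_⟩
  rw [toLp_trig, ← dist_eq_norm]
  exact hfd

/-- The `L^p` norm can be computed by testing against trigonometric polynomials. -/
lemma integral_rpow_le_of_forall_trig {n : ℕ} {p q : ℝ} (hpq : p.HolderConjugate q)
    {g : UnitAddTorus (Fin n) → ℂ} (hg : MemLp g (ENNReal.ofReal p) volume) {K : ℝ} (hK : 0 ≤ K)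
    (h : ∀ s c, ‖∫ x, g x * trig s c x‖ ≤ K * (∫ x, ‖trig s c x‖ ^ q) ^ (1 / q)) :
    ∫ x, ‖g x‖ ^ p ≤ K ^ p := by
  have : Fact (1 ≤ ENNReal.ofReal q) := ⟨by simpa using hpq.symm.lt.le⟩
  have := hpq.ennrealOfReal
  have hp0 : 0 < p := hpq.pos
  have hq0 : 0 < q := hpq.symm.pos
  have hp0' : ENNReal.ofReal p ≠ 0 := by simpa using hp0
  have hq0' : ENNReal.ofReal q ≠ 0 := by simpa using hq0
  set φ : UnitAddTorus (Fin n) → ℂ := fun x => ((‖g x‖ ^ (p - 2) : ℝ) : ℂ) * (starRingEnd ℂ) (g x)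
    with hφ
  have hφn : ∀ x, ‖φ x‖ ^ q = ‖g x‖ ^ p := by
    intro x
    have h1 : ‖φ x‖ = ‖g x‖ ^ (p - 2) * ‖g x‖ := by
      rw [hφ, norm_mul, RCLike.norm_conj, Complex.norm_real, Real.norm_of_nonneg (by positivity)]
    rw [h1]
    rcases eq_or_ne (‖g x‖) 0 with h0 | h0
    · rw [h0, mul_zero, Real.zero_rpow hp0.ne', Real.zero_rpow hq0.ne']
    · rw [← Real.rpow_add_one h0, ← Real.rpow_mul (norm_nonneg _)]
      congr 1
      have := hpq.sub_one_mul_conj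
      linarith
  have hgφ : ∀ x, g x * φ x = ((‖g x‖ ^ p : ℝ) : ℂ) := by
    intro x
    rw [hφ]
    rcases eq_or_ne (‖g x‖) 0 with h0 | h0
    · rw [h0, Real.zero_rpow hp0.ne', norm_eq_zero.1 h0]; simp
    · have : g x * (starRingEnd ℂ) (g x) = ((‖g x‖ ^ (2 : ℝ) : ℝ) : ℂ) := by
        rw [Complex.mul_conj, Complex.normSq_eq_norm_sq]; norm_num
      calc _ = ((‖g x‖ ^ (p - 2) : ℝ) : ℂ) * (g x * (starRingEnd ℂ) (g x)) := by ring
        _ = _ := by rw [this, ← Complex.ofReal_mul, ← Real.rpow_add (by positivity)]; congr 2; ring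
  have hφm : MemLp φ (ENNReal.ofReal q) volume := by
    have hm : AEStronglyMeasurable φ volume := by
      have hgm := hg.1
      refine AEStronglyMeasurable.mul ?_ (Complex.continuous_conj.comp_aestronglyMeasurable hgm)
      exact Complex.continuous_ofReal.comp_aestronglyMeasurable
        ((hgm.norm.aemeasurable.pow_const _).aestronglyMeasurable)
    rw [← integrable_norm_rpow_iff hm hq0' ENNReal.ofReal_ne_top, ENNReal.toReal_ofReal hq0.le]
    simp only [hφn]
    have := hg.integrable_norm_rpow hp0' ENNReal.ofReal_ne_top
    rwa [ENNReal.toReal_ofReal hp0.le] at this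
  set I := ∫ x, ‖g x‖ ^ p with hI
  have hI0 : 0 ≤ I := integral_nonneg fun _ => by positivity
  have hnφ : ‖hφm.toLp‖ = I ^ (1 / q) := by
    rw [Lp.norm_toLp, hφm.eLpNorm_eq_integral_rpow_norm hq0' ENNReal.ofReal_ne_top,
      ENNReal.toReal_ofReal (by positivity), ENNReal.toReal_ofReal hq0.le, one_div]
    simp only [hφn]; rfl
  have key : ∀ ε : ℝ, 0 < ε → I ≤ K * (I ^ (1 / q) + ε) + I ^ (1 / p) * ε := by
    intro ε hε
    obtain ⟨s, c, hsc⟩ := dense_trig hφm.toLp hε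
    set F := trig s c
    have hFm := memLp_continuousMap (ENNReal.ofReal q) F
    have hd : (∫ x, ‖φ x - F x‖ ^ q) ^ (1 / q) < ε := by
      have hm := hφm.sub hFm
      have : ‖(hm.toLp)‖ < ε := by
        refine lt_of_eq_of_lt ?_ hsc
        rw [MemLp.toLp_sub hφm hFm]; rfl
      rw [Lp.norm_toLp, hm.eLpNorm_eq_integral_rpow_norm hq0' ENNReal.ofReal_ne_top,
        ENNReal.toReal_ofReal (by positivity), ENNReal.toReal_ofReal hq0.le, ← one_div] at this
      exact this
    have hFn : (∫ x, ‖F x‖ ^ q) ^ (1 / q) ≤ I ^ (1 / q) + ε := by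
      rw [← norm_toLp_eq hpq.symm.lt, ← hnφ]
      have := norm_sub_norm_le (ContinuousMap.toLp (E := ℂ) (ENNReal.ofReal q) volume ℂ F) hφm.toLp
      rw [norm_sub_rev] at this
      linarith
    have hi1 : Integrable fun x => g x * F x := by
      exact hg.integrable_mul (q := ENNReal.ofReal q) hFm
    have hi2 : Integrable fun x => g x * (φ x - F x) := by
      exact hg.integrable_mul (q := ENNReal.ofReal q) (hφm.sub hFm)
    have e1 : ((I : ℝ) : ℂ) = (∫ x, g x * F x) + ∫ x, g x * (φ x - F x) := by
      rw [← integral_add hi1 hi2, hI, ← integral_complex_ofReal]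
      refine integral_congr_ae (Filter.Eventually.of_forall fun x => ?_)
      simp only [← hgφ]; ring
    have e2 : ‖∫ x, g x * (φ x - F x)‖ ≤ I ^ (1 / p) * ε := by
      refine (norm_integral_le_integral_norm _).trans ?_
      simp only [norm_mul]
      refine (integral_mul_norm_le_Lp_mul_Lq hpq hg (hφm.sub hFm)).trans ?_
      gcongr
      exact hd.le
    calc I = ‖((I : ℝ) : ℂ)‖ := by rw [Complex.norm_real, Real.norm_of_nonneg hI0]
      _ ≤ _ := by
        rw [e1]
        refine (norm_add_le _ _).trans (add_le_add ((h s c).trans ?_) e2)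
        gcongr
  have hfin : I ≤ K * I ^ (1 / q) := by
    have hc : Continuous fun ε : ℝ => K * (I ^ (1 / q) + ε) + I ^ (1 / p) * ε := by fun_prop
    have hlim := (hc.tendsto 0).mono_left (nhdsWithin_le_nhds (s := Ioi 0))
    simp only [add_zero, mul_zero] at hlim
    exact ge_of_tendsto hlim (eventually_nhdsWithin_of_forall fun ε hε => key ε hε)
  rcases hI0.eq_or_lt with h0 | h0
  · rw [← h0]; positivity
  have h1 : I ^ (1 / p) ≤ K := by
    have h2 : I = I ^ (1 / p) * I ^ (1 / q) := by
      rw [← Real.rpow_add h0, one_div, one_div, hpq.inv_add_inv_eq_one, Real.rpow_one]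
    have h3 : 0 < I ^ (1 / q) := by positivity
    by_contra hcon
    push Not at hcon
    have := mul_lt_mul_of_pos_right hcon h3
    linarith
  calc I = (I ^ (1 / p)) ^ p := by
        rw [← Real.rpow_mul hI0, one_div_mul_cancel hp0.ne', Real.rpow_one]
    _ ≤ K ^ p := by gcongr

lemma integral_mFourier_of_ne_zero {n : ℕ} {k : Fin n → ℤ} (hk : k ≠ 0) :
    ∫ x : UnitAddTorus (Fin n), mFourier k x = 0 := by
  obtain ⟨i, hi⟩ : ∃ i, k i ≠ 0 := Function.ne_iff.1 hk
  have h : ∫ x : UnitAddTorus (Fin n), mFourier k x =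
      ∏ i, ∫ t : UnitAddCircle, (fourier (k i) t : ℂ) :=
    integral_fintype_prod_eq_prod (fun i (t : UnitAddCircle) => (fourier (k i) t : ℂ))
  rw [h]
  refine Finset.prod_eq_zero (Finset.mem_univ i) ?_
  have := integral_eq_zero_of_add_right_eq_neg (μ := AddCircle.haarAddCircle)
    (fourier_add_half_inv_index (T := 1) hi (by norm_num))
  exact this

lemma integral_trig_mul_trig {n : ℕ} (m : (Fin n → ℤ) → ℂ) (s t : Finset (Fin n → ℤ))
    (c d : (Fin n → ℤ) → ℂ) : ∫ x, trig s (fun k => m k * c k) x * trig t d x =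
      ∫ x, trig s c x * trig t (fun k => m (-k) * d k) x := by
  have key : ∀ c d : (Fin n → ℤ) → ℂ, ∫ x, trig s c x * trig t d x =
      ∑ k ∈ s, ∑ l ∈ t, c k * d l * ∫ x, mFourier (k + l) x := by
    intro c d
    have hInt : ∀ (z : ℂ) k, Integrable fun x : UnitAddTorus (Fin n) => z * mFourier k x := by
      intro z k
      exact Continuous.integrable_of_hasCompactSupport (by fun_prop)
        (HasCompactSupport.of_compactSpace _)
    have h : ∀ x, trig s c x * trig t d x =
        ∑ k ∈ s, ∑ l ∈ t, c k * d l * mFourier (k + l) x := by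
      intro x
      rw [trig_apply, trig_apply, Finset.sum_mul_sum]
      refine Finset.sum_congr rfl fun k _ => Finset.sum_congr rfl fun l _ => ?_
      rw [mFourier_add]; ring
    simp only [h]
    rw [integral_finsetSum _ fun k _ => integrable_finsetSum _ fun l _ => hInt _ _]
    refine Finset.sum_congr rfl fun k _ => ?_
    rw [integral_finsetSum _ fun l _ => hInt _ _]
    exact Finset.sum_congr rfl fun l _ => integral_const_mul _ _
  rw [key, key]
  refine Finset.sum_congr rfl fun k _ => Finset.sum_congr rfl fun l _ => ?_
  rcases eq_or_ne (k + l) 0 with h | h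
  · rw [eq_neg_of_add_eq_zero_left h]; ring
  · rw [integral_mFourier_of_ne_zero h]; simp

lemma IsMult.dual {n : ℕ} {p q : ℝ} (hpq : p.HolderConjugate q) [Fact (1 ≤ ENNReal.ofReal p)]
    [Fact (1 ≤ ENNReal.ofReal q)] {m : (Fin n → ℤ) → ℂ} (hm : IsMult (ENNReal.ofReal q) m) :
    IsMult (ENNReal.ofReal p) (fun k => m (-k)) := by
  have := hpq.ennrealOfReal
  obtain ⟨C, hC, h⟩ := hm
  refine ⟨C, hC, fun s c => ?_⟩
  have h1 := integral_rpow_le_of_forall_trig hpq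
    (memLp_continuousMap (ENNReal.ofReal p) (trig s fun k => m (-k) * c k))
    (K := C * ‖ContinuousMap.toLp (E := ℂ) (ENNReal.ofReal p) volume ℂ (trig s c)‖)
    (by positivity) (fun t d => ?_)
  · rw [← norm_toLp_rpow hpq.lt] at h1
    exact (Real.rpow_le_rpow_iff (norm_nonneg _) (by positivity) hpq.pos).1 h1
  · rw [integral_trig_mul_trig (fun k => m (-k))]
    simp only [neg_neg]
    refine (norm_integral_le_integral_norm _).trans ?_
    simp only [norm_mul]
    refine (integral_mul_norm_le_Lp_mul_Lq hpq (memLp_continuousMap _ _)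
      (memLp_continuousMap _ _)).trans ?_
    rw [← norm_toLp_eq hpq.lt, ← norm_toLp_eq hpq.symm.lt, ← norm_toLp_eq hpq.symm.lt]
    have := h t d
    calc _ ≤ _ * _ := mul_le_mul_of_nonneg_left this (norm_nonneg _)
      _ = _ := by ring

lemma IsMult.mul {n : ℕ} {p : ℝ≥0∞} [Fact (1 ≤ p)] {m m' : (Fin n → ℤ) → ℂ} (h : IsMult p m)
    (h' : IsMult p m') : IsMult p (fun k => m k * m' k) := by
  obtain ⟨C, hC, h⟩ := h
  obtain ⟨C', hC', h'⟩ := h'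
  refine ⟨C * C', by positivity, fun s c => ?_⟩
  have := h s (fun k => m' k * c k)
  simp only [← mul_assoc] at this ⊢
  refine this.trans ?_
  rw [mul_assoc]
  exact mul_le_mul_of_nonneg_left (h' s c) hC

lemma isMult_riesz {n : ℕ} {p : ℝ} (hp1 : 1 < p)
    [Fact (1 ≤ ENNReal.ofReal p)] (j : Fin n) :
    IsMult (ENNReal.ofReal p) (riesz (n := n) j) := by
  have hn : 0 < n := j.pos
  rcases le_total p 2 with h2 | h2
  · exact isMult_riesz_of_le_two hn hp1 h2 j
  · have hpq := Real.HolderConjugate.conjExponent hp1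
    set q := p.conjExponent
    have hq1 : 1 < q := hpq.symm.lt
    have : Fact (1 ≤ ENNReal.ofReal q) := ⟨by simpa using hq1.le⟩
    have hq2 : q ≤ 2 := by
      have := hpq.mul_eq_add
      nlinarith
    obtain ⟨C, hC, h⟩ := (isMult_riesz_of_le_two hn hq1 hq2 j).dual hpq
    refine ⟨C, hC, fun s c => ?_⟩
    have := h s c
    have e : trig s (fun k => riesz j (-k) * c k) = - trig s (fun k => riesz j k * c k) := by
      have hf : ∀ k : Fin n → ℤ, freq (-k) = - freq k := fun k => by
        ext i; simp [freq]
      ext x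
      simp [trig_apply, riesz, hf]
    rwa [e, map_neg, norm_neg] at this

lemma sum_sq_freq {n : ℕ} (m : Fin n → ℤ) :
    ∑ a, (m a : ℂ) * m a = ((‖freq m‖ ^ 2 : ℝ) : ℂ) := by
  rw [EuclideanSpace.norm_sq_eq]
  push_cast
  refine Finset.sum_congr rfl fun a _ => ?_
  simp only [freq, Real.norm_eq_abs]
  rw [← Complex.ofReal_pow, sq_abs]
  push_cast
  ring

/-- The differential of a field is recovered from the trace-free symmetric part of its
differential by Riesz transforms. -/
lemma symbol_identity {n : ℕ} (hn : 2 ≤ n) (m : Fin n → ℤ) (W : Fin n → ℂ)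
    (L : Fin n → Fin n → ℂ) (hL : ∀ a b, L a b = 1 / 2 * (m a * W b + m b * W a) -
      (∑ c, m c * W c) / n * if a = b then 1 else 0) (j k : Fin n) :
    m j * W k = (∑ a, 2 * (riesz a m * riesz j m) * L a k) -
      ((n - 2 : ℂ) / (n - 1)) *
        ∑ a, ∑ b, (riesz j m * riesz k m * (riesz a m * riesz b m)) * L a b := by
  set S := ∑ c, (m c : ℂ) * W c with hS
  set N : ℂ := ((‖freq m‖ : ℝ) : ℂ) with hN
  have hQ : ∑ a, (m a : ℂ) * m a = N ^ 2 := by rw [sum_sq_freq]; push_cast; rfl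
  have hr : ∀ a, riesz a m = m a * N⁻¹ := fun a => by simp [riesz, freq, hN]
  have hn0 : (n : ℂ) ≠ 0 := by exact_mod_cast (by omega : n ≠ 0)
  have hn1 : (n : ℂ) - 1 ≠ 0 := by
    rw [sub_ne_zero]; exact_mod_cast (by omega : n ≠ 1)
  rcases eq_or_ne m 0 with rfl | h0
  · simp [hr]
  have hN0 : N ≠ 0 := by
    have : freq m ≠ 0 := fun h => h0 (funext fun i => by
      simpa [freq] using congrArg (fun v : Euc n => v i) h)
    simpa [hN] using this
  have h1 : ∀ k, ∑ a, m a * L a k = 1 / 2 * (N ^ 2 * W k + m k * S) - S / n * m k := by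
    intro k
    have : ∀ a, m a * L a k = 1 / 2 * ((m a * m a) * W k + m k * (m a * W a)) -
        S / n * (if a = k then (m a : ℂ) else 0) := by
      intro a; rw [hL]; split_ifs <;> ring
    simp only [this]
    rw [Finset.sum_sub_distrib, ← Finset.mul_sum, Finset.sum_add_distrib, ← Finset.sum_mul, hQ,
      ← Finset.mul_sum, ← hS, ← Finset.mul_sum]
    simp
  have h2 : ∑ a, ∑ b, m a * (m b * L a b) = N ^ 2 * S - S / n * N ^ 2 := by
    rw [Finset.sum_comm]
    have : ∀ b, ∑ a, m a * (m b * L a b) =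
        1 / 2 * (N ^ 2 * (m b * W b) + (m b * m b) * S) - S / n * (m b * m b) := by
      intro b
      have : ∑ a, m a * (m b * L a b) = m b * ∑ a, m a * L a b := by
        rw [Finset.mul_sum]; exact Finset.sum_congr rfl fun a _ => by ring
      rw [this, h1]; ring
    simp only [this]
    rw [Finset.sum_sub_distrib, ← Finset.mul_sum, ← Finset.mul_sum, Finset.sum_add_distrib,
      ← Finset.mul_sum, ← Finset.sum_mul, hQ, ← hS]
    ring
  have e1 : ∑ a, 2 * (riesz a m * riesz j m) * L a k = 2 * m j * N⁻¹ ^ 2 * ∑ a, m a * L a k := by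
    rw [Finset.mul_sum]
    exact Finset.sum_congr rfl fun a _ => by rw [hr, hr]; ring
  have e2 : ∑ a, ∑ b, (riesz j m * riesz k m * (riesz a m * riesz b m)) * L a b =
      m j * m k * N⁻¹ ^ 4 * ∑ a, ∑ b, m a * (m b * L a b) := by
    simp only [Finset.mul_sum]
    exact Finset.sum_congr rfl fun a _ => Finset.sum_congr rfl fun b _ => by
      simp only [hr]; ring
  rw [e1, e2, h1, h2]
  field_simp
  ring

lemma integrable_mul_trig {n : ℕ} {p q : ℝ} (hpq : p.HolderConjugate q)
    {g : UnitAddTorus (Fin n) → ℂ} (hg : MemLp g (ENNReal.ofReal p) volume)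
    (F : C(UnitAddTorus (Fin n), ℂ)) : Integrable fun x => g x * F x := by
  have := hpq.ennrealOfReal
  exact hg.integrable_mul (q := ENNReal.ofReal q) (memLp_continuousMap _ F)

lemma integral_mul_trig {n : ℕ} {p q : ℝ} (hpq : p.HolderConjugate q)
    {g : UnitAddTorus (Fin n) → ℂ} (hg : MemLp g (ENNReal.ofReal p) volume) (s c) :
    ∫ x, g x * trig s c x = ∑ k ∈ s, c k * ∫ x, g x * mFourier k x := by
  have : ∀ x, g x * trig s c x = ∑ k ∈ s, c k * (g x * mFourier k x) := fun x => by
    rw [trig_apply, Finset.mul_sum]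
    exact Finset.sum_congr rfl fun k _ => by ring
  simp only [this]
  rw [integral_finsetSum _ fun k _ => (integrable_mul_trig hpq hg _).const_mul _]
  exact Finset.sum_congr rfl fun k _ => integral_const_mul _ _

lemma norm_integral_mul_mult_le {n : ℕ} {p q : ℝ} (hpq : p.HolderConjugate q)
    [Fact (1 ≤ ENNReal.ofReal q)] {m : (Fin n → ℤ) → ℂ} (hm : IsMult (ENNReal.ofReal q) m) :
    ∃ C : ℝ, 0 ≤ C ∧ ∀ (g : UnitAddTorus (Fin n) → ℂ) (Λ : ℝ), 0 ≤ Λ →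
      MemLp g (ENNReal.ofReal p) volume → ∫ x, ‖g x‖ ^ p ≤ Λ ^ p → ∀ s c,
      ‖∑ k ∈ s, c k * (m k * ∫ x, g x * mFourier k x)‖ ≤
        C * Λ * (∫ x, ‖trig s c x‖ ^ q) ^ (1 / q) := by
  have := hpq.ennrealOfReal
  obtain ⟨C, hC, h⟩ := hm
  refine ⟨C, hC, fun g Λ hΛ hg hgΛ s c => ?_⟩
  have e : ∑ k ∈ s, c k * (m k * ∫ x, g x * mFourier k x) =
      ∫ x, g x * trig s (fun k => m k * c k) x := by
    rw [integral_mul_trig hpq hg]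
    exact Finset.sum_congr rfl fun k _ => by ring
  rw [e]
  refine (norm_integral_le_integral_norm _).trans ?_
  simp only [norm_mul]
  refine (integral_mul_norm_le_Lp_mul_Lq hpq hg (memLp_continuousMap _ _)).trans ?_
  rw [← norm_toLp_eq hpq.symm.lt, ← norm_toLp_eq hpq.symm.lt]
  have h1 : (∫ x, ‖g x‖ ^ p) ^ (1 / p) ≤ Λ := by
    refine (Real.rpow_le_rpow (integral_nonneg fun _ => by positivity) hgΛ
      (one_div_nonneg.2 hpq.nonneg)).trans ?_
    rw [← Real.rpow_mul hΛ, mul_one_div_cancel hpq.pos.ne', Real.rpow_one]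
  calc _ ≤ Λ * (C * ‖ContinuousMap.toLp (E := ℂ) (ENNReal.ofReal q) volume ℂ (trig s c)‖) :=
        mul_le_mul h1 (h s c) (norm_nonneg _) hΛ
    _ = _ := by ring

lemma exists_torus_korn {n : ℕ} (hn : 2 ≤ n) {p : ℝ} (hp1 : 1 < p) :
    ∃ C : ℝ, 0 ≤ C ∧ ∀ (j k : Fin n) (D : UnitAddTorus (Fin n) → ℂ)
      (L : Fin n → Fin n → UnitAddTorus (Fin n) → ℂ) (Λ : ℝ), 0 ≤ Λ →
      MemLp D (ENNReal.ofReal p) volume → (∀ a b, MemLp (L a b) (ENNReal.ofReal p) volume) →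
      (∀ a b, ∫ x, ‖L a b x‖ ^ p ≤ Λ ^ p) →
      (∀ m : Fin n → ℤ, ∃ W : Fin n → ℂ, ∫ x, D x * mFourier m x = m j * W k ∧
        ∀ a b, ∫ x, L a b x * mFourier m x = 1 / 2 * (m a * W b + m b * W a) -
          (∑ c, m c * W c) / n * if a = b then 1 else 0) →
      ∫ x, ‖D x‖ ^ p ≤ (C * Λ) ^ p := by
  have hpq := Real.HolderConjugate.conjExponent hp1
  set q := p.conjExponent
  have : Fact (1 ≤ ENNReal.ofReal q) := ⟨by simpa using hpq.symm.lt.le⟩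
  have hR := fun j : Fin n => isMult_riesz (p := q) hpq.symm.lt j
  choose C₁ hC₁ h₁ using fun a j : Fin n =>
    norm_integral_mul_mult_le hpq ((hR a).mul (hR j))
  choose C₂ hC₂ h₂ using fun j k a b : Fin n =>
    norm_integral_mul_mult_le hpq (((hR j).mul (hR k)).mul ((hR a).mul (hR b)))
  set κ : ℂ := (n - 2 : ℂ) / (n - 1) with hκ
  set K : Fin n → Fin n → ℝ := fun j k => (∑ a, 2 * C₁ a j) + ‖κ‖ * ∑ a, ∑ b, C₂ j k a b with hK
  have hK0 : ∀ j k, 0 ≤ K j k := fun j k => by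
    have h1 := Finset.sum_nonneg fun a (_ : a ∈ Finset.univ) => mul_nonneg zero_le_two (hC₁ a j)
    have h2 := Finset.sum_nonneg fun a (_ : a ∈ Finset.univ) =>
      Finset.sum_nonneg fun b (_ : b ∈ Finset.univ) => hC₂ j k a b
    simp only [hK]; positivity
  refine ⟨∑ j, ∑ k, K j k, Finset.sum_nonneg fun j _ => Finset.sum_nonneg fun k _ => hK0 j k,
    fun j k D L Λ hΛ hD hL hLΛ hW => ?_⟩
  have hKle : K j k ≤ ∑ j, ∑ k, K j k :=
    (Finset.single_le_sum (f := fun k => K j k) (fun k _ => hK0 j k) (Finset.mem_univ k)).trans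
      (Finset.single_le_sum (f := fun j => ∑ k, K j k)
        (fun j _ => Finset.sum_nonneg fun k _ => hK0 j k) (Finset.mem_univ j))
  refine (integral_rpow_le_of_forall_trig hpq hD (mul_nonneg (hK0 j k) hΛ)
    fun s c => ?_).trans (Real.rpow_le_rpow (mul_nonneg (hK0 j k) hΛ) (by gcongr) hpq.nonneg)
  set T := (∫ x, ‖trig s c x‖ ^ q) ^ (1 / q)
  have e : ∫ x, D x * trig s c x =
      (∑ a, 2 * ∑ m ∈ s, c m * (riesz a m * riesz j m * ∫ x, L a k x * mFourier m x)) -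
      κ * ∑ a, ∑ b, ∑ m ∈ s, c m * (riesz j m * riesz k m * (riesz a m * riesz b m) *
        ∫ x, L a b x * mFourier m x) := by
    rw [integral_mul_trig hpq hD]
    have : ∀ m, ∫ x, D x * mFourier m x =
        (∑ a, 2 * (riesz a m * riesz j m) * ∫ x, L a k x * mFourier m x) - κ *
        ∑ a, ∑ b, (riesz j m * riesz k m * (riesz a m * riesz b m)) *
          ∫ x, L a b x * mFourier m x := by
      intro m
      obtain ⟨W, hW1, hW2⟩ := hW m
      rw [hW1]
      exact symbol_identity hn m W (fun a b => ∫ x, L a b x * mFourier m x) hW2 j k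
    simp only [this, mul_sub, Finset.sum_sub_distrib, Finset.mul_sum]
    congr 1
    · rw [Finset.sum_comm]
      exact Finset.sum_congr rfl fun a _ => Finset.sum_congr rfl fun m _ => by ring
    · rw [Finset.sum_comm]
      refine Finset.sum_congr rfl fun a _ => ?_
      rw [Finset.sum_comm]
      exact Finset.sum_congr rfl fun b _ => Finset.sum_congr rfl fun m _ => by ring
  rw [e]
  refine (norm_sub_le _ _).trans ?_
  have b1 : ‖∑ a, 2 * ∑ m ∈ s, c m * (riesz a m * riesz j m * ∫ x, L a k x * mFourier m x)‖ ≤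
      (∑ a, 2 * C₁ a j) * Λ * T := by
    rw [Finset.sum_mul, Finset.sum_mul]
    refine (norm_sum_le _ _).trans (Finset.sum_le_sum fun a _ => ?_)
    rw [norm_mul, Complex.norm_ofNat]
    have := h₁ a j (L a k) Λ hΛ (hL a k) (hLΛ a k) s c
    linarith
  have b2 : ‖∑ a, ∑ b, ∑ m ∈ s, c m * (riesz j m * riesz k m * (riesz a m * riesz b m) *
        ∫ x, L a b x * mFourier m x)‖ ≤ (∑ a, ∑ b, C₂ j k a b) * Λ * T := by
    rw [Finset.sum_mul, Finset.sum_mul]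
    refine (norm_sum_le _ _).trans (Finset.sum_le_sum fun a _ => ?_)
    rw [Finset.sum_mul, Finset.sum_mul]
    refine (norm_sum_le _ _).trans (Finset.sum_le_sum fun b _ => ?_)
    exact h₂ j k a b (L a b) Λ hΛ (hL a b) (hLΛ a b) s c
  rw [norm_mul]
  calc _ ≤ (∑ a, 2 * C₁ a j) * Λ * T + ‖κ‖ * ((∑ a, ∑ b, C₂ j k a b) * Λ * T) := by gcongr
    _ = _ := by simp only [hK]; ring

/-- The fundamental domain of the torus. -/
def fundCube (n : ℕ) : Set (Fin n → ℝ) := {x | ∀ i, x i ∈ Ioc (-(1 / 2) : ℝ) (-(1 / 2) + 1)}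

/-- Representatives of points of the torus. -/
def torusRep {n : ℕ} (x : UnitAddTorus (Fin n)) : Euc n :=
  WithLp.toLp 2 (measurableEquivPiIoc (fun _ => -(1 / 2) : Fin n → ℝ) x).1

lemma measurableSet_fundCube (n : ℕ) : MeasurableSet (fundCube n) :=
  MeasurableSet.univ_pi' fun _ => measurableSet_Ioc

lemma measurableEmbedding_torusRep {n : ℕ} : MeasurableEmbedding (torusRep (n := n)) :=
  (MeasurableEquiv.toLp 2 (Fin n → ℝ)).measurableEmbedding.comp
    ((MeasurableEmbedding.subtype_coe (measurableSet_fundCube n)).comp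
      (measurableEquivPiIoc (fun _ => -(1 / 2) : Fin n → ℝ)).measurableEmbedding)

lemma measurePreserving_torusRep {n : ℕ} : MeasurePreserving (torusRep (n := n)) volume
    (volume.restrict (WithLp.ofLp ⁻¹' fundCube n)) := by
  have h1 := measurePreserving_equivPiIoc (fun _ => -(1 / 2) : Fin n → ℝ)
  have h2 : MeasurePreserving (Subtype.val : fundCube n → Fin n → ℝ)
      (volume.comap Subtype.val) (volume.restrict (fundCube n)) :=
    ⟨measurable_subtype_coe, map_comap_subtype_coe (measurableSet_fundCube n) volume⟩
  have h3 : MeasurePreserving (WithLp.toLp 2) (volume.restrict (fundCube n))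
      (volume.restrict (WithLp.ofLp ⁻¹' fundCube n : Set (Euc n))) := by
    have := (PiLp.volume_preserving_toLp (Fin n)).restrict_preimage_emb
      (MeasurableEquiv.toLp 2 (Fin n → ℝ)).measurableEmbedding
      (WithLp.ofLp ⁻¹' fundCube n : Set (Euc n))
    exact this
  exact h3.comp (h2.comp h1)

/-- The characters as functions on Euclidean space. -/
def expChar {n : ℕ} (m : Fin n → ℤ) (x : Euc n) : ℂ :=
  Complex.exp (2 * Real.pi * Complex.I * (inner ℝ (freq m) x : ℝ))

lemma expChar_torusRep {n : ℕ} (m : Fin n → ℤ) (x : UnitAddTorus (Fin n)) :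
    expChar m (torusRep x) = mFourier m x := by
  have hx : x = fun i => ((torusRep x i : ℝ) : UnitAddCircle) :=
    ((measurableEquivPiIoc (fun _ => -(1 / 2) : Fin n → ℝ)).symm_apply_apply x).symm
  conv_rhs => rw [hx]
  simp only [mFourier, ContinuousMap.coe_mk, fourier_coe_apply, ← Complex.exp_sum]
  rw [expChar, inner_freq]
  congr 1
  push_cast
  rw [Finset.mul_sum]
  exact Finset.sum_congr rfl fun i _ => by ring

lemma norm_expChar {n : ℕ} (m : Fin n → ℤ) (x : Euc n) : ‖expChar m x‖ = 1 := by
  rw [expChar, show (2 * Real.pi * Complex.I * (inner ℝ (freq m) x : ℝ) : ℂ) =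
    ((2 * Real.pi * inner ℝ (freq m) x : ℝ) : ℂ) * Complex.I by push_cast; ring]
  exact Complex.norm_exp_ofReal_mul_I _

lemma hasFDerivAt_expChar {n : ℕ} (m : Fin n → ℤ) (x : Euc n) :
    HasFDerivAt (expChar m) (expChar m x • ((2 * Real.pi * Complex.I : ℂ) •
      (Complex.ofRealCLM ∘L innerSL ℝ (freq m)))) x := by
  have h1 : HasFDerivAt (fun x : Euc n => ((inner ℝ (freq m) x : ℝ) : ℂ))
      (Complex.ofRealCLM ∘L innerSL ℝ (freq m)) x :=
    (Complex.ofRealCLM ∘L innerSL ℝ (freq m)).hasFDerivAt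
  exact (h1.const_mul (2 * Real.pi * Complex.I : ℂ)).cexp

lemma fderiv_expChar_single {n : ℕ} (m : Fin n → ℤ) (x : Euc n) (j : Fin n) :
    fderiv ℝ (expChar m) x (EuclideanSpace.single j 1) =
      (2 * Real.pi * Complex.I) * m j * expChar m x := by
  rw [(hasFDerivAt_expChar m x).fderiv]
  simp [freq, EuclideanSpace.inner_single_right]
  ring

lemma continuous_expChar {n : ℕ} (m : Fin n → ℤ) : Continuous (expChar (n := n) m) :=
  continuous_iff_continuousAt.2 fun x => (hasFDerivAt_expChar m x).continuousAt

lemma abs_le_matNorm {n : ℕ} (M : Matrix (Fin n) (Fin n) ℝ) (i j : Fin n) :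
    |M i j| ≤ matNorm M := by
  rw [← Real.sqrt_sq_eq_abs]
  refine Real.sqrt_le_sqrt ?_
  exact (Finset.single_le_sum (f := fun j => M i j ^ 2) (fun _ _ => sq_nonneg _)
    (Finset.mem_univ j)).trans (Finset.single_le_sum (f := fun i => ∑ j, M i j ^ 2)
      (fun _ _ => Finset.sum_nonneg fun _ _ => sq_nonneg _) (Finset.mem_univ i))

lemma matNorm_nonneg {n : ℕ} (M : Matrix (Fin n) (Fin n) ℝ) : 0 ≤ matNorm M := Real.sqrt_nonneg _

lemma matNorm_le_sum {n : ℕ} (M : Matrix (Fin n) (Fin n) ℝ) : matNorm M ≤ ∑ i, ∑ j, |M i j| := by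
  refine Real.sqrt_le_iff.2 ⟨Finset.sum_nonneg fun i _ => Finset.sum_nonneg fun j _ => abs_nonneg _, ?_⟩
  calc ∑ i, ∑ j, M i j ^ 2 ≤ ∑ i, (∑ j, |M i j|) ^ 2 := by
        refine Finset.sum_le_sum fun i _ => ?_
        simp only [← sq_abs (M i _)]
        exact Finset.sum_sq_le_sq_sum_of_nonneg fun j _ => abs_nonneg _
    _ ≤ _ := Finset.sum_sq_le_sq_sum_of_nonneg fun i _ => Finset.sum_nonneg fun j _ => abs_nonneg _

lemma matNorm_rpow_le {n : ℕ} {p : ℝ} (hp : 1 ≤ p) (M : Matrix (Fin n) (Fin n) ℝ) :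
    matNorm M ^ p ≤ ((n : ℝ) * n) ^ (p - 1) * ∑ i, ∑ j, |M i j| ^ p := by
  have h := Real.rpow_sum_le_const_mul_sum_rpow (Finset.univ : Finset (Fin n × Fin n))
    (fun x => M x.1 x.2) hp
  simp only [Finset.card_univ, Fintype.card_prod, Fintype.card_fin, Nat.cast_mul,
    Fintype.sum_prod_type] at h
  exact (Real.rpow_le_rpow (matNorm_nonneg M) (matNorm_le_sum M) (by linarith)).trans h

lemma measurable_Dmat {n : ℕ} (v : Euc n → Euc n) (i j : Fin n) :
    Measurable fun x => Dmat v x i j :=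
  (EuclideanSpace.proj (𝕜 := ℝ) i).continuous.measurable.comp
    (measurable_fderiv_apply_const ℝ v (EuclideanSpace.single j 1))

lemma lMat_apply {n : ℕ} (v : Euc n → Euc n) (x : Euc n) (a b : Fin n) :
    lMat v x a b = 1 / 2 * (Dmat v x a b + Dmat v x b a) -
      (∑ c, Dmat v x c c) / n * if a = b then 1 else 0 := by
  simp [lMat, epsMat, Matrix.trace, Matrix.one_apply, mul_add]

lemma measurable_lMat {n : ℕ} (v : Euc n → Euc n) (i j : Fin n) :
    Measurable fun x => lMat v x i j := by
  simp only [lMat_apply]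
  have := fun i j => measurable_Dmat v i j
  fun_prop

lemma measurable_matNorm {n : ℕ} {M : Euc n → Matrix (Fin n) (Fin n) ℝ}
    (h : ∀ i j, Measurable fun x => M x i j) : Measurable fun x => matNorm (M x) := by
  unfold matNorm
  exact (Finset.measurable_sum _ fun i _ => Finset.measurable_sum _ fun j _ =>
    (h i j).pow_const 2).sqrt

lemma matNorm_zero {n : ℕ} : matNorm (0 : Matrix (Fin n) (Fin n) ℝ) = 0 := by simp [matNorm]

lemma abs_lMat_le {n : ℕ} (v : Euc n → Euc n) (x : Euc n) (a b : Fin n) :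
    |lMat v x a b| ≤ 2 * matNorm (Dmat v x) := by
  have hn : 0 < n := a.pos
  rw [lMat_apply]
  have h1 := abs_le.1 (abs_le_matNorm (Dmat v x) a b)
  have h2 := abs_le.1 (abs_le_matNorm (Dmat v x) b a)
  have h3 : |(∑ c, Dmat v x c c) / n| ≤ matNorm (Dmat v x) := by
    rw [abs_div, Nat.abs_cast, div_le_iff₀ (by positivity)]
    refine (Finset.abs_sum_le_sum_abs _ _).trans ?_
    refine (Finset.sum_le_card_nsmul _ _ _ fun c _ => abs_le_matNorm (Dmat v x) c c).trans ?_
    simp [mul_comm]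
  have h3 := abs_le.1 h3
  have h4 := matNorm_nonneg (Dmat v x)
  split_ifs <;> rw [abs_le] <;> constructor <;> linarith [h1.1, h1.2, h2.1, h2.2, h3.1, h3.2]

lemma matNorm_lMat_le {n : ℕ} (v : Euc n → Euc n) (x : Euc n) :
    matNorm (lMat v x) ≤ 2 * n * n * matNorm (Dmat v x) := by
  refine (matNorm_le_sum _).trans ?_
  refine (Finset.sum_le_sum fun i _ => Finset.sum_le_sum fun j _ => abs_lMat_le v x i j).trans ?_
  simp only [Finset.sum_const, Finset.card_univ, Fintype.card_fin, nsmul_eq_mul]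
  exact le_of_eq (by ring)

lemma fderiv_eq_zero_of_notMem {n : ℕ} {V : Euc n → Euc n} {K : Set (Euc n)}
    (hK : tsupport V ⊆ K) {x : Euc n} (hx : x ∉ K) : fderiv ℝ V x = 0 := by
  by_contra h
  exact hx (hK (support_fderiv_subset ℝ h))

/-- Korn inequality for fields supported well inside the unit cube. -/
lemma exists_compactSupport_korn {n : ℕ} (hn : 2 ≤ n) {p : ℝ} (hp1 : 1 < p) :
    ∃ C : ℝ, 0 ≤ C ∧ ∀ V : Euc n → Euc n, Differentiable ℝ V →
      tsupport V ⊆ closedBall 0 (2 / 5) → Integrable (fun x => matNorm (Dmat V x) ^ p) →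
      ∫ x, matNorm (Dmat V x) ^ p ≤ C * ∫ x, matNorm (lMat V x) ^ p := by
  obtain ⟨C, hC, h⟩ := exists_torus_korn hn hp1
  have hp0 : 0 < p := by linarith
  refine ⟨((n : ℝ) * n) ^ (p - 1) * (n * n * C ^ p), by positivity, fun V hV hsupp hInt => ?_⟩
  have hfd : ∀ x, x ∉ closedBall (0 : Euc n) (2 / 5) → fderiv ℝ V x = 0 := fun x hx =>
    fderiv_eq_zero_of_notMem hsupp hx
  have hD0 : ∀ x, x ∉ closedBall (0 : Euc n) (2 / 5) → Dmat V x = 0 := fun x hx => by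
    ext i j; simp [Dmat, hfd x hx]
  have hL0 : ∀ x, x ∉ closedBall (0 : Euc n) (2 / 5) → lMat V x = 0 := fun x hx => by
    ext i j; simp [lMat_apply, hD0 x hx]
  have hcube : closedBall (0 : Euc n) (2 / 5) ⊆ WithLp.ofLp ⁻¹' fundCube n := by
    intro x hx i
    have h1 : |x i| ≤ 2 / 5 := (PiLp.norm_apply_le x i).trans (by simpa using hx)
    have := abs_le.1 h1
    constructor <;> dsimp only <;> linarith [this.1, this.2]
  have htr : ∀ F : Euc n → ℂ, (∀ x, x ∉ closedBall (0 : Euc n) (2 / 5) → F x = 0) →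
      ∫ x, F (torusRep x) = ∫ x, F x := fun F hF => by
    rw [measurePreserving_torusRep.integral_comp measurableEmbedding_torusRep]
    exact setIntegral_eq_integral_of_forall_compl_eq_zero fun x hx => hF x fun h => hx (hcube h)
  have htr' : ∀ F : Euc n → ℝ, (∀ x, x ∉ closedBall (0 : Euc n) (2 / 5) → F x = 0) →
      ∫ x, F (torusRep x) = ∫ x, F x := fun F hF => by
    rw [measurePreserving_torusRep.integral_comp measurableEmbedding_torusRep]
    exact setIntegral_eq_integral_of_forall_compl_eq_zero fun x hx => hF x fun h => hx (hcube h)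
  have hmem : ∀ F : Euc n → ℝ, Measurable F → ∀ c : ℝ, (∀ x, |F x| ≤ c * matNorm (Dmat V x)) →
      MemLp F (ENNReal.ofReal p) volume := by
    intro F hF c hc
    have h1 : MemLp (fun x => matNorm (Dmat V x)) (ENNReal.ofReal p) volume := by
      rw [← integrable_norm_rpow_iff (measurable_matNorm (measurable_Dmat V)).aestronglyMeasurable
        (by simpa using hp0) (by simp), ENNReal.toReal_ofReal hp0.le]
      simpa only [Real.norm_of_nonneg (matNorm_nonneg _)] using hInt
    refine h1.of_le_mul (c := c) hF.aestronglyMeasurable (Filter.Eventually.of_forall fun x => ?_)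
    rw [Real.norm_eq_abs, Real.norm_of_nonneg (matNorm_nonneg _)]
    exact hc x
  have hmD : ∀ i j, MemLp (fun x => Dmat V x i j) (ENNReal.ofReal p) volume := fun i j =>
    hmem _ (measurable_Dmat V i j) 1 fun x => by simpa using abs_le_matNorm _ i j
  have hmL : ∀ i j, MemLp (fun x => lMat V x i j) (ENNReal.ofReal p) volume := fun i j =>
    hmem _ (measurable_lMat V i j) 2 fun x => abs_lMat_le V x i j
  have hintL : Integrable fun x => matNorm (lMat V x) ^ p := by
    have h1 : Integrable fun x => (2 * n * n * matNorm (Dmat V x)) ^ p := by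
      simp_rw [fun x => Real.mul_rpow (z := p) (by positivity : (0 : ℝ) ≤ 2 * n * n)
        (matNorm_nonneg (Dmat V x))]
      exact hInt.const_mul _
    refine h1.mono' ((measurable_matNorm (measurable_lMat V)).pow_const p).aestronglyMeasurable
      (Filter.Eventually.of_forall fun x => ?_)
    rw [Real.norm_of_nonneg (by have := matNorm_nonneg (lMat V x); positivity)]
    exact Real.rpow_le_rpow (matNorm_nonneg _) (matNorm_lMat_le V x) hp0.le
  have hto : ∀ F : Euc n → ℝ, MemLp F (ENNReal.ofReal p) volume →
      MemLp (fun x => (F (torusRep x) : ℂ)) (ENNReal.ofReal p) volume := fun F hF =>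
    ((hF.restrict _).comp_measurePreserving measurePreserving_torusRep).ofReal
  have hDint : ∀ i j, Integrable fun x => Dmat V x i j := fun i j => by
    have : IntegrableOn (fun x => Dmat V x i j) (closedBall (0 : Euc n) (2 / 5)) := by
      have : IsFiniteMeasure (volume.restrict (closedBall (0 : Euc n) (2 / 5))) :=
        isFiniteMeasure_restrict.2 measure_closedBall_lt_top.ne
      exact ((hmD i j).restrict _).integrable (by simpa using hp1.le)
    exact this.integrable_of_forall_notMem_eq_zero fun x hx => by simp [hD0 x hx]
  have hVint : ∀ k, Integrable fun x => V x k := fun k => by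
    refine Continuous.integrable_of_hasCompactSupport
      ((EuclideanSpace.proj (𝕜 := ℝ) k).continuous.comp hV.continuous) ?_
    refine HasCompactSupport.of_support_subset_isCompact (isCompact_closedBall 0 (2 / 5))
      fun x hx => hsupp (subset_tsupport _ fun h => hx ?_)
    simp [h]
  have hmulE : ∀ (F : Euc n → ℝ) m, Integrable F → Integrable fun x => (F x : ℂ) * expChar m x :=
    fun F m hF => by
    refine (hF.ofReal (𝕜 := ℂ)).mul_bdd (c := 1) (continuous_expChar m).aestronglyMeasurable
      (Filter.Eventually.of_forall fun x => (norm_expChar m x).le)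
  set W : (Fin n → ℤ) → Fin n → ℂ := fun m k =>
    -(2 * Real.pi * Complex.I) * ∫ x, (V x k : ℂ) * expChar m x with hW
  have hIBP : ∀ m j k, ∫ x, (Dmat V x k j : ℂ) * expChar m x = m j * W m k := by
    intro m j k
    have hVk : ∀ x, HasFDerivAt (fun x => (V x k : ℂ))
        (Complex.ofRealCLM ∘L EuclideanSpace.proj (𝕜 := ℝ) k ∘L fderiv ℝ V x) x := fun x =>
      (Complex.ofRealCLM ∘L EuclideanSpace.proj (𝕜 := ℝ) k).hasFDerivAt.comp x (hV x).hasFDerivAt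
    have h1 : ∀ x, fderiv ℝ (fun x => (V x k : ℂ)) x (EuclideanSpace.single j 1) =
        (Dmat V x k j : ℂ) := fun x => by rw [(hVk x).fderiv]; rfl
    have := integral_mul_fderiv_eq_neg_fderiv_mul_of_integrable (𝕜 := ℂ)
      (f := fun x => (V x k : ℂ)) (g := expChar m) (v := EuclideanSpace.single j (1 : ℝ))
      (μ := volume) ?_ ?_ ?_ (fun x _ => (hVk x).differentiableAt)
      (fun x _ => (hasFDerivAt_expChar m x).differentiableAt)
    · simp only [h1] at this
      rw [← neg_eq_iff_eq_neg] at this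
      rw [← this]
      simp only [fderiv_expChar_single, hW]
      rw [show (fun x => (V x k : ℂ) * (2 * Real.pi * Complex.I * m j * expChar m x)) =
        fun x => (2 * Real.pi * Complex.I * m j) * ((V x k : ℂ) * expChar m x) by
          ext x; ring, integral_const_mul]
      ring
    · simp only [h1]; exact hmulE _ m (hDint k j)
    · simp only [fderiv_expChar_single]
      refine ((hmulE _ m (hVint k)).const_mul (2 * Real.pi * Complex.I * m j)).congr
        (Filter.Eventually.of_forall fun x => ?_)
      simp only; ring
    · exact hmulE _ m (hVint k)
  set Λ := (∫ x, matNorm (lMat V x) ^ p) ^ (1 / p) with hΛ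
  have hI0 : 0 ≤ ∫ x, matNorm (lMat V x) ^ p :=
    integral_nonneg fun x => Real.rpow_nonneg (matNorm_nonneg _) _
  have hΛ0 : 0 ≤ Λ := Real.rpow_nonneg hI0 _
  have hΛp : Λ ^ p = ∫ x, matNorm (lMat V x) ^ p := by
    rw [hΛ, ← Real.rpow_mul hI0, one_div_mul_cancel hp0.ne', Real.rpow_one]
  have hkey : ∀ k j, ∫ x, |Dmat V x k j| ^ p ≤ C ^ p * ∫ x, matNorm (lMat V x) ^ p := by
    intro k j
    have h1 := h j k (fun x => (Dmat V (torusRep x) k j : ℂ))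
      (fun a b x => (lMat V (torusRep x) a b : ℂ)) Λ hΛ0 (hto _ (hmD k j))
      (fun a b => hto _ (hmL a b)) ?_ ?_
    · rw [← hΛp, ← Real.mul_rpow hC hΛ0]
      refine le_of_eq_of_le ?_ h1
      simp only [Complex.norm_real, Real.norm_eq_abs]
      exact (htr' (fun x => |Dmat V x k j| ^ p) fun x hx => by
        simp [hD0 x hx, Real.zero_rpow hp0.ne']).symm
    · intro a b
      simp only [Complex.norm_real, Real.norm_eq_abs]
      rw [htr' (fun x => |lMat V x a b| ^ p) fun x hx => by
        simp [hL0 x hx, Real.zero_rpow hp0.ne'], hΛp]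
      exact integral_mono_of_nonneg (Filter.Eventually.of_forall fun x => by positivity) hintL
        (Filter.Eventually.of_forall fun x =>
          Real.rpow_le_rpow (abs_nonneg _) (abs_le_matNorm _ a b) hp0.le)
    · intro m
      have hD : ∀ j k, ∫ x, (Dmat V (torusRep x) k j : ℂ) * mFourier m x = m j * W m k := by
        intro j k
        rw [← hIBP]
        simp only [← expChar_torusRep]
        exact htr (fun x => (Dmat V x k j : ℂ) * expChar m x) fun x hx => by simp [hD0 x hx]
      have hi : ∀ k j, Integrable fun x => (Dmat V (torusRep x) k j : ℂ) * mFourier m x :=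
        fun k j => by
        have h1 := (hto _ (hmD k j)).integrable (by simpa using hp1.le)
        exact h1.mul_bdd (c := 1) (mFourier m).continuous.aestronglyMeasurable
          (Filter.Eventually.of_forall fun x => by
            rw [← expChar_torusRep]; exact (norm_expChar m _).le)
      refine ⟨W m, hD j k, fun a b => ?_⟩
      have e : ∀ x, (lMat V (torusRep x) a b : ℂ) * mFourier m x =
          1 / 2 * ((Dmat V (torusRep x) a b : ℂ) * mFourier m x +
            (Dmat V (torusRep x) b a : ℂ) * mFourier m x) -
          (∑ c, (Dmat V (torusRep x) c c : ℂ) * mFourier m x) *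
            ((1 : ℂ) / n * if a = b then 1 else 0) := fun x => by
        rw [lMat_apply, ← Finset.sum_mul]
        split_ifs <;> (push_cast; ring)
      simp only [e]
      rw [integral_sub (by exact ((hi a b).add (hi b a)).const_mul _)
        ((integrable_finsetSum _ fun c _ => hi c c).mul_const _), integral_const_mul,
        integral_add (hi a b) (hi b a), integral_mul_const, integral_finsetSum _ fun c _ => hi c c]
      simp only [hD]
      ring
  have hDp : ∀ i j, Integrable fun x => |Dmat V x i j| ^ p := fun i j => by
    simpa [ENNReal.toReal_ofReal hp0.le] using
      (hmD i j).integrable_norm_rpow (by simpa using hp0) (by simp)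
  calc ∫ x, matNorm (Dmat V x) ^ p
      ≤ ∫ x, ((n : ℝ) * n) ^ (p - 1) * ∑ i, ∑ j, |Dmat V x i j| ^ p := by
        refine integral_mono hInt ?_ fun x => matNorm_rpow_le hp1.le _
        exact (integrable_finsetSum _ fun i _ => integrable_finsetSum _ fun j _ =>
          hDp i j).const_mul _
    _ = ((n : ℝ) * n) ^ (p - 1) * ∑ i, ∑ j, ∫ x, |Dmat V x i j| ^ p := by
        rw [integral_const_mul, integral_finsetSum _ fun i _ => integrable_finsetSum _ fun j _ =>
          hDp i j]
        simp_rw [integral_finsetSum _ fun j _ => hDp _ j]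
    _ ≤ ((n : ℝ) * n) ^ (p - 1) * ∑ i : Fin n, ∑ j : Fin n,
        C ^ p * ∫ x, matNorm (lMat V x) ^ p := by
        gcongr with i _ j _
        exact hkey i j
    _ = _ := by
        simp only [Finset.sum_const, Finset.card_univ, Fintype.card_fin, nsmul_eq_mul]
        ring

end

section

open scoped ContDiff Convolution

/-- Partial derivative of a scalar function. -/
def pd {n : ℕ} (i : Fin n) (f : Euc n → ℝ) (x : Euc n) : ℝ :=
  fderiv ℝ f x (EuclideanSpace.single i 1)

lemma contDiff_pd {n : ℕ} {f : Euc n → ℝ} (hf : ContDiff ℝ ∞ f) (i : Fin n) :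
    ContDiff ℝ ∞ (pd i f) :=
  (hf.fderiv_right (by simp)).clm_apply contDiff_const

lemma pd_add {n : ℕ} {f g : Euc n → ℝ} (hf : ContDiff ℝ ∞ f) (hg : ContDiff ℝ ∞ g) (i : Fin n) :
    pd i (fun x => f x + g x) = fun x => pd i f x + pd i g x := by
  ext x
  simp only [pd]
  rw [fderiv_fun_add (hf.differentiable (by simp) x) (hg.differentiable (by simp) x)]
  rfl

lemma pd_sub {n : ℕ} {f g : Euc n → ℝ} (hf : ContDiff ℝ ∞ f) (hg : ContDiff ℝ ∞ g) (i : Fin n) :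
    pd i (fun x => f x - g x) = fun x => pd i f x - pd i g x := by
  ext x
  simp only [pd]
  rw [fderiv_fun_sub (hf.differentiable (by simp) x) (hg.differentiable (by simp) x)]
  rfl

lemma pd_const_mul {n : ℕ} {f : Euc n → ℝ} (hf : ContDiff ℝ ∞ f) (c : ℝ) (i : Fin n) :
    pd i (fun x => c * f x) = fun x => c * pd i f x := by
  ext x
  simp only [pd]
  rw [fderiv_const_mul (hf.differentiable (by simp) x)]
  rfl

lemma pd_sum {n : ℕ} {ι : Type*} {s : Finset ι} {f : ι → Euc n → ℝ}
    (hf : ∀ k, ContDiff ℝ ∞ (f k)) (i : Fin n) :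
    pd i (fun x => ∑ k ∈ s, f k x) = fun x => ∑ k ∈ s, pd i (f k) x := by
  ext x
  simp only [pd]
  rw [fderiv_fun_sum fun k _ => (hf k).differentiable (by simp) x]
  simp

lemma pd_comm {n : ℕ} {f : Euc n → ℝ} (hf : ContDiff ℝ ∞ f) (i j : Fin n) :
    pd i (pd j f) = pd j (pd i f) := by
  have key : ∀ i j x, pd i (pd j f) x =
      fderiv ℝ (fderiv ℝ f) x (EuclideanSpace.single i 1) (EuclideanSpace.single j 1) := by
    intro i j x
    have h1 : DifferentiableAt ℝ (fderiv ℝ f) x :=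
      (hf.fderiv_right (m := ∞) (by simp)).differentiable (by simp) x
    have := fderiv_clm_apply h1 (differentiableAt_const (EuclideanSpace.single j (1 : ℝ)))
    unfold pd
    rw [this]
    simp
  ext x
  rw [key, key]
  exact (hf.contDiffAt.isSymmSndFDerivAt (by simp; exact WithTop.coe_le_coe.2 le_top)) _ _

lemma clm_apply_eq_sum {n : ℕ} (L : Euc n →L[ℝ] ℝ) (u : Euc n) :
    L u = ∑ h, u h * L (EuclideanSpace.single h 1) := by
  conv_lhs => rw [← (EuclideanSpace.basisFun (Fin n) ℝ).sum_repr u]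
  simp

lemma hasDerivAt_line {n : ℕ} {f : Euc n → ℝ} (hf : ContDiff ℝ ∞ f) (z u : Euc n) (t : ℝ) :
    HasDerivAt (fun t : ℝ => f (z + t • u)) (∑ h, u h * pd h f (z + t • u)) t := by
  have h1 : HasDerivAt (fun t : ℝ => z + t • u) u t := by
    simpa using ((hasDerivAt_id t).smul_const u).const_add z
  have := (hf.differentiable (by simp) (z + t • u)).hasFDerivAt.comp_hasDerivAt t h1
  rwa [clm_apply_eq_sum] at this

lemma third_derivative_identity {n : ℕ} (hn : 3 ≤ n) (T : Fin n → Fin n → Fin n → Fin n → ℝ)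
    (h12 : ∀ a b c k, T a b c k = T b a c k) (h23 : ∀ a b c k, T a b c k = T a c b k)
    (D : Fin n → Fin n → ℝ) (hD : ∀ h j, D h j = 1 / n * ∑ c, T h j c c)
    (S : Fin n → Fin n → Fin n → Fin n → ℝ)
    (hS : ∀ c e a b, S c e a b = 1 / 2 * (T c e a b + T c e b a) -
      (if a = b then 1 else 0) * D c e) (h j : Fin n) :
    D h j = 1 / (n - 2) * ((∑ a, S h a a j) + (∑ a, S j a a h) - (∑ a, S a a h j) -
      (if h = j then 1 else 0) / (n - 1) * ∑ b, ∑ a, S b a a b) := by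
  have hn' : (3 : ℝ) ≤ n := by exact_mod_cast hn
  have h1 : ∀ h j, ∑ c, T h j c c = n * D h j := fun h j => by
    rw [hD]; field_simp
  have h2 : ∀ h j, ∑ a, S h a a j = 1 / 2 * (∑ a, T h a a j) + (n / 2 - 1) * D h j := by
    intro h j
    simp only [hS, Finset.sum_sub_distrib, ← Finset.mul_sum, Finset.sum_add_distrib, ite_mul,
      one_mul, zero_mul, Finset.sum_ite_eq', Finset.mem_univ, if_true]
    have : ∑ a, T h a j a = n * D h j := by
      rw [← h1]; exact Finset.sum_congr rfl fun a _ => h23 _ _ _ _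
    rw [this]; ring
  have h3 : ∑ a, S a a h j = 1 / 2 * ((∑ a, T h a a j) + ∑ a, T j a a h) -
      (if h = j then 1 else 0) * ∑ a, D a a := by
    simp only [hS, Finset.sum_sub_distrib, ← Finset.mul_sum, Finset.sum_add_distrib]
    have : ∀ h j, ∑ a, T a a h j = ∑ a, T h a a j := fun h j =>
      Finset.sum_congr rfl fun a _ => by rw [h23, h12]
    rw [this, this]
  have h4 : ∑ b, ∑ a, S b a a b = (n - 1) * ∑ a, D a a := by
    simp only [h2, Finset.sum_add_distrib, ← Finset.mul_sum]
    have : ∑ b, ∑ a, T b a a b = n * ∑ a, D a a := by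
      rw [Finset.sum_comm, Finset.mul_sum]
      refine Finset.sum_congr rfl fun a _ => ?_
      rw [← h1]
      exact Finset.sum_congr rfl fun b _ => by rw [h12, h23]
    rw [this]; ring
  have h5 : D j h = D h j := by
    rw [hD, hD]; congr 1; exact Finset.sum_congr rfl fun c _ => h12 _ _ _ _
  rw [h2, h2, h3, h4, h5]
  have h6 : (n : ℝ) - 2 ≠ 0 := by linarith
  have h7 : (n : ℝ) - 1 ≠ 0 := by linarith
  field_simp
  ring

/-- Normalized divergence. -/
def divn {n : ℕ} (V : Fin n → Euc n → ℝ) (x : Euc n) : ℝ := 1 / n * ∑ c, pd c (V c) x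

/-- Entries of the trace-free symmetric gradient. -/
def devE {n : ℕ} (V : Fin n → Euc n → ℝ) (a b : Fin n) (x : Euc n) : ℝ :=
  1 / 2 * (pd a (V b) x + pd b (V a) x) - (if a = b then 1 else 0) * divn V x

/-- The conformal jet of `V` at `y`, evaluated at `x`. -/
def confJet {n : ℕ} (V : Fin n → Euc n → ℝ) (x y : Euc n) (k : Fin n) : ℝ :=
  V k y + ∑ j, (x j - y j) * (1 / 2 * (pd j (V k) y - pd k (V j) y)) + (x k - y k) * divn V y +
    ((x k - y k) * ∑ j, (x j - y j) * pd j (divn V) y -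
      1 / 2 * (∑ j, (x j - y j) ^ 2) * pd k (divn V) y)

lemma contDiff_divn {n : ℕ} {V : Fin n → Euc n → ℝ} (hV : ∀ k, ContDiff ℝ ∞ (V k)) :
    ContDiff ℝ ∞ (divn V) :=
  contDiff_const.mul (ContDiff.sum fun c _ => contDiff_pd (hV c) c)

lemma contDiff_devE {n : ℕ} {V : Fin n → Euc n → ℝ} (hV : ∀ k, ContDiff ℝ ∞ (V k)) (a b : Fin n) :
    ContDiff ℝ ∞ (devE V a b) :=
  (contDiff_const.mul ((contDiff_pd (hV b) a).add (contDiff_pd (hV a) b))).sub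
    (contDiff_const.mul (contDiff_divn hV))

lemma pd_divn {n : ℕ} {V : Fin n → Euc n → ℝ} (hV : ∀ k, ContDiff ℝ ∞ (V k)) (j : Fin n) :
    pd j (divn V) = fun x => 1 / n * ∑ c, pd j (pd c (V c)) x := by
  unfold divn
  rw [pd_const_mul (ContDiff.sum fun c _ => contDiff_pd (hV c) c),
    pd_sum fun c => contDiff_pd (hV c) c]

lemma pd_pd_divn {n : ℕ} {V : Fin n → Euc n → ℝ} (hV : ∀ k, ContDiff ℝ ∞ (V k)) (h j : Fin n) :
    pd h (pd j (divn V)) = fun x => 1 / n * ∑ c, pd h (pd j (pd c (V c))) x := by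
  rw [pd_divn hV, pd_const_mul (ContDiff.sum fun c _ => contDiff_pd (contDiff_pd (hV c) c) j),
    pd_sum fun c => contDiff_pd (contDiff_pd (hV c) c) j]

lemma pd_devE {n : ℕ} {V : Fin n → Euc n → ℝ} (hV : ∀ k, ContDiff ℝ ∞ (V k)) (j a b : Fin n) :
    pd j (devE V a b) = fun x => 1 / 2 * (pd j (pd a (V b)) x + pd j (pd b (V a)) x) -
      (if a = b then 1 else 0) * pd j (divn V) x := by
  unfold devE
  have h1 := contDiff_pd (hV b) a
  have h2 := contDiff_pd (hV a) b
  rw [pd_sub (contDiff_const.mul (h1.add h2)) (contDiff_const.mul (contDiff_divn hV)),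
    pd_const_mul (h1.add h2), pd_const_mul (contDiff_divn hV), pd_add h1 h2]

lemma pd_pd_devE {n : ℕ} {V : Fin n → Euc n → ℝ} (hV : ∀ k, ContDiff ℝ ∞ (V k)) (i j a b : Fin n) :
    pd i (pd j (devE V a b)) = fun x =>
      1 / 2 * (pd i (pd j (pd a (V b))) x + pd i (pd j (pd b (V a))) x) -
      (if a = b then 1 else 0) * pd i (pd j (divn V)) x := by
  have h1 := contDiff_pd (contDiff_pd (hV b) a) j
  have h2 := contDiff_pd (contDiff_pd (hV a) b) j
  have h3 := contDiff_pd (contDiff_divn hV) j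
  rw [pd_devE hV, pd_sub (contDiff_const.mul (h1.add h2)) (contDiff_const.mul h3),
    pd_const_mul (h1.add h2), pd_const_mul h3, pd_add h1 h2]

lemma pd_pd_divn_eq {n : ℕ} (hn : 3 ≤ n) {V : Fin n → Euc n → ℝ} (hV : ∀ k, ContDiff ℝ ∞ (V k))
    (h j : Fin n) (x : Euc n) : pd h (pd j (divn V)) x =
      1 / (n - 2) * ((∑ a, pd h (pd a (devE V a j)) x) + (∑ a, pd j (pd a (devE V a h)) x) -
      (∑ a, pd a (pd a (devE V h j)) x) - (if h = j then 1 else 0) / (n - 1) *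
        ∑ b, ∑ a, pd b (pd a (devE V a b)) x) := by
  refine third_derivative_identity hn (fun a b c k => pd a (pd b (pd c (V k))) x)
    (fun a b c k => ?_) (fun a b c k => ?_) (fun h j => pd h (pd j (divn V)) x)
    (fun h j => by rw [pd_pd_divn hV]) (fun c e a b => pd c (pd e (devE V a b)) x)
    (fun c e a b => by rw [pd_pd_devE hV]) h j
  · rw [pd_comm (contDiff_pd (hV k) c)]
  · rw [pd_comm (hV k)]

lemma confJet_algebra {n : ℕ} (u : Fin n → ℝ) (τ : ℝ) (k : Fin n) (P : Fin n → Fin n → ℝ)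
    (Q : Fin n → Fin n → Fin n → ℝ) (hQ : ∀ a b c, Q a b c = Q b a c) (d₀ : ℝ) (d₁ : Fin n → ℝ)
    (d₂ : Fin n → Fin n → ℝ) :
    (∑ h, u h * P h k) + (-1 * (∑ j, u j * (1 / 2 * (P j k - P k j))) +
      τ * ∑ h, u h * ∑ j, u j * (1 / 2 * (Q h j k - Q h k j))) +
      (-1 * u k * d₀ + τ * u k * ∑ h, u h * d₁ h) +
      ((2 * τ * -1 * u k * (∑ j, u j * d₁ j) + τ ^ 2 * u k * ∑ h, u h * ∑ j, u j * d₂ h j) -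
        (2 * τ * -1 * (1 / 2 * ∑ j, u j ^ 2) * d₁ k +
          τ ^ 2 * (1 / 2 * ∑ j, u j ^ 2) * ∑ h, u h * d₂ h k)) =
    (∑ h, u h * (1 / 2 * (P h k + P k h) - (if h = k then 1 else 0) * d₀)) +
      (∑ h, ∑ j, u h * u j * (τ * (1 / 2 * (Q j h k + Q j k h) -
        (if h = k then 1 else 0) * d₁ j))) -
      (∑ h, ∑ j, u h * u j * (τ * (1 / 2 * (Q k h j + Q k j h) -
        (if h = j then 1 else 0) * d₁ k))) +
      (∑ h, ∑ j, u k * u h * u j * (τ ^ 2 * d₂ h j)) -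
        ∑ h, 1 / 2 * (∑ j, u j ^ 2) * u h * (τ ^ 2 * d₂ h k) := by
  have e1 : ∑ h, u h * (1 / 2 * (P h k + P k h) - (if h = k then 1 else 0) * d₀) =
      1 / 2 * (∑ h, u h * P h k) + 1 / 2 * (∑ h, u h * P k h) - u k * d₀ := by
    have : u k * d₀ = ∑ h, u h * ((if h = k then 1 else 0) * d₀) := by simp
    rw [this, Finset.mul_sum, Finset.mul_sum, ← Finset.sum_add_distrib, ← Finset.sum_sub_distrib]
    exact Finset.sum_congr rfl fun _ _ => by ring
  have e1' : ∑ j, u j * (1 / 2 * (P j k - P k j)) =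
      1 / 2 * (∑ h, u h * P h k) - 1 / 2 * (∑ h, u h * P k h) := by
    rw [Finset.mul_sum, Finset.mul_sum, ← Finset.sum_sub_distrib]
    exact Finset.sum_congr rfl fun _ _ => by ring
  have e2' : ∑ h, u h * ∑ j, u j * (1 / 2 * (Q h j k - Q h k j)) =
      1 / 2 * (∑ h, ∑ j, u h * u j * Q h j k) - 1 / 2 * ∑ h, ∑ j, u h * u j * Q h k j := by
    rw [Finset.mul_sum, Finset.mul_sum, ← Finset.sum_sub_distrib]
    refine Finset.sum_congr rfl fun h _ => ?_
    rw [Finset.mul_sum, Finset.mul_sum, Finset.mul_sum, ← Finset.sum_sub_distrib]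
    exact Finset.sum_congr rfl fun _ _ => by ring
  have e2 : ∑ h, ∑ j, u h * u j * (τ * (1 / 2 * (Q j h k + Q j k h) -
        (if h = k then 1 else 0) * d₁ j)) = τ * (1 / 2 * (∑ h, ∑ j, u h * u j * Q h j k) +
      1 / 2 * (∑ h, ∑ j, u h * u j * Q h k j) - u k * ∑ j, u j * d₁ j) := by
    have a1 : ∑ h, ∑ j, u h * u j * Q h k j = ∑ h, ∑ j, u h * u j * Q j k h := by
      rw [Finset.sum_comm]
      exact Finset.sum_congr rfl fun _ _ => Finset.sum_congr rfl fun _ _ => by ring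
    have a2 : u k * ∑ j, u j * d₁ j =
        ∑ h, ∑ j, u h * u j * ((if h = k then 1 else 0) * d₁ j) := by
      rw [Finset.sum_comm, Finset.mul_sum]
      exact Finset.sum_congr rfl fun _ _ => by simp; ring
    rw [a1, a2, Finset.mul_sum, Finset.mul_sum, ← Finset.sum_add_distrib,
      ← Finset.sum_sub_distrib, Finset.mul_sum]
    refine Finset.sum_congr rfl fun h _ => ?_
    rw [Finset.mul_sum, Finset.mul_sum, ← Finset.sum_add_distrib, ← Finset.sum_sub_distrib,
      Finset.mul_sum]
    exact Finset.sum_congr rfl fun j _ => by rw [hQ j h k]; ring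
  have e3 : ∑ h, ∑ j, u h * u j * (τ * (1 / 2 * (Q k h j + Q k j h) -
        (if h = j then 1 else 0) * d₁ k)) = τ * ((∑ h, ∑ j, u h * u j * Q h k j) -
      (∑ j, u j ^ 2) * d₁ k) := by
    have a1 : ∑ h, ∑ j, u h * u j * Q h k j = ∑ h, ∑ j, u h * u j * Q k j h := by
      rw [Finset.sum_comm]
      exact Finset.sum_congr rfl fun _ _ => Finset.sum_congr rfl fun _ _ => by
        rw [hQ]; ring
    have a2 : (∑ j, u j ^ 2) * d₁ k =
        ∑ h, ∑ j, u h * u j * ((if h = j then 1 else 0) * d₁ k) := by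
      rw [Finset.sum_mul]
      exact Finset.sum_congr rfl fun _ _ => by simp [sq]
    have a3 : ∑ h, ∑ j, u h * u j * Q h k j =
        1 / 2 * (∑ h, ∑ j, u h * u j * Q h k j) + 1 / 2 * ∑ h, ∑ j, u h * u j * Q k j h := by
      rw [← a1]; ring
    rw [a3, a2, Finset.mul_sum, Finset.mul_sum, ← Finset.sum_add_distrib,
      ← Finset.sum_sub_distrib, Finset.mul_sum]
    refine Finset.sum_congr rfl fun h _ => ?_
    rw [Finset.mul_sum, Finset.mul_sum, ← Finset.sum_add_distrib, ← Finset.sum_sub_distrib,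
      Finset.mul_sum]
    exact Finset.sum_congr rfl fun j _ => by rw [hQ h k j]; ring
  have e4 : ∑ h, ∑ j, u k * u h * u j * (τ ^ 2 * d₂ h j) =
      τ ^ 2 * u k * ∑ h, u h * ∑ j, u j * d₂ h j := by
    rw [Finset.mul_sum]
    refine Finset.sum_congr rfl fun h _ => ?_
    rw [Finset.mul_sum, Finset.mul_sum]
    exact Finset.sum_congr rfl fun j _ => by ring
  have e5 : ∑ h, 1 / 2 * (∑ j, u j ^ 2) * u h * (τ ^ 2 * d₂ h k) =
      τ ^ 2 * (1 / 2 * ∑ j, u j ^ 2) * ∑ h, u h * d₂ h k := by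
    generalize ∑ j, u j ^ 2 = S
    rw [Finset.mul_sum]
    exact Finset.sum_congr rfl fun j _ => by ring
  rw [e1, e1', e2, e2', e3, e4, e5]
  ring

lemma hasDerivAt_confJet {n : ℕ} {V : Fin n → Euc n → ℝ} (hV : ∀ k, ContDiff ℝ ∞ (V k))
    (x z : Euc n) (k : Fin n) (t : ℝ) :
    HasDerivAt (fun t : ℝ => confJet V x (z + t • (x - z)) k)
      ((∑ h, (x - z) h * devE V h k (z + t • (x - z))) +
        (∑ h, ∑ j, (x - z) h * (x - z) j * ((1 - t) * pd j (devE V h k) (z + t • (x - z)))) -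
        (∑ h, ∑ j, (x - z) h * (x - z) j * ((1 - t) * pd k (devE V h j) (z + t • (x - z)))) +
        (∑ h, ∑ j, (x - z) k * (x - z) h * (x - z) j *
          ((1 - t) ^ 2 * pd h (pd j (divn V)) (z + t • (x - z)))) -
        ∑ h, 1 / 2 * (∑ j, (x - z) j ^ 2) * (x - z) h *
          ((1 - t) ^ 2 * pd h (pd k (divn V)) (z + t • (x - z)))) t := by
  set u := x - z with hu
  have hxu : ∀ (t : ℝ) j, x j - (z + t • u) j = (1 - t) * u j := fun t j => by
    simp [hu]; ring
  set f₁ : Euc n → ℝ := fun y => ∑ j, u j * (1 / 2 * (pd j (V k) y - pd k (V j) y)) with hf₁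
  set f₃ : Euc n → ℝ := fun y => ∑ j, u j * pd j (divn V) y with hf₃
  have hA : ∀ j, ContDiff ℝ ∞ fun y => pd j (V k) y - pd k (V j) y := fun j =>
    (contDiff_pd (hV k) j).sub (contDiff_pd (hV j) k)
  have hs₁ : ContDiff ℝ ∞ f₁ := ContDiff.sum fun j _ => contDiff_const.mul (contDiff_const.mul (hA j))
  have hs₃ : ContDiff ℝ ∞ f₃ := ContDiff.sum fun j _ =>
    contDiff_const.mul (contDiff_pd (contDiff_divn hV) j)
  have hp₁ : ∀ h, pd h f₁ = fun y =>
      ∑ j, u j * (1 / 2 * (pd h (pd j (V k)) y - pd h (pd k (V j)) y)) := fun h => by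
    rw [hf₁, pd_sum fun j => contDiff_const.mul (contDiff_const.mul (hA j))]
    ext y
    refine Finset.sum_congr rfl fun j _ => ?_
    rw [pd_const_mul (contDiff_const.mul (hA j)), pd_const_mul (hA j),
      pd_sub (contDiff_pd (hV k) j) (contDiff_pd (hV j) k)]
  have hp₃ : ∀ h, pd h f₃ = fun y => ∑ j, u j * pd h (pd j (divn V)) y := fun h => by
    rw [hf₃, pd_sum fun j => contDiff_const.mul (contDiff_pd (contDiff_divn hV) j)]
    ext y
    refine Finset.sum_congr rfl fun j _ => ?_
    rw [pd_const_mul (contDiff_pd (contDiff_divn hV) j)]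
  have hfun : (fun t : ℝ => confJet V x (z + t • u) k) = fun t : ℝ =>
      V k (z + t • u) + (1 - t) * f₁ (z + t • u) + (1 - t) * u k * divn V (z + t • u) +
      ((1 - t) ^ 2 * u k * f₃ (z + t • u) -
        (1 - t) ^ 2 * (1 / 2 * ∑ j, u j ^ 2) * pd k (divn V) (z + t • u)) := by
    ext t
    simp only [confJet, hxu, hf₁, hf₃, mul_pow, mul_assoc, ← Finset.mul_sum]
    ring
  rw [hfun]
  have h1t : HasDerivAt (fun t : ℝ => 1 - t) (-1) t := by
    simpa using (hasDerivAt_id t).const_sub 1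
  have h2t : HasDerivAt (fun t : ℝ => (1 - t) ^ 2) (2 * (1 - t) * (-1)) t := by
    simpa using h1t.fun_pow 2
  have hd := (((hasDerivAt_line (hV k) z u t).add
    (h1t.mul (hasDerivAt_line hs₁ z u t))).add
    ((h1t.mul_const (u k)).mul (hasDerivAt_line (contDiff_divn hV) z u t))).add
    (((h2t.mul_const (u k)).mul (hasDerivAt_line hs₃ z u t)).sub
    ((h2t.mul_const (1 / 2 * ∑ j, u j ^ 2)).mul
      (hasDerivAt_line (contDiff_pd (contDiff_divn hV) k) z u t)))
  refine hd.congr_deriv ?_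
  simp only [hp₁, hp₃, pd_devE hV]
  simp only [devE, hf₁, hf₃]
  exact confJet_algebra (fun j => u j) (1 - t) k (fun a b => pd a (V b) (z + t • u))
    (fun a b c => pd a (pd b (V c)) (z + t • u)) (fun a b c => by rw [pd_comm (hV c)])
    (divn V (z + t • u)) (fun j => pd j (divn V) (z + t • u))
    (fun h j => pd h (pd j (divn V)) (z + t • u))

/-- Smooth kernels supported in the unit ball in the second variable. -/
def IsKer {n : ℕ} (Q : Euc n × Euc n → ℝ) : Prop :=
  ContDiff ℝ ∞ Q ∧ ∀ x z, z ∉ closedBall (0 : Euc n) 1 → Q (x, z) = 0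

/-- Derivative of a kernel in the second variable. -/
def kerPd {n : ℕ} (j : Fin n) (Q : Euc n × Euc n → ℝ) (q : Euc n × Euc n) : ℝ :=
  fderiv ℝ Q q (0, EuclideanSpace.single j 1)

lemma IsKer.exists_bound {n : ℕ} {Q : Euc n × Euc n → ℝ} (hQ : IsKer Q) :
    ∃ C : ℝ, 0 ≤ C ∧ ∀ x ∈ closedBall (0 : Euc n) 1, ∀ z, |Q (x, z)| ≤ C := by
  obtain ⟨C, hC⟩ := ((isCompact_closedBall (0 : Euc n) 1).prod
    (isCompact_closedBall (0 : Euc n) 1)).exists_bound_of_continuousOn hQ.1.continuous.continuousOn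
  refine ⟨C ⊔ 0, le_max_right _ _, fun x hx z => ?_⟩
  by_cases hz : z ∈ closedBall (0 : Euc n) 1
  · exact (hC (x, z) ⟨hx, hz⟩).trans (le_max_left _ _)
  · simp [hQ.2 x z hz]

lemma IsKer.kerPd {n : ℕ} {Q : Euc n × Euc n → ℝ} (hQ : IsKer Q) (j : Fin n) :
    IsKer (kerPd j Q) := by
  refine ⟨(hQ.1.fderiv_right (by simp)).clm_apply contDiff_const, fun x z hz => ?_⟩
  have h : Q =ᶠ[nhds (x, z)] fun _ => 0 := by
    have : IsOpen {q : Euc n × Euc n | q.2 ∉ closedBall (0 : Euc n) 1} :=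
      (isClosed_closedBall.preimage continuous_snd).isOpen_compl
    filter_upwards [this.mem_nhds hz] with q hq using hQ.2 q.1 q.2 hq
  simp [_root_.kerPd, h.fderiv_eq]

lemma IsKer.hasCompactSupport {n : ℕ} {Q : Euc n × Euc n → ℝ} (hQ : IsKer Q) (x : Euc n) :
    HasCompactSupport fun z => Q (x, z) :=
  HasCompactSupport.of_support_subset_isCompact (isCompact_closedBall 0 1) fun z hz => by
    by_contra h
    exact hz (hQ.2 x z h)

lemma IsKer.continuous {n : ℕ} {Q : Euc n × Euc n → ℝ} (hQ : IsKer Q) (x : Euc n) :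
    Continuous fun z => Q (x, z) := hQ.1.continuous.comp (by fun_prop)

lemma IsKer.integrable_mul {n : ℕ} {Q : Euc n × Euc n → ℝ} (hQ : IsKer Q) (x : Euc n)
    {g : Euc n → ℝ} (hg : Continuous g) : Integrable fun z => Q (x, z) * g z :=
  ((hQ.continuous x).mul hg).integrable_of_hasCompactSupport (hQ.hasCompactSupport x).mul_right

lemma IsKer.integral_mul_pd {n : ℕ} {Q : Euc n × Euc n → ℝ} (hQ : IsKer Q) {f : Euc n → ℝ}
    (hf : ContDiff ℝ ∞ f) (x : Euc n) (t : ℝ) (j : Fin n) :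
    ∫ z, Q (x, z) * ((1 - t) * pd j f (z + t • (x - z))) =
      -∫ z, _root_.kerPd j Q (x, z) * f (z + t • (x - z)) := by
  have h1 : ∀ z, HasFDerivAt (fun z => z + t • (x - z))
      ((1 - t) • ContinuousLinearMap.id ℝ (Euc n)) z := fun z => by
    have := (hasFDerivAt_id (𝕜 := ℝ) z).add (((hasFDerivAt_id (𝕜 := ℝ) z).const_sub x).const_smul t)
    refine this.congr_fderiv ?_
    ext v; simp; ring
  have h2 : ∀ z, fderiv ℝ (fun z => f (z + t • (x - z))) z (EuclideanSpace.single j 1) =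
      (1 - t) * pd j f (z + t • (x - z)) := fun z => by
    have := (hf.differentiable (by simp) (z + t • (x - z))).hasFDerivAt.comp z (h1 z)
    rw [show (fun z => f (z + t • (x - z))) = f ∘ fun z => z + t • (x - z) from rfl, this.fderiv]
    simp [pd]
  have h3 : ∀ z, fderiv ℝ (fun z => Q (x, z)) z (EuclideanSpace.single j 1) =
      _root_.kerPd j Q (x, z) := fun z => by
    have h : HasFDerivAt (fun z : Euc n => (x, z)) (ContinuousLinearMap.inr ℝ (Euc n) (Euc n)) z :=
      hasFDerivAt_prodMk_right x z
    have := (hQ.1.differentiable (by simp) (x, z)).hasFDerivAt.comp z h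
    rw [show (fun z => Q (x, z)) = Q ∘ fun z => (x, z) from rfl, this.fderiv]
    simp [_root_.kerPd]
  have hc : Continuous fun z => z + t • (x - z) := by fun_prop
  have := integral_mul_fderiv_eq_neg_fderiv_mul_of_integrable (𝕜 := ℝ) (μ := volume)
    (f := fun z => Q (x, z)) (g := fun z => f (z + t • (x - z)))
    (v := EuclideanSpace.single j (1 : ℝ)) ?_ ?_ ?_
    (fun z _ => (hQ.1.comp (contDiff_prodMk_right x)).differentiable (by simp) z)
    (fun z _ => (hf.differentiable (by simp) _).comp z (h1 z).differentiableAt)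
  · simpa only [h2, h3] using this
  · simp only [h3]
    exact (hQ.kerPd j).integrable_mul x (hf.continuous.comp hc)
  · simp only [h2]
    exact hQ.integrable_mul x (continuous_const.mul ((contDiff_pd hf j).continuous.comp hc))
  · exact hQ.integrable_mul x (hf.continuous.comp hc)

/-- Integral operators on families of functions whose integrals are dominated by the averages of
the family along segments. -/
def Dominated {n : ℕ} (T : (Fin n → Fin n → Euc n → ℝ) → Euc n → ℝ → Euc n → ℝ) : Prop :=
  ∃ C : ℝ, 0 ≤ C ∧ ∀ F, (∀ a b, ContDiff ℝ ∞ (F a b)) → ∀ x ∈ closedBall (0 : Euc n) 1, ∀ t : ℝ,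
    Integrable (T F x t) ∧ |∫ z, T F x t z| ≤
      C * ∫ z in closedBall (0 : Euc n) 1, ∑ a, ∑ b, |F a b (z + t • (x - z))|

lemma integrableOn_sum_abs {n : ℕ} {F : Fin n → Fin n → Euc n → ℝ}
    (hF : ∀ a b, ContDiff ℝ ∞ (F a b)) (x : Euc n) (t : ℝ) :
    IntegrableOn (fun z => ∑ a, ∑ b, |F a b (z + t • (x - z))|) (closedBall (0 : Euc n) 1) := by
  refine ContinuousOn.integrableOn_compact (isCompact_closedBall 0 1)
    (Continuous.continuousOn ?_)
  have := fun a b => (hF a b).continuous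
  fun_prop

lemma Dominated.add {n : ℕ} {S T : (Fin n → Fin n → Euc n → ℝ) → Euc n → ℝ → Euc n → ℝ}
    (hS : Dominated S) (hT : Dominated T) : Dominated fun F x t z => S F x t z + T F x t z := by
  obtain ⟨C, hC, h⟩ := hS
  obtain ⟨D, hD, h'⟩ := hT
  refine ⟨C + D, by positivity, fun F hF x hx t => ⟨(h F hF x hx t).1.add (h' F hF x hx t).1, ?_⟩⟩
  rw [integral_add (h F hF x hx t).1 (h' F hF x hx t).1, add_mul]
  exact (abs_add_le _ _).trans (add_le_add (h F hF x hx t).2 (h' F hF x hx t).2)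

lemma Dominated.const_mul {n : ℕ} {T : (Fin n → Fin n → Euc n → ℝ) → Euc n → ℝ → Euc n → ℝ}
    (hT : Dominated T) (c : ℝ) : Dominated fun F x t z => c * T F x t z := by
  obtain ⟨D, hD, h⟩ := hT
  refine ⟨|c| * D, by positivity, fun F hF x hx t => ⟨(h F hF x hx t).1.const_mul c, ?_⟩⟩
  rw [integral_const_mul, abs_mul, mul_assoc]
  exact mul_le_mul_of_nonneg_left (h F hF x hx t).2 (abs_nonneg c)

lemma Dominated.sub {n : ℕ} {S T : (Fin n → Fin n → Euc n → ℝ) → Euc n → ℝ → Euc n → ℝ}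
    (hS : Dominated S) (hT : Dominated T) : Dominated fun F x t z => S F x t z - T F x t z := by
  simpa [sub_eq_add_neg] using hS.add (hT.const_mul (-1))

lemma Dominated.sum {n : ℕ} {ι : Type*} {s : Finset ι}
    {T : ι → (Fin n → Fin n → Euc n → ℝ) → Euc n → ℝ → Euc n → ℝ}
    (hT : ∀ i, Dominated (T i)) : Dominated fun F x t z => ∑ i ∈ s, T i F x t z := by
  classical
  induction s using Finset.induction_on with
  | empty => exact ⟨0, le_rfl, fun F hF x hx t => by simp⟩
  | insert i s hi ih => simpa [Finset.sum_insert hi] using (hT i).add ih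

lemma IsKer.dominated {n : ℕ} {Q : Euc n × Euc n → ℝ} (hQ : IsKer Q) (a b : Fin n) :
    Dominated fun F x t z => Q (x, z) * F a b (z + t • (x - z)) := by
  obtain ⟨C, hC, h⟩ := hQ.exists_bound
  refine ⟨C, hC, fun F hF x hx t => ?_⟩
  have hc : Continuous fun z => F a b (z + t • (x - z)) := by
    have := (hF a b).continuous
    fun_prop
  refine ⟨hQ.integrable_mul x hc, ?_⟩
  rw [← setIntegral_eq_integral_of_forall_compl_eq_zero (s := closedBall (0 : Euc n) 1)
    fun z hz => by simp [hQ.2 x z hz], ← integral_const_mul]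
  rw [← Real.norm_eq_abs]
  refine norm_integral_le_of_norm_le (f := fun z => Q (x, z) * F a b (z + t • (x - z)))
    (g := fun z => C * ∑ a, ∑ b, |F a b (z + t • (x - z))|)
    ((integrableOn_sum_abs hF x t).const_mul C) (Filter.Eventually.of_forall fun z => ?_)
  simp only [norm_mul, Real.norm_eq_abs]
  refine mul_le_mul (h x hx z) ?_ (abs_nonneg _) hC
  exact (Finset.single_le_sum (f := fun b => |F a b (z + t • (x - z))|)
    (fun _ _ => abs_nonneg _) (Finset.mem_univ b)).trans
    (Finset.single_le_sum (f := fun a => ∑ b, |F a b (z + t • (x - z))|)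
      (fun _ _ => Finset.sum_nonneg fun _ _ => abs_nonneg _) (Finset.mem_univ a))

lemma IsKer.dominated_pd {n : ℕ} {Q : Euc n × Euc n → ℝ} (hQ : IsKer Q) (j a b : Fin n) :
    Dominated fun F x t z => Q (x, z) * ((1 - t) * pd j (F a b) (z + t • (x - z))) := by
  obtain ⟨C, hC, h⟩ := (hQ.kerPd j).dominated a b
  refine ⟨C, hC, fun F hF x hx t => ?_⟩
  have hc : Continuous fun z => (1 - t) * pd j (F a b) (z + t • (x - z)) := by
    have := (contDiff_pd (hF a b) j).continuous
    fun_prop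
  refine ⟨hQ.integrable_mul x hc, ?_⟩
  rw [hQ.integral_mul_pd (hF a b), abs_neg]
  exact (h F hF x hx t).2

lemma IsKer.dominated_pd_pd {n : ℕ} {Q : Euc n × Euc n → ℝ} (hQ : IsKer Q) (i j a b : Fin n) :
    Dominated fun F x t z => Q (x, z) * ((1 - t) ^ 2 * pd i (pd j (F a b)) (z + t • (x - z))) := by
  obtain ⟨C, hC, h⟩ := ((hQ.kerPd i).kerPd j).dominated a b
  refine ⟨C, hC, fun F hF x hx t => ?_⟩
  have hs := contDiff_pd (hF a b) j
  have hc : Continuous fun z => (1 - t) ^ 2 * pd i (pd j (F a b)) (z + t • (x - z)) := by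
    have := (contDiff_pd hs i).continuous
    fun_prop
  refine ⟨hQ.integrable_mul x hc, ?_⟩
  have e : ∀ z, Q (x, z) * ((1 - t) ^ 2 * pd i (pd j (F a b)) (z + t • (x - z))) =
      (1 - t) * (Q (x, z) * ((1 - t) * pd i (pd j (F a b)) (z + t • (x - z)))) := fun z => by ring
  have e' : ∀ z, (1 - t) * (_root_.kerPd i Q (x, z) * pd j (F a b) (z + t • (x - z))) =
      _root_.kerPd i Q (x, z) * ((1 - t) * pd j (F a b) (z + t • (x - z))) := fun z => by ring
  simp only [e]
  rw [integral_const_mul, hQ.integral_mul_pd hs, mul_neg, ← integral_const_mul]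
  simp only [e']
  rw [(hQ.kerPd i).integral_mul_pd (hF a b), neg_neg]
  exact (h F hF x hx t).2

lemma IsKer.const_mul_apply {n : ℕ} (ρ : ContDiffBump (0 : Euc n)) (hρ : ρ.rOut = 1)
    {q : Euc n → ℝ} (hq : ContDiff ℝ ∞ q) :
    IsKer fun p : Euc n × Euc n => ρ.normed volume p.2 * q (p.1 - p.2) := by
  refine ⟨(ρ.contDiff_normed.comp contDiff_snd).mul (hq.comp (contDiff_fst.sub contDiff_snd)),
    fun x z hz => ?_⟩
  have : ρ.normed volume z = 0 := by
    rw [← Function.notMem_support, ρ.support_normed_eq, hρ]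
    exact fun h => hz (ball_subset_closedBall h)
  simp [this]

/-- A bump function on the unit ball. -/
def unitBump (n : ℕ) : ContDiffBump (0 : Euc n) := ⟨1 / 2, 1, by norm_num, by norm_num⟩

/-- The weighted second derivatives of the normalized divergence, in terms of a matrix field. -/
def divKernel {n : ℕ} (h j : Fin n) (Q : Euc n → ℝ) (F : Fin n → Fin n → Euc n → ℝ) (x : Euc n)
    (t : ℝ) (z : Euc n) : ℝ :=
  1 / ((n : ℝ) - 2) * ((∑ a, (unitBump n).normed volume z * Q (x - z) *
        ((1 - t) ^ 2 * pd h (pd a (F a j)) (z + t • (x - z)))) +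
     (∑ a, (unitBump n).normed volume z * Q (x - z) *
      ((1 - t) ^ 2 * pd j (pd a (F a h)) (z + t • (x - z)))) -
     (∑ a, (unitBump n).normed volume z * Q (x - z) *
      ((1 - t) ^ 2 * pd a (pd a (F h j)) (z + t • (x - z)))) -
     ((if h = j then 1 else 0) / ((n : ℝ) - 1)) *
      ∑ b, ∑ a, (unitBump n).normed volume z * Q (x - z) *
      ((1 - t) ^ 2 * pd b (pd a (F a b)) (z + t • (x - z))))

/-- The weighted derivative of the conformal jet along segments, in terms of a matrix field. -/
def jetKernel {n : ℕ} (k : Fin n) (F : Fin n → Fin n → Euc n → ℝ) (x : Euc n) (t : ℝ)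
    (z : Euc n) : ℝ :=
  (∑ h, (unitBump n).normed volume z * (x - z) h * F h k (z + t • (x - z))) +
    (∑ h, ∑ j, (unitBump n).normed volume z * ((x - z) h * (x - z) j) *
      ((1 - t) * pd j (F h k) (z + t • (x - z)))) -
    (∑ h, ∑ j, (unitBump n).normed volume z * ((x - z) h * (x - z) j) *
      ((1 - t) * pd k (F h j) (z + t • (x - z)))) +
    (∑ h, ∑ j, divKernel h j (fun u => u k * u h * u j) F x t z) -
    ∑ h, divKernel h k (fun u => 1 / 2 * (∑ j, u j ^ 2) * u h) F x t z

lemma isKer_unitBump_mul {n : ℕ} {q : Euc n → ℝ} (hq : ContDiff ℝ ∞ q) :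
    IsKer fun p : Euc n × Euc n => (unitBump n).normed volume p.2 * q (p.1 - p.2) :=
  IsKer.const_mul_apply (unitBump n) rfl hq

lemma dominated_divKernel {n : ℕ} (h j : Fin n) {Q : Euc n → ℝ} (hQ : ContDiff ℝ ∞ Q) :
    Dominated (divKernel h j Q) :=
  Dominated.const_mul ((((Dominated.sum fun a => (isKer_unitBump_mul hQ).dominated_pd_pd h a a j).add
      (Dominated.sum fun a => (isKer_unitBump_mul hQ).dominated_pd_pd j a a h)).sub
      (Dominated.sum fun a => (isKer_unitBump_mul hQ).dominated_pd_pd a a h j)).sub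
      ((Dominated.sum fun b => Dominated.sum fun a =>
        (isKer_unitBump_mul hQ).dominated_pd_pd b a a b).const_mul _)) _

lemma dominated_jetKernel {n : ℕ} (k : Fin n) : Dominated (jetKernel (n := n) k) := by
  have hc : ∀ j, ContDiff ℝ ∞ fun u : Euc n => u j := fun j =>
    (EuclideanSpace.proj (𝕜 := ℝ) j).contDiff
  have h1 : Dominated fun F x t z => ∑ h,
      (unitBump n).normed volume z * (x - z) h * F h k (z + t • (x - z)) :=
    Dominated.sum fun h => (isKer_unitBump_mul (hc h)).dominated h k
  have h2 : Dominated fun F x t z => ∑ h, ∑ j, (unitBump n).normed volume z *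
      ((x - z) h * (x - z) j) * ((1 - t) * pd j (F h k) (z + t • (x - z))) :=
    Dominated.sum fun h => Dominated.sum fun j =>
      (isKer_unitBump_mul ((hc h).mul (hc j))).dominated_pd j h k
  have h3 : Dominated fun F x t z => ∑ h, ∑ j, (unitBump n).normed volume z *
      ((x - z) h * (x - z) j) * ((1 - t) * pd k (F h j) (z + t • (x - z))) :=
    Dominated.sum fun h => Dominated.sum fun j =>
      (isKer_unitBump_mul ((hc h).mul (hc j))).dominated_pd k h j
  have h4 : Dominated fun F x t z => ∑ h, ∑ j, divKernel h j (fun u => u k * u h * u j) F x t z :=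
    Dominated.sum fun h => Dominated.sum fun j =>
      dominated_divKernel h j (((hc k).mul (hc h)).mul (hc j))
  have h5 : Dominated fun F x t z =>
      ∑ h, divKernel h k (fun u => 1 / 2 * (∑ j, u j ^ 2) * u h) F x t z :=
    Dominated.sum fun h => dominated_divKernel h k
      ((contDiff_const.mul (ContDiff.sum fun j _ => (hc j).pow 2)).mul (hc h))
  exact (((h1.add h2).sub h3).add h4).sub h5

lemma divKernel_devE {n : ℕ} (hn : 3 ≤ n) {V : Fin n → Euc n → ℝ} (hV : ∀ k, ContDiff ℝ ∞ (V k))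
    (h j : Fin n) (Q : Euc n → ℝ) (x z : Euc n) (t : ℝ) :
    divKernel h j Q (devE V) x t z = (unitBump n).normed volume z * Q (x - z) *
      ((1 - t) ^ 2 * pd h (pd j (divn V)) (z + t • (x - z))) := by
  rw [pd_pd_divn_eq hn hV, divKernel]
  simp only [← Finset.mul_sum]
  ring

lemma hasDerivAt_mul_confJet {n : ℕ} (hn : 3 ≤ n) {V : Fin n → Euc n → ℝ}
    (hV : ∀ k, ContDiff ℝ ∞ (V k)) (x z : Euc n) (k : Fin n) (t : ℝ) :
    HasDerivAt (fun t : ℝ => (unitBump n).normed volume z * confJet V x (z + t • (x - z)) k)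
      (jetKernel k (devE V) x t z) t := by
  refine ((hasDerivAt_confJet hV x z k t).const_mul _).congr_deriv ?_
  simp only [jetKernel, divKernel_devE hn hV, mul_assoc, ← Finset.mul_sum]
  ring

lemma continuous_jetKernel {n : ℕ} (k : Fin n) {F : Fin n → Fin n → Euc n → ℝ}
    (hF : ∀ a b, ContDiff ℝ ∞ (F a b)) (x : Euc n) :
    Continuous fun q : ℝ × Euc n => jetKernel k F x q.1 q.2 := by
  have h0 := fun a b => (hF a b).continuous
  have h1 := fun i a b => (contDiff_pd (hF a b) i).continuous
  have h2 := fun i j a b => (contDiff_pd (contDiff_pd (hF a b) i) j).continuous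
  have h3 : Continuous ((unitBump n).normed (volume : Measure (Euc n))) :=
    (unitBump n).continuous_normed
  unfold jetKernel divKernel
  fun_prop

lemma jetKernel_eq_zero {n : ℕ} (k : Fin n) (F : Fin n → Fin n → Euc n → ℝ) (x : Euc n) (t : ℝ)
    {z : Euc n} (hz : z ∉ closedBall (0 : Euc n) 1) : jetKernel k F x t z = 0 := by
  have h := (isKer_unitBump_mul (contDiff_const (c := (1 : ℝ)) (E := Euc n))).2 0 z hz
  simp only [mul_one] at h
  simp [jetKernel, divKernel, h]

lemma integral_confJet_eq {n : ℕ} (hn : 3 ≤ n) {V : Fin n → Euc n → ℝ}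
    (hV : ∀ k, ContDiff ℝ ∞ (V k)) (x : Euc n) (k : Fin n) :
    V k x - ∫ z, (unitBump n).normed volume z * confJet V x z k =
      ∫ t in (0 : ℝ)..1, ∫ z, jetKernel k (devE V) x t z := by
  have hc := continuous_jetKernel k (fun a b => contDiff_devE hV a b) x
  have hz : ∀ z, ∫ t in (0 : ℝ)..1, jetKernel k (devE V) x t z =
      (unitBump n).normed volume z * V k x - (unitBump n).normed volume z * confJet V x z k := by
    intro z
    rw [intervalIntegral.integral_eq_sub_of_hasDerivAt
      (fun t _ => hasDerivAt_mul_confJet hn hV x z k t)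
      ((hc.comp (Continuous.prodMk_left z)).intervalIntegrable 0 1)]
    simp [confJet]
  have hswap := intervalIntegral_integral_swap (μ := volume) (a := (0 : ℝ)) (b := 1)
    (f := fun t z => jetKernel k (devE V) x t z) ?_
  · rw [hswap]
    simp only [hz]
    have h1 : Integrable fun z => (unitBump n).normed (volume : Measure (Euc n)) z :=
      (unitBump n).integrable_normed
    have hJ : Continuous fun z => confJet V x z k := by
      have h0 := fun a => (hV a).continuous
      have h1 := fun i a => (contDiff_pd (hV a) i).continuous
      have h2 := (contDiff_divn hV).continuous
      have h3 := fun i => (contDiff_pd (contDiff_divn hV) i).continuous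
      unfold confJet
      fun_prop
    have h2 : Integrable fun z => (unitBump n).normed volume z * confJet V x z k := by
      simpa using (isKer_unitBump_mul (contDiff_const (c := (1 : ℝ)))).integrable_mul x hJ
    rw [integral_sub (h1.mul_const _) h2, integral_mul_const, (unitBump n).integral_normed, one_mul]
  · have h1 : IntegrableOn (fun q : ℝ × Euc n => jetKernel k (devE V) x q.1 q.2)
        (Icc 0 1 ×ˢ closedBall 0 1) :=
      hc.continuousOn.integrableOn_compact (isCompact_Icc.prod (isCompact_closedBall 0 1))
    have h2 : IntegrableOn (fun q : ℝ × Euc n => jetKernel k (devE V) x q.1 q.2)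
        (uIoc 0 1 ×ˢ univ) := by
      have := h1.of_forall_sdiff_eq_zero
        (t := Icc 0 1 ×ˢ univ) (measurableSet_Icc.prod MeasurableSet.univ) fun q hq => by
          refine jetKernel_eq_zero k _ x _ fun h => hq.2 ⟨hq.1.1, h⟩
      refine this.mono_set (prod_mono ?_ subset_rfl)
      rw [uIoc_of_le zero_le_one]
      exact Ioc_subset_Icc_self
    rw [IntegrableOn, Measure.volume_eq_prod, ← Measure.prod_restrict, Measure.restrict_univ] at h2
    exact h2

/-- Differentiable solutions of `lMat w = 0` which are quadratic along lines. -/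
structure IsConf {n : ℕ} (w : Euc n → Euc n) : Prop where
  contDiff : ContDiff ℝ ∞ w
  lagrange : ∀ x h (s : ℝ), w (x + s • h) = ((s - 1) * (s - 2) / 2) • w x -
    (s * (s - 2)) • w (x + h) + (s * (s - 1) / 2) • w (x + (2 : ℝ) • h)
  lMat_eq : ∀ x, lMat w x = 0

lemma lMat_sub {n : ℕ} {v w : Euc n → Euc n} {x : Euc n} (hv : DifferentiableAt ℝ v x)
    (hw : DifferentiableAt ℝ w x) : lMat (fun x => v x - w x) x = lMat v x - lMat w x := by
  have h : Dmat (fun x => v x - w x) x = Dmat v x - Dmat w x := by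
    ext i j
    simp only [Dmat, Matrix.sub_apply]
    rw [fderiv_fun_sub hv hw]
    rfl
  ext a b
  simp only [lMat_apply, h, Matrix.sub_apply, Finset.sum_sub_distrib]
  ring

lemma IsConf.sub {n : ℕ} {v w : Euc n → Euc n} (hv : IsConf v) (hw : IsConf w) :
    IsConf fun x => v x - w x := by
  refine ⟨hv.contDiff.sub hw.contDiff, fun x h s => ?_, fun x => ?_⟩
  · rw [hv.lagrange, hw.lagrange]
    module
  · rw [lMat_sub (hv.contDiff.differentiable (by simp) x) (hw.contDiff.differentiable (by simp) x),
      hv.lMat_eq, hw.lMat_eq, sub_zero]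

lemma Dmat_comp_affine {n : ℕ} {v : Euc n → Euc n} (c r : ℝ) (a x : Euc n)
    (hv : DifferentiableAt ℝ v (a + r • x)) :
    Dmat (fun x => c • v (a + r • x)) x = (c * r) • Dmat v (a + r • x) := by
  have h1 : HasFDerivAt (fun x : Euc n => a + r • x) (r • ContinuousLinearMap.id ℝ (Euc n)) x :=
    ((hasFDerivAt_id (𝕜 := ℝ) x).const_smul r).const_add a
  have h2 := (hv.hasFDerivAt.comp x h1).const_smul c
  ext i j
  simp only [Dmat]
  rw [show (fun x => c • v (a + r • x)) = c • (v ∘ fun x => a + r • x) from rfl, h2.fderiv]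
  simp [Dmat]
  ring

lemma lMat_comp_affine {n : ℕ} {v : Euc n → Euc n} (c r : ℝ) (a x : Euc n)
    (hv : DifferentiableAt ℝ v (a + r • x)) :
    lMat (fun x => c • v (a + r • x)) x = (c * r) • lMat v (a + r • x) := by
  ext i j
  simp only [lMat_apply, Dmat_comp_affine c r a x hv, Matrix.smul_apply, smul_eq_mul,
    ← Finset.mul_sum]
  ring

lemma IsConf.comp_affine {n : ℕ} {w : Euc n → Euc n} (hw : IsConf w) (c r : ℝ) (a : Euc n) :
    IsConf fun x => c • w (a + r • x) := by
  refine ⟨?_, fun x h s => ?_, fun x => ?_⟩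
  · exact (hw.contDiff.comp (contDiff_const.add (contDiff_id.const_smul r))).const_smul c
  · have := hw.lagrange (a + r • x) (r • h) s
    rw [show a + r • (x + s • h) = a + r • x + s • r • h by module, this,
      show a + r • (x + h) = a + r • x + r • h by module,
      show a + r • (x + (2 : ℝ) • h) = a + r • x + (2 : ℝ) • r • h by module]
    module
  · rw [lMat_comp_affine _ _ _ _ (hw.contDiff.differentiable (by simp) _), hw.lMat_eq, smul_zero]

open scoped RealInnerProductSpace in
lemma isConf_explicit {n : ℕ} (a b : Euc n) (A : Euc n →L[ℝ] Euc n)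
    (hA : ∀ i j, (A (EuclideanSpace.single j 1)) i = -(A (EuclideanSpace.single i 1)) j) (d : ℝ)
    (hn : n ≠ 0) :
    IsConf fun x => a + A x + d • x + ⟪b, x⟫ • x - (1 / 2 * ⟪x, x⟫) • b := by
  refine ⟨?_, fun x h s => ?_, fun x => ?_⟩
  · exact (((contDiff_const.add A.contDiff).add (contDiff_id.const_smul d)).add
      ((contDiff_const.inner ℝ contDiff_id).smul contDiff_id)).sub
      ((contDiff_const.mul (contDiff_id.inner ℝ contDiff_id)).smul contDiff_const)
  · simp only [map_add, map_smul, inner_add_left, inner_add_right, real_inner_smul_left,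
      real_inner_smul_right, real_inner_comm x h]
    module
  · have hD : ∀ i j, Dmat (fun x => a + A x + d • x + ⟪b, x⟫ • x - (1 / 2 * ⟪x, x⟫) • b) x i j =
        A (EuclideanSpace.single j 1) i + (d + ⟪b, x⟫) * (if i = j then 1 else 0) + b j * x i -
          x j * b i := by
      intro i j
      have h1 := (((A.hasFDerivAt (x := x)).const_add a).add
        ((hasFDerivAt_id (𝕜 := ℝ) x).const_smul d))
      have h2 := ((innerSL ℝ b).hasFDerivAt (x := x)).smul (hasFDerivAt_id (𝕜 := ℝ) x)
      have h3 := ((((hasFDerivAt_id (𝕜 := ℝ) x).inner ℝ (hasFDerivAt_id (𝕜 := ℝ) x)).const_mul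
        (1 / 2 : ℝ)).smul_const b)
      have := (h1.add h2).sub h3
      rw [Dmat]
      erw [this.fderiv]
      simp [EuclideanSpace.inner_single_left, EuclideanSpace.inner_single_right]
      split_ifs <;> ring
    have hA0 : ∀ i, A (EuclideanSpace.single i 1) i = 0 := fun i => by linarith [hA i i]
    have hn' : (n : ℝ) ≠ 0 := by exact_mod_cast hn
    have hs : (∑ c, Dmat (fun x => a + A x + d • x + ⟪b, x⟫ • x - (1 / 2 * ⟪x, x⟫) • b) x c c) / n =
        d + ⟪b, x⟫ := by
      rw [div_eq_iff hn', mul_comm]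
      have : ∀ c, Dmat (fun x => a + A x + d • x + ⟪b, x⟫ • x - (1 / 2 * ⟪x, x⟫) • b) x c c =
          d + ⟪b, x⟫ := fun c => by rw [hD, hA0]; simp; ring
      rw [Finset.sum_congr rfl fun c _ => this c]
      simp [mul_add]
    ext i j
    rw [lMat_apply, hs, hD, hD, hA i j]
    by_cases h : i = j
    · simp [h]; ring
    · simp [h, Ne.symm h]; ring

lemma exists_isConf_eq_integral {n : ℕ} (hn : n ≠ 0) {V : Fin n → Euc n → ℝ}
    (hV : ∀ k, ContDiff ℝ ∞ (V k)) :
    ∃ w, IsConf w ∧ ∀ x k, w x k = ∫ z, (unitBump n).normed volume z * confJet V x z k := by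
  set ρ : Euc n → ℝ := (unitBump n).normed volume with hρ
  have hInt : ∀ {f : Euc n → ℝ}, Continuous f → Integrable fun z => ρ z * f z := fun hf => by
    simpa using (isKer_unitBump_mul (contDiff_const (c := (1 : ℝ)))).integrable_mul 0 hf
  have c0 := fun a => (hV a).continuous
  have c1 := fun i a => (contDiff_pd (hV a) i).continuous
  have c2 := (contDiff_divn hV).continuous
  have c3 := fun i => (contDiff_pd (contDiff_divn hV) i).continuous
  let A : Fin n → Fin n → Euc n → ℝ := fun k j z =>
    1 / 2 * (pd j (V k) z - pd k (V j) z) + z j * pd k (divn V) z - z k * pd j (divn V) z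
  let d : Euc n → ℝ := fun z => divn V z - ∑ j, z j * pd j (divn V) z
  let a : Fin n → Euc n → ℝ := fun k z => V k z -
    ∑ j, z j * (1 / 2 * (pd j (V k) z - pd k (V j) z)) - z k * divn V z +
    (z k * ∑ j, z j * pd j (divn V) z) - 1 / 2 * (∑ j, z j ^ 2) * pd k (divn V) z
  have hA : ∀ k j, Continuous (A k j) := fun k j => by dsimp only [A]; fun_prop
  have hd : Continuous d := by dsimp only [d]; fun_prop
  have ha : ∀ k, Continuous (a k) := fun k => by dsimp only [a]; fun_prop
  have key : ∀ x z k, ρ z * confJet V x z k = ρ z * a k z + ∑ j, x j * (ρ z * A k j z) +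
      x k * (ρ z * d z) + x k * (∑ j, x j * (ρ z * pd j (divn V) z)) -
      1 / 2 * (∑ j, x j ^ 2) * (ρ z * pd k (divn V) z) := by
    intro x z k
    simp only [confJet, A, d, a]
    have e1 : ∑ j, x j * (ρ z * (1 / 2 * (pd j (V k) z - pd k (V j) z) + z j * pd k (divn V) z -
        z k * pd j (divn V) z)) = ρ z * (∑ j, x j * (1 / 2 * (pd j (V k) z - pd k (V j) z))) +
        ρ z * pd k (divn V) z * (∑ j, x j * z j) - ρ z * z k * ∑ j, x j * pd j (divn V) z := by
      simp only [Finset.mul_sum, ← Finset.sum_add_distrib, ← Finset.sum_sub_distrib]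
      exact Finset.sum_congr rfl fun j _ => by ring
    have e2 : ∑ j, (x j - z j) ^ 2 = ∑ j, x j ^ 2 - 2 * ∑ j, x j * z j + ∑ j, z j ^ 2 := by
      simp only [Finset.mul_sum, ← Finset.sum_add_distrib, ← Finset.sum_sub_distrib]
      exact Finset.sum_congr rfl fun j _ => by ring
    have e3 : ∑ j, x j * (ρ z * pd j (divn V) z) = ρ z * ∑ j, x j * pd j (divn V) z := by
      simp only [Finset.mul_sum]
      exact Finset.sum_congr rfl fun j _ => by ring
    rw [e1, e2, e3]
    simp only [sub_mul, Finset.sum_sub_distrib]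
    ring
  let b' : Euc n := WithLp.toLp 2 fun j => ∫ z, ρ z * pd j (divn V) z
  let a' : Euc n := WithLp.toLp 2 fun k => ∫ z, ρ z * a k z
  let M : Matrix (Fin n) (Fin n) ℝ := fun k j => ∫ z, ρ z * A k j z
  have hM : ∀ (x : Euc n) k, Matrix.toEuclideanCLM (𝕜 := ℝ) M x k = ∑ j, M k j * x j := fun x k => by
    simp [Matrix.mulVec, dotProduct]
  refine ⟨_, isConf_explicit a' b' (Matrix.toEuclideanCLM (𝕜 := ℝ) M) ?_ (∫ z, ρ z * d z) hn, ?_⟩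
  · intro i j
    rw [hM, hM]
    simp only [PiLp.single_apply, mul_ite, mul_one, mul_zero, Finset.sum_ite_eq', Finset.mem_univ,
      if_true, M, ← integral_neg]
    congr 1
    ext z
    simp only [A]
    ring
  · intro x k
    simp only [key]
    have i1 := hInt (ha k)
    have i2 : Integrable fun z => ∑ j, x j * (ρ z * A k j z) :=
      integrable_finsetSum _ fun j _ => (hInt (hA k j)).const_mul _
    have i3 := (hInt hd).const_mul (x k)
    have i4 : Integrable fun z => x k * ∑ j, x j * (ρ z * pd j (divn V) z) :=
      (integrable_finsetSum _ fun j _ => (hInt (c3 j)).const_mul _).const_mul _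
    have i5 := (hInt (c3 k)).const_mul (1 / 2 * ∑ j, x j ^ 2)
    refine Eq.symm ((integral_sub (((i1.add i2).add i3).add i4) i5).trans ?_)
    rw [integral_add' ((i1.add i2).add i3) i4, integral_add' (i1.add i2) i3, integral_add' i1 i2,
      integral_finsetSum _ fun j _ => (hInt (hA k j)).const_mul _]
    simp only [integral_const_mul]
    rw [integral_finsetSum _ fun j _ => (hInt (c3 j)).const_mul _]
    simp only [integral_const_mul]
    simp only [PiLp.sub_apply, PiLp.add_apply, PiLp.smul_apply, smul_eq_mul, hM, PiLp.inner_apply,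
      RCLike.inner_apply, conj_trivial, a', b', M]
    simp only [mul_comm, pow_two]

lemma devE_eq_lMat {n : ℕ} {v : Euc n → Euc n} {x : Euc n} (hv : DifferentiableAt ℝ v x)
    (a b : Fin n) : devE (fun k x => v x k) a b x = lMat v x a b := by
  have h : ∀ a b, pd a (fun x => v x b) x = Dmat v x b a := fun a b => by
    have := ((EuclideanSpace.proj (𝕜 := ℝ) b).hasFDerivAt.comp x hv.hasFDerivAt).fderiv
    exact congrArg (fun L : Euc n →L[ℝ] ℝ => L (EuclideanSpace.single a 1)) this
  simp only [devE, divn, h, lMat_apply]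
  ring

lemma continuous_matNorm_lMat {n : ℕ} {v : Euc n → Euc n} (hv : ContDiff ℝ ∞ v) :
    Continuous fun x => matNorm (lMat v x) := by
  have h : ∀ a b, Continuous fun x => lMat v x a b := fun a b => by
    have := (contDiff_devE (V := fun k x => v x k)
      (fun k => (EuclideanSpace.proj (𝕜 := ℝ) k).contDiff.comp hv) a b).continuous
    refine this.congr fun x => devE_eq_lMat (hv.differentiable (by simp) x) a b
  unfold matNorm
  fun_prop

lemma norm_le_sum_abs {n : ℕ} (u : Euc n) : ‖u‖ ≤ ∑ k, |u k| := by
  conv_lhs => rw [← (EuclideanSpace.basisFun (Fin n) ℝ).sum_repr u]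
  refine (norm_sum_le _ _).trans (le_of_eq ?_)
  simp [norm_smul]

/-- Pointwise Poincaré inequality for the trace-free symmetric gradient on the unit ball. -/
lemma exists_isConf_norm_sub_le {n : ℕ} (hn : 3 ≤ n) :
    ∃ C : ℝ, 0 ≤ C ∧ ∀ v : Euc n → Euc n, ContDiff ℝ ∞ v → ∃ w, IsConf w ∧
      ∀ x ∈ closedBall (0 : Euc n) 1, ‖v x - w x‖ ≤ C * ∫ t in (0 : ℝ)..1,
        ∫ z in closedBall (0 : Euc n) 1, matNorm (lMat v (z + t • (x - z))) := by
  choose C hC h using fun k : Fin n => dominated_jetKernel k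
  refine ⟨∑ k, C k * (n * n), Finset.sum_nonneg fun k _ => mul_nonneg (hC k) (by positivity),
    fun v hv => ?_⟩
  have hV : ∀ k, ContDiff ℝ ∞ fun x => v x k := fun k =>
    (EuclideanSpace.proj (𝕜 := ℝ) k).contDiff.comp hv
  obtain ⟨w, hw, hwV⟩ := exists_isConf_eq_integral (by omega) hV
  refine ⟨w, hw, fun x hx => (norm_le_sum_abs _).trans ?_⟩
  rw [Finset.sum_mul]
  refine Finset.sum_le_sum fun k _ => ?_
  have hG := continuous_matNorm_lMat hv
  have hGc : Continuous fun q : ℝ × Euc n => matNorm (lMat v (q.2 + q.1 • (x - q.2))) :=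
    hG.comp (by fun_prop)
  have hc : Continuous fun t : ℝ =>
      ∫ z in closedBall (0 : Euc n) 1, matNorm (lMat v (z + t • (x - z))) :=
    continuous_parametric_integral_of_continuous hGc (isCompact_closedBall 0 1)
  rw [PiLp.sub_apply, hwV, integral_confJet_eq hn hV x k, ← Real.norm_eq_abs, mul_assoc,
    ← intervalIntegral.integral_const_mul, ← intervalIntegral.integral_const_mul]
  refine intervalIntegral.norm_integral_le_of_norm_le zero_le_one
    (Filter.Eventually.of_forall fun t _ => ?_)
    ((continuous_const.mul (continuous_const.mul hc)).intervalIntegrable _ _)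
  refine (h k _ (fun a b => contDiff_devE hV a b) x hx t).2.trans
    (mul_le_mul_of_nonneg_left ?_ (hC k))
  rw [← integral_const_mul]
  refine setIntegral_mono (integrableOn_sum_abs (fun a b => contDiff_devE hV a b) x t)
    ((continuous_const.mul (hG.comp (by fun_prop))).continuousOn.integrableOn_compact
      (isCompact_closedBall 0 1)) fun z => ?_
  calc ∑ a, ∑ b, |devE (fun k x => v x k) a b (z + t • (x - z))|
      ≤ ∑ _a : Fin n, ∑ _b : Fin n, matNorm (lMat v (z + t • (x - z))) := by
        refine Finset.sum_le_sum fun a _ => Finset.sum_le_sum fun b _ => ?_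
        rw [devE_eq_lMat (hv.differentiable (by simp) _)]
        exact abs_le_matNorm _ _ _
    _ = n * n * matNorm (lMat v (z + t • (x - z))) := by simp; ring

lemma lintegral_rpow_le {α : Type*} {m : MeasurableSpace α} (μ : Measure α) {q : ℝ} (hq : 1 ≤ q)
    {f : α → ℝ≥0∞} (hf : AEMeasurable f μ) :
    (∫⁻ x, f x ∂μ) ^ q ≤ μ univ ^ (q - 1) * ∫⁻ x, f x ^ q ∂μ := by
  have hq0 : 0 < q := by linarith
  have := eLpNorm'_le_eLpNorm'_mul_rpow_measure_univ (μ := μ) (f := f) zero_lt_one hq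
    hf.aestronglyMeasurable
  simp only [eLpNorm', enorm_eq_self, ENNReal.rpow_one, div_one] at this
  calc (∫⁻ x, f x ∂μ) ^ q ≤ ((∫⁻ x, f x ^ q ∂μ) ^ (1 / q) * μ univ ^ (1 - 1 / q)) ^ q :=
        ENNReal.rpow_le_rpow this hq0.le
    _ = _ := by
        rw [ENNReal.mul_rpow_of_nonneg _ _ hq0.le, ← ENNReal.rpow_mul, ← ENNReal.rpow_mul,
          one_div_mul_cancel hq0.ne', ENNReal.rpow_one, sub_mul, one_div_mul_cancel hq0.ne',
          one_mul, mul_comm]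

lemma measurableEmbedding_affine {n : ℕ} (a : Euc n) {r : ℝ} (hr : r ≠ 0) :
    MeasurableEmbedding fun x : Euc n => a + r • x :=
  ((Homeomorph.smulOfNeZero r hr).trans (Homeomorph.addLeft a)).measurableEmbedding

lemma setLIntegral_comp_affine {n : ℕ} (f : Euc n → ℝ≥0∞) (a : Euc n) {r : ℝ} (hr : 0 < r)
    (s : Set (Euc n)) :
    ∫⁻ x in (fun x => a + r • x) ⁻¹' s, f (a + r • x) =
      ENNReal.ofReal (r ^ n)⁻¹ * ∫⁻ y in s, f y := by
  have he := measurableEmbedding_affine a hr.ne'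
  have hm : Measure.map (fun x : Euc n => a + r • x) volume =
      ENNReal.ofReal (r ^ n)⁻¹ • (volume : Measure (Euc n)) := by
    have h1 := Measure.map_addHaar_smul (volume : Measure (Euc n)) hr.ne'
    have h2 : Measure.map (fun x : Euc n => a + r • x) volume =
        Measure.map (fun x => a + x) (Measure.map (fun x => r • x) volume) := by
      rw [Measure.map_map (by fun_prop) (by fun_prop)]
      rfl
    rw [h2, h1, Measure.map_smul, (measurePreserving_add_left volume a).map_eq,
      finrank_euclideanSpace_fin, abs_of_pos (by positivity)]
  rw [← he.lintegral_map, ← he.restrict_map, hm, Measure.restrict_smul, lintegral_smul_measure,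
    smul_eq_mul]

lemma preimage_affine_ball {n : ℕ} (a : Euc n) {r : ℝ} (hr : 0 < r) (ρ : ℝ) :
    (fun x => a + r • x) ⁻¹' ball a (r * ρ) = ball 0 ρ := by
  ext x
  simp [norm_smul, abs_of_pos hr, hr]

/-- Averages along segments joining points of the unit ball. -/
def segAvg {n : ℕ} (G : Euc n → ℝ≥0∞) (x : Euc n) : ℝ≥0∞ :=
  ∫⁻ t in Ioc (0 : ℝ) 1, ∫⁻ z in closedBall (0 : Euc n) 1, G (z + t • (x - z))

lemma setLIntegral_setLIntegral_segment_le {n : ℕ} {H : Euc n → ℝ≥0∞} (hH : Measurable H)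
    {t : ℝ} (ht0 : 0 < t) (ht1 : t ≤ 1) :
    ∫⁻ x in closedBall (0 : Euc n) 1, ∫⁻ z in closedBall (0 : Euc n) 1, H (z + t • (x - z)) ≤
      volume (closedBall (0 : Euc n) 1) * 2 ^ n * ∫⁻ y in closedBall (0 : Euc n) 1, H y := by
  set B := closedBall (0 : Euc n) 1
  have hB : MeasurableSet B := isClosed_closedBall.measurableSet
  have key : ∀ s : ℝ, 1 / 2 ≤ s → s ≤ 1 → ∀ z ∈ B,
      ∫⁻ x in B, H ((1 - s) • z + s • x) ≤ 2 ^ n * ∫⁻ y in B, H y := by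
    intro s hs hs1 z hz
    have hs0 : 0 < s := by linarith
    have hsub : B ⊆ (fun x => (1 - s) • z + s • x) ⁻¹' B := fun x hx =>
      convex_closedBall (0 : Euc n) 1 hz hx (by linarith) hs0.le (by ring)
    refine (lintegral_mono_set hsub).trans ?_
    rw [setLIntegral_comp_affine _ _ hs0]
    gcongr
    rw [show (2 : ℝ≥0∞) ^ n = ENNReal.ofReal (2 ^ n) by
      rw [ENNReal.ofReal_pow (by norm_num)]; simp]
    refine ENNReal.ofReal_le_ofReal ?_
    rw [← inv_pow]
    refine pow_le_pow_left₀ (by positivity) ?_ n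
    rw [inv_le_comm₀ hs0 (by norm_num)]
    linarith
  rcases le_total (1 / 2) t with h | h
  · rw [lintegral_lintegral_swap (by fun_prop)]
    calc ∫⁻ z in B, ∫⁻ x in B, H (z + t • (x - z))
        ≤ ∫⁻ _ in B, 2 ^ n * ∫⁻ y in B, H y := by
          refine setLIntegral_mono measurable_const fun z hz => ?_
          refine le_trans (le_of_eq ?_) (key t h ht1 z hz)
          congr! 3 with x
          module
      _ = _ := by rw [setLIntegral_const]; ring
  · calc ∫⁻ x in B, ∫⁻ z in B, H (z + t • (x - z))
        ≤ ∫⁻ _ in B, 2 ^ n * ∫⁻ y in B, H y := by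
          refine setLIntegral_mono measurable_const fun z hz => ?_
          refine le_trans (le_of_eq ?_) (key (1 - t) (by linarith) (by linarith) z hz)
          congr! 3 with x
          module
      _ = _ := by rw [setLIntegral_const]; ring

lemma setLIntegral_segAvg_rpow_le {n : ℕ} {q : ℝ} (hq : 1 ≤ q) {G : Euc n → ℝ≥0∞}
    (hG : Measurable G) :
    ∫⁻ x in closedBall (0 : Euc n) 1, segAvg G x ^ q ≤
      volume (closedBall (0 : Euc n) 1) ^ q * 2 ^ n * ∫⁻ y in closedBall (0 : Euc n) 1, G y ^ q := by
  set B := closedBall (0 : Euc n) 1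
  set T := (volume : Measure ℝ).restrict (Ioc 0 1)
  have hT : T univ = 1 := by simp [T]
  have hm : Measurable fun p : (Euc n × ℝ) × Euc n => G (p.2 + p.1.2 • (p.1.1 - p.2)) :=
    hG.comp (by fun_prop)
  have hBtop : volume B ≠ ⊤ := measure_closedBall_lt_top.ne
  have h1 : ∀ x, segAvg G x ^ q ≤
      volume B ^ (q - 1) * ∫⁻ t, (∫⁻ z in B, G (z + t • (x - z)) ^ q) ∂T := by
    intro x
    refine (lintegral_rpow_le T hq ?_).trans ?_
    · exact (Measurable.lintegral_prod_right'
        (f := fun p : ℝ × Euc n => G (p.2 + p.1 • (x - p.2))) (hG.comp (by fun_prop))).aemeasurable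
    · rw [hT, ENNReal.one_rpow, one_mul, ← lintegral_const_mul' _ _
        (ENNReal.rpow_ne_top_of_nonneg (by linarith) hBtop)]
      refine lintegral_mono fun t => ?_
      refine (lintegral_rpow_le _ hq (hG.comp (by fun_prop)).aemeasurable).trans ?_
      rw [Measure.restrict_apply_univ]
      exact le_rfl
  calc ∫⁻ x in B, segAvg G x ^ q
      ≤ ∫⁻ x in B, volume B ^ (q - 1) * ∫⁻ t, (∫⁻ z in B, G (z + t • (x - z)) ^ q) ∂T :=
        lintegral_mono h1
    _ = volume B ^ (q - 1) * ∫⁻ t, (∫⁻ x in B, ∫⁻ z in B, G (z + t • (x - z)) ^ q) ∂T := by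
        rw [lintegral_const_mul' _ _ (ENNReal.rpow_ne_top_of_nonneg (by linarith) hBtop),
          lintegral_lintegral_swap]
        exact (Measurable.lintegral_prod_right' (hm.pow_const q)).aemeasurable
    _ ≤ volume B ^ (q - 1) * ∫⁻ _, (volume B * 2 ^ n * ∫⁻ y in B, G y ^ q) ∂T := by
        refine mul_le_mul' le_rfl (setLIntegral_mono measurable_const fun t ht => ?_)
        exact setLIntegral_setLIntegral_segment_le (hG.pow_const q) ht.1 ht.2
    _ = _ := by
        rw [lintegral_const, hT, mul_one, ← mul_assoc, ← mul_assoc]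
        congr 2
        nth_rewrite 2 [← ENNReal.rpow_one (volume B)]
        rw [← ENNReal.rpow_add_of_nonneg _ _ (by linarith) zero_le_one]
        simp

/-- Mollification of a vector field. -/
def mollify {n : ℕ} (φ : ContDiffBump (0 : Euc n)) (v : Euc n → Euc n) : Euc n → Euc n :=
  v ⋆[(ContinuousLinearMap.lsmul ℝ ℝ).flip, volume] φ.normed volume

lemma contDiff_mollify {n : ℕ} (φ : ContDiffBump (0 : Euc n)) {v : Euc n → Euc n}
    (hv : Continuous v) : ContDiff ℝ ∞ (mollify φ v) :=
  HasCompactSupport.contDiff_convolution_right _ φ.hasCompactSupport_normed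
    (hv.locallyIntegrable) φ.contDiff_normed

lemma integrable_normed_mul {n : ℕ} (φ : ContDiffBump (0 : Euc n)) (x : Euc n) {g : Euc n → ℝ}
    (hg : Integrable g) : Integrable fun t => φ.normed volume (x - t) * g t := by
  have hc : Continuous fun t => φ.normed volume (x - t) :=
    (φ.contDiff_normed (n := 0)).continuous.comp (by fun_prop)
  obtain ⟨C, hC⟩ := (φ.contDiff_normed (n := 0) (μ := volume)).continuous.bounded_above_of_compact_support
    φ.hasCompactSupport_normed
  exact hg.bdd_mul hc.aestronglyMeasurable (Filter.Eventually.of_forall fun t => hC _)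

lemma Dmat_mollify {n : ℕ} (φ : ContDiffBump (0 : Euc n)) {v : Euc n → Euc n}
    (hv : Differentiable ℝ v) (hc : HasCompactSupport v)
    (hi : ∀ i j, Integrable fun x => Dmat v x i j) (x : Euc n) (i j : Fin n) :
    Dmat (mollify φ v) x i j = ∫ t, φ.normed volume (x - t) * Dmat v t i j := by
  have hvi : Integrable v := hv.continuous.integrable_of_hasCompactSupport hc
  have hφ1 : ContDiff ℝ 1 (φ.normed (volume : Measure (Euc n))) := φ.contDiff_normed
  have hφc := φ.hasCompactSupport_normed (μ := volume)
  have h1 := (hφc.hasFDerivAt_convolution_right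
    (ContinuousLinearMap.lsmul ℝ ℝ).flip (μ := volume) hv.continuous.locallyIntegrable hφ1 x).fderiv
  rw [Dmat, mollify, h1, convolution_precompR_apply (μ := volume) _ hv.continuous.locallyIntegrable
    (hφc.fderiv ℝ) (hφ1.continuous_fderiv one_ne_zero)]
  simp only [convolution, ContinuousLinearMap.flip_apply, ContinuousLinearMap.lsmul_apply]
  have hd : Continuous fun t => fderiv ℝ (φ.normed (volume : Measure (Euc n))) (x - t)
      (EuclideanSpace.single j 1) :=
    ((hφ1.continuous_fderiv one_ne_zero).comp (by fun_prop)).clm_apply continuous_const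
  have hvk : ∀ k, Continuous fun t => v t k := fun k =>
    (EuclideanSpace.proj (𝕜 := ℝ) k).continuous.comp hv.continuous
  have hvc : ∀ k, HasCompactSupport fun t => v t k := fun k =>
    hc.comp_left (g := fun u : Euc n => u k) rfl
  have hInt : ∀ k, Integrable fun t => fderiv ℝ (φ.normed (volume : Measure (Euc n))) (x - t)
      (EuclideanSpace.single j 1) * v t k := fun k =>
    (hd.mul (hvk k)).integrable_of_hasCompactSupport (hvc k).mul_left
  rw [eval_integral_piLp (fun k => by simpa using hInt k)]
  simp only [PiLp.smul_apply, smul_eq_mul]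
  have hφd : ∀ t, HasFDerivAt (fun t => φ.normed (volume : Measure (Euc n)) (x - t))
      (-fderiv ℝ (φ.normed (volume : Measure (Euc n))) (x - t)) t := fun t => by
    have := (hφ1.differentiable one_ne_zero (x - t)).hasFDerivAt.comp t
      ((hasFDerivAt_id (𝕜 := ℝ) t).const_sub x)
    refine this.congr_fderiv ?_
    ext u; simp
  have hvd : ∀ t, fderiv ℝ (fun t => v t i) t (EuclideanSpace.single j 1) = Dmat v t i j :=
    fun t => by
      have := ((EuclideanSpace.proj (𝕜 := ℝ) i).hasFDerivAt.comp t (hv t).hasFDerivAt).fderiv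
      exact congrArg (fun L : Euc n →L[ℝ] ℝ => L (EuclideanSpace.single j 1)) this
  have := integral_mul_fderiv_eq_neg_fderiv_mul_of_integrable (𝕜 := ℝ) (μ := volume)
    (f := fun t => φ.normed (volume : Measure (Euc n)) (x - t)) (g := fun t => v t i)
    (v := EuclideanSpace.single j (1 : ℝ)) ?_ ?_ ?_ (fun t _ => (hφd t).differentiableAt)
    (fun t _ => (EuclideanSpace.proj (𝕜 := ℝ) i).differentiableAt.comp t (hv t))
  · simp only [hvd, (hφd _).fderiv] at this
    rw [this, ← integral_neg]
    simp
  · simp only [(hφd _).fderiv]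
    simpa using (hInt i).neg
  · simp only [hvd]
    exact integrable_normed_mul φ x (hi i j)
  · exact integrable_normed_mul φ x ((hvk i).integrable_of_hasCompactSupport (hvc i))

lemma lMat_mollify {n : ℕ} (φ : ContDiffBump (0 : Euc n)) {v : Euc n → Euc n}
    (hv : Differentiable ℝ v) (hc : HasCompactSupport v)
    (hi : ∀ i j, Integrable fun x => Dmat v x i j) (x : Euc n) (a b : Fin n) :
    lMat (mollify φ v) x a b = ∫ t, φ.normed volume (x - t) * lMat v t a b := by
  have h := fun i j => integrable_normed_mul φ x (hi i j)
  have e : ∀ t, φ.normed volume (x - t) * lMat v t a b =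
      (1 / 2 * (φ.normed volume (x - t) * Dmat v t a b + φ.normed volume (x - t) * Dmat v t b a)) -
      (if a = b then 1 else 0) / n * ∑ c, φ.normed volume (x - t) * Dmat v t c c := fun t => by
    rw [lMat_apply, ← Finset.mul_sum]
    ring
  have hA : Integrable fun t => 1 / 2 * (φ.normed volume (x - t) * Dmat v t a b +
      φ.normed volume (x - t) * Dmat v t b a) := ((h a b).add (h b a)).const_mul _
  have hB : Integrable fun t => (if a = b then 1 else 0) / (n : ℝ) *
      ∑ c, φ.normed volume (x - t) * Dmat v t c c :=
    (integrable_finsetSum _ fun c _ => h c c).const_mul _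
  rw [integral_congr_ae (Filter.Eventually.of_forall e), integral_sub hA hB,
    integral_const_mul, integral_const_mul,
    integral_add (h a b) (h b a), integral_finsetSum _ fun c _ => h c c, lMat_apply]
  simp only [Dmat_mollify φ hv hc hi]
  ring

lemma ofReal_matNorm_lMat_mollify_le {n : ℕ} (φ : ContDiffBump (0 : Euc n)) {v : Euc n → Euc n}
    (hv : Differentiable ℝ v) (hc : HasCompactSupport v)
    (hi : ∀ i j, Integrable fun x => Dmat v x i j) (x : Euc n) :
    ENNReal.ofReal (matNorm (lMat (mollify φ v) x)) ≤
      n ^ 2 * ∫⁻ t, ENNReal.ofReal (φ.normed volume (x - t)) * ENNReal.ofReal (matNorm (lMat v t)) := by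
  have key : ∀ M : Matrix (Fin n) (Fin n) ℝ, ENNReal.ofReal (matNorm M) ≤
      ∑ a, ∑ b, ENNReal.ofReal |M a b| := fun M => by
    refine (ENNReal.ofReal_le_ofReal (matNorm_le_sum M)).trans (le_of_eq ?_)
    refine (ENNReal.ofReal_sum_of_nonneg fun _ _ =>
      Finset.sum_nonneg fun _ _ => abs_nonneg _).trans ?_
    exact Finset.sum_congr rfl fun a _ => ENNReal.ofReal_sum_of_nonneg fun _ _ => abs_nonneg _
  refine (key _).trans ?_
  have : ∀ a b : Fin n, ENNReal.ofReal |lMat (mollify φ v) x a b| ≤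
      ∫⁻ t, ENNReal.ofReal (φ.normed volume (x - t)) * ENNReal.ofReal (matNorm (lMat v t)) := by
    intro a b
    rw [lMat_mollify φ hv hc hi, ← Real.norm_eq_abs, ofReal_norm]
    refine (enorm_integral_le_lintegral_enorm _).trans (lintegral_mono fun t => ?_)
    rw [enorm_mul, ← ofReal_norm, Real.norm_of_nonneg (φ.nonneg_normed _), ← ofReal_norm]
    gcongr
    exact abs_le_matNorm _ _ _
  calc ∑ a, ∑ b, ENNReal.ofReal |lMat (mollify φ v) x a b|
      ≤ ∑ _a : Fin n, ∑ _b : Fin n, ∫⁻ t, ENNReal.ofReal (φ.normed volume (x - t)) *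
        ENNReal.ofReal (matNorm (lMat v t)) := by
        exact Finset.sum_le_sum fun a _ => Finset.sum_le_sum fun b _ => this a b
    _ = _ := by simp; ring

lemma lintegral_ofReal_normed {n : ℕ} (φ : ContDiffBump (0 : Euc n)) :
    ∫⁻ t, ENNReal.ofReal (φ.normed volume t) = 1 := by
  rw [← ofReal_integral_eq_lintegral_ofReal φ.integrable_normed
    (Filter.Eventually.of_forall φ.nonneg_normed), φ.integral_normed, ENNReal.ofReal_one]

lemma setLIntegral_average_rpow_le {n : ℕ} (φ : ContDiffBump (0 : Euc n)) (hφ : φ.rOut ≤ 1)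
    {q : ℝ} (hq : 1 ≤ q) {G : Euc n → ℝ≥0∞} (hG : Measurable G) :
    ∫⁻ x in closedBall (0 : Euc n) 1,
      (∫⁻ t, ENNReal.ofReal (φ.normed volume (x - t)) * G t) ^ q ≤
      ∫⁻ y in ball (0 : Euc n) 2, G y ^ q := by
  have hm : Measurable fun t : Euc n => ENNReal.ofReal (φ.normed volume t) :=
    ((φ.contDiff_normed (n := 0)).continuous.measurable).ennreal_ofReal
  have hmx : ∀ x, Measurable fun t : Euc n => ENNReal.ofReal (φ.normed volume (x - t)) := fun x =>
    hm.comp (by fun_prop)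
  have h0 : ∀ {x t : Euc n}, x ∈ closedBall (0 : Euc n) 1 → t ∉ ball (0 : Euc n) 2 →
      ENNReal.ofReal (φ.normed volume (x - t)) = 0 := by
    intro x t hx ht
    have : φ.normed volume (x - t) = 0 := by
      rw [← Function.notMem_support, φ.support_normed_eq, mem_ball_zero_iff, not_lt]
      rw [mem_closedBall_zero_iff] at hx
      rw [mem_ball_zero_iff, not_lt] at ht
      have := norm_sub_norm_le t x
      rw [norm_sub_rev] at this
      linarith
    simp [this]
  calc ∫⁻ x in closedBall (0 : Euc n) 1,
      (∫⁻ t, ENNReal.ofReal (φ.normed volume (x - t)) * G t) ^ q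
      ≤ ∫⁻ x in closedBall (0 : Euc n) 1, ∫⁻ t in ball (0 : Euc n) 2,
          ENNReal.ofReal (φ.normed volume (x - t)) * G t ^ q := by
        refine setLIntegral_mono' isClosed_closedBall.measurableSet fun x hx => ?_
        have h1 := lintegral_rpow_le
          ((volume : Measure (Euc n)).withDensity fun t => ENNReal.ofReal (φ.normed volume (x - t)))
          hq hG.aemeasurable
        rw [withDensity_apply _ MeasurableSet.univ, setLIntegral_univ,
          lintegral_withDensity_eq_lintegral_mul _ (hmx x) hG,
          lintegral_withDensity_eq_lintegral_mul _ (hmx x) (hG.pow_const q),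
          lintegral_sub_left_eq_self (fun t => ENNReal.ofReal (φ.normed volume t)),
          lintegral_ofReal_normed, ENNReal.one_rpow, one_mul] at h1
        refine h1.trans (le_of_eq ?_)
        rw [setLIntegral_eq_of_support_subset]
        · rfl
        · intro t ht
          by_contra h
          exact ht (by simp [h0 hx h])
    _ ≤ ∫⁻ x, ∫⁻ t in ball (0 : Euc n) 2, ENNReal.ofReal (φ.normed volume (x - t)) * G t ^ q :=
        setLIntegral_le_lintegral _ _
    _ = ∫⁻ t in ball (0 : Euc n) 2, ∫⁻ x, ENNReal.ofReal (φ.normed volume (x - t)) * G t ^ q := by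
        refine lintegral_lintegral_swap (Measurable.aemeasurable ?_)
        exact (hm.comp (measurable_fst.sub measurable_snd)).mul
          ((hG.pow_const q).comp measurable_snd)
    _ = _ := by
        congr 1
        ext t
        have hmt : Measurable fun x => ENNReal.ofReal (φ.normed volume (x - t)) :=
          hm.comp (measurable_id.sub_const t)
        rw [lintegral_mul_const _ hmt,
          lintegral_sub_right_eq_self (fun x => ENNReal.ofReal (φ.normed volume x)),
          lintegral_ofReal_normed, one_mul]

/-- The density `|l(v)| + δ`, as an extended nonnegative function. -/
def devDensity {n : ℕ} (v : Euc n → Euc n) (δ : ℝ) (x : Euc n) : ℝ≥0∞ :=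
  ENNReal.ofReal (matNorm (lMat v x) + δ)

lemma measurable_devDensity {n : ℕ} (v : Euc n → Euc n) (δ : ℝ) : Measurable (devDensity v δ) :=
  ((measurable_matNorm (measurable_lMat v)).add_const δ).ennreal_ofReal

lemma ofReal_le_devDensity {n : ℕ} (v : Euc n → Euc n) (δ : ℝ) (x : Euc n) :
    ENNReal.ofReal δ ≤ devDensity v δ x :=
  ENNReal.ofReal_le_ofReal (by linarith [matNorm_nonneg (lMat v x)])

lemma ofReal_matNorm_le_devDensity {n : ℕ} (v : Euc n → Euc n) {δ : ℝ} (hδ : 0 ≤ δ) (x : Euc n) :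
    ENNReal.ofReal (matNorm (lMat v x)) ≤ devDensity v δ x :=
  ENNReal.ofReal_le_ofReal (by linarith)

lemma exists_dist_mollify_le {n : ℕ} {v : Euc n → Euc n} (hv : Continuous v)
    (hc : HasCompactSupport v) {δ : ℝ} (hδ : 0 < δ) :
    ∃ φ : ContDiffBump (0 : Euc n), φ.rOut ≤ 1 ∧ ∀ x, ‖mollify φ v x - v x‖ ≤ δ := by
  obtain ⟨ε, hε, h⟩ := Metric.uniformContinuous_iff.1 (hc.uniformContinuous_of_continuous hv) δ hδ
  refine ⟨⟨min ε 1 / 2, min ε 1, by positivity, half_lt_self (by positivity)⟩, min_le_right _ _,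
    fun x => ?_⟩
  rw [← dist_eq_norm, mollify, convolution_flip]
  refine ContDiffBump.dist_normed_convolution_le hv.aestronglyMeasurable fun y hy => (h ?_).le
  exact lt_of_lt_of_le hy (min_le_left _ _)

lemma ofReal_segment_le_segAvg {n : ℕ} {f : Euc n → ℝ} (h0 : ∀ x, 0 ≤ f x)
    (x : Euc n) :
    ENNReal.ofReal (∫ t in (0 : ℝ)..1, ∫ z in closedBall (0 : Euc n) 1, f (z + t • (x - z))) ≤
      segAvg (fun y => ENNReal.ofReal (f y)) x := by
  rw [intervalIntegral.integral_of_le zero_le_one, segAvg]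
  have h1 : ∀ t : ℝ, ‖∫ z in closedBall (0 : Euc n) 1, f (z + t • (x - z))‖ₑ ≤
      ∫⁻ z in closedBall (0 : Euc n) 1, ENNReal.ofReal (f (z + t • (x - z))) := fun t => by
    refine (enorm_integral_le_lintegral_enorm _).trans (lintegral_mono fun z => ?_)
    rw [Real.enorm_of_nonneg (h0 _)]
  rw [← Real.enorm_of_nonneg (integral_nonneg fun t => integral_nonneg fun z => h0 _)]
  exact (enorm_integral_le_lintegral_enorm _).trans (lintegral_mono h1)

lemma exists_isConf_setLIntegral_le {n : ℕ} (hn : 3 ≤ n) :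
    ∃ C : ℝ → ℝ≥0∞, (∀ q, 1 ≤ q → C q ≠ ⊤) ∧ ∀ v : Euc n → Euc n, Differentiable ℝ v →
      HasCompactSupport v → (∀ i j, Integrable fun x => Dmat v x i j) → ∀ δ : ℝ, 0 < δ →
      ∃ w, IsConf w ∧ ∀ q : ℝ, 1 ≤ q → ∫⁻ x in closedBall (0 : Euc n) 1, ‖v x - w x‖ₑ ^ q ≤
        C q * ∫⁻ x in ball (0 : Euc n) 2, devDensity v δ x ^ q := by
  obtain ⟨C, hC, hP⟩ := exists_isConf_norm_sub_le hn
  set B := closedBall (0 : Euc n) 1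
  have hBtop : volume B ≠ ⊤ := measure_closedBall_lt_top.ne
  have hB2 : B ⊆ ball (0 : Euc n) 2 := closedBall_subset_ball (by norm_num)
  refine ⟨fun q => 2 ^ (q - 1) * (1 + ENNReal.ofReal C ^ q * (volume B ^ q * 2 ^ n * (n ^ 2) ^ q)),
    fun q hq => ?_, fun v hv hc hi δ hδ => ?_⟩
  · have h0 : 0 ≤ q := by linarith
    refine ENNReal.mul_ne_top (ENNReal.rpow_ne_top_of_nonneg (by linarith) (by simp))
      (ENNReal.add_ne_top.2 ⟨by simp, ENNReal.mul_ne_top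
        (ENNReal.rpow_ne_top_of_nonneg h0 (by simp)) (ENNReal.mul_ne_top (ENNReal.mul_ne_top
        (ENNReal.rpow_ne_top_of_nonneg h0 hBtop) (by simp))
        (ENNReal.rpow_ne_top_of_nonneg h0 (by simp)))⟩)
  obtain ⟨φ, hφ, hφv⟩ := exists_dist_mollify_le hv.continuous hc hδ
  have hsm := contDiff_mollify φ hv.continuous
  obtain ⟨w, hw, hwle⟩ := hP _ hsm
  refine ⟨w, hw, fun q hq => ?_⟩
  have hq0 : 0 ≤ q := by linarith
  set G := fun y => ENNReal.ofReal (matNorm (lMat v y))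
  set G1 := fun y => ENNReal.ofReal (matNorm (lMat (mollify φ v) y))
  have hG : Measurable G := (measurable_matNorm (measurable_lMat v)).ennreal_ofReal
  have hG1 : Measurable G1 := (measurable_matNorm (measurable_lMat _)).ennreal_ofReal
  have hpt : ∀ x ∈ B, ‖v x - w x‖ₑ ^ q ≤
      2 ^ (q - 1) * (ENNReal.ofReal δ ^ q + ENNReal.ofReal C ^ q * segAvg G1 x ^ q) := by
    intro x hx
    have h1 : ‖v x - w x‖ₑ ≤ ENNReal.ofReal δ + ENNReal.ofReal C * segAvg G1 x := by
      calc ‖v x - w x‖ₑ ≤ ENNReal.ofReal (δ + C * ∫ t in (0 : ℝ)..1,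
            ∫ z in closedBall (0 : Euc n) 1, matNorm (lMat (mollify φ v) (z + t • (x - z)))) := by
            rw [← ofReal_norm]
            refine ENNReal.ofReal_le_ofReal ?_
            calc ‖v x - w x‖ ≤ ‖v x - mollify φ v x‖ + ‖mollify φ v x - w x‖ :=
                  norm_sub_le_norm_sub_add_norm_sub _ _ _
              _ ≤ _ := add_le_add (by rw [norm_sub_rev]; exact hφv x) (hwle x hx)
        _ ≤ ENNReal.ofReal δ + ENNReal.ofReal C * _ := by
            refine ENNReal.ofReal_add_le.trans ?_
            rw [ENNReal.ofReal_mul hC]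
        _ ≤ _ := by
            gcongr
            exact ofReal_segment_le_segAvg (fun _ => matNorm_nonneg _) x
    refine (ENNReal.rpow_le_rpow h1 hq0).trans ((ENNReal.rpow_add_le_mul_rpow_add_rpow _ _ hq).trans
      (le_of_eq ?_))
    rw [ENNReal.mul_rpow_of_nonneg _ _ hq0]
  have hδint : ∫⁻ _ in B, ENNReal.ofReal δ ^ q ≤
      ∫⁻ x in ball (0 : Euc n) 2, devDensity v δ x ^ q :=
    (lintegral_mono_set hB2).trans (lintegral_mono fun x =>
      ENNReal.rpow_le_rpow (ofReal_le_devDensity v δ x) hq0)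
  have hG1int : ∫⁻ x in B, G1 x ^ q ≤
      (n ^ 2) ^ q * ∫⁻ x in ball (0 : Euc n) 2, devDensity v δ x ^ q := by
    calc ∫⁻ x in B, G1 x ^ q
        ≤ ∫⁻ x in B, (n ^ 2) ^ q *
          (∫⁻ t, ENNReal.ofReal (φ.normed volume (x - t)) * G t) ^ q := by
          refine lintegral_mono fun x => ?_
          rw [← ENNReal.mul_rpow_of_nonneg _ _ hq0]
          exact ENNReal.rpow_le_rpow (ofReal_matNorm_lMat_mollify_le φ hv hc hi x) hq0
      _ ≤ (n ^ 2) ^ q * ∫⁻ y in ball (0 : Euc n) 2, G y ^ q := by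
          rw [lintegral_const_mul' _ _ (ENNReal.rpow_ne_top_of_nonneg hq0 (by simp))]
          exact mul_le_mul' le_rfl (setLIntegral_average_rpow_le φ hφ hq hG)
      _ ≤ _ := by
          gcongr with y
          exact ofReal_matNorm_le_devDensity v hδ.le y
  have hC' : ENNReal.ofReal C ^ q ≠ ⊤ := ENNReal.rpow_ne_top_of_nonneg hq0 (by simp)
  calc ∫⁻ x in B, ‖v x - w x‖ₑ ^ q
      ≤ ∫⁻ x in B, 2 ^ (q - 1) * (ENNReal.ofReal δ ^ q + ENNReal.ofReal C ^ q * segAvg G1 x ^ q) :=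
        setLIntegral_mono' isClosed_closedBall.measurableSet hpt
    _ = 2 ^ (q - 1) * (∫⁻ _ in B, ENNReal.ofReal δ ^ q) +
        2 ^ (q - 1) * (ENNReal.ofReal C ^ q * ∫⁻ x in B, segAvg G1 x ^ q) := by
        rw [lintegral_const_mul' _ _ (ENNReal.rpow_ne_top_of_nonneg (by linarith) (by simp)),
          lintegral_add_left measurable_const, lintegral_const_mul' _ _ hC', mul_add]
    _ ≤ 2 ^ (q - 1) * (∫⁻ x in ball (0 : Euc n) 2, devDensity v δ x ^ q) +
        2 ^ (q - 1) * (ENNReal.ofReal C ^ q * (volume B ^ q * 2 ^ n * ((n ^ 2) ^ q *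
          ∫⁻ x in ball (0 : Euc n) 2, devDensity v δ x ^ q))) := by
        gcongr
        exact (setLIntegral_segAvg_rpow_le hq hG1).trans (by gcongr)
    _ = _ := by ring

lemma matNorm_eq_norm {n : ℕ} (M : Matrix (Fin n) (Fin n) ℝ) :
    matNorm M = ‖(WithLp.toLp 2 fun k : Fin n × Fin n => M k.1 k.2)‖ := by
  rw [EuclideanSpace.norm_eq, matNorm, Fintype.sum_prod_type]
  simp

lemma matNorm_add_le {n : ℕ} (M N : Matrix (Fin n) (Fin n) ℝ) :
    matNorm (M + N) ≤ matNorm M + matNorm N := by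
  simp only [matNorm_eq_norm]
  exact norm_add_le (WithLp.toLp 2 fun k : Fin n × Fin n => M k.1 k.2) (WithLp.toLp 2 fun k => N k.1 k.2)

lemma matNorm_sub_le {n : ℕ} (M N : Matrix (Fin n) (Fin n) ℝ) :
    matNorm (M - N) ≤ matNorm M + matNorm N := by
  simp only [matNorm_eq_norm]
  exact norm_sub_le (WithLp.toLp 2 fun k : Fin n × Fin n => M k.1 k.2) (WithLp.toLp 2 fun k => N k.1 k.2)

lemma matNorm_smul {n : ℕ} (c : ℝ) (M : Matrix (Fin n) (Fin n) ℝ) :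
    matNorm (c • M) = |c| * matNorm M := by
  simp only [matNorm_eq_norm]
  exact norm_smul c (WithLp.toLp 2 fun k : Fin n × Fin n => M k.1 k.2)

lemma matNorm_le_of_abs_le {n : ℕ} {M : Matrix (Fin n) (Fin n) ℝ} {A : ℝ} (h : ∀ i j, |M i j| ≤ A) :
    matNorm M ≤ n * n * A := by
  refine (matNorm_le_sum M).trans ?_
  refine (Finset.sum_le_sum fun i _ => Finset.sum_le_sum fun j _ => h i j).trans ?_
  simp [mul_assoc]

lemma Dmat_sub {n : ℕ} {v w : Euc n → Euc n} {x : Euc n} (hv : DifferentiableAt ℝ v x)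
    (hw : DifferentiableAt ℝ w x) : Dmat (fun x => v x - w x) x = Dmat v x - Dmat w x := by
  ext i j
  simp only [Dmat, Matrix.sub_apply]
  rw [fderiv_fun_sub hv hw]
  rfl

lemma Dmat_smul_apply {n : ℕ} {χ : Euc n → ℝ} {u : Euc n → Euc n} {x : Euc n}
    (hχ : DifferentiableAt ℝ χ x) (hu : DifferentiableAt ℝ u x) (i j : Fin n) :
    Dmat (fun x => χ x • u x) x i j =
      χ x * Dmat u x i j + fderiv ℝ χ x (EuclideanSpace.single j 1) * u x i := by
  simp only [Dmat]
  rw [fderiv_fun_smul hχ hu]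
  simp

lemma abs_fderiv_single_mul_le {n : ℕ} {χ : Euc n → ℝ} {u x : Euc n} {L : ℝ}
    (hL : ‖fderiv ℝ χ x‖ ≤ L) (i j : Fin n) :
    |fderiv ℝ χ x (EuclideanSpace.single j 1) * u i| ≤ L * ‖u‖ := by
  rw [abs_mul]
  refine mul_le_mul ?_ (PiLp.norm_apply_le u i) (abs_nonneg _) ((norm_nonneg _).trans hL)
  refine ((fderiv ℝ χ x).le_opNorm _).trans ?_
  simpa using hL

lemma matNorm_Dmat_smul_le {n : ℕ} {χ : Euc n → ℝ} {u : Euc n → Euc n} {x : Euc n} {L : ℝ}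
    (hχ : DifferentiableAt ℝ χ x) (hu : DifferentiableAt ℝ u x) (h1 : |χ x| ≤ 1)
    (hL : ‖fderiv ℝ χ x‖ ≤ L) :
    matNorm (Dmat (fun x => χ x • u x) x) ≤ n * n * (matNorm (Dmat u x) + L * ‖u x‖) := by
  refine matNorm_le_of_abs_le fun i j => ?_
  rw [Dmat_smul_apply hχ hu]
  refine (abs_add_le _ _).trans (add_le_add ?_ (abs_fderiv_single_mul_le hL i j))
  rw [abs_mul]
  exact (mul_le_of_le_one_left (abs_nonneg _) h1).trans (abs_le_matNorm _ _ _)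

lemma matNorm_lMat_smul_le {n : ℕ} {χ : Euc n → ℝ} {u : Euc n → Euc n} {x : Euc n} {L : ℝ}
    (hχ : DifferentiableAt ℝ χ x) (hu : DifferentiableAt ℝ u x) (h1 : |χ x| ≤ 1)
    (hL : ‖fderiv ℝ χ x‖ ≤ L) :
    matNorm (lMat (fun x => χ x • u x) x) ≤ n * n * (matNorm (lMat u x) + 2 * L * ‖u x‖) := by
  refine matNorm_le_of_abs_le fun a b => ?_
  have hn : (0 : ℝ) < n := by exact_mod_cast a.pos
  have e : lMat (fun x => χ x • u x) x a b = χ x * lMat u x a b +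
      (1 / 2 * (fderiv ℝ χ x (EuclideanSpace.single b 1) * u x a +
        fderiv ℝ χ x (EuclideanSpace.single a 1) * u x b) -
      (∑ c, fderiv ℝ χ x (EuclideanSpace.single c 1) * u x c) / n * if a = b then 1 else 0) := by
    simp only [lMat_apply, Dmat_smul_apply hχ hu, Finset.sum_add_distrib, ← Finset.mul_sum]
    ring
  have h2 := abs_fderiv_single_mul_le (u := u x) hL
  have h3 : |(∑ c, fderiv ℝ χ x (EuclideanSpace.single c 1) * u x c) / n| ≤ L * ‖u x‖ := by
    rw [abs_div, abs_of_pos hn, div_le_iff₀ hn]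
    refine (Finset.abs_sum_le_sum_abs _ _).trans
      ((Finset.sum_le_sum fun c _ => h2 c c).trans (le_of_eq ?_))
    simp [mul_comm]
  have h4 := h2 a b
  have h5 := h2 b a
  rw [e]
  refine (abs_add_le _ _).trans (add_le_add ?_ ?_)
  · rw [abs_mul]
    exact (mul_le_of_le_one_left (abs_nonneg _) h1).trans (abs_le_matNorm _ _ _)
  · rw [abs_le] at h3 h4 h5 ⊢
    split_ifs <;> constructor <;> linarith

lemma exists_norm_fderiv_bump_le {n : ℕ} (χ : ContDiffBump (0 : Euc n)) :
    ∃ L : ℝ, 0 ≤ L ∧ ∀ x, ‖fderiv ℝ χ x‖ ≤ L := by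
  obtain ⟨L, hL⟩ := (χ.contDiff (n := 1)).continuous_fderiv one_ne_zero
    |>.bounded_above_of_compact_support (χ.hasCompactSupport.fderiv ℝ)
  exact ⟨L, (norm_nonneg _).trans (hL 0), hL⟩

lemma abs_bump_le_one {n : ℕ} (χ : ContDiffBump (0 : Euc n)) (x : Euc n) : |χ x| ≤ 1 := by
  rw [abs_of_nonneg χ.nonneg]
  exact χ.le_one

lemma tsupport_bump_smul_subset {n : ℕ} (χ : ContDiffBump (0 : Euc n)) (u : Euc n → Euc n) :
    tsupport (fun x => χ x • u x) ⊆ closedBall 0 χ.rOut := by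
  rw [← χ.tsupport_eq]
  exact closure_mono (Function.support_smul_subset_left (χ : Euc n → ℝ) u)

lemma differentiable_bump_smul {n : ℕ} (χ : ContDiffBump (0 : Euc n)) {u : Euc n → Euc n}
    (hu : ∀ x ∈ closedBall (0 : Euc n) χ.rOut, DifferentiableAt ℝ u x) :
    Differentiable ℝ fun x => χ x • u x := by
  intro x
  by_cases hx : x ∈ closedBall (0 : Euc n) χ.rOut
  · exact ((χ.contDiff (n := 1)).differentiable one_ne_zero x).smul (hu x hx)
  · have h0 : x ∉ tsupport fun x => χ x • u x := fun h => hx (tsupport_bump_smul_subset χ u h)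
    exact (differentiableAt_const (0 : Euc n)).congr_of_eventuallyEq
      (notMem_tsupport_iff_eventuallyEq.1 h0)

lemma Dmat_eq_zero_of_notMem {n : ℕ} {V : Euc n → Euc n} {K : Set (Euc n)}
    (hK : tsupport V ⊆ K) {x : Euc n} (hx : x ∉ K) : Dmat V x = 0 := by
  ext i j
  simp [Dmat, fderiv_eq_zero_of_notMem hK hx]

lemma lMat_eq_zero_of_Dmat_eq_zero {n : ℕ} {V : Euc n → Euc n} {x : Euc n} (h : Dmat V x = 0) :
    lMat V x = 0 := by
  simp [lMat, epsMat, h]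

lemma measurable_ofReal_matNorm_Dmat {n : ℕ} (v : Euc n → Euc n) :
    Measurable fun x => ENNReal.ofReal (matNorm (Dmat v x)) :=
  (measurable_matNorm (measurable_Dmat v)).ennreal_ofReal

lemma integrable_matNorm_rpow_iff {n : ℕ} {p : ℝ} (hp : 0 ≤ p) {μ : Measure (Euc n)}
    {M : Euc n → Matrix (Fin n) (Fin n) ℝ} (hM : ∀ i j, Measurable fun x => M x i j) :
    Integrable (fun x => matNorm (M x) ^ p) μ ↔
      ∫⁻ x, ENNReal.ofReal (matNorm (M x)) ^ p ∂μ ≠ ⊤ := by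
  simp only [ENNReal.ofReal_rpow_of_nonneg (matNorm_nonneg _) hp]
  exact (lintegral_ofReal_ne_top_iff_integrable
    ((measurable_matNorm hM).pow_const p).aestronglyMeasurable
    (Filter.Eventually.of_forall fun x => Real.rpow_nonneg (matNorm_nonneg _) _)).symm

lemma ofReal_integral_matNorm_rpow {n : ℕ} {p : ℝ} (hp : 0 ≤ p) {μ : Measure (Euc n)}
    {M : Euc n → Matrix (Fin n) (Fin n) ℝ} (h : Integrable (fun x => matNorm (M x) ^ p) μ) :
    ENNReal.ofReal (∫ x, matNorm (M x) ^ p ∂μ) =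
      ∫⁻ x, ENNReal.ofReal (matNorm (M x)) ^ p ∂μ := by
  rw [ofReal_integral_eq_lintegral_ofReal h
    (Filter.Eventually.of_forall fun x => Real.rpow_nonneg (matNorm_nonneg _) _)]
  simp only [ENNReal.ofReal_rpow_of_nonneg (matNorm_nonneg _) hp]

lemma exists_compactSupport_korn_lintegral {n : ℕ} (hn : 2 ≤ n) {p : ℝ} (hp1 : 1 < p) :
    ∃ C : ℝ≥0∞, C ≠ ⊤ ∧ ∀ V : Euc n → Euc n, Differentiable ℝ V →
      tsupport V ⊆ closedBall 0 (2 / 5) → ∫⁻ x, ENNReal.ofReal (matNorm (Dmat V x)) ^ p ≠ ⊤ →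
      ∫⁻ x, ENNReal.ofReal (matNorm (Dmat V x)) ^ p ≤
        C * ∫⁻ x, ENNReal.ofReal (matNorm (lMat V x)) ^ p := by
  obtain ⟨C, hC, h⟩ := exists_compactSupport_korn hn hp1
  have hp0 : 0 ≤ p := by linarith
  refine ⟨ENNReal.ofReal C, ENNReal.ofReal_ne_top, fun V hV hs hfin => ?_⟩
  have hInt := (integrable_matNorm_rpow_iff hp0 (measurable_Dmat V)).2 hfin
  have hint' : Integrable (fun x => matNorm (lMat V x) ^ p) := by
    refine (hInt.const_mul ((2 * n * n : ℝ) ^ p)).mono'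
      ((measurable_matNorm (measurable_lMat V)).pow_const p).aestronglyMeasurable
      (Filter.Eventually.of_forall fun x => ?_)
    rw [Real.norm_of_nonneg (Real.rpow_nonneg (matNorm_nonneg _) _),
      ← Real.mul_rpow (by positivity) (matNorm_nonneg _)]
    exact Real.rpow_le_rpow (matNorm_nonneg _) (matNorm_lMat_le V x) hp0
  rw [← ofReal_integral_matNorm_rpow hp0 hInt, ← ofReal_integral_matNorm_rpow hp0 hint',
    ← ENNReal.ofReal_mul hC]
  exact ENNReal.ofReal_le_ofReal (h V hV hs hInt)

lemma rpow_add_le_const_mul {p : ℝ} (hp : 1 ≤ p) (a b : ℝ≥0∞) :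
    (a + b) ^ p ≤ 2 ^ p * (a ^ p + b ^ p) := by
  refine (ENNReal.rpow_add_le_mul_rpow_add_rpow a b hp).trans ?_
  gcongr
  · norm_num
  · linarith

lemma two_rpow_ne_top (p : ℝ) : (2 : ℝ≥0∞) ^ p ≠ ⊤ := by
  simp

lemma setLIntegral_rpow_ne_top_of_continuousOn {n : ℕ} {p : ℝ} (hp : 0 ≤ p) {K : Set (Euc n)}
    (hK : IsCompact K) {f : Euc n → ℝ} (hf : ContinuousOn f K) :
    ∫⁻ x in K, ENNReal.ofReal (f x) ^ p ≠ ⊤ := by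
  obtain ⟨A, hA⟩ := hK.bddAbove_image hf
  refine ne_top_of_le_ne_top (b := ENNReal.ofReal A ^ p * volume K) (ENNReal.mul_ne_top
    (ENNReal.rpow_ne_top_of_nonneg hp ENNReal.ofReal_ne_top) hK.measure_lt_top.ne) ?_
  rw [← setLIntegral_const]
  refine setLIntegral_mono' hK.measurableSet fun x hx => ?_
  exact ENNReal.rpow_le_rpow (ENNReal.ofReal_le_ofReal (hA (mem_image_of_mem f hx))) hp

lemma lintegral_Dmat_bump_smul_ne_top {n : ℕ} {p : ℝ} (hp : 1 ≤ p) (χ : ContDiffBump (0 : Euc n))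
    {u : Euc n → Euc n} (hu : ∀ x ∈ closedBall (0 : Euc n) χ.rOut, DifferentiableAt ℝ u x)
    (hfin : ∫⁻ x in closedBall (0 : Euc n) χ.rOut, ENNReal.ofReal (matNorm (Dmat u x)) ^ p ≠ ⊤) :
    ∫⁻ x, ENNReal.ofReal (matNorm (Dmat (fun x => χ x • u x) x)) ^ p ≠ ⊤ := by
  obtain ⟨L, hL0, hL⟩ := exists_norm_fderiv_bump_le χ
  have hp0 : 0 < p := by linarith
  set B := closedBall (0 : Euc n) χ.rOut
  have hc : ContinuousOn (fun x => n * n * L * ‖u x‖) B := fun x hx =>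
    ((hu x hx).continuousAt.norm.const_mul _).continuousWithinAt
  have h2 := setLIntegral_rpow_ne_top_of_continuousOn hp0.le (isCompact_closedBall 0 χ.rOut) hc
  have hK : ENNReal.ofReal (n * n) ^ p ≠ ⊤ :=
    ENNReal.rpow_ne_top_of_nonneg hp0.le ENNReal.ofReal_ne_top
  rw [← setLIntegral_eq_of_support_subset (s := B)]
  · refine ne_top_of_le_ne_top (b := 2 ^ p * (ENNReal.ofReal (n * n) ^ p *
      ∫⁻ x in B, ENNReal.ofReal (matNorm (Dmat u x)) ^ p) +
      2 ^ p * ∫⁻ x in B, ENNReal.ofReal (n * n * L * ‖u x‖) ^ p) (ENNReal.add_ne_top.2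
        ⟨ENNReal.mul_ne_top (two_rpow_ne_top p) (ENNReal.mul_ne_top hK hfin),
          ENNReal.mul_ne_top (two_rpow_ne_top p) h2⟩) ?_
    rw [← lintegral_const_mul' _ _ hK, ← lintegral_const_mul' _ _ (two_rpow_ne_top p),
      ← lintegral_const_mul' _ _ (two_rpow_ne_top p), ← lintegral_add_left
      ((((measurable_ofReal_matNorm_Dmat u).pow_const p).const_mul _).const_mul _)]
    refine setLIntegral_mono' isClosed_closedBall.measurableSet fun x hx => ?_
    rw [← mul_add, ← ENNReal.mul_rpow_of_nonneg _ _ hp0.le]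
    refine le_trans (ENNReal.rpow_le_rpow ?_ hp0.le) (rpow_add_le_const_mul hp _ _)
    rw [← ENNReal.ofReal_mul (by positivity), ← ENNReal.ofReal_add
      (mul_nonneg (by positivity) (matNorm_nonneg _)) (by positivity)]
    refine ENNReal.ofReal_le_ofReal ((matNorm_Dmat_smul_le
      ((χ.contDiff (n := 1)).differentiable one_ne_zero x) (hu x hx) (abs_bump_le_one χ x)
      (hL x)).trans (le_of_eq (by ring)))
  · intro x hx
    by_contra h
    apply hx
    simp only
    rw [Dmat_eq_zero_of_notMem (tsupport_bump_smul_subset χ u) h, matNorm_zero]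
    simp [hp0]

lemma integrable_of_lintegral_rpow_ne_top {n : ℕ} {p : ℝ} (hp : 1 ≤ p) {V : Euc n → Euc n} {R : ℝ}
    (hs : tsupport V ⊆ closedBall 0 R)
    (hfin : ∫⁻ x, ENNReal.ofReal (matNorm (Dmat V x)) ^ p ≠ ⊤) (i j : Fin n) :
    Integrable fun x => Dmat V x i j := by
  refine ⟨(measurable_Dmat V i j).aestronglyMeasurable, ?_⟩
  rw [HasFiniteIntegral, ← setLIntegral_eq_of_support_subset (s := closedBall 0 R)]
  · calc ∫⁻ x in closedBall 0 R, ‖Dmat V x i j‖ₑ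
        ≤ ∫⁻ x in closedBall 0 R, (1 + ENNReal.ofReal (matNorm (Dmat V x)) ^ p) := by
          refine lintegral_mono fun x => ?_
          rw [← ofReal_norm, Real.norm_eq_abs]
          refine (ENNReal.ofReal_le_ofReal (abs_le_matNorm (Dmat V x) i j)).trans ?_
          rcases le_total (ENNReal.ofReal (matNorm (Dmat V x))) 1 with h | h
          · exact h.trans le_self_add
          · refine le_trans ?_ le_add_self
            exact (ENNReal.rpow_one _).symm.le.trans (ENNReal.rpow_le_rpow_of_exponent_le h hp)
      _ ≤ volume (closedBall (0 : Euc n) R) + ∫⁻ x, ENNReal.ofReal (matNorm (Dmat V x)) ^ p := by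
          rw [lintegral_add_left measurable_const, setLIntegral_const, one_mul]
          exact add_le_add le_rfl (setLIntegral_le_lintegral _ _)
      _ < ⊤ := ENNReal.add_lt_top.2 ⟨measure_closedBall_lt_top, hfin.lt_top⟩
  · intro x hx
    by_contra h
    apply hx
    simp [Dmat_eq_zero_of_notMem hs h]

lemma Dmat_congr {n : ℕ} {u v : Euc n → Euc n} {x : Euc n} (h : u =ᶠ[nhds x] v) :
    Dmat u x = Dmat v x := by
  ext i j
  simp [Dmat, h.fderiv_eq]

lemma lMat_congr {n : ℕ} {u v : Euc n → Euc n} {x : Euc n} (h : Dmat u x = Dmat v x) :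
    lMat u x = lMat v x := by
  simp [lMat, epsMat, h]

lemma bump_smul_eventuallyEq {n : ℕ} (χ : ContDiffBump (0 : Euc n)) (u : Euc n → Euc n) {x : Euc n}
    (hx : x ∈ ball (0 : Euc n) χ.rIn) : (fun y => χ y • u y) =ᶠ[nhds x] u := by
  filter_upwards [χ.eventuallyEq_one_of_mem_ball hx] with y hy
  simp [hy]

lemma IsConf.differentiable {n : ℕ} {w : Euc n → Euc n} (hw : IsConf w) : Differentiable ℝ w :=
  hw.contDiff.differentiable (by simp)

lemma IsConf.continuous_matNorm_Dmat {n : ℕ} {w : Euc n → Euc n} (hw : IsConf w) :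
    Continuous fun x => matNorm (Dmat w x) := by
  have h : ∀ i j, Continuous fun x => Dmat w x i j := fun i j =>
    (EuclideanSpace.proj (𝕜 := ℝ) i).continuous.comp
      ((hw.contDiff.continuous_fderiv (by simp)).clm_apply continuous_const)
  unfold matNorm
  exact (continuous_finsetSum _ fun i _ => continuous_finsetSum _ fun j _ => (h i j).pow 2).sqrt

/-- Local Korn inequality at unit scale. -/
lemma exists_isConf_unit_korn {n : ℕ} (hn : 3 ≤ n) {p : ℝ} (hp1 : 1 < p) :
    ∃ C : ℝ≥0∞, C ≠ ⊤ ∧ ∀ v : Euc n → Euc n, (∀ x ∈ ball (0 : Euc n) 4, DifferentiableAt ℝ v x) →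
      ∫⁻ x in ball (0 : Euc n) 4, ENNReal.ofReal (matNorm (Dmat v x)) ^ p ≠ ⊤ → ∀ δ : ℝ, 0 < δ →
      ∃ w, IsConf w ∧
        ∫⁻ x in ball (0 : Euc n) (1 / 5), ‖v x - w x‖ₑ ^ p ≤
          C * ∫⁻ x in ball (0 : Euc n) 4, devDensity v δ x ^ p ∧
        ∫⁻ x in ball (0 : Euc n) (1 / 5), ‖v x - w x‖ₑ ≤
          C * ∫⁻ x in ball (0 : Euc n) 4, devDensity v δ x ∧
        ∫⁻ x in ball (0 : Euc n) (1 / 5), ENNReal.ofReal (matNorm (Dmat v x - Dmat w x)) ^ p ≤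
          C * ∫⁻ x in ball (0 : Euc n) 4, devDensity v δ x ^ p := by
  obtain ⟨C, hC, hP⟩ := exists_isConf_setLIntegral_le hn
  obtain ⟨C1, hC1, hK⟩ := exists_compactSupport_korn_lintegral (by omega : 2 ≤ n) hp1
  have hp0 : 0 < p := by linarith
  have hn0 : (0 : ℝ) ≤ n := n.cast_nonneg
  let χ' : ContDiffBump (0 : Euc n) := ⟨2, 3, by norm_num, by norm_num⟩
  let χ : ContDiffBump (0 : Euc n) := ⟨1 / 5, 2 / 5, by norm_num, by norm_num⟩
  obtain ⟨L, hL0, hL⟩ := exists_norm_fderiv_bump_le χ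
  set A := ENNReal.ofReal (n * n * (1 + 2 * L))
  have hA : A ^ p ≠ ⊤ := ENNReal.rpow_ne_top_of_nonneg hp0.le ENNReal.ofReal_ne_top
  set D := C1 * (A ^ p * (2 ^ p * (1 + C p)))
  have hD : D ≠ ⊤ := ENNReal.mul_ne_top hC1 (ENNReal.mul_ne_top hA (ENNReal.mul_ne_top
    (two_rpow_ne_top p) (ENNReal.add_ne_top.2 ⟨by simp, hC p hp1.le⟩)))
  refine ⟨C p + C 1 + D, ENNReal.add_ne_top.2 ⟨ENNReal.add_ne_top.2 ⟨hC p hp1.le, hC 1 le_rfl⟩, hD⟩,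
    fun v hv hfin δ hδ => ?_⟩
  set v' : Euc n → Euc n := fun x => χ' x • v x
  have h34 : closedBall (0 : Euc n) 3 ⊆ ball 0 4 := closedBall_subset_ball (by norm_num)
  have hv' : Differentiable ℝ v' := differentiable_bump_smul χ' fun x hx => hv x (h34 hx)
  have hs' : tsupport v' ⊆ closedBall 0 3 := tsupport_bump_smul_subset χ' v
  have hfin' : ∫⁻ x, ENNReal.ofReal (matNorm (Dmat v' x)) ^ p ≠ ⊤ :=
    lintegral_Dmat_bump_smul_ne_top hp1.le χ' (fun x hx => hv x (h34 hx))
      (ne_top_of_le_ne_top hfin (lintegral_mono_set h34))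
  obtain ⟨w, hw, hwq⟩ := hP v' hv' (HasCompactSupport.of_support_subset_isCompact
    (isCompact_closedBall 0 3) (subset_tsupport _ |>.trans hs'))
    (integrable_of_lintegral_rpow_ne_top hp1.le hs' hfin') δ hδ
  have heq : ∀ x ∈ ball (0 : Euc n) 2, Dmat v' x = Dmat v x := fun x hx =>
    Dmat_congr (bump_smul_eventuallyEq χ' v hx)
  have hg : ∀ q : ℝ, ∫⁻ x in ball (0 : Euc n) 2, devDensity v' δ x ^ q ≤
      ∫⁻ x in ball (0 : Euc n) 4, devDensity v δ x ^ q := fun q => by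
    refine le_trans (le_of_eq ?_) (lintegral_mono_set (ball_subset_ball (by norm_num : (2 : ℝ) ≤ 4)))
    refine setLIntegral_congr_fun isOpen_ball.measurableSet fun x hx => ?_
    simp only [devDensity, lMat_congr (heq x hx)]
  have h51 : ball (0 : Euc n) (1 / 5) ⊆ closedBall 0 1 := fun x hx => by
    rw [mem_ball_zero_iff] at hx
    rw [mem_closedBall_zero_iff]
    linarith
  have hvq : ∀ q : ℝ, 1 ≤ q → ∫⁻ x in ball (0 : Euc n) (1 / 5), ‖v x - w x‖ₑ ^ q ≤
      C q * ∫⁻ x in ball (0 : Euc n) 4, devDensity v δ x ^ q := fun q hq => by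
    refine le_trans ?_ ((hwq q hq).trans (mul_le_mul' le_rfl (hg q)))
    refine le_trans (le_of_eq ?_) (lintegral_mono_set h51)
    refine setLIntegral_congr_fun isOpen_ball.measurableSet fun x hx => ?_
    have : x ∈ ball (0 : Euc n) 2 := by
      rw [mem_ball_zero_iff] at hx ⊢
      linarith
    simp only [(bump_smul_eventuallyEq χ' v this).self_of_nhds, v']
  refine ⟨w, hw, (hvq p hp1.le).trans ?_, ?_, ?_⟩
  · exact mul_le_mul' (le_add_right le_self_add) le_rfl
  · have := hvq 1 le_rfl
    simp only [ENNReal.rpow_one] at this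
    exact this.trans (mul_le_mul' (le_add_right le_add_self) le_rfl)
  set u : Euc n → Euc n := fun x => v' x - w x
  have hu : Differentiable ℝ u := hv'.sub hw.differentiable
  have hDu : ∀ x, Dmat u x = Dmat v' x - Dmat w x := fun x => Dmat_sub (hv' x) (hw.differentiable x)
  have hlu : ∀ x, lMat u x = lMat v' x := fun x => by
    rw [lMat_sub (hv' x) (hw.differentiable x), hw.lMat_eq, sub_zero]
  have hB25 : closedBall (0 : Euc n) (2 / 5) ⊆ closedBall 0 1 := closedBall_subset_closedBall (by norm_num)
  have hB2 : closedBall (0 : Euc n) (2 / 5) ⊆ ball 0 2 := closedBall_subset_ball (by norm_num)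
  have hfu : ∫⁻ x in closedBall (0 : Euc n) (2 / 5), ENNReal.ofReal (matNorm (Dmat u x)) ^ p ≠ ⊤ := by
    have h2 := setLIntegral_rpow_ne_top_of_continuousOn hp0.le
      (isCompact_closedBall (0 : Euc n) (2 / 5)) hw.continuous_matNorm_Dmat.continuousOn
    refine ne_top_of_le_ne_top (ENNReal.mul_ne_top (two_rpow_ne_top p)
      (ENNReal.add_ne_top.2 ⟨hfin', h2⟩)) ?_
    refine le_trans ?_ (mul_le_mul' le_rfl (add_le_add
      (setLIntegral_le_lintegral (closedBall (0 : Euc n) (2 / 5)) _) le_rfl))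
    rw [← lintegral_add_left ((measurable_ofReal_matNorm_Dmat v').pow_const p),
      ← lintegral_const_mul' _ _ (two_rpow_ne_top p)]
    refine lintegral_mono fun x => le_trans (ENNReal.rpow_le_rpow ?_ hp0.le)
      (rpow_add_le_const_mul hp1.le _ _)
    rw [← ENNReal.ofReal_add (matNorm_nonneg _) (matNorm_nonneg _), hDu]
    exact ENNReal.ofReal_le_ofReal (matNorm_sub_le _ _)
  have hVs := tsupport_bump_smul_subset χ u
  have hkorn := hK (fun x => χ x • u x) (differentiable_bump_smul χ fun x _ => hu x) hVs
    (lintegral_Dmat_bump_smul_ne_top hp1.le χ (fun x _ => hu x) hfu)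
  calc ∫⁻ x in ball (0 : Euc n) (1 / 5), ENNReal.ofReal (matNorm (Dmat v x - Dmat w x)) ^ p
      = ∫⁻ x in ball (0 : Euc n) (1 / 5),
          ENNReal.ofReal (matNorm (Dmat (fun x => χ x • u x) x)) ^ p := by
        refine setLIntegral_congr_fun isOpen_ball.measurableSet fun x hx => ?_
        have : x ∈ ball (0 : Euc n) 2 := by
          rw [mem_ball_zero_iff] at hx ⊢
          linarith
        simp only [Dmat_congr (bump_smul_eventuallyEq χ u hx), hDu, heq x this]
    _ ≤ ∫⁻ x, ENNReal.ofReal (matNorm (Dmat (fun x => χ x • u x) x)) ^ p :=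
        setLIntegral_le_lintegral _ _
    _ ≤ C1 * ∫⁻ x, ENNReal.ofReal (matNorm (lMat (fun x => χ x • u x) x)) ^ p := hkorn
    _ = C1 * ∫⁻ x in closedBall (0 : Euc n) (2 / 5),
          ENNReal.ofReal (matNorm (lMat (fun x => χ x • u x) x)) ^ p := by
        congr 1
        refine (setLIntegral_eq_of_support_subset ?_).symm
        intro x hx
        by_contra h
        apply hx
        simp only
        rw [lMat_eq_zero_of_Dmat_eq_zero (Dmat_eq_zero_of_notMem hVs h), matNorm_zero]
        simp [hp0]
    _ ≤ C1 * ∫⁻ x in closedBall (0 : Euc n) (2 / 5),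
          A ^ p * (2 ^ p * (devDensity v' δ x ^ p + ‖u x‖ₑ ^ p)) := by
        refine mul_le_mul' le_rfl (lintegral_mono fun x => ?_)
        refine le_trans ?_ (mul_le_mul' le_rfl (rpow_add_le_const_mul hp1.le _ _))
        rw [← ENNReal.mul_rpow_of_nonneg _ _ hp0.le]
        refine ENNReal.rpow_le_rpow ?_ hp0.le
        rw [devDensity, ← ofReal_norm, ← ENNReal.ofReal_add
          (by linarith [matNorm_nonneg (lMat v' x)]) (norm_nonneg _),
          ← ENNReal.ofReal_mul (by positivity)]
        refine ENNReal.ofReal_le_ofReal ((matNorm_lMat_smul_le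
          ((χ.contDiff (n := 1)).differentiable one_ne_zero x) (hu x) (abs_bump_le_one χ x)
          (hL x)).trans ?_)
        rw [hlu, mul_assoc (n * n : ℝ)]
        refine mul_le_mul_of_nonneg_left ?_ (by positivity)
        nlinarith [matNorm_nonneg (lMat v' x), norm_nonneg (u x),
          mul_nonneg hL0 (matNorm_nonneg (lMat v' x)), mul_nonneg hL0 hδ.le]
    _ = C1 * (A ^ p * (2 ^ p * ((∫⁻ x in closedBall (0 : Euc n) (2 / 5), devDensity v' δ x ^ p) +
          ∫⁻ x in closedBall (0 : Euc n) (2 / 5), ‖u x‖ₑ ^ p))) := by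
        rw [lintegral_const_mul' _ _ hA, lintegral_const_mul' _ _ (two_rpow_ne_top p),
          lintegral_add_left ((measurable_devDensity v' δ).pow_const p)]
    _ ≤ C1 * (A ^ p * (2 ^ p * ((∫⁻ x in ball (0 : Euc n) 4, devDensity v δ x ^ p) +
          C p * ∫⁻ x in ball (0 : Euc n) 4, devDensity v δ x ^ p))) := by
        refine mul_le_mul' le_rfl (mul_le_mul' le_rfl (mul_le_mul' le_rfl (add_le_add ?_ ?_)))
        · exact (lintegral_mono_set hB2).trans (hg p)
        · exact (lintegral_mono_set hB25).trans ((hwq p hp1.le).trans (mul_le_mul' le_rfl (hg p)))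
    _ = D * ∫⁻ x in ball (0 : Euc n) 4, devDensity v δ x ^ p := by
        simp only [D]
        ring
    _ ≤ _ := mul_le_mul' le_add_self le_rfl

/-- Local Korn inequality on balls of bounded radius. -/
lemma exists_isConf_ball_korn {n : ℕ} (hn : 3 ≤ n) {p : ℝ} (hp1 : 1 < p) (R : ℝ) :
    ∃ C : ℝ≥0∞, C ≠ ⊤ ∧ ∀ (v : Euc n → Euc n) (a : Euc n) (r : ℝ), 0 < r → r ≤ R →
      (∀ x ∈ ball a (20 * r), DifferentiableAt ℝ v x) →
      ∫⁻ x in ball a (20 * r), ENNReal.ofReal (matNorm (Dmat v x)) ^ p ≠ ⊤ → ∀ δ : ℝ, 0 < δ →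
      ∃ w, IsConf w ∧
        ∫⁻ x in ball a r, ‖v x - w x‖ₑ ^ p ≤
          C * ∫⁻ x in ball a (20 * r), devDensity v δ x ^ p ∧
        ∫⁻ x in ball a r, ENNReal.ofReal (matNorm (Dmat v x - Dmat w x)) ^ p ≤
          C * ∫⁻ x in ball a (20 * r), devDensity v δ x ^ p ∧
        ∫⁻ x in ball a r, ‖v x - w x‖ₑ ≤
          C * ENNReal.ofReal r * ∫⁻ x in ball a (20 * r), devDensity v δ x := by
  obtain ⟨C, hC, hU⟩ := exists_isConf_unit_korn hn hp1
  have hp0 : 0 < p := by linarith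
  set T := ENNReal.ofReal (5 * R) ^ p
  have hT : T ≠ ⊤ := ENNReal.rpow_ne_top_of_nonneg hp0.le ENNReal.ofReal_ne_top
  refine ⟨C * (T + 5) + C, ENNReal.add_ne_top.2 ⟨ENNReal.mul_ne_top hC (ENNReal.add_ne_top.2
    ⟨hT, by simp⟩), hC⟩, fun v a r hr hrR hv hfin δ hδ => ?_⟩
  set ρ := 5 * r with hρ
  have hρ0 : 0 < ρ := by positivity
  set c := ENNReal.ofReal (ρ ^ n)⁻¹
  have hc0 : c ≠ 0 := by
    simp only [c, ne_eq, ENNReal.ofReal_eq_zero, not_le]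
    positivity
  have hct : c ≠ ⊤ := ENNReal.ofReal_ne_top
  have hs : ∀ f : Euc n → ℝ≥0∞, ∫⁻ y in ball (0 : Euc n) (1 / 5), f (a + ρ • y) =
      c * ∫⁻ x in ball a r, f x := fun f => by
    rw [← setLIntegral_comp_affine f a hρ0, show r = ρ * (1 / 5) by rw [hρ]; ring,
      preimage_affine_ball a hρ0]
  have hb : ∀ f : Euc n → ℝ≥0∞, ∫⁻ y in ball (0 : Euc n) 4, f (a + ρ • y) =
      c * ∫⁻ x in ball a (20 * r), f x := fun f => by
    rw [← setLIntegral_comp_affine f a hρ0, show 20 * r = ρ * 4 by rw [hρ]; ring,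
      preimage_affine_ball a hρ0]
  have hmem : ∀ y ∈ ball (0 : Euc n) 4, a + ρ • y ∈ ball a (20 * r) := fun y hy => by
    rw [← preimage_affine_ball a hρ0, show ρ * 4 = 20 * r by rw [hρ]; ring] at hy
    exact hy
  set V : Euc n → Euc n := fun y => (1 : ℝ) • v (a + ρ • y)
  have hDV : ∀ y ∈ ball (0 : Euc n) 4, Dmat V y = ρ • Dmat v (a + ρ • y) := fun y hy => by
    rw [Dmat_comp_affine 1 ρ a y (hv _ (hmem y hy)), one_mul]
  have hlV : ∀ y ∈ ball (0 : Euc n) 4, devDensity V (ρ * δ) y =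
      ENNReal.ofReal ρ * devDensity v δ (a + ρ • y) := fun y hy => by
    rw [devDensity, lMat_comp_affine 1 ρ a y (hv _ (hmem y hy)), one_mul, matNorm_smul,
      abs_of_pos hρ0, ← mul_add, ENNReal.ofReal_mul hρ0.le, devDensity]
  have hVdiff : ∀ y ∈ ball (0 : Euc n) 4, DifferentiableAt ℝ V y := fun y hy =>
    ((hv _ (hmem y hy)).comp y (by fun_prop : DifferentiableAt ℝ (fun y : Euc n => a + ρ • y) y)).const_smul
      (1 : ℝ)
  have hρt : ENNReal.ofReal ρ ^ p ≠ ⊤ := ENNReal.rpow_ne_top_of_nonneg hp0.le ENNReal.ofReal_ne_top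
  have hVfin : ∫⁻ x in ball (0 : Euc n) 4, ENNReal.ofReal (matNorm (Dmat V x)) ^ p ≠ ⊤ := by
    have : ∫⁻ x in ball (0 : Euc n) 4, ENNReal.ofReal (matNorm (Dmat V x)) ^ p =
        ENNReal.ofReal ρ ^ p * (c * ∫⁻ x in ball a (20 * r),
          ENNReal.ofReal (matNorm (Dmat v x)) ^ p) := by
      rw [← hb (fun x => ENNReal.ofReal (matNorm (Dmat v x)) ^ p), ← lintegral_const_mul' _ _ hρt]
      refine setLIntegral_congr_fun isOpen_ball.measurableSet fun y hy => ?_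
      simp only [hDV y hy, matNorm_smul, abs_of_pos hρ0, ENNReal.ofReal_mul hρ0.le,
        ENNReal.mul_rpow_of_nonneg _ _ hp0.le]
    rw [this]
    exact ENNReal.mul_ne_top hρt (ENNReal.mul_ne_top hct hfin)
  obtain ⟨W, hW, h1, h2, h3⟩ := hU V hVdiff hVfin (ρ * δ) (by positivity)
  set w : Euc n → Euc n := fun x => (1 : ℝ) • W ((-ρ⁻¹) • a + ρ⁻¹ • x)
  have hw : IsConf w := hW.comp_affine 1 ρ⁻¹ _
  have hWw : W = fun y => (1 : ℝ) • w (a + ρ • y) := by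
    ext1 y
    simp only [w, one_smul]
    congr 1
    rw [smul_add, smul_smul, inv_mul_cancel₀ hρ0.ne']
    module
  have hDW : ∀ y, Dmat W y = ρ • Dmat w (a + ρ • y) := fun y => by
    rw [hWw, Dmat_comp_affine 1 ρ a y (hw.differentiable _), one_mul]
  have hI : ∀ q : ℝ, 0 ≤ q → ∫⁻ y in ball (0 : Euc n) 4, devDensity V (ρ * δ) y ^ q =
      ENNReal.ofReal ρ ^ q * (c * ∫⁻ x in ball a (20 * r), devDensity v δ x ^ q) := fun q hq => by
    rw [← hb (fun x => devDensity v δ x ^ q), ← lintegral_const_mul' _ _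
      (ENNReal.rpow_ne_top_of_nonneg hq ENNReal.ofReal_ne_top)]
    refine setLIntegral_congr_fun isOpen_ball.measurableSet fun y hy => ?_
    simp only [hlV y hy, ENNReal.mul_rpow_of_nonneg _ _ hq]
  have hN : ∀ q : ℝ, ∫⁻ y in ball (0 : Euc n) (1 / 5), ‖V y - W y‖ₑ ^ q =
      c * ∫⁻ x in ball a r, ‖v x - w x‖ₑ ^ q := fun q => by
    rw [← hs (fun x => ‖v x - w x‖ₑ ^ q)]
    simp only [hWw, V, one_smul]
  have hρT : ENNReal.ofReal ρ ^ p ≤ T :=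
    ENNReal.rpow_le_rpow (ENNReal.ofReal_le_ofReal (by rw [hρ]; linarith)) hp0.le
  refine ⟨w, hw, ?_, ?_, ?_⟩
  · rw [hN, hI p hp0.le, ← mul_assoc, mul_left_comm, ENNReal.mul_le_mul_iff_right hc0 hct] at h1
    refine h1.trans (mul_le_mul' ?_ le_rfl)
    exact (mul_le_mul' le_rfl (hρT.trans le_self_add)).trans le_self_add
  · have hL : ∫⁻ y in ball (0 : Euc n) (1 / 5), ENNReal.ofReal (matNorm (Dmat V y - Dmat W y)) ^ p =
        ENNReal.ofReal ρ ^ p * (c * ∫⁻ x in ball a r,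
          ENNReal.ofReal (matNorm (Dmat v x - Dmat w x)) ^ p) := by
      rw [← hs (fun x => ENNReal.ofReal (matNorm (Dmat v x - Dmat w x)) ^ p),
        ← lintegral_const_mul' _ _ hρt]
      refine setLIntegral_congr_fun isOpen_ball.measurableSet fun y hy => ?_
      have hy4 : y ∈ ball (0 : Euc n) 4 := ball_subset_ball (by norm_num) hy
      simp only [hDV y hy4, hDW, ← smul_sub, matNorm_smul, abs_of_pos hρ0,
        ENNReal.ofReal_mul hρ0.le, ENNReal.mul_rpow_of_nonneg _ _ hp0.le]
    have hρp : ENNReal.ofReal ρ ^ p ≠ 0 := by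
      rw [ne_eq, ENNReal.rpow_eq_zero_iff_of_pos hp0, ENNReal.ofReal_eq_zero, not_le]
      exact hρ0
    rw [hL, hI p hp0.le, mul_left_comm C,
      ENNReal.mul_le_mul_iff_right hρp hρt, mul_left_comm C,
      ENNReal.mul_le_mul_iff_right hc0 hct] at h3
    exact h3.trans (mul_le_mul' le_add_self le_rfl)
  · have hN1 := hN 1
    have hI1 := hI 1 zero_le_one
    simp only [ENNReal.rpow_one] at hN1 hI1
    rw [hN1, hI1, ← mul_assoc, mul_left_comm, ENNReal.mul_le_mul_iff_right hc0 hct, hρ,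
      ENNReal.ofReal_mul (by norm_num), ← mul_assoc C] at h2
    refine h2.trans (mul_le_mul' (mul_le_mul' ?_ le_rfl) le_rfl)
    simp only [ENNReal.ofReal_ofNat]
    exact (mul_le_mul' le_rfl le_add_self).trans le_self_add

lemma IsConf.continuous {n : ℕ} {w : Euc n → Euc n} (hw : IsConf w) : Continuous w :=
  hw.contDiff.continuous

/-- A field in the kernel is controlled on a large ball by its mean on a small one. -/
lemma exists_isConf_enorm_le (n : ℕ) {Λ : ℝ} (hΛ : 0 ≤ Λ) :
    ∃ C : ℝ≥0∞, C ≠ ⊤ ∧ ∀ q : Euc n → Euc n, IsConf q → ∀ (c : Euc n) (r : ℝ), 0 < r →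
      ∀ y ∈ closedBall c (Λ * r),
        ‖q y‖ₑ * ENNReal.ofReal (r ^ n) ≤ C * ∫⁻ x in ball c r, ‖q x‖ₑ := by
  set s : ℝ := 4 * (Λ + 1)
  have hs : 4 ≤ s := by simp only [s]; linarith
  set V0 := volume (ball (0 : Euc n) (1 / 2))
  have hV00 : V0 ≠ 0 := (measure_ball_pos volume _ (by norm_num)).ne'
  have hV0t : V0 ≠ ⊤ := measure_ball_lt_top.ne
  set A := ENNReal.ofReal (s ^ 2) * 2 ^ n
  refine ⟨V0⁻¹ * (3 * A), ENNReal.mul_ne_top (ENNReal.inv_ne_top.2 hV00)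
    (ENNReal.mul_ne_top (by simp) (ENNReal.mul_ne_top ENNReal.ofReal_ne_top (by simp))),
    fun q hq c r hr y hy => ?_⟩
  rw [mem_closedBall, dist_eq_norm] at hy
  have hpt : ∀ j : ℝ, 0 ≤ j → j ≤ 2 → ∀ z : Euc n,
      z + j • (s⁻¹ • (y - z)) = (j * s⁻¹) • y + (1 - j * s⁻¹) • z := fun j _ _ z => by module
  have hInt : ∀ j : ℝ, 0 ≤ j → j ≤ 2 →
      ∫⁻ z in ball c (r / 2), ‖q (z + j • (s⁻¹ • (y - z)))‖ₑ ≤ 2 ^ n * ∫⁻ x in ball c r, ‖q x‖ₑ := by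
    intro j hj0 hj2
    have hjs : j * s⁻¹ ≤ 1 / 2 := by
      rw [← div_eq_mul_inv, div_le_iff₀ (by linarith)]
      linarith
    have hjs0 : 0 ≤ j * s⁻¹ := mul_nonneg hj0 (by positivity)
    have hpos : 0 < 1 - j * s⁻¹ := by linarith
    simp only [hpt j hj0 hj2]
    have hsub : ball c (r / 2) ⊆ (fun z => (j * s⁻¹) • y + (1 - j * s⁻¹) • z) ⁻¹' ball c r := by
      intro z hz
      rw [mem_ball, dist_eq_norm] at hz
      rw [mem_preimage, mem_ball, dist_eq_norm]
      have hns : ‖s⁻¹ • (y - z)‖ ≤ r / 4 := by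
        rw [norm_smul, Real.norm_of_nonneg (by positivity), inv_mul_le_iff₀ (by linarith)]
        calc ‖y - z‖ ≤ ‖y - c‖ + ‖c - z‖ := norm_sub_le_norm_sub_add_norm_sub _ _ _
          _ ≤ Λ * r + r := add_le_add hy (by rw [norm_sub_rev]; linarith)
          _ = s * (r / 4) := by simp only [s]; ring
      rw [← hpt j hj0 hj2]
      calc ‖z + j • (s⁻¹ • (y - z)) - c‖ = ‖(z - c) + j • (s⁻¹ • (y - z))‖ := by congr 1; module
        _ ≤ ‖z - c‖ + ‖j • (s⁻¹ • (y - z))‖ := norm_add_le _ _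
        _ < r / 2 + 2 * (r / 4) := by
          refine add_lt_add_of_lt_of_le hz ?_
          rw [norm_smul, Real.norm_of_nonneg hj0]
          exact mul_le_mul hj2 hns (norm_nonneg _) (by norm_num)
        _ = r := by ring
    refine (lintegral_mono_set hsub).trans ?_
    rw [setLIntegral_comp_affine (fun x => ‖q x‖ₑ) _ hpos]
    refine mul_le_mul' ?_ le_rfl
    rw [show (2 : ℝ≥0∞) ^ n = ENNReal.ofReal (2 ^ n) by
      rw [ENNReal.ofReal_pow (by norm_num)]; simp]
    refine ENNReal.ofReal_le_ofReal ?_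
    rw [← inv_pow]
    refine pow_le_pow_left₀ (by positivity) ?_ n
    rw [inv_le_comm₀ hpos (by norm_num)]
    linarith
  have hlag : ∀ z, ‖q y‖ₑ ≤ ENNReal.ofReal (s ^ 2) * ‖q (z + (0 : ℝ) • (s⁻¹ • (y - z)))‖ₑ +
      ENNReal.ofReal (s ^ 2) * ‖q (z + (1 : ℝ) • (s⁻¹ • (y - z)))‖ₑ +
      ENNReal.ofReal (s ^ 2) * ‖q (z + (2 : ℝ) • (s⁻¹ • (y - z)))‖ₑ := by
    intro z
    have h := hq.lagrange z (s⁻¹ • (y - z)) s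
    have e : z + s • (s⁻¹ • (y - z)) = y := by
      rw [smul_smul, mul_inv_cancel₀ (by linarith), one_smul, add_sub_cancel]
    rw [e] at h
    simp only [zero_smul, add_zero, one_smul]
    simp only [← ofReal_norm]
    rw [← ENNReal.ofReal_mul (by positivity), ← ENNReal.ofReal_mul (by positivity),
      ← ENNReal.ofReal_mul (by positivity), ← ENNReal.ofReal_add (by positivity) (by positivity),
      ← ENNReal.ofReal_add (by positivity) (by positivity)]
    refine ENNReal.ofReal_le_ofReal ?_
    rw [h]
    refine (norm_add_le _ _).trans (add_le_add ((norm_sub_le _ _).trans (add_le_add ?_ ?_)) ?_)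
    all_goals
      rw [norm_smul, Real.norm_eq_abs]
      refine mul_le_mul_of_nonneg_right ?_ (norm_nonneg _)
      rw [abs_le]
      constructor <;> nlinarith
  have hcont : ∀ j : ℝ, Measurable fun z => ‖q (z + j • (s⁻¹ • (y - z)))‖ₑ := fun j =>
    (hq.continuous.comp (by fun_prop)).enorm.measurable
  have hvol : volume (ball c (r / 2)) = ENNReal.ofReal (r ^ n) * V0 := by
    rw [show r / 2 = r * (1 / 2) by ring, Measure.addHaar_ball_mul_of_pos _ _ hr,
      finrank_euclideanSpace_fin]
  have hS : ENNReal.ofReal (s ^ 2) ≠ ⊤ := ENNReal.ofReal_ne_top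
  have key : ‖q y‖ₑ * (ENNReal.ofReal (r ^ n) * V0) ≤ 3 * A * ∫⁻ x in ball c r, ‖q x‖ₑ := by
    calc ‖q y‖ₑ * (ENNReal.ofReal (r ^ n) * V0) = ∫⁻ _ in ball c (r / 2), ‖q y‖ₑ := by
          rw [setLIntegral_const, hvol]
      _ ≤ _ := lintegral_mono hlag
      _ = ENNReal.ofReal (s ^ 2) *
            (∫⁻ z in ball c (r / 2), ‖q (z + (0 : ℝ) • (s⁻¹ • (y - z)))‖ₑ) +
          ENNReal.ofReal (s ^ 2) *
            (∫⁻ z in ball c (r / 2), ‖q (z + (1 : ℝ) • (s⁻¹ • (y - z)))‖ₑ) +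
          ENNReal.ofReal (s ^ 2) *
            (∫⁻ z in ball c (r / 2), ‖q (z + (2 : ℝ) • (s⁻¹ • (y - z)))‖ₑ) := by
          have hm : Measurable fun z =>
              ENNReal.ofReal (s ^ 2) * ‖q (z + (0 : ℝ) • (s⁻¹ • (y - z)))‖ₑ +
              ENNReal.ofReal (s ^ 2) * ‖q (z + (1 : ℝ) • (s⁻¹ • (y - z)))‖ₑ :=
            ((hcont 0).const_mul _).add ((hcont 1).const_mul _)
          rw [lintegral_add_left hm,
            lintegral_add_left ((hcont 0).const_mul _), lintegral_const_mul' _ _ hS,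
            lintegral_const_mul' _ _ hS, lintegral_const_mul' _ _ hS]
      _ ≤ ENNReal.ofReal (s ^ 2) * (2 ^ n * ∫⁻ x in ball c r, ‖q x‖ₑ) +
          ENNReal.ofReal (s ^ 2) * (2 ^ n * ∫⁻ x in ball c r, ‖q x‖ₑ) +
          ENNReal.ofReal (s ^ 2) * (2 ^ n * ∫⁻ x in ball c r, ‖q x‖ₑ) :=
          add_le_add (add_le_add (mul_le_mul' le_rfl (hInt 0 le_rfl (by norm_num)))
            (mul_le_mul' le_rfl (hInt 1 (by norm_num) (by norm_num))))
            (mul_le_mul' le_rfl (hInt 2 (by norm_num) le_rfl))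
      _ = _ := by simp only [A]; ring
  calc ‖q y‖ₑ * ENNReal.ofReal (r ^ n) = V0⁻¹ * (‖q y‖ₑ * (ENNReal.ofReal (r ^ n) * V0)) := by
        rw [mul_left_comm, mul_comm (ENNReal.ofReal (r ^ n)), ← mul_assoc V0⁻¹,
          ENNReal.inv_mul_cancel hV00 hV0t, one_mul]
    _ ≤ V0⁻¹ * (3 * A * ∫⁻ x in ball c r, ‖q x‖ₑ) := mul_le_mul' le_rfl key
    _ = _ := by ring

lemma IsConf.fderiv_eq {n : ℕ} {w : Euc n → Euc n} (hw : IsConf w) (x h : Euc n) :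
    fderiv ℝ w x h = (-(3 / 2) : ℝ) • w x + (2 : ℝ) • w (x + h) - (1 / 2 : ℝ) • w (x + (2 : ℝ) • h) := by
  have h1 : HasDerivAt (fun s : ℝ => w (x + s • h)) (fderiv ℝ w x h) 0 := by
    have hl : HasDerivAt (fun s : ℝ => x + s • h) h 0 := by
      simpa using ((hasDerivAt_id (0 : ℝ)).smul_const h).const_add x
    have hd : HasFDerivAt w (fderiv ℝ w x) (x + (0 : ℝ) • h) := by
      simpa using (hw.differentiable x).hasFDerivAt
    exact hd.comp_hasDerivAt 0 hl
  have h2 : HasDerivAt (fun s : ℝ => ((s - 1) * (s - 2) / 2) • w x - (s * (s - 2)) • w (x + h) +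
      (s * (s - 1) / 2) • w (x + (2 : ℝ) • h))
      ((-(3 / 2) : ℝ) • w x - (-2 : ℝ) • w (x + h) + (-(1 / 2) : ℝ) • w (x + (2 : ℝ) • h)) 0 := by
    have i := hasDerivAt_id (0 : ℝ)
    refine ((HasDerivAt.smul_const ?_ _).sub (HasDerivAt.smul_const ?_ _)).add
      (HasDerivAt.smul_const ?_ _)
    · exact (((i.sub_const 1).mul (i.sub_const 2)).div_const 2).congr_deriv (by norm_num)
    · exact (i.mul (i.sub_const 2)).congr_deriv (by norm_num)
    · exact ((i.mul (i.sub_const 1)).div_const 2).congr_deriv (by norm_num)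
  have h3 : (fun s : ℝ => w (x + s • h)) = fun s : ℝ => ((s - 1) * (s - 2) / 2) • w x -
      (s * (s - 2)) • w (x + h) + (s * (s - 1) / 2) • w (x + (2 : ℝ) • h) :=
    funext fun s => hw.lagrange x h s
  rw [h3] at h1
  rw [h1.unique h2]
  module

lemma exists_isConf_jet_le (n : ℕ) {Λ : ℝ} (hΛ : 0 ≤ Λ) (R : ℝ) :
    ∃ C : ℝ≥0∞, C ≠ ⊤ ∧ ∀ q : Euc n → Euc n, IsConf q → ∀ (c : Euc n) (r : ℝ), 0 < r → r ≤ R →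
      ∀ y ∈ closedBall c (Λ * r),
        (‖q y‖ₑ + ENNReal.ofReal (matNorm (Dmat q y))) * ENNReal.ofReal (r ^ (n + 1)) ≤
          C * ∫⁻ x in ball c r, ‖q x‖ₑ := by
  obtain ⟨C, hC, h⟩ := exists_isConf_enorm_le n (by linarith : 0 ≤ Λ + 2)
  set A := ENNReal.ofReal (n * n)
  refine ⟨(ENNReal.ofReal R + A * 5) * C, ENNReal.mul_ne_top (ENNReal.add_ne_top.2
    ⟨ENNReal.ofReal_ne_top, ENNReal.mul_ne_top ENNReal.ofReal_ne_top (by simp)⟩) hC,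
    fun q hq c r hr hrR y hy => ?_⟩
  set I := ∫⁻ x in ball c r, ‖q x‖ₑ
  set ρ := ENNReal.ofReal (r ^ n)
  have hb : ∀ j : ℝ, 0 ≤ j → j ≤ 2 → ∀ k : Fin n,
      ‖q (y + j • (r • EuclideanSpace.single k (1 : ℝ)))‖ₑ * ρ ≤ C * I := fun j hj0 hj k => by
    refine h q hq c r hr _ ?_
    rw [mem_closedBall, dist_eq_norm] at hy ⊢
    calc ‖y + j • (r • EuclideanSpace.single k (1 : ℝ)) - c‖
        = ‖(y - c) + j • (r • EuclideanSpace.single k (1 : ℝ))‖ := by congr 1; module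
      _ ≤ ‖y - c‖ + ‖j • (r • EuclideanSpace.single k (1 : ℝ))‖ := norm_add_le _ _
      _ ≤ Λ * r + 2 * r := by
          refine add_le_add hy ?_
          rw [norm_smul, norm_smul, PiLp.norm_single, Real.norm_of_nonneg hj0,
            Real.norm_of_nonneg hr.le, norm_one, mul_one]
          exact mul_le_mul_of_nonneg_right hj hr.le
      _ = _ := by ring
  have h0 : ‖q y‖ₑ * ρ ≤ C * I := by
    refine h q hq c r hr _ (closedBall_subset_closedBall ?_ hy)
    nlinarith
  have hD : ∀ i k, ENNReal.ofReal |Dmat q y i k| * (ρ * ENNReal.ofReal r) ≤ 5 * (C * I) := by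
    intro i k
    set e := EuclideanSpace.single k (1 : ℝ)
    have hle : |Dmat q y i k| * r ≤ 2 * ‖q y‖ + 2 * ‖q (y + (1 : ℝ) • (r • e))‖ +
        1 * ‖q (y + (2 : ℝ) • (r • e))‖ := by
      have h1 : |Dmat q y i k| * r ≤ ‖fderiv ℝ q y (r • e)‖ := by
        rw [map_smul, norm_smul, Real.norm_of_nonneg hr.le, mul_comm]
        exact mul_le_mul_of_nonneg_left (PiLp.norm_apply_le (fderiv ℝ q y e) i) hr.le
      rw [hq.fderiv_eq] at h1
      simp only [one_smul]
      refine h1.trans ((norm_sub_le _ _).trans (add_le_add ((norm_add_le _ _).trans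
        (add_le_add ?_ ?_)) ?_))
      all_goals
        rw [norm_smul]
        refine mul_le_mul_of_nonneg_right ?_ (norm_nonneg _)
        norm_num
    calc ENNReal.ofReal |Dmat q y i k| * (ρ * ENNReal.ofReal r)
        = ENNReal.ofReal (|Dmat q y i k| * r) * ρ := by
          rw [ENNReal.ofReal_mul (abs_nonneg _)]; ring
      _ ≤ (2 * ‖q y‖ₑ + 2 * ‖q (y + (1 : ℝ) • (r • e))‖ₑ + 1 * ‖q (y + (2 : ℝ) • (r • e))‖ₑ) * ρ := by
          refine mul_le_mul' ((ENNReal.ofReal_le_ofReal hle).trans (le_of_eq ?_)) le_rfl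
          rw [ENNReal.ofReal_add (by positivity) (by positivity),
            ENNReal.ofReal_add (by positivity) (by positivity), ENNReal.ofReal_mul (by norm_num),
            ENNReal.ofReal_mul (by norm_num), ENNReal.ofReal_mul (by norm_num)]
          simp
      _ = 2 * (‖q y‖ₑ * ρ) + 2 * (‖q (y + (1 : ℝ) • (r • e))‖ₑ * ρ) +
            1 * (‖q (y + (2 : ℝ) • (r • e))‖ₑ * ρ) := by ring
      _ ≤ 2 * (C * I) + 2 * (C * I) + 1 * (C * I) :=
          add_le_add (add_le_add (mul_le_mul' le_rfl h0)
            (mul_le_mul' le_rfl (hb 1 (by norm_num) (by norm_num) k)))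
            (mul_le_mul' le_rfl (hb 2 (by norm_num) le_rfl k))
      _ = _ := by ring
  have hDn : ENNReal.ofReal (matNorm (Dmat q y)) * (ρ * ENNReal.ofReal r) ≤ A * 5 * (C * I) := by
    have hsum : ENNReal.ofReal (matNorm (Dmat q y)) ≤ ∑ i, ∑ k, ENNReal.ofReal |Dmat q y i k| := by
      refine (ENNReal.ofReal_le_ofReal (matNorm_le_sum _)).trans (le_of_eq ?_)
      refine (ENNReal.ofReal_sum_of_nonneg fun _ _ =>
        Finset.sum_nonneg fun _ _ => abs_nonneg _).trans ?_
      exact Finset.sum_congr rfl fun a _ => ENNReal.ofReal_sum_of_nonneg fun _ _ => abs_nonneg _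
    refine (mul_le_mul' hsum le_rfl).trans ?_
    rw [Finset.sum_mul]
    simp only [Finset.sum_mul]
    refine (Finset.sum_le_sum fun i _ => Finset.sum_le_sum fun k _ => hD i k).trans (le_of_eq ?_)
    simp only [Finset.sum_const, Finset.card_univ, Fintype.card_fin, nsmul_eq_mul, A]
    rw [ENNReal.ofReal_mul (by positivity), ENNReal.ofReal_natCast]
    ring
  calc (‖q y‖ₑ + ENNReal.ofReal (matNorm (Dmat q y))) * ENNReal.ofReal (r ^ (n + 1))
      = ENNReal.ofReal r * (‖q y‖ₑ * ρ) +
        ENNReal.ofReal (matNorm (Dmat q y)) * (ρ * ENNReal.ofReal r) := by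
        rw [pow_succ, ENNReal.ofReal_mul (by positivity)]
        ring
    _ ≤ ENNReal.ofReal R * (C * I) + A * 5 * (C * I) :=
        add_le_add (mul_le_mul' (ENNReal.ofReal_le_ofReal hrR) h0) hDn
    _ = _ := by ring

lemma infDist_frontier_le_infDist_compl {E : Type*} [NormedAddCommGroup E] [NormedSpace ℝ E]
    [FiniteDimensional ℝ E] {s : Set E} (hs : s ≠ univ) {x : E} (hx : x ∈ s) :
    infDist x (frontier s) ≤ infDist x sᶜ := by
  obtain ⟨y, hy, he⟩ := exists_mem_frontier_infDist_compl_eq_dist hx hs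
  exact he ▸ infDist_le_dist_of_mem hy

lemma infDist_compl_pos {α : Type*} [PseudoMetricSpace α] {s : Set α} (ho : IsOpen s)
    (hs : s ≠ univ) {x : α} (hx : x ∈ s) : 0 < infDist x sᶜ :=
  (ho.isClosed_compl.notMem_iff_infDist_pos (nonempty_compl.2 hs)).1 fun h => h hx

/-- A John domain can be traversed by chains whose steps grow geometrically and stay comparable
to the distance to the boundary. -/
lemma exists_john_chain {n : ℕ} {Ω : Set (Euc n)} (hΩo : IsOpen Ω) (hΩ : Ω ≠ univ)
    (hJ : IsJohnDomain Ω) :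
    ∃ x₀ ∈ Ω, ∃ c : ℝ, 1 ≤ c ∧ ∀ κ : ℝ, 0 < κ → ∀ x ∈ Ω, ∃ (M : ℕ) (z : ℕ → Euc n), z 0 = x ∧
      (∀ k ≤ M, z k ∈ Ω ∧ (1 + κ) ^ k * infDist x Ωᶜ ≤ c * infDist (z k) Ωᶜ ∧
        infDist (z k) Ωᶜ ≤ (1 + κ) ^ k * infDist x Ωᶜ ∧
        dist x (z k) ≤ (1 + κ) ^ k * infDist x Ωᶜ) ∧
      (∀ k < M, dist (z k) (z (k + 1)) ≤ κ * ((1 + κ) ^ k * infDist x Ωᶜ)) ∧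
      dist (z M) x₀ ≤ κ * ((1 + κ) ^ M * infDist x Ωᶜ) := by
  obtain ⟨C, hC, x₀, hx₀, hJ⟩ := hJ
  refine ⟨x₀, hx₀, 3 * C, by linarith, fun κ hκ x hx => ?_⟩
  obtain ⟨L, hL, γ, h0, h1, hmem, hlip, hd⟩ := hJ x hx
  set d := infDist x Ωᶜ
  have hd0 : 0 < d := infDist_compl_pos hΩo hΩ hx
  obtain ⟨M, hM1, hM2⟩ := exists_nat_pow_near (show 1 ≤ (L + d) / d by
    rw [le_div_iff₀ hd0]; linarith) (show (1 : ℝ) < 1 + κ by linarith)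
  rw [le_div_iff₀ hd0] at hM1
  rw [div_lt_iff₀ hd0] at hM2
  set t : ℕ → ℝ := fun k => (1 + κ) ^ k * d - d
  have ht : ∀ k ≤ M, t k ∈ Icc 0 L := fun k hk => by
    have h1 : 1 ≤ (1 + κ) ^ k := one_le_pow₀ (by linarith)
    have h2 : (1 + κ) ^ k ≤ (1 + κ) ^ M := pow_le_pow_right₀ (by linarith) hk
    constructor
    · simp only [t]; nlinarith
    · simp only [t]; nlinarith
  have hdist : ∀ a ∈ Icc 0 L, ∀ b ∈ Icc 0 L, a ≤ b → dist (γ a) (γ b) ≤ b - a :=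
    fun a ha b hb hab => (hlip a ha b hb).trans (by rw [abs_sub_comm, abs_of_nonneg (by linarith)])
  have h0L : (0 : ℝ) ∈ Icc 0 L := ⟨le_rfl, hL⟩
  refine ⟨M, fun k => γ (t k), by simp [t, h0], fun k hk => ?_, fun k hk => ?_, ?_⟩
  · have hxk : dist x (γ (t k)) ≤ t k := by
      have := hdist 0 h0L _ (ht k hk) (ht k hk).1
      rwa [h0, sub_zero] at this
    have e1 : d ≤ infDist (γ (t k)) Ωᶜ + dist x (γ (t k)) := infDist_le_infDist_add_dist
    have e2 : infDist (γ (t k)) Ωᶜ ≤ d + dist (γ (t k)) x := infDist_le_infDist_add_dist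
    have e3 := (hd _ (ht k hk)).trans (infDist_frontier_le_infDist_compl hΩ (hmem _ (ht k hk)))
    rw [div_le_iff₀ (by linarith)] at e3
    rw [dist_comm] at e2
    have hs : (1 + κ) ^ k * d = t k + d := by simp only [t]; ring
    refine ⟨hmem _ (ht k hk), ?_, by linarith, by linarith⟩
    rw [hs]
    rcases le_total (t k) (d / 2) with h | h
    · have : 0 ≤ infDist (γ (t k)) Ωᶜ := infDist_nonneg
      nlinarith
    · linarith
  · have := hdist _ (ht k hk.le) _ (ht (k + 1) hk) (by
      simp only [t]
      have : (1 + κ) ^ k ≤ (1 + κ) ^ (k + 1) := pow_le_pow_right₀ (by linarith) (by omega)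
      nlinarith)
    refine this.trans (le_of_eq ?_)
    simp only [t, pow_succ]
    ring
  · have := hdist _ (ht M le_rfl) L ⟨hL, le_rfl⟩ (ht M le_rfl).2
    rw [h1] at this
    refine this.trans ?_
    simp only [t]
    rw [pow_succ] at hM2
    nlinarith

/-- Distance between the first-order jets of two fields at a point. -/
def jetDist {n : ℕ} (v w : Euc n → Euc n) (y : Euc n) : ℝ≥0∞ :=
  ‖v y - w y‖ₑ + ENNReal.ofReal (matNorm (Dmat v y - Dmat w y))

lemma jetDist_self {n : ℕ} (v : Euc n → Euc n) (y : Euc n) : jetDist v v y = 0 := by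
  simp [jetDist, matNorm]

lemma jetDist_triangle {n : ℕ} (u v w : Euc n → Euc n) (y : Euc n) :
    jetDist u w y ≤ jetDist u v y + jetDist v w y := by
  have h1 : ‖u y - w y‖ₑ ≤ ‖u y - v y‖ₑ + ‖v y - w y‖ₑ := by
    rw [← sub_add_sub_cancel (u y) (v y)]
    exact enorm_add_le _ _
  have h2 : ENNReal.ofReal (matNorm (Dmat u y - Dmat w y)) ≤
      ENNReal.ofReal (matNorm (Dmat u y - Dmat v y)) +
        ENNReal.ofReal (matNorm (Dmat v y - Dmat w y)) := by
    rw [← ENNReal.ofReal_add (matNorm_nonneg _) (matNorm_nonneg _),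
      ← sub_add_sub_cancel (Dmat u y) (Dmat v y)]
    exact ENNReal.ofReal_le_ofReal (matNorm_add_le _ _)
  exact (add_le_add h1 h2).trans (le_of_eq (add_add_add_comm _ _ _ _))

lemma jetDist_le_sum {n : ℕ} (w : ℕ → Euc n → Euc n) (y : Euc n) (k : ℕ) :
    jetDist (w 0) (w k) y ≤ ∑ i ∈ Finset.range k, jetDist (w i) (w (i + 1)) y := by
  induction k with
  | zero => simp [jetDist_self]
  | succ k ih =>
    rw [Finset.sum_range_succ]
    exact (jetDist_triangle _ (w k) _ _).trans (add_le_add ih le_rfl)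

/-- Two fields of the kernel approximating the same field on overlapping balls are close. -/
lemma exists_jetDist_le (n : ℕ) {Λ μ : ℝ} (hΛ : 0 ≤ Λ) (R : ℝ) {C₀ : ℝ≥0∞} (hC₀ : C₀ ≠ ⊤) :
    ∃ C : ℝ≥0∞, C ≠ ⊤ ∧ ∀ (v w w' : Euc n → Euc n) (a b c : Euc n) (r r' ρ : ℝ) (I I' : ℝ≥0∞),
      IsConf w → IsConf w' → 0 < ρ → ρ ≤ R → r ≤ μ * ρ → r' ≤ μ * ρ →
      ContinuousOn v (ball c ρ) → ball c ρ ⊆ ball a r → ball c ρ ⊆ ball b r' →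
      ∫⁻ x in ball a r, ‖v x - w x‖ₑ ≤ C₀ * ENNReal.ofReal r * I →
      ∫⁻ x in ball b r', ‖v x - w' x‖ₑ ≤ C₀ * ENNReal.ofReal r' * I' →
      ∀ y ∈ closedBall c (Λ * ρ),
        jetDist w w' y ≤ C * ((ENNReal.ofReal (ρ ^ n))⁻¹ * (I + I')) := by
  obtain ⟨C, hC, h⟩ := exists_isConf_jet_le n hΛ R
  refine ⟨C * (C₀ * ENNReal.ofReal μ), ENNReal.mul_ne_top hC
    (ENNReal.mul_ne_top hC₀ ENNReal.ofReal_ne_top), ?_⟩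
  intro v w w' a b c r r' ρ I I' hw hw' hρ hρR hr hr' hv hs hs' h1 h2 y hy
  have hj := h _ (hw.sub hw') c ρ hρ hρR y hy
  rw [Dmat_sub (hw.differentiable y) (hw'.differentiable y)] at hj
  change jetDist w w' y * _ ≤ _ at hj
  have hm : AEMeasurable (fun x => ‖v x - w x‖ₑ) (volume.restrict (ball c ρ)) :=
    (hv.sub hw.continuous.continuousOn).enorm.aemeasurable measurableSet_ball
  have hd : ∫⁻ x in ball c ρ, ‖w x - w' x‖ₑ ≤
      C₀ * ENNReal.ofReal μ * ENNReal.ofReal ρ * (I + I') := by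
    have hμ : ∀ t, t ≤ μ * ρ → ENNReal.ofReal t ≤ ENNReal.ofReal μ * ENNReal.ofReal ρ :=
      fun t ht => (ENNReal.ofReal_le_ofReal ht).trans (le_of_eq (ENNReal.ofReal_mul' hρ.le))
    calc ∫⁻ x in ball c ρ, ‖w x - w' x‖ₑ
        ≤ ∫⁻ x in ball c ρ, (‖v x - w x‖ₑ + ‖v x - w' x‖ₑ) := by
          refine lintegral_mono fun x => ?_
          rw [show w x - w' x = (v x - w' x) - (v x - w x) by abel, add_comm]
          exact enorm_sub_le
      _ = (∫⁻ x in ball c ρ, ‖v x - w x‖ₑ) + ∫⁻ x in ball c ρ, ‖v x - w' x‖ₑ :=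
          lintegral_add_left' hm _
      _ ≤ C₀ * ENNReal.ofReal r * I + C₀ * ENNReal.ofReal r' * I' :=
          add_le_add ((lintegral_mono_set hs).trans h1) ((lintegral_mono_set hs').trans h2)
      _ ≤ C₀ * (ENNReal.ofReal μ * ENNReal.ofReal ρ) * I +
            C₀ * (ENNReal.ofReal μ * ENNReal.ofReal ρ) * I' :=
          add_le_add (mul_le_mul' (mul_le_mul' le_rfl (hμ _ hr)) le_rfl)
            (mul_le_mul' (mul_le_mul' le_rfl (hμ _ hr')) le_rfl)
      _ = _ := by ring
  have hρ1 : ENNReal.ofReal ρ ≠ 0 := by simpa using hρ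
  have hρn : ENNReal.ofReal (ρ ^ n) ≠ 0 := by simpa using pow_pos hρ n
  rw [pow_succ, ENNReal.ofReal_mul (by positivity)] at hj
  have hj2 : (jetDist w w' y * ENNReal.ofReal (ρ ^ n)) * ENNReal.ofReal ρ ≤
      (C * (C₀ * ENNReal.ofReal μ) * (I + I')) * ENNReal.ofReal ρ := by
    refine (le_of_eq (by ring)).trans (hj.trans ((mul_le_mul' le_rfl hd).trans (le_of_eq ?_)))
    ring
  rw [ENNReal.mul_le_mul_iff_left hρ1 ENNReal.ofReal_ne_top] at hj2
  rw [mul_left_comm, ← ENNReal.div_eq_inv_mul, ENNReal.le_div_iff_mul_le (Or.inl hρn)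
    (Or.inl ENNReal.ofReal_ne_top)]
  exact hj2

/-- A geometric sequence has boundedly many terms in an interval with bounded endpoint ratio. -/
lemma exists_card_geometric_le {κ : ℝ} (hκ : 0 < κ) (μ : ℝ) :
    ∃ N : ℕ, ∀ (s T : ℝ) (M : ℕ), 0 < s → 0 < T →
      ((Finset.range M).filter fun i => T ≤ (1 + κ) ^ i * s ∧ (1 + κ) ^ i * s ≤ μ * T).card ≤ N := by
  obtain ⟨N, hN⟩ := pow_unbounded_of_one_lt μ (show 1 < 1 + κ by linarith)
  refine ⟨N, fun s T M hs hT => ?_⟩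
  set F := (Finset.range M).filter fun i => T ≤ (1 + κ) ^ i * s ∧ (1 + κ) ^ i * s ≤ μ * T
  rcases F.eq_empty_or_nonempty with h | h
  · simp [h]
  set m := F.min' h
  have hm := (Finset.mem_filter.1 (F.min'_mem h)).2
  have hsub : F ⊆ Finset.Ico m (m + N) := fun i hi => by
    rw [Finset.mem_Ico]
    refine ⟨F.min'_le i hi, ?_⟩
    by_contra! hc
    have h1 := (Finset.mem_filter.1 hi).2.2
    have h2 : (1 + κ) ^ (m + N) ≤ (1 + κ) ^ i := pow_le_pow_right₀ (by linarith) hc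
    have h3 : μ * T < (1 + κ) ^ N * T := mul_lt_mul_of_pos_right hN hT
    have h4 : (1 + κ) ^ N * T ≤ (1 + κ) ^ N * ((1 + κ) ^ m * s) :=
      mul_le_mul_of_nonneg_left hm.1 (by positivity)
    have h5 : (1 + κ) ^ (m + N) * s ≤ (1 + κ) ^ i * s := mul_le_mul_of_nonneg_right h2 hs.le
    rw [pow_add] at h5
    nlinarith
  exact (Finset.card_le_card hsub).trans (by simp)

/-- Weighted average of `g` over the points `y` of `Ω` whose distance to the boundary is
comparable to or larger than the distance to `x`. -/
def whitneyAvg {n : ℕ} (Ω : Set (Euc n)) (Λ : ℝ) (g : Euc n → ℝ≥0∞) (x : Euc n) : ℝ≥0∞ :=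
  ∫⁻ y in Ω, {y | dist x y ≤ Λ * infDist y Ωᶜ}.indicator
    (fun y => g y * (ENNReal.ofReal (infDist y Ωᶜ ^ n))⁻¹) y

lemma exists_sum_chain_le (n : ℕ) {κ : ℝ} (hκ : 0 < κ) (μ : ℝ) :
    ∃ A : ℝ≥0∞, A ≠ ⊤ ∧ ∀ (Ω : Set (Euc n)) (Λ s : ℝ) (x : Euc n) (M : ℕ) (B : ℕ → Set (Euc n))
      (g : Euc n → ℝ≥0∞), Measurable g → MeasurableSet Ω → 0 < s →
      (∀ y ∈ Ω, 0 < infDist y Ωᶜ) →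
      (∀ i < M, MeasurableSet (B i) ∧ ∀ y ∈ B i, y ∈ Ω ∧ infDist y Ωᶜ ≤ 2 * ((1 + κ) ^ i * s) ∧
        (1 + κ) ^ i * s ≤ μ * infDist y Ωᶜ ∧ dist x y ≤ Λ * infDist y Ωᶜ) →
      ∑ i ∈ Finset.range M, (ENNReal.ofReal (((1 + κ) ^ i * s) ^ n))⁻¹ * ∫⁻ y in B i, g y ≤
        A * whitneyAvg Ω Λ g x := by
  obtain ⟨N, hN⟩ := exists_card_geometric_le hκ (2 * μ)
  refine ⟨N * 2 ^ n, ENNReal.mul_ne_top (by simp) (by simp), ?_⟩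
  intro Ω Λ s x M B g hg hΩ hs hd hB
  set a : ℕ → ℝ≥0∞ := fun i => (ENNReal.ofReal (((1 + κ) ^ i * s) ^ n))⁻¹
  have hat : ∀ i, a i ≠ ⊤ := fun i => by
    have : 0 < ((1 + κ) ^ i * s) ^ n := by positivity
    simpa [a] using this
  have hterm : ∀ i ∈ Finset.range M, a i * ∫⁻ y in B i, g y =
      ∫⁻ y in Ω, (B i).indicator (fun y => a i * g y) y := fun i hi => by
    obtain ⟨hm, hsub⟩ := hB i (Finset.mem_range.1 hi)
    rw [← lintegral_const_mul' _ _ (hat i), lintegral_indicator hm,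
      Measure.restrict_restrict hm, inter_eq_left.2 fun y hy => (hsub y hy).1]
  refine (le_of_eq (Finset.sum_congr rfl hterm)).trans ?_
  rw [← lintegral_finsetSum]
  swap
  · exact fun i hi => (hg.const_mul _).indicator (hB i (Finset.mem_range.1 hi)).1
  rw [whitneyAvg, ← lintegral_const_mul' _ _ (ENNReal.mul_ne_top (by simp) (by simp))]
  refine setLIntegral_mono' hΩ fun y hy => ?_
  have hdy := hd y hy
  set d := infDist y Ωᶜ
  by_cases hex : ∃ i < M, y ∈ B i
  swap
  · refine (le_of_eq (Finset.sum_eq_zero fun i hi => ?_)).trans bot_le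
    exact indicator_of_notMem (fun h => hex ⟨i, Finset.mem_range.1 hi, h⟩) _
  obtain ⟨i₀, hi₀, hy₀⟩ := hex
  rw [indicator_of_mem (show y ∈ {y | dist x y ≤ Λ * infDist y Ωᶜ} from
    ((hB i₀ hi₀).2 y hy₀).2.2.2)]
  set F := (Finset.range M).filter fun i => d / 2 ≤ (1 + κ) ^ i * s ∧
    (1 + κ) ^ i * s ≤ 2 * μ * (d / 2)
  have hle : ∀ i ∈ Finset.range M, (B i).indicator (fun y => a i * g y) y ≤
      if d / 2 ≤ (1 + κ) ^ i * s ∧ (1 + κ) ^ i * s ≤ 2 * μ * (d / 2) then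
        2 ^ n * (g y * (ENNReal.ofReal (d ^ n))⁻¹) else 0 := fun i hi => by
    by_cases hyi : y ∈ B i
    · obtain ⟨-, h1, h2, -⟩ := (hB i (Finset.mem_range.1 hi)).2 y hyi
      rw [indicator_of_mem hyi, if_pos ⟨by linarith, by linarith⟩]
      have h3 : a i ≤ 2 ^ n * (ENNReal.ofReal (d ^ n))⁻¹ := by
        have h2n : ENNReal.ofReal (2 ^ n) = 2 ^ n := by
          rw [ENNReal.ofReal_pow (by norm_num)]; simp
        have h4 : ENNReal.ofReal (d ^ n) ≤ 2 ^ n * ENNReal.ofReal (((1 + κ) ^ i * s) ^ n) := by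
          rw [← h2n, ← ENNReal.ofReal_mul (by positivity), ← mul_pow]
          exact ENNReal.ofReal_le_ofReal (pow_le_pow_left₀ hdy.le h1 n)
        have h5 := ENNReal.inv_le_inv.2 h4
        rw [ENNReal.mul_inv (Or.inl (by simp)) (Or.inl (by simp))] at h5
        calc a i = 2 ^ n * ((2 ^ n)⁻¹ * a i) := by
              rw [← mul_assoc, ENNReal.mul_inv_cancel (by simp) (by simp), one_mul]
          _ ≤ _ := mul_le_mul' le_rfl h5
      calc a i * g y ≤ 2 ^ n * (ENNReal.ofReal (d ^ n))⁻¹ * g y := mul_le_mul' h3 le_rfl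
        _ = _ := by ring
    · rw [indicator_of_notMem hyi]
      exact bot_le
  refine (Finset.sum_le_sum hle).trans ?_
  rw [← Finset.sum_filter, Finset.sum_const, nsmul_eq_mul, mul_assoc (N : ℝ≥0∞)]
  exact mul_le_mul' (by exact_mod_cast hN s (d / 2) M hs (by positivity)) le_rfl

lemma exists_infDist_compl_le {n : ℕ} {Ω : Set (Euc n)} (hΩ : Ω ≠ univ)
    (hΩb : Bornology.IsBounded Ω) (x₀ : Euc n) :
    ∃ D : ℝ, 0 < D ∧ ∀ x ∈ Ω, infDist x Ωᶜ ≤ D ∧ dist x x₀ ≤ D := by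
  obtain ⟨b, hb⟩ := nonempty_compl.2 hΩ
  obtain ⟨D₁, h₁⟩ := hΩb.subset_closedBall b
  obtain ⟨D₂, h₂⟩ := hΩb.subset_closedBall x₀
  refine ⟨max 1 (max D₁ D₂), by positivity, fun x hx => ⟨?_, ?_⟩⟩
  · exact ((infDist_le_dist_of_mem hb).trans (h₁ hx)).trans
      ((le_max_left _ _).trans (le_max_right _ _))
  · exact (mem_closedBall.1 (h₂ hx)).trans ((le_max_right _ _).trans (le_max_right _ _))

/-- On a John domain the local approximations of a field by elements of the kernel are comparable
to a single global one. -/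
lemma exists_isConf_john_jetDist_le {n : ℕ} (hn : 3 ≤ n) {p : ℝ} (hp1 : 1 < p) {Ω : Set (Euc n)}
    (hΩo : IsOpen Ω) (hΩ : Ω ≠ univ) (hΩb : Bornology.IsBounded Ω) (hJ : IsJohnDomain Ω) :
    ∃ K Λ : ℝ, 40 ≤ K ∧ 0 < Λ ∧ ∃ C : ℝ≥0∞, C ≠ ⊤ ∧ ∀ v : Euc n → Euc n,
      (∀ x ∈ Ω, DifferentiableAt ℝ v x) →
      ∫⁻ x in Ω, ENNReal.ofReal (matNorm (Dmat v x)) ^ p ≠ ⊤ → ∀ δ : ℝ, 0 < δ →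
      ∃ w', IsConf w' ∧ ∀ x ∈ Ω, ∃ w, IsConf w ∧
        ∫⁻ y in ball x (infDist x Ωᶜ / K), ‖v y - w y‖ₑ ^ p ≤
          C * ∫⁻ y in ball x (20 * (infDist x Ωᶜ / K)), devDensity v δ y ^ p ∧
        ∫⁻ y in ball x (infDist x Ωᶜ / K), ENNReal.ofReal (matNorm (Dmat v y - Dmat w y)) ^ p ≤
          C * ∫⁻ y in ball x (20 * (infDist x Ωᶜ / K)), devDensity v δ y ^ p ∧
        ∀ y ∈ ball x (infDist x Ωᶜ / K), jetDist w w' y ≤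
          C * (whitneyAvg Ω Λ (devDensity v δ) x + ∫⁻ y in Ω, devDensity v δ y) := by
  obtain ⟨x₀, hx₀, c, hc, hchain⟩ := exists_john_chain hΩo hΩ hJ
  obtain ⟨D, hD, hDΩ⟩ := exists_infDist_compl_le hΩ hΩb x₀
  have hdpos : ∀ y ∈ Ω, 0 < infDist y Ωᶜ := fun y hy => infDist_compl_pos hΩo hΩ hy
  set K := 40 * c with hK
  have hK40 : 40 ≤ K := by linarith
  have hK0 : 0 < K := by linarith
  set κ := 1 / (2 * K) with hκdef
  have hκ : 0 < κ := by positivity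
  have hκ1 : κ ≤ 1 := by
    rw [hκdef, div_le_one (by positivity)]
    linarith
  have hκK : ∀ t : ℝ, κ * t = t / K / 2 := fun t => by
    rw [hκdef]
    field_simp
  set ρ₀ := infDist x₀ Ωᶜ / (4 * K) with hρdef
  have hρ₀ : 0 < ρ₀ := div_pos (hdpos x₀ hx₀) (by positivity)
  have hρd : infDist x₀ Ωᶜ = 4 * K * ρ₀ := by
    rw [hρdef]
    field_simp
  have hDc : D ≤ c * D := le_mul_of_one_le_left hD.le hc
  have hρR : ρ₀ ≤ c * D := by
    have := (hDΩ x₀ hx₀).1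
    nlinarith
  obtain ⟨C₀, hC₀, hfit⟩ := exists_isConf_ball_korn hn hp1 (c * D)
  obtain ⟨C₁, hC₁, hlink⟩ := exists_jetDist_le n (Λ := 6 * K) (μ := 4) (by positivity) (c * D) hC₀
  obtain ⟨C₂, hC₂, hend⟩ :=
    exists_jetDist_le n (Λ := D / ρ₀) (μ := 8 * c) (by positivity) (c * D) hC₀
  obtain ⟨A, hA, hsum⟩ := exists_sum_chain_le n hκ (2 * c)
  set E := ENNReal.ofReal ((2 * K) ^ n)
  have hE : E ≠ ⊤ := ENNReal.ofReal_ne_top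
  set Z := (ENNReal.ofReal (ρ₀ ^ n))⁻¹
  have hZ : Z ≠ ⊤ := by
    have : 0 < ρ₀ ^ n := by positivity
    simpa [Z] using this
  set C₃ := C₁ * E * (1 + 2 ^ n) * A
  have hC₃ : C₃ ≠ ⊤ := ENNReal.mul_ne_top (ENNReal.mul_ne_top (ENNReal.mul_ne_top hC₁ hE)
    (ENNReal.add_ne_top.2 ⟨by simp, by simp⟩)) hA
  set C₄ := C₂ * Z * 2
  have hC₄ : C₄ ≠ ⊤ := ENNReal.mul_ne_top (ENNReal.mul_ne_top hC₂ hZ) (by simp)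
  refine ⟨K, 3 * c, hK40, by linarith, C₀ + (C₃ + C₄), ENNReal.add_ne_top.2
    ⟨hC₀, ENNReal.add_ne_top.2 ⟨hC₃, hC₄⟩⟩, fun v hv hfin δ hδ => ?_⟩
  set g := devDensity v δ
  set G := ∫⁻ y in Ω, g y
  have hballΩ : ∀ (a : Euc n) (r : ℝ), r ≤ infDist a Ωᶜ → ball a r ⊆ Ω := fun a r hr =>
    (ball_subset_ball hr).trans ball_infDist_compl_subset
  have hcont : ContinuousOn v Ω := fun x hx => (hv x hx).continuousAt.continuousWithinAt
  have hfit' : ∀ (a : Euc n) (r : ℝ), 0 < r → r ≤ c * D → 20 * r ≤ infDist a Ωᶜ →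
      ∃ w, IsConf w ∧
        ∫⁻ x in ball a r, ‖v x - w x‖ₑ ^ p ≤ C₀ * ∫⁻ x in ball a (20 * r), g x ^ p ∧
        ∫⁻ x in ball a r, ENNReal.ofReal (matNorm (Dmat v x - Dmat w x)) ^ p ≤
          C₀ * ∫⁻ x in ball a (20 * r), g x ^ p ∧
        ∫⁻ x in ball a r, ‖v x - w x‖ₑ ≤
          C₀ * ENNReal.ofReal r * ∫⁻ x in ball a (20 * r), g x := fun a r hr hrR hra =>
    hfit v a r hr hrR (fun x hx => hv x (hballΩ _ _ hra hx))
      (ne_top_of_le_ne_top hfin (lintegral_mono_set (hballΩ _ _ hra))) δ hδ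
  obtain ⟨w', hw', -, -, hw'3⟩ := hfit' x₀ ρ₀ hρ₀ hρR (by rw [hρd]; nlinarith)
  refine ⟨w', hw', fun x hx => ?_⟩
  obtain ⟨M, z, hz0, hz, hstep, hlast⟩ := hchain κ hκ x hx
  set s : ℕ → ℝ := fun k => (1 + κ) ^ k * infDist x Ωᶜ
  have hs0 : ∀ k, 0 < s k := fun k => mul_pos (by positivity) (hdpos x hx)
  have hs2 : ∀ k, s (k + 1) = (1 + κ) * s k := fun k => by
    simp only [s, pow_succ]
    ring
  have hsle : ∀ k, s (k + 1) ≤ 2 * s k := fun k => by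
    rw [hs2]
    exact mul_le_mul_of_nonneg_right (by linarith) (hs0 k).le
  have hsge : ∀ k, s k ≤ s (k + 1) := fun k => by
    rw [hs2]
    exact le_mul_of_one_le_left (hs0 k).le (by linarith)
  set r : ℕ → ℝ := fun k => s k / K
  have hr0 : ∀ k, 0 < r k := fun k => div_pos (hs0 k) hK0
  have hsr : ∀ k, s k = K * r k := fun k => by
    simp only [r]
    field_simp
  have hrs : ∀ k, r k ≤ s k := fun k => by
    have := hr0 k
    rw [hsr]
    nlinarith
  have h20 : ∀ k, 20 * r k = s k / (2 * c) := fun k => by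
    have : c ≠ 0 := by positivity
    rw [hsr, hK]
    field_simp
    ring
  have h20' : ∀ k ≤ M, 20 * r k ≤ infDist (z k) Ωᶜ / 2 := fun k hk => by
    rw [h20, div_le_iff₀ (by positivity)]
    linarith [(hz k hk).2.1]
  have h20d : ∀ k ≤ M, 20 * r k ≤ infDist (z k) Ωᶜ := fun k hk => by
    have : 0 ≤ infDist (z k) Ωᶜ := infDist_nonneg
    linarith [h20' k hk]
  have hrR : ∀ k ≤ M, r k ≤ c * D := fun k hk => (hrs k).trans ((hz k hk).2.1.trans
    (mul_le_mul_of_nonneg_left (hDΩ _ (hz k hk).1).1 (by linarith)))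
  choose! w hw hw1 hw2 hw3 using fun k (hk : k ≤ M) =>
    hfit' (z k) (r k) (hr0 k) (hrR k hk) (h20d k hk)
  set I : ℕ → ℝ≥0∞ := fun k => ∫⁻ y in ball (z k) (20 * r k), g y
  have hr00 : r 0 = infDist x Ωᶜ / K := by simp [r, s]
  refine ⟨w 0, hw 0 bot_le, ?_, ?_, fun y hy => ?_⟩
  · rw [← hr00, ← hz0]
    exact (hw1 0 bot_le).trans (mul_le_mul' le_self_add le_rfl)
  · rw [← hr00, ← hz0]
    exact (hw2 0 bot_le).trans (mul_le_mul' le_self_add le_rfl)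
  rw [← hr00, mem_ball] at hy
  have hrk : ∀ k, r 0 ≤ s k := fun k => by
    refine (hrs 0).trans ?_
    exact monotone_nat_of_le_succ hsge (Nat.zero_le k)
  set b : ℕ → ℝ≥0∞ := fun k => (ENNReal.ofReal (s k ^ n))⁻¹
  have hb2 : ∀ k, b k ≤ 2 ^ n * b (k + 1) := fun k => by
    have h2n : ENNReal.ofReal (2 ^ n) = 2 ^ n := by
      rw [ENNReal.ofReal_pow (by norm_num)]; simp
    have h4 : ENNReal.ofReal (s (k + 1) ^ n) ≤ 2 ^ n * ENNReal.ofReal (s k ^ n) := by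
      rw [← h2n, ← ENNReal.ofReal_mul (by positivity), ← mul_pow]
      exact ENNReal.ofReal_le_ofReal (pow_le_pow_left₀ (hs0 _).le (hsle k) n)
    have h5 := ENNReal.inv_le_inv.2 h4
    rw [ENNReal.mul_inv (Or.inl (by simp)) (Or.inl (by simp))] at h5
    calc b k = 2 ^ n * ((2 ^ n)⁻¹ * b k) := by
          rw [← mul_assoc, ENNReal.mul_inv_cancel (by simp) (by simp), one_mul]
      _ ≤ _ := mul_le_mul' le_rfl h5
  have hrb : ∀ k, (ENNReal.ofReal ((r k / 2) ^ n))⁻¹ = E * b k := fun k => by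
    have hE0 : E ≠ 0 := by
      have : 0 < (2 * K) ^ n := by positivity
      simpa [E] using this
    simp only [b]
    rw [hsr k, show K * r k = 2 * K * (r k / 2) by ring, mul_pow, ENNReal.ofReal_mul (by positivity),
      ENNReal.mul_inv (Or.inl hE0) (Or.inl hE), ← mul_assoc, ENNReal.mul_inv_cancel hE0 hE, one_mul]
  have hstep' : ∀ k < M, jetDist (w k) (w (k + 1)) y ≤
      C₁ * E * (b k * I k + 2 ^ n * (b (k + 1) * I (k + 1))) := fun k hk => by
    have hd := hstep k hk
    rw [hκK] at hd
    change dist (z k) (z (k + 1)) ≤ r k / 2 at hd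
    have hsub : ball (z (k + 1)) (r k / 2) ⊆ ball (z k) (r k) :=
      ball_subset_ball' (by rw [dist_comm]; linarith)
    have hrr : r k ≤ r (k + 1) := div_le_div_of_nonneg_right (hsge k) hK0.le
    have hrr2 : r (k + 1) ≤ 2 * r k := by
      simp only [r]
      rw [← mul_div_assoc]
      exact div_le_div_of_nonneg_right (hsle k) hK0.le
    have hr0k := hr0 k
    refine (hlink v (w k) (w (k + 1)) (z k) (z (k + 1)) (z (k + 1)) (r k) (r (k + 1)) (r k / 2)
      (I k) (I (k + 1)) (hw k hk.le) (hw (k + 1) hk) (by linarith) ?_ (by linarith) (by linarith)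
      (hcont.mono (hsub.trans (hballΩ _ _ ?_))) hsub (ball_subset_ball (by linarith))
      (hw3 k hk.le) (hw3 (k + 1) hk) y ?_).trans ?_
    · linarith [hrR k hk.le]
    · linarith [h20d k hk.le]
    · rw [mem_closedBall]
      have h1 := (hz (k + 1) hk).2.2.2
      change dist x (z (k + 1)) ≤ s (k + 1) at h1
      have h2 := dist_triangle y x (z (k + 1))
      rw [hz0] at *
      have h3 := hrk k
      have h4 := hsle k
      have h5 := hsr k
      nlinarith
    · rw [hrb]
      calc C₁ * (E * b k * (I k + I (k + 1))) = C₁ * E * (b k * I k + b k * I (k + 1)) := by ring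
        _ ≤ C₁ * E * (b k * I k + 2 ^ n * b (k + 1) * I (k + 1)) :=
          mul_le_mul' le_rfl (add_le_add le_rfl (mul_le_mul' (hb2 k) le_rfl))
        _ = _ := by ring
  have hIG : ∀ k ≤ M, I k ≤ G := fun k hk => lintegral_mono_set (hballΩ _ _ (h20d k hk))
  have hendM : jetDist (w M) w' y ≤ C₄ * G := by
    have hd := hlast
    rw [hκK] at hd
    change dist (z M) x₀ ≤ r M / 2 at hd
    have e1 : infDist x₀ Ωᶜ ≤ infDist (z M) Ωᶜ + dist x₀ (z M) := infDist_le_infDist_add_dist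
    have e2 : infDist (z M) Ωᶜ ≤ infDist x₀ Ωᶜ + dist (z M) x₀ := infDist_le_infDist_add_dist
    obtain ⟨-, f1, f2, -⟩ := hz M le_rfl
    change s M ≤ _ at f1
    change _ ≤ s M at f2
    have hr0M := hr0 M
    have hsrM := hsr M
    rw [dist_comm] at e1
    have g1 : ρ₀ ≤ r M / 2 := by
      rw [hρd] at e1
      nlinarith
    have g2 : r M ≤ 8 * c * ρ₀ := by
      rw [hρd] at e2
      have : s M ≤ c * (4 * K * ρ₀ + r M / 2) := f1.trans
        (mul_le_mul_of_nonneg_left (by linarith) (by linarith))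
      have h7 : c * r M = K * r M / 40 := by rw [hK]; ring
      have h8 : K * r M ≤ K * (8 * c * ρ₀) := by nlinarith
      exact le_of_mul_le_mul_left h8 hK0
    have hsub : ball x₀ ρ₀ ⊆ ball (z M) (r M) :=
      ball_subset_ball' (by rw [dist_comm]; linarith)
    refine (hend v (w M) w' (z M) x₀ x₀ (r M) ρ₀ ρ₀ (I M) _ (hw M le_rfl) hw' hρ₀ hρR g2 ?_
      (hcont.mono (hballΩ _ _ ?_)) hsub Subset.rfl (hw3 M le_rfl) hw'3 y ?_).trans ?_
    · nlinarith
    · rw [hρd]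
      nlinarith
    · rw [mem_closedBall, div_mul_cancel₀ _ hρ₀.ne']
      refine (hDΩ y (hballΩ (z 0) (r 0) ?_ ?_)).2
      · linarith [h20d 0 bot_le, hr0 0]
      · rw [hz0]
        exact hy
    · calc C₂ * (Z * (I M + ∫⁻ x in ball x₀ (20 * ρ₀), g x)) ≤ C₂ * (Z * (G + G)) := by
            refine mul_le_mul' le_rfl (mul_le_mul' le_rfl (add_le_add (hIG M le_rfl)
              (lintegral_mono_set (hballΩ _ _ ?_))))
            rw [hρd]
            nlinarith
        _ = _ := by simp only [C₄]; ring
  have hSavg : ∑ i ∈ Finset.range (M + 1), b i * I i ≤ A * whitneyAvg Ω (3 * c) g x := by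
    refine hsum Ω (3 * c) (infDist x Ωᶜ) x (M + 1) (fun i => ball (z i) (20 * r i)) g
      (measurable_devDensity v δ) hΩo.measurableSet (hdpos x hx) hdpos fun i hi => ?_
    have hiM : i ≤ M := by omega
    refine ⟨measurableSet_ball, fun y hy => ?_⟩
    obtain ⟨-, f1, f2, f3⟩ := hz i hiM
    change s i ≤ _ at f1
    change _ ≤ s i at f2
    change _ ≤ s i at f3
    change _ ∧ _ ≤ 2 * s i ∧ s i ≤ _ ∧ _
    rw [mem_ball] at hy
    have e1 : infDist y Ωᶜ ≤ infDist (z i) Ωᶜ + dist y (z i) := infDist_le_infDist_add_dist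
    have e2 : infDist (z i) Ωᶜ ≤ infDist y Ωᶜ + dist (z i) y := infDist_le_infDist_add_dist
    rw [dist_comm] at e2
    have e3 := h20' i hiM
    have e4 : s i ≤ 2 * c * infDist y Ωᶜ := by nlinarith
    have e5 := dist_triangle x (z i) y
    rw [dist_comm (z i) y] at e5
    exact ⟨hballΩ _ _ (h20d i hiM) hy, by linarith, e4, by linarith⟩
  calc jetDist (w 0) w' y ≤ jetDist (w 0) (w M) y + jetDist (w M) w' y := jetDist_triangle _ _ _ _
    _ ≤ (∑ i ∈ Finset.range M, C₁ * E * (b i * I i + 2 ^ n * (b (i + 1) * I (i + 1)))) + C₄ * G :=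
        add_le_add ((jetDist_le_sum w y M).trans (Finset.sum_le_sum fun i hi =>
          hstep' i (Finset.mem_range.1 hi))) hendM
    _ = C₁ * E * ((∑ i ∈ Finset.range M, b i * I i) +
          2 ^ n * ∑ i ∈ Finset.range M, b (i + 1) * I (i + 1)) + C₄ * G := by
        rw [← Finset.mul_sum, Finset.sum_add_distrib, ← Finset.mul_sum]
    _ ≤ C₁ * E * ((∑ i ∈ Finset.range (M + 1), b i * I i) +
          2 ^ n * ∑ i ∈ Finset.range (M + 1), b i * I i) + C₄ * G := by
        refine add_le_add (mul_le_mul' le_rfl (add_le_add ?_ (mul_le_mul' le_rfl ?_))) le_rfl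
        · rw [Finset.sum_range_succ]
          exact le_self_add
        · rw [Finset.sum_range_succ' _ M]
          exact le_self_add
    _ = C₁ * E * (1 + 2 ^ n) * (∑ i ∈ Finset.range (M + 1), b i * I i) + C₄ * G := by ring
    _ ≤ C₁ * E * (1 + 2 ^ n) * (A * whitneyAvg Ω (3 * c) g x) + C₄ * G :=
        add_le_add (mul_le_mul' le_rfl hSavg) le_rfl
    _ = C₃ * whitneyAvg Ω (3 * c) g x + C₄ * G := by simp only [C₃]; ring
    _ ≤ (C₀ + (C₃ + C₄)) * whitneyAvg Ω (3 * c) g x + (C₀ + (C₃ + C₄)) * G :=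
        add_le_add (mul_le_mul' (le_self_add.trans le_add_self) le_rfl)
          (mul_le_mul' (le_add_self.trans le_add_self) le_rfl)
    _ = _ := by ring

/-- Weak type estimate for averages over balls with prescribed radii. -/
lemma exists_volume_mul_le_lintegral (n : ℕ) {Λ : ℝ} (hΛ : 0 < Λ) :
    ∃ C : ℝ≥0∞, C ≠ ⊤ ∧ ∀ (Ω : Set (Euc n)) (d : Euc n → ℝ) (D : ℝ), MeasurableSet Ω →
      (∀ y ∈ Ω, 0 < d y ∧ d y ≤ D) → ∀ (h : Euc n → ℝ≥0∞) (t : ℝ≥0∞),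
        volume {y ∈ Ω | t * ENNReal.ofReal (d y ^ n) <
          ∫⁻ x in closedBall y (Λ * d y) ∩ Ω, h x} * t ≤ C * ∫⁻ x in Ω, h x := by
  set V0 := volume (ball (0 : Euc n) 1)
  refine ⟨ENNReal.ofReal ((5 * Λ) ^ n) * V0, ENNReal.mul_ne_top ENNReal.ofReal_ne_top
    measure_ball_lt_top.ne, fun Ω d D hΩ hd h t => ?_⟩
  set F := {y ∈ Ω | t * ENNReal.ofReal (d y ^ n) < ∫⁻ x in closedBall y (Λ * d y) ∩ Ω, h x}
  obtain ⟨u, huF, hdisj, hcov⟩ := Vitali.exists_disjoint_subfamily_covering_enlargement_closedBall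
    F id (fun y => Λ * d y) (Λ * D) (fun y hy => mul_le_mul_of_nonneg_left (hd y hy.1).2 hΛ.le) 5
    (by norm_num)
  have hcount : u.Countable := hdisj.countable_of_nonempty_interior fun y hy => by
    refine ⟨y, ball_subset_interior_closedBall (mem_ball_self ?_)⟩
    exact mul_pos hΛ (hd y (huF hy).1).1
  have hsub : F ⊆ ⋃ y ∈ u, closedBall y (5 * (Λ * d y)) := fun y hy => by
    obtain ⟨b, hb, hyb⟩ := hcov y hy
    exact mem_biUnion hb (hyb (mem_closedBall_self (mul_pos hΛ (hd y hy.1).1).le))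
  have hvol : ∀ y ∈ u, volume (closedBall y (5 * (Λ * d y))) * t ≤
      ENNReal.ofReal ((5 * Λ) ^ n) * V0 * ∫⁻ x in closedBall y (Λ * d y) ∩ Ω, h x := fun y hy => by
    have hdy := (hd y (huF hy).1).1
    rw [Measure.addHaar_closedBall _ _ (by positivity), finrank_euclideanSpace_fin, ← mul_assoc,
      mul_pow, ENNReal.ofReal_mul (by positivity)]
    calc _ = ENNReal.ofReal ((5 * Λ) ^ n) * V0 * (t * ENNReal.ofReal (d y ^ n)) := by ring
      _ ≤ _ := mul_le_mul' le_rfl (huF hy).2.le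
  have hdisj' : u.PairwiseDisjoint fun y => closedBall y (Λ * d y) ∩ Ω :=
    hdisj.mono fun y => inter_subset_left
  calc volume F * t ≤ (∑' y : u, volume (closedBall (y : Euc n) (5 * (Λ * d y)))) * t :=
        mul_le_mul' ((measure_mono hsub).trans (measure_biUnion_le _ hcount _)) le_rfl
    _ = ∑' y : u, volume (closedBall (y : Euc n) (5 * (Λ * d y))) * t := ENNReal.tsum_mul_right.symm
    _ ≤ ∑' y : u, ENNReal.ofReal ((5 * Λ) ^ n) * V0 *
          ∫⁻ x in closedBall (y : Euc n) (Λ * d y) ∩ Ω, h x :=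
        ENNReal.tsum_le_tsum fun y => hvol y y.2
    _ = ENNReal.ofReal ((5 * Λ) ^ n) * V0 *
          ∑' y : u, ∫⁻ x in closedBall (y : Euc n) (Λ * d y) ∩ Ω, h x := ENNReal.tsum_mul_left
    _ = ENNReal.ofReal ((5 * Λ) ^ n) * V0 *
          ∫⁻ x in ⋃ y ∈ u, closedBall y (Λ * d y) ∩ Ω, h x := by
        rw [lintegral_biUnion hcount (fun y _ => measurableSet_closedBall.inter hΩ) hdisj']
    _ ≤ _ := mul_le_mul' le_rfl (lintegral_mono_set (iUnion₂_subset fun y _ => inter_subset_right))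

/-- Average over a ball whose radius is proportional to `d`. -/
def ballAvg {n : ℕ} (Ω : Set (Euc n)) (Λ : ℝ) (d : Euc n → ℝ) (h : Euc n → ℝ≥0∞) (y : Euc n) : ℝ≥0∞ :=
  (ENNReal.ofReal (d y ^ n))⁻¹ * ∫⁻ x in closedBall y (Λ * d y) ∩ Ω, h x

lemma measurableSet_dist_le {n : ℕ} (Λ : ℝ) {d : Euc n → ℝ} (hd : Continuous d) :
    MeasurableSet {z : Euc n × Euc n | dist z.2 z.1 ≤ Λ * d z.1} :=
  (isClosed_le (by fun_prop) (by fun_prop)).measurableSet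

lemma ballAvg_eq {n : ℕ} {Ω : Set (Euc n)} (Λ : ℝ) {d : Euc n → ℝ} (h : Euc n → ℝ≥0∞) (y : Euc n) :
    ballAvg Ω Λ d h y = (ENNReal.ofReal (d y ^ n))⁻¹ *
      ∫⁻ x in Ω, {z : Euc n × Euc n | dist z.2 z.1 ≤ Λ * d z.1}.indicator (fun z => h z.2) (y, x) := by
  rw [ballAvg]
  congr 1
  rw [← Measure.restrict_restrict measurableSet_closedBall, ← lintegral_indicator measurableSet_closedBall]
  rfl

lemma measurable_ballAvg {n : ℕ} {Ω : Set (Euc n)} (Λ : ℝ) {d : Euc n → ℝ} (hd : Continuous d)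
    {h : Euc n → ℝ≥0∞} (hh : Measurable h) : Measurable (ballAvg Ω Λ d h) := by
  have : ballAvg Ω Λ d h = fun y => (ENNReal.ofReal (d y ^ n))⁻¹ * ∫⁻ x in Ω,
      {z : Euc n × Euc n | dist z.2 z.1 ≤ Λ * d z.1}.indicator (fun z => h z.2) (y, x) :=
    funext fun y => ballAvg_eq Λ h y
  rw [this]
  refine Measurable.mul ?_ ?_
  · exact (ENNReal.measurable_ofReal.comp (hd.measurable.pow_const n)).inv
  · exact ((hh.comp measurable_snd).indicator (measurableSet_dist_le Λ hd)).lintegral_prod_right'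

lemma ballAvg_const_le {n : ℕ} (Ω : Set (Euc n)) {Λ : ℝ} (hΛ : 0 < Λ) {d : Euc n → ℝ} {y : Euc n}
    (hd : 0 < d y) (c : ℝ≥0∞) :
    ballAvg Ω Λ d (fun _ => c) y ≤ ENNReal.ofReal (Λ ^ n) * volume (ball (0 : Euc n) 1) * c := by
  have hdn : 0 < d y ^ n := pow_pos hd n
  rw [ballAvg, setLIntegral_const]
  calc _ ≤ (ENNReal.ofReal (d y ^ n))⁻¹ * (c * volume (closedBall y (Λ * d y))) :=
        mul_le_mul' le_rfl (mul_le_mul' le_rfl (measure_mono inter_subset_left))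
    _ = (ENNReal.ofReal (d y ^ n))⁻¹ * ENNReal.ofReal (d y ^ n) *
          (ENNReal.ofReal (Λ ^ n) * volume (ball (0 : Euc n) 1) * c) := by
        rw [Measure.addHaar_closedBall _ _ (by positivity), finrank_euclideanSpace_fin, mul_pow,
          ENNReal.ofReal_mul (by positivity)]
        ring
    _ = _ := by rw [ENNReal.inv_mul_cancel (by simpa using hdn) ENNReal.ofReal_ne_top, one_mul]

lemma ballAvg_mono {n : ℕ} {Ω : Set (Euc n)} (Λ : ℝ) (d : Euc n → ℝ) {h h' : Euc n → ℝ≥0∞}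
    (hle : ∀ x, h x ≤ h' x) (y : Euc n) : ballAvg Ω Λ d h y ≤ ballAvg Ω Λ d h' y :=
  mul_le_mul' le_rfl (lintegral_mono hle)

/-- The averaging operator is bounded on `L^q` for `q > 1`. -/
lemma exists_lintegral_ballAvg_rpow_le (n : ℕ) {Λ : ℝ} (hΛ : 0 < Λ) {q : ℝ} (hq : 1 < q) :
    ∃ C : ℝ≥0∞, C ≠ ⊤ ∧ ∀ (Ω : Set (Euc n)) (d : Euc n → ℝ) (D : ℝ), MeasurableSet Ω →
      Continuous d → (∀ y ∈ Ω, 0 < d y ∧ d y ≤ D) → ∀ h : Euc n → ℝ, Measurable h → (∀ x, 0 ≤ h x) →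
      (∃ N, ∀ x, h x ≤ N) →
      ∫⁻ y in Ω, ballAvg Ω Λ d (fun x => ENNReal.ofReal (h x)) y ^ q ≤
        C * ∫⁻ x in Ω, ENNReal.ofReal (h x) ^ q := by
  obtain ⟨C, hC, hweak⟩ := exists_volume_mul_le_lintegral n hΛ
  set A := (ENNReal.ofReal (Λ ^ n) * volume (ball (0 : Euc n) 1)).toReal
  have hAt : ENNReal.ofReal (Λ ^ n) * volume (ball (0 : Euc n) 1) ≠ ⊤ :=
    ENNReal.mul_ne_top ENNReal.ofReal_ne_top measure_ball_lt_top.ne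
  have hAe : ENNReal.ofReal (Λ ^ n) * volume (ball (0 : Euc n) 1) = ENNReal.ofReal A :=
    (ENNReal.ofReal_toReal hAt).symm
  have hA : 0 < A := ENNReal.toReal_pos (mul_ne_zero (by simpa using pow_pos hΛ n)
    (measure_ball_pos volume _ one_pos).ne') hAt
  have hq0 : 0 < q := by linarith
  have hq1 : 0 < q - 1 := by linarith
  refine ⟨ENNReal.ofReal q * (2 * C * (ENNReal.ofReal (q - 1))⁻¹ *
    ENNReal.ofReal ((2 * A) ^ (q - 1))), ?_, ?_⟩
  · refine ENNReal.mul_ne_top ENNReal.ofReal_ne_top (ENNReal.mul_ne_top (ENNReal.mul_ne_top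
      (ENNReal.mul_ne_top (by simp) hC) ?_) ENNReal.ofReal_ne_top)
    simpa using hq
  intro Ω d D hΩ hdc hd h hh h0 ⟨N, hN⟩
  set H := fun x => ENNReal.ofReal (h x)
  have hH : Measurable H := hh.ennreal_ofReal
  set T := ballAvg Ω Λ d H
  have hTt : ∀ y ∈ Ω, T y ≠ ⊤ := fun y hy => by
    refine ne_top_of_le_ne_top ?_ ((ballAvg_mono Λ d (fun x => ENNReal.ofReal_le_ofReal (hN x)) y).trans
      (ballAvg_const_le Ω hΛ (hd y hy).1 _))
    exact ENNReal.mul_ne_top hAt ENNReal.ofReal_ne_top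
  have hTm : Measurable T := measurable_ballAvg Λ hdc hH
  set μ := volume.restrict Ω
  set ν := μ.withDensity H
  have hlevel : ∀ t : ℝ, 0 < t → μ {y | t < (T y).toReal} * ENNReal.ofReal t ≤
      2 * C * ν {x | t < 2 * A * h x} := by
    intro t ht
    have hset : MeasurableSet {x | t < 2 * A * h x} := measurableSet_lt measurable_const (hh.const_mul _)
    set h' := {x | t < 2 * A * h x}.indicator H
    have hsplit : ∀ y ∈ Ω, T y ≤ ballAvg Ω Λ d h' y + ENNReal.ofReal (t / 2) := fun y hy => by
      have hle : ∀ x, H x ≤ h' x + ENNReal.ofReal (t / (2 * A)) := fun x => by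
        by_cases hx : t < 2 * A * h x
        · simp only [h', indicator_of_mem (show x ∈ {x | t < 2 * A * h x} from hx)]
          exact le_self_add
        · refine le_add_left (ENNReal.ofReal_le_ofReal ?_)
          rw [le_div_iff₀ (by positivity)]
          linarith
      calc T y ≤ ballAvg Ω Λ d (fun x => h' x + ENNReal.ofReal (t / (2 * A))) y := ballAvg_mono Λ d hle y
        _ = ballAvg Ω Λ d h' y + ballAvg Ω Λ d (fun _ => ENNReal.ofReal (t / (2 * A))) y := by
            simp only [ballAvg]
            rw [lintegral_add_right _ measurable_const, mul_add]
        _ ≤ _ := by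
            refine add_le_add le_rfl ((ballAvg_const_le Ω hΛ (hd y hy).1 _).trans (le_of_eq ?_))
            rw [hAe, ← ENNReal.ofReal_mul hA.le]
            congr 1
            field_simp
    have hsub : {y | t < (T y).toReal} ∩ Ω ⊆ {y ∈ Ω | ENNReal.ofReal (t / 2) *
        ENNReal.ofReal (d y ^ n) < ∫⁻ x in closedBall y (Λ * d y) ∩ Ω, h' x} := by
      rintro y ⟨hy, hyΩ⟩
      refine ⟨hyΩ, ?_⟩
      have h1 : ENNReal.ofReal t < T y := (ENNReal.ofReal_lt_iff_lt_toReal ht.le (hTt y hyΩ)).2 hy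
      have hdn : 0 < d y ^ n := pow_pos (hd y hyΩ).1 n
      by_contra! hc
      have h2 : ballAvg Ω Λ d h' y ≤ ENNReal.ofReal (t / 2) := by
        rw [ballAvg, ← ENNReal.div_eq_inv_mul]
        exact ENNReal.div_le_of_le_mul hc
      have h3 := (hsplit y hyΩ).trans (add_le_add h2 le_rfl)
      rw [← ENNReal.ofReal_add (by positivity) (by positivity), add_halves] at h3
      exact absurd h1 (not_lt.2 h3)
    have hw := hweak Ω d D hΩ hd h' (ENNReal.ofReal (t / 2))
    have hν : ∫⁻ x in Ω, h' x = ν {x | t < 2 * A * h x} := by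
      rw [withDensity_apply _ hset, lintegral_indicator hset]
    rw [hν] at hw
    have ht2 : ENNReal.ofReal t = 2 * ENNReal.ofReal (t / 2) := by
      rw [← ENNReal.ofReal_ofNat, ← ENNReal.ofReal_mul (by norm_num), mul_div_cancel₀]
      norm_num
    calc μ {y | t < (T y).toReal} * ENNReal.ofReal t
        = 2 * (volume ({y | t < (T y).toReal} ∩ Ω) * ENNReal.ofReal (t / 2)) := by
          rw [Measure.restrict_apply (measurableSet_lt measurable_const hTm.ennreal_toReal),
            mul_left_comm, ← ht2]
      _ ≤ 2 * (C * ν {x | t < 2 * A * h x}) :=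
          mul_le_mul' le_rfl ((mul_le_mul' (measure_mono hsub) le_rfl).trans hw)
      _ = _ := by ring
  have hrp : ∀ (x : ℝ), 0 ≤ x → ∀ (r : ℝ), 0 ≤ r → ENNReal.ofReal (x ^ r) = ENNReal.ofReal x ^ r :=
    fun x hx r hr => (ENNReal.ofReal_rpow_of_nonneg hx hr).symm
  have hL := lintegral_rpow_eq_lintegral_meas_lt_mul μ (f := fun y => (T y).toReal)
    (Filter.Eventually.of_forall fun y => ENNReal.toReal_nonneg) hTm.ennreal_toReal.aemeasurable hq0
  have hR := lintegral_rpow_eq_lintegral_meas_lt_mul ν (f := fun x => 2 * A * h x)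
    (Filter.Eventually.of_forall fun x => mul_nonneg (by positivity) (h0 x))
    (hh.const_mul _).aemeasurable hq1
  have hR' : ∫⁻ t in Ioi (0 : ℝ), ν {x | t < 2 * A * h x} * ENNReal.ofReal (t ^ (q - 1 - 1)) =
      (ENNReal.ofReal (q - 1))⁻¹ * (ENNReal.ofReal ((2 * A) ^ (q - 1)) * ∫⁻ x in Ω, H x ^ q) := by
    have hz : ENNReal.ofReal (q - 1) ≠ 0 := by simpa using hq
    have hmm : Measurable fun x => ENNReal.ofReal ((2 * A * h x) ^ (q - 1)) :=
      ENNReal.measurable_ofReal.comp ((hh.const_mul _).pow_const _)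
    rw [← one_mul (∫⁻ t in Ioi (0 : ℝ), _), ← ENNReal.inv_mul_cancel hz ENNReal.ofReal_ne_top, mul_assoc,
      ← hR, lintegral_withDensity_eq_lintegral_mul _ hH hmm,
      ← lintegral_const_mul' _ _ ENNReal.ofReal_ne_top]
    congr 1
    refine lintegral_congr fun x => ?_
    simp only [Pi.mul_apply, H]
    rw [Real.mul_rpow (by positivity) (h0 x), ENNReal.ofReal_mul (by positivity), hrp _ (h0 x) _ hq1.le,
      mul_left_comm]
    congr 1
    nth_rewrite 1 [← ENNReal.rpow_one (ENNReal.ofReal (h x))]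
    rw [← ENNReal.rpow_add_of_nonneg _ _ zero_le_one hq1.le]
    congr 1
    ring
  calc ∫⁻ y in Ω, T y ^ q = ∫⁻ y in Ω, ENNReal.ofReal ((T y).toReal ^ q) := by
        refine setLIntegral_congr_fun hΩ fun y hy => ?_
        rw [hrp _ ENNReal.toReal_nonneg _ hq0.le, ENNReal.ofReal_toReal (hTt y hy)]
    _ = ENNReal.ofReal q * ∫⁻ t in Ioi (0 : ℝ), μ {y | t < (T y).toReal} * ENNReal.ofReal (t ^ (q - 1)) := hL
    _ ≤ ENNReal.ofReal q * ∫⁻ t in Ioi (0 : ℝ), 2 * C *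
          (ν {x | t < 2 * A * h x} * ENNReal.ofReal (t ^ (q - 1 - 1))) := by
        refine mul_le_mul' le_rfl (setLIntegral_mono' measurableSet_Ioi fun t ht => ?_)
        have ht0 : 0 < t := ht
        have e : t ^ (q - 1) = t * t ^ (q - 1 - 1) := by
          nth_rewrite 2 [← Real.rpow_one t]
          rw [← Real.rpow_add ht0]
          congr 1
          ring
        rw [e, ENNReal.ofReal_mul ht0.le, ← mul_assoc, ← mul_assoc]
        exact mul_le_mul' (hlevel t ht0) le_rfl
    _ = _ := by
        rw [lintegral_const_mul' _ _ (ENNReal.mul_ne_top (by simp) hC), hR']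
        ring

lemma measurable_whitney_kernel {n : ℕ} (Ω : Set (Euc n)) (Λ : ℝ) {g : Euc n → ℝ≥0∞}
    (hg : Measurable g) :
    Measurable ({z : Euc n × Euc n | dist z.2 z.1 ≤ Λ * infDist z.1 Ωᶜ}.indicator
      (fun z => g z.1 * (ENNReal.ofReal (infDist z.1 Ωᶜ ^ n))⁻¹)) := by
  refine Measurable.indicator ?_ (measurableSet_dist_le Λ (continuous_infDist_pt Ωᶜ))
  refine (hg.comp measurable_fst).mul (Measurable.inv (ENNReal.measurable_ofReal.comp ?_))
  exact (((continuous_infDist_pt Ωᶜ).comp continuous_fst).pow n).measurable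

lemma measurable_whitneyAvg {n : ℕ} (Ω : Set (Euc n)) (Λ : ℝ) {g : Euc n → ℝ≥0∞}
    (hg : Measurable g) : Measurable (whitneyAvg Ω Λ g) :=
  (measurable_whitney_kernel Ω Λ hg).lintegral_prod_left'

/-- The averaging operators `whitneyAvg` and `ballAvg` are adjoint. -/
lemma lintegral_whitneyAvg_mul {n : ℕ} (Ω : Set (Euc n)) (Λ : ℝ) {g H : Euc n → ℝ≥0∞}
    (hg : Measurable g) (hH : Measurable H) :
    ∫⁻ x in Ω, whitneyAvg Ω Λ g x * H x =
      ∫⁻ y in Ω, g y * ballAvg Ω Λ (fun y => infDist y Ωᶜ) H y := by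
  set k := {z : Euc n × Euc n | dist z.2 z.1 ≤ Λ * infDist z.1 Ωᶜ}.indicator
      (fun z => g z.1 * (ENNReal.ofReal (infDist z.1 Ωᶜ ^ n))⁻¹)
  have hk : Measurable k := measurable_whitney_kernel Ω Λ hg
  calc ∫⁻ x in Ω, whitneyAvg Ω Λ g x * H x = ∫⁻ x in Ω, ∫⁻ y in Ω, k (y, x) * H x :=
        lintegral_congr fun x =>
          (lintegral_mul_const _ (hk.comp (measurable_id.prodMk measurable_const))).symm
    _ = ∫⁻ y in Ω, ∫⁻ x in Ω, k (y, x) * H x :=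
        lintegral_lintegral_swap ((hk.comp measurable_swap).mul (hH.comp measurable_fst)).aemeasurable
    _ = _ := by
        refine lintegral_congr fun y => ?_
        have hm : Measurable fun x => {z : Euc n × Euc n | dist z.2 z.1 ≤ Λ * infDist z.1 Ωᶜ}.indicator
            (fun z => H z.2) (y, x) :=
          ((hH.comp measurable_snd).indicator
            (measurableSet_dist_le Λ (continuous_infDist_pt Ωᶜ))).comp
              (measurable_const.prodMk measurable_id)
        rw [ballAvg_eq, ← mul_assoc, ← lintegral_const_mul _ hm]
        refine lintegral_congr fun x => ?_
        simp only [k, indicator]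
        split_ifs <;> simp

/-- `whitneyAvg` is bounded on `L^p`. -/
lemma exists_lintegral_whitneyAvg_rpow_le (n : ℕ) {Λ : ℝ} (hΛ : 0 < Λ) {p : ℝ} (hp1 : 1 < p) :
    ∃ C : ℝ≥0∞, C ≠ ⊤ ∧ ∀ (Ω : Set (Euc n)) (D : ℝ), MeasurableSet Ω → volume Ω ≠ ⊤ →
      (∀ y ∈ Ω, 0 < infDist y Ωᶜ ∧ infDist y Ωᶜ ≤ D) → ∀ g : Euc n → ℝ≥0∞, Measurable g →
      ∫⁻ x in Ω, whitneyAvg Ω Λ g x ^ p ≤ C * ∫⁻ x in Ω, g x ^ p := by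
  have hpq : p.HolderConjugate (p.conjExponent) := Real.HolderConjugate.conjExponent hp1
  set q := p.conjExponent
  have hp0 : 0 < p := by linarith
  have hq1 : 1 < q := hpq.symm.lt
  have hq0 : 0 < q := by linarith
  obtain ⟨C, hC, hT⟩ := exists_lintegral_ballAvg_rpow_le n hΛ hq1
  refine ⟨(C ^ (1 / q)) ^ p, ENNReal.rpow_ne_top_of_nonneg hp0.le
    (ENNReal.rpow_ne_top_of_nonneg (by positivity) hC), fun Ω D hΩ hvol hd g hg => ?_⟩
  set S := whitneyAvg Ω Λ g
  have hS : Measurable S := measurable_whitneyAvg Ω Λ hg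
  set G := ∫⁻ x in Ω, g x ^ p
  have hN : ∀ N : ℕ, ∫⁻ x in Ω, min (S x) N ^ p ≤ (C ^ (1 / q)) ^ p * G := by
    intro N
    set F := fun x => min (S x) (N : ℝ≥0∞)
    have hF : Measurable F := hS.min measurable_const
    have hFt : ∀ x, F x ≠ ⊤ := fun x => ne_top_of_le_ne_top (by simp) (min_le_right (S x) (N : ℝ≥0∞))
    set h := fun x => (F x).toReal ^ (p - 1)
    have hh : Measurable h := hF.ennreal_toReal.pow_const _
    have hhF : ∀ x, ENNReal.ofReal (h x) = F x ^ (p - 1) := fun x => by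
      simp only [h]
      rw [← ENNReal.ofReal_rpow_of_nonneg ENNReal.toReal_nonneg (by linarith),
        ENNReal.ofReal_toReal (hFt x)]
    have hb : ∀ x, h x ≤ (N : ℝ) ^ (p - 1) := fun x => by
      refine Real.rpow_le_rpow ENNReal.toReal_nonneg ?_ (by linarith)
      have := ENNReal.toReal_mono (by simp) (min_le_right (S x) (N : ℝ≥0∞))
      simpa using this
    set X := ∫⁻ x in Ω, F x ^ p
    have hX : X ≠ ⊤ := by
      refine ne_top_of_le_ne_top ?_ (lintegral_mono fun x => ENNReal.rpow_le_rpow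
        (min_le_right (S x) (N : ℝ≥0∞)) hp0.le)
      rw [setLIntegral_const]
      exact ENNReal.mul_ne_top (ENNReal.rpow_ne_top_of_nonneg hp0.le (by simp)) hvol
    have hTm : Measurable (ballAvg Ω Λ (fun y => infDist y Ωᶜ) fun x => ENNReal.ofReal (h x)) :=
      measurable_ballAvg Λ (continuous_infDist_pt Ωᶜ) hh.ennreal_ofReal
    have hTX := hT Ω (fun y => infDist y Ωᶜ) D hΩ (continuous_infDist_pt Ωᶜ) hd h hh
      (fun x => Real.rpow_nonneg ENNReal.toReal_nonneg _) ⟨_, hb⟩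
    have hHX : ∫⁻ x in Ω, ENNReal.ofReal (h x) ^ q = X := by
      refine lintegral_congr fun x => ?_
      rw [hhF, ← ENNReal.rpow_mul, hpq.sub_one_mul_conj]
    rw [hHX] at hTX
    have key : X ≤ G ^ (1 / p) * (C ^ (1 / q) * X ^ (1 / q)) := by
      calc X ≤ ∫⁻ x in Ω, S x * ENNReal.ofReal (h x) := by
            refine lintegral_mono fun x => ?_
            rw [hhF]
            calc F x ^ p = F x ^ (1 + (p - 1)) := by congr 1; ring
              _ = F x * F x ^ (p - 1) := by
                  rw [ENNReal.rpow_add_of_nonneg _ _ zero_le_one (by linarith), ENNReal.rpow_one]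
              _ ≤ _ := mul_le_mul' (min_le_left _ _) le_rfl
        _ = _ := lintegral_whitneyAvg_mul Ω Λ hg hh.ennreal_ofReal
        _ ≤ _ := ENNReal.lintegral_mul_le_Lp_mul_Lq _ hpq hg.aemeasurable hTm.aemeasurable
        _ ≤ G ^ (1 / p) * (C * X) ^ (1 / q) :=
            mul_le_mul' le_rfl (ENNReal.rpow_le_rpow hTX (by positivity))
        _ = _ := by rw [ENNReal.mul_rpow_of_nonneg _ _ (by positivity)]
    rcases eq_or_ne X 0 with h0 | h0
    · rw [h0]
      exact bot_le
    have hXq : X ^ (1 / q) ≠ 0 := (ENNReal.rpow_pos (pos_iff_ne_zero.2 h0) hX).ne'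
    have hXt : X ^ (1 / q) ≠ ⊤ := ENNReal.rpow_ne_top_of_nonneg (by positivity) hX
    have hsplit : X = X ^ (1 / p) * X ^ (1 / q) := by
      rw [← ENNReal.rpow_add _ _ h0 hX, one_div, one_div, hpq.inv_add_inv_eq_one, ENNReal.rpow_one]
    have h1 : X ^ (1 / p) * X ^ (1 / q) ≤ (G ^ (1 / p) * C ^ (1 / q)) * X ^ (1 / q) := by
      rw [← hsplit, mul_assoc]
      exact key
    rw [ENNReal.mul_le_mul_iff_left hXq hXt] at h1
    have h2 := ENNReal.rpow_le_rpow h1 hp0.le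
    rw [ENNReal.mul_rpow_of_nonneg _ _ hp0.le, ← ENNReal.rpow_mul, ← ENNReal.rpow_mul,
      one_div_mul_cancel hp0.ne', ENNReal.rpow_one, ENNReal.rpow_one, mul_comm] at h2
    exact h2
  have hlim : Filter.Tendsto (fun N : ℕ => ∫⁻ x in Ω, min (S x) N ^ p) Filter.atTop
      (nhds (∫⁻ x in Ω, S x ^ p)) := by
    refine lintegral_tendsto_of_tendsto_of_monotone
      (fun N => ((hS.min measurable_const).pow_const p).aemeasurable) ?_ ?_
    · refine Filter.Eventually.of_forall fun x a b hab => ENNReal.rpow_le_rpow ?_ hp0.le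
      exact min_le_min le_rfl (by exact_mod_cast hab)
    · refine Filter.Eventually.of_forall fun x => ?_
      have h1 : Filter.Tendsto (fun N : ℕ => min (S x) (N : ℝ≥0∞)) Filter.atTop (nhds (min (S x) ⊤)) :=
        tendsto_const_nhds.min ENNReal.tendsto_nat_nhds_top
      rw [min_top_right] at h1
      exact (ENNReal.continuous_rpow_const.tendsto _).comp h1
  exact le_of_tendsto' hlim hN

/-- Weighted integral over `Ω` of the integrals over Whitney-type balls. -/
def whitneyIntegral {n : ℕ} (Ω : Set (Euc n)) (a : ℝ) (F : Euc n → ℝ≥0∞) : ℝ≥0∞ :=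
  ∫⁻ x in Ω, (ENNReal.ofReal (infDist x Ωᶜ ^ n))⁻¹ * ∫⁻ y in ball x (a * infDist x Ωᶜ), F y

lemma whitneyIntegral_eq {n : ℕ} {Ω : Set (Euc n)} {a : ℝ} (ha : a ≤ 1) {F : Euc n → ℝ≥0∞}
    (hF : Measurable F) :
    whitneyIntegral Ω a F = ∫⁻ y in Ω, F y * ∫⁻ x in Ω,
      {x | dist y x < a * infDist x Ωᶜ}.indicator
        (fun x => (ENNReal.ofReal (infDist x Ωᶜ ^ n))⁻¹) x := by
  have hd : Continuous fun x : Euc n => infDist x Ωᶜ := continuous_infDist_pt Ωᶜ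
  have hc : Measurable fun x : Euc n => (ENNReal.ofReal (infDist x Ωᶜ ^ n))⁻¹ :=
    (ENNReal.measurable_ofReal.comp (hd.pow n).measurable).inv
  have hset : MeasurableSet {z : Euc n × Euc n | dist z.2 z.1 < a * infDist z.1 Ωᶜ} :=
    (isOpen_lt (by fun_prop) (by fun_prop)).measurableSet
  set k := {z : Euc n × Euc n | dist z.2 z.1 < a * infDist z.1 Ωᶜ}.indicator
      (fun z => (ENNReal.ofReal (infDist z.1 Ωᶜ ^ n))⁻¹)
  have hk : Measurable k := (hc.comp measurable_fst).indicator hset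
  calc whitneyIntegral Ω a F = ∫⁻ x in Ω, ∫⁻ y in Ω, F y * k (x, y) := by
        refine lintegral_congr fun x => ?_
        have hsub : ball x (a * infDist x Ωᶜ) ⊆ Ω :=
          (ball_subset_ball (mul_le_of_le_one_left infDist_nonneg ha)).trans
            ball_infDist_compl_subset
        rw [← lintegral_const_mul _ hF, ← inter_eq_left.2 hsub,
          ← Measure.restrict_restrict measurableSet_ball, ← lintegral_indicator measurableSet_ball]
        refine lintegral_congr fun y => ?_
        simp only [k, indicator, mem_ball, Set.mem_ofPred_eq]
        split_ifs
        · rw [mul_comm]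
        · rw [mul_zero]
    _ = ∫⁻ y in Ω, ∫⁻ x in Ω, F y * k (x, y) :=
        lintegral_lintegral_swap ((hF.comp measurable_snd).mul hk).aemeasurable
    _ = _ := lintegral_congr fun y =>
        lintegral_const_mul _ (hk.comp (measurable_id.prodMk measurable_const))

lemma exists_whitneyIntegral_le (n : ℕ) :
    ∃ C : ℝ≥0∞, C ≠ ⊤ ∧ ∀ (Ω : Set (Euc n)) (a : ℝ), MeasurableSet Ω → a ≤ 1 / 2 →
      (∀ y ∈ Ω, 0 < infDist y Ωᶜ) → ∀ F : Euc n → ℝ≥0∞, Measurable F →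
      whitneyIntegral Ω a F ≤ C * ∫⁻ x in Ω, F x := by
  refine ⟨2 ^ n * volume (ball (0 : Euc n) 1), ENNReal.mul_ne_top (by simp) measure_ball_lt_top.ne,
    fun Ω a hΩ ha hd F hF => ?_⟩
  rw [whitneyIntegral_eq (by linarith) hF, ← lintegral_const_mul _ hF]
  refine setLIntegral_mono' hΩ fun y hy => ?_
  rw [mul_comm]
  refine mul_le_mul' ?_ le_rfl
  have hdy := hd y hy
  set d := infDist y Ωᶜ
  have hdn : 0 < d ^ n := pow_pos hdy n
  have hle : ∀ x, {x | dist y x < a * infDist x Ωᶜ}.indicator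
      (fun x => (ENNReal.ofReal (infDist x Ωᶜ ^ n))⁻¹) x ≤
      (ball y d).indicator (fun _ => 2 ^ n * (ENNReal.ofReal (d ^ n))⁻¹) x := fun x => by
    by_cases hx : dist y x < a * infDist x Ωᶜ
    · have h0 : 0 ≤ infDist x Ωᶜ := infDist_nonneg
      have h1 : dist y x < infDist x Ωᶜ / 2 := by nlinarith
      have e1 : d ≤ infDist x Ωᶜ + dist y x := infDist_le_infDist_add_dist
      have e2 : infDist x Ωᶜ ≤ d + dist x y := infDist_le_infDist_add_dist
      rw [dist_comm] at e2
      rw [indicator_of_mem (show x ∈ {x | dist y x < a * infDist x Ωᶜ} from hx),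
        indicator_of_mem (by rw [mem_ball, dist_comm]; linarith)]
      have h2n : ENNReal.ofReal (2 ^ n) = 2 ^ n := by
        rw [ENNReal.ofReal_pow (by norm_num)]; simp
      have h4 : ENNReal.ofReal (d ^ n) ≤ 2 ^ n * ENNReal.ofReal (infDist x Ωᶜ ^ n) := by
        rw [← h2n, ← ENNReal.ofReal_mul (by positivity), ← mul_pow]
        exact ENNReal.ofReal_le_ofReal (pow_le_pow_left₀ hdy.le (by linarith) n)
      have h5 := ENNReal.inv_le_inv.2 h4
      rw [ENNReal.mul_inv (Or.inl (by simp)) (Or.inl (by simp))] at h5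
      calc (ENNReal.ofReal (infDist x Ωᶜ ^ n))⁻¹
          = 2 ^ n * ((2 ^ n)⁻¹ * (ENNReal.ofReal (infDist x Ωᶜ ^ n))⁻¹) := by
            rw [← mul_assoc, ENNReal.mul_inv_cancel (by simp) (by simp), one_mul]
        _ ≤ _ := mul_le_mul' le_rfl h5
    · rw [indicator_of_notMem (show x ∉ {x | dist y x < a * infDist x Ωᶜ} from hx)]
      exact bot_le
  calc _ ≤ ∫⁻ x in Ω, (ball y d).indicator (fun _ => 2 ^ n * (ENNReal.ofReal (d ^ n))⁻¹) x :=
        lintegral_mono hle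
    _ ≤ ∫⁻ x, (ball y d).indicator (fun _ => 2 ^ n * (ENNReal.ofReal (d ^ n))⁻¹) x :=
        setLIntegral_le_lintegral _ _
    _ = 2 ^ n * (ENNReal.ofReal (d ^ n))⁻¹ *
          (ENNReal.ofReal (d ^ n) * volume (ball (0 : Euc n) 1)) := by
        rw [lintegral_indicator_const measurableSet_ball, Measure.addHaar_ball_of_pos _ _ hdy,
          finrank_euclideanSpace_fin]
    _ = 2 ^ n * ((ENNReal.ofReal (d ^ n))⁻¹ * ENNReal.ofReal (d ^ n)) *
          volume (ball (0 : Euc n) 1) := by ring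
    _ = _ := by rw [ENNReal.inv_mul_cancel (by simpa using hdn) ENNReal.ofReal_ne_top, mul_one]

lemma exists_lintegral_le_whitneyIntegral (n : ℕ) {a : ℝ} (ha0 : 0 < a) (ha : a ≤ 1) :
    ∃ C : ℝ≥0∞, C ≠ ⊤ ∧ ∀ Ω : Set (Euc n), MeasurableSet Ω →
      (∀ y ∈ Ω, 0 < infDist y Ωᶜ) → ∀ F : Euc n → ℝ≥0∞, AEMeasurable F (volume.restrict Ω) →
      ∫⁻ x in Ω, F x ≤ C * whitneyIntegral Ω a F := by
  set c₀ := ENNReal.ofReal ((a / 4) ^ n) * volume (ball (0 : Euc n) 1)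
  have hc0 : c₀ ≠ 0 := mul_ne_zero (by simpa using pow_pos (by positivity) n)
    (measure_ball_pos volume _ one_pos).ne'
  have hct : c₀ ≠ ⊤ := ENNReal.mul_ne_top ENNReal.ofReal_ne_top measure_ball_lt_top.ne
  refine ⟨c₀⁻¹, ENNReal.inv_ne_top.2 hc0, fun Ω hΩ hd F hF => ?_⟩
  set F' := hF.mk F
  have hF' : Measurable F' := hF.measurable_mk
  have hFF : whitneyIntegral Ω a F = whitneyIntegral Ω a F' := by
    refine lintegral_congr fun x => ?_
    have hsub : ball x (a * infDist x Ωᶜ) ⊆ Ω :=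
      (ball_subset_ball (mul_le_of_le_one_left infDist_nonneg ha)).trans
        ball_infDist_compl_subset
    rw [lintegral_congr_ae (ae_restrict_of_ae_restrict_of_subset hsub hF.ae_eq_mk)]
  rw [hFF, lintegral_congr_ae hF.ae_eq_mk, whitneyIntegral_eq ha hF']
  change ∫⁻ y in Ω, F' y ≤ _
  suffices hs : c₀ * ∫⁻ y in Ω, F' y ≤ ∫⁻ y in Ω, F' y * ∫⁻ x in Ω,
      {x | dist y x < a * infDist x Ωᶜ}.indicator
        (fun x => (ENNReal.ofReal (infDist x Ωᶜ ^ n))⁻¹) x by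
    calc ∫⁻ y in Ω, F' y = c₀⁻¹ * (c₀ * ∫⁻ y in Ω, F' y) := by
          rw [← mul_assoc, ENNReal.inv_mul_cancel hc0 hct, one_mul]
      _ ≤ _ := mul_le_mul' le_rfl hs
  rw [← lintegral_const_mul _ hF']
  refine setLIntegral_mono' hΩ fun y hy => ?_
  rw [mul_comm]
  refine mul_le_mul' le_rfl ?_
  have hdy := hd y hy
  set d := infDist y Ωᶜ
  have h2n : ENNReal.ofReal (2 ^ n) = 2 ^ n := by
    rw [ENNReal.ofReal_pow (by norm_num)]; simp
  have hdn : ENNReal.ofReal (d ^ n) ≠ 0 := by simpa using pow_pos hdy n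
  have hsubΩ : ball y (a / 2 * d) ⊆ Ω :=
    (ball_subset_ball (mul_le_of_le_one_left hdy.le (by linarith))).trans
      ball_infDist_compl_subset
  have hle : ∀ x, (ball y (a / 2 * d)).indicator (fun _ => (2 ^ n)⁻¹ * (ENNReal.ofReal (d ^ n))⁻¹) x ≤
      {x | dist y x < a * infDist x Ωᶜ}.indicator
        (fun x => (ENNReal.ofReal (infDist x Ωᶜ ^ n))⁻¹) x := fun x => by
    by_cases hx : x ∈ ball y (a / 2 * d)
    · have hx' := hx
      rw [mem_ball, dist_comm] at hx'
      have e1 : d ≤ infDist x Ωᶜ + dist y x := infDist_le_infDist_add_dist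
      have e2 : infDist x Ωᶜ ≤ d + dist x y := infDist_le_infDist_add_dist
      rw [dist_comm] at e2
      have h1 : d / 2 ≤ infDist x Ωᶜ := by nlinarith
      rw [indicator_of_mem hx, indicator_of_mem (show x ∈ {x | dist y x < a * infDist x Ωᶜ} by
        change dist y x < a * infDist x Ωᶜ; nlinarith)]
      rw [← ENNReal.mul_inv (Or.inl (by simp)) (Or.inl (by simp)), ENNReal.inv_le_inv, ← h2n,
        ← ENNReal.ofReal_mul (by positivity), ← mul_pow]
      exact ENNReal.ofReal_le_ofReal (pow_le_pow_left₀ infDist_nonneg (by nlinarith) n)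
    · rw [indicator_of_notMem hx]
      exact bot_le
  refine le_trans (le_of_eq ?_) (lintegral_mono hle)
  rw [lintegral_indicator_const measurableSet_ball, Measure.restrict_apply measurableSet_ball,
    inter_eq_left.2 hsubΩ, Measure.addHaar_ball_of_pos _ _ (by positivity),
    finrank_euclideanSpace_fin, mul_pow, ENNReal.ofReal_mul (by positivity)]
  have e : ENNReal.ofReal ((a / 2) ^ n) = 2 ^ n * ENNReal.ofReal ((a / 4) ^ n) := by
    rw [← h2n, ← ENNReal.ofReal_mul (by positivity), ← mul_pow]
    congr 2
    ring
  rw [e]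
  calc c₀ = ((2 ^ n)⁻¹ * 2 ^ n) * ((ENNReal.ofReal (d ^ n))⁻¹ * ENNReal.ofReal (d ^ n)) * c₀ := by
        rw [ENNReal.inv_mul_cancel (by simp) (by simp),
          ENNReal.inv_mul_cancel hdn ENNReal.ofReal_ne_top, one_mul, one_mul]
    _ = _ := by simp only [c₀]; ring

/-- Korn's inequality on a John domain, up to an element of the kernel of `lMat`. -/
lemma exists_isConf_korn_john {n : ℕ} (hn : 3 ≤ n) {p : ℝ} (hp1 : 1 < p) {Ω : Set (Euc n)}
    (hΩo : IsOpen Ω) (hΩ : Ω ≠ univ) (hΩb : Bornology.IsBounded Ω) (hJ : IsJohnDomain Ω) :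
    ∃ C : ℝ≥0∞, C ≠ ⊤ ∧ ∀ v : Euc n → Euc n, (∀ x ∈ Ω, DifferentiableAt ℝ v x) →
      ∫⁻ x in Ω, ENNReal.ofReal (matNorm (Dmat v x)) ^ p ≠ ⊤ → ∀ δ : ℝ, 0 < δ →
      ∃ w, IsConf w ∧ ∫⁻ x in Ω, (‖v x - w x‖ₑ ^ p +
        ENNReal.ofReal (matNorm (Dmat v x - Dmat w x)) ^ p) ≤
          C * ∫⁻ x in Ω, devDensity v δ x ^ p := by
  have hp0 : 0 < p := by linarith
  have hdpos : ∀ y ∈ Ω, 0 < infDist y Ωᶜ := fun y hy => infDist_compl_pos hΩo hΩ hy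
  have hvol : volume Ω ≠ ⊤ := hΩb.measure_lt_top.ne
  obtain ⟨D, hD, hDΩ⟩ := exists_infDist_compl_le hΩ hΩb 0
  obtain ⟨K, Λ, hK, hΛ, C, hC, hloc⟩ := exists_isConf_john_jetDist_le hn hp1 hΩo hΩ hΩb hJ
  have hK0 : 0 < K := by linarith
  obtain ⟨C₁, hC₁, hW₁⟩ := exists_lintegral_le_whitneyIntegral n (a := 1 / K) (by positivity)
    (by rw [div_le_one hK0]; linarith)
  obtain ⟨C₂, hC₂, hW₂⟩ := exists_whitneyIntegral_le n
  obtain ⟨C₃, hC₃, hS⟩ := exists_lintegral_whitneyAvg_rpow_le n hΛ hp1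
  set V := volume (ball (0 : Euc n) 1)
  have hV : V ≠ ⊤ := measure_ball_lt_top.ne
  set E : ℝ≥0∞ := 2 ^ p * (2 * C) with hE
  set H : ℝ≥0∞ := 2 ^ p * (2 * V * (C ^ p * 2 ^ p)) with hH
  have hEt : E ≠ ⊤ := ENNReal.mul_ne_top (two_rpow_ne_top p) (ENNReal.mul_ne_top (by simp) hC)
  have hHt : H ≠ ⊤ := ENNReal.mul_ne_top (two_rpow_ne_top p) (ENNReal.mul_ne_top
    (ENNReal.mul_ne_top (by simp) hV) (ENNReal.mul_ne_top
      (ENNReal.rpow_ne_top_of_nonneg hp0.le hC) (two_rpow_ne_top p)))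
  have hvp : volume Ω ^ (p - 1) * volume Ω ≠ ⊤ := ENNReal.mul_ne_top
    (ENNReal.rpow_ne_top_of_nonneg (by linarith) hvol) hvol
  refine ⟨C₁ * (E * C₂ + H * (C₃ + volume Ω ^ (p - 1) * volume Ω)), ENNReal.mul_ne_top hC₁
    (ENNReal.add_ne_top.2 ⟨ENNReal.mul_ne_top hEt hC₂,
      ENNReal.mul_ne_top hHt (ENNReal.add_ne_top.2 ⟨hC₃, hvp⟩)⟩), fun v hv hDv δ hδ => ?_⟩
  obtain ⟨w', hw', hx⟩ := hloc v hv hDv δ hδ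
  refine ⟨w', hw', ?_⟩
  set g := devDensity v δ
  have hg : Measurable g := measurable_devDensity v δ
  set S := whitneyAvg Ω Λ g
  have hSm : Measurable S := measurable_whitneyAvg Ω Λ hg
  set G := ∫⁻ y in Ω, g y
  have hDm : ∀ w, Measurable fun y => ENNReal.ofReal (matNorm (Dmat v y - Dmat w y)) ^ p :=
    fun w => ((measurable_matNorm fun i j => (measurable_Dmat v i j).sub
      (measurable_Dmat w i j)).ennreal_ofReal).pow_const p
  have hvc : ContinuousOn (fun y => v y - w' y) Ω := fun y hy =>
    ((hv y hy).continuousAt.sub hw'.continuous.continuousAt).continuousWithinAt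
  have hF : AEMeasurable (fun y => ‖v y - w' y‖ₑ ^ p +
      ENNReal.ofReal (matNorm (Dmat v y - Dmat w' y)) ^ p) (volume.restrict Ω) :=
    ((hvc.aemeasurable hΩo.measurableSet).enorm.pow_const p).add (hDm w').aemeasurable
  have key : ∀ x ∈ Ω, (ENNReal.ofReal (infDist x Ωᶜ ^ n))⁻¹ * ∫⁻ y in ball x (1 / K * infDist x Ωᶜ),
      (‖v y - w' y‖ₑ ^ p + ENNReal.ofReal (matNorm (Dmat v y - Dmat w' y)) ^ p) ≤
      E * ((ENNReal.ofReal (infDist x Ωᶜ ^ n))⁻¹ *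
        ∫⁻ y in ball x (20 / K * infDist x Ωᶜ), g y ^ p) + H * (S x ^ p + G ^ p) := by
    intro x hxΩ
    obtain ⟨w, hw, h1, h2, h3⟩ := hx x hxΩ
    set d := infDist x Ωᶜ
    have hd : 0 < d := hdpos x hxΩ
    have hdn : ENNReal.ofReal (d ^ n) ≠ 0 := by simpa using pow_pos hd n
    rw [show 1 / K * d = d / K by ring, show 20 / K * d = 20 * (d / K) by ring]
    set I := ∫⁻ y in ball x (20 * (d / K)), g y ^ p
    set J := C * (S x + G) with hJdef
    have hpt : ∀ y ∈ ball x (d / K), ‖v y - w' y‖ₑ ^ p +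
        ENNReal.ofReal (matNorm (Dmat v y - Dmat w' y)) ^ p ≤ 2 ^ p *
          (ENNReal.ofReal (matNorm (Dmat v y - Dmat w y)) ^ p + (‖v y - w y‖ₑ ^ p + 2 * J ^ p)) := by
      intro y hy
      have hj := h3 y hy
      rw [jetDist] at hj
      have ha : ‖v y - w' y‖ₑ ≤ ‖v y - w y‖ₑ + J := by
        rw [← sub_add_sub_cancel (v y) (w y) (w' y)]
        exact (enorm_add_le _ _).trans (add_le_add le_rfl (le_self_add.trans hj))
      have hb : ENNReal.ofReal (matNorm (Dmat v y - Dmat w' y)) ≤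
          ENNReal.ofReal (matNorm (Dmat v y - Dmat w y)) + J := by
        rw [← sub_add_sub_cancel (Dmat v y) (Dmat w y) (Dmat w' y)]
        refine (ENNReal.ofReal_le_ofReal (matNorm_add_le _ _)).trans ?_
        rw [ENNReal.ofReal_add (matNorm_nonneg _) (matNorm_nonneg _)]
        exact add_le_add le_rfl (le_add_self.trans hj)
      refine (add_le_add ((ENNReal.rpow_le_rpow ha hp0.le).trans (rpow_add_le_const_mul hp1.le _ _))
        ((ENNReal.rpow_le_rpow hb hp0.le).trans (rpow_add_le_const_mul hp1.le _ _))).trans_eq ?_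
      ring
    have hB : (ENNReal.ofReal (d ^ n))⁻¹ * volume (ball x (d / K)) ≤ V := by
      have hsub : volume (ball x (d / K)) ≤ ENNReal.ofReal (d ^ n) * V := by
        refine (measure_mono (ball_subset_ball (div_le_self hd.le (by linarith)))).trans_eq ?_
        rw [Measure.addHaar_ball_of_pos volume x hd, finrank_euclideanSpace_fin]
      refine (mul_le_mul' le_rfl hsub).trans_eq ?_
      rw [← mul_assoc, ENNReal.inv_mul_cancel hdn ENNReal.ofReal_ne_top, one_mul]
    calc (ENNReal.ofReal (d ^ n))⁻¹ * ∫⁻ y in ball x (d / K),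
        (‖v y - w' y‖ₑ ^ p + ENNReal.ofReal (matNorm (Dmat v y - Dmat w' y)) ^ p)
        ≤ (ENNReal.ofReal (d ^ n))⁻¹ * ∫⁻ y in ball x (d / K), 2 ^ p *
          (ENNReal.ofReal (matNorm (Dmat v y - Dmat w y)) ^ p +
            (‖v y - w y‖ₑ ^ p + 2 * J ^ p)) :=
          mul_le_mul' le_rfl (setLIntegral_mono' measurableSet_ball hpt)
      _ = (ENNReal.ofReal (d ^ n))⁻¹ * (2 ^ p *
          ((∫⁻ y in ball x (d / K), ENNReal.ofReal (matNorm (Dmat v y - Dmat w y)) ^ p) +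
            ((∫⁻ y in ball x (d / K), ‖v y - w y‖ₑ ^ p) +
              2 * J ^ p * volume (ball x (d / K))))) := by
          rw [lintegral_const_mul' _ _ (two_rpow_ne_top p), lintegral_add_left (hDm w),
            lintegral_add_right _ measurable_const, setLIntegral_const]
      _ ≤ (ENNReal.ofReal (d ^ n))⁻¹ * (2 ^ p *
          (C * I + (C * I + 2 * J ^ p * volume (ball x (d / K))))) :=
          mul_le_mul' le_rfl (mul_le_mul' le_rfl (add_le_add h2 (add_le_add h1 le_rfl)))
      _ = E * ((ENNReal.ofReal (d ^ n))⁻¹ * I) + 2 ^ p * (2 * J ^ p *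
          ((ENNReal.ofReal (d ^ n))⁻¹ * volume (ball x (d / K)))) := by
          rw [hE]
          ring
      _ ≤ E * ((ENNReal.ofReal (d ^ n))⁻¹ * I) + 2 ^ p * (2 *
          (C ^ p * (2 ^ p * (S x ^ p + G ^ p))) * V) := by
          refine add_le_add le_rfl (mul_le_mul' le_rfl (mul_le_mul' (mul_le_mul' le_rfl ?_) hB))
          rw [hJdef, ENNReal.mul_rpow_of_nonneg _ _ hp0.le]
          exact mul_le_mul' le_rfl (rpow_add_le_const_mul hp1.le _ _)
      _ = _ := by
          rw [hH]
          ring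
  have hG : G ^ p ≤ volume Ω ^ (p - 1) * ∫⁻ x in Ω, g x ^ p := by
    simpa using lintegral_rpow_le (volume.restrict Ω) hp1.le hg.aemeasurable
  refine (hW₁ Ω hΩo.measurableSet hdpos _ hF).trans ?_
  rw [mul_assoc]
  refine mul_le_mul' le_rfl ?_
  calc whitneyIntegral Ω (1 / K) _
      ≤ ∫⁻ x in Ω, (E * ((ENNReal.ofReal (infDist x Ωᶜ ^ n))⁻¹ *
        ∫⁻ y in ball x (20 / K * infDist x Ωᶜ), g y ^ p) + H * (S x ^ p + G ^ p)) :=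
        setLIntegral_mono' hΩo.measurableSet key
    _ = E * whitneyIntegral Ω (20 / K) (fun y => g y ^ p) +
        H * ((∫⁻ x in Ω, S x ^ p) + G ^ p * volume Ω) := by
        rw [lintegral_add_right _ (((hSm.pow_const p).add_const _).const_mul _),
          lintegral_const_mul' _ _ hEt, lintegral_const_mul' _ _ hHt,
          lintegral_add_right _ measurable_const, setLIntegral_const]
        rfl
    _ ≤ E * (C₂ * ∫⁻ x in Ω, g x ^ p) + H * ((C₃ * ∫⁻ x in Ω, g x ^ p) +
        (volume Ω ^ (p - 1) * ∫⁻ x in Ω, g x ^ p) * volume Ω) := by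
        refine add_le_add (mul_le_mul' le_rfl (hW₂ Ω _ hΩo.measurableSet ?_ hdpos _
          (hg.pow_const p))) (mul_le_mul' le_rfl (add_le_add (hS Ω D hΩo.measurableSet hvol
            (fun y hy => ⟨hdpos y hy, (hDΩ y hy).1⟩) g hg) (mul_le_mul' hG le_rfl)))
        rw [div_le_div_iff₀ hK0 two_pos]
        linarith
    _ = _ := by ring

/-- The `p`-th power of the `W^{1,p}` norm, as an extended nonnegative number. -/
def sobolevEnergy {n : ℕ} (Ω : Set (Euc n)) (p : ℝ) (v : Euc n → Euc n) : ℝ≥0∞ :=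
  ∫⁻ x in Ω, (‖v x‖ₑ ^ p + ENNReal.ofReal (matNorm (Dmat v x)) ^ p)

lemma measurable_ofReal_matNorm_Dmat_rpow {n : ℕ} (v : Euc n → Euc n) (p : ℝ) :
    Measurable fun x => ENNReal.ofReal (matNorm (Dmat v x)) ^ p :=
  (measurable_ofReal_matNorm_Dmat v).pow_const p

lemma sobolevEnergy_eq {n : ℕ} (Ω : Set (Euc n)) (p : ℝ) (v : Euc n → Euc n) :
    sobolevEnergy Ω p v = (∫⁻ x in Ω, ‖v x‖ₑ ^ p) +
      ∫⁻ x in Ω, ENNReal.ofReal (matNorm (Dmat v x)) ^ p :=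
  lintegral_add_right _ (measurable_ofReal_matNorm_Dmat_rpow v p)

lemma memW1p_iff {n : ℕ} {Ω : Set (Euc n)} (hΩo : IsOpen Ω) {p : ℝ} (hp : 0 < p)
    {v : Euc n → Euc n} :
    memW1p Ω p v ↔ (∀ x ∈ Ω, DifferentiableAt ℝ v x) ∧ sobolevEnergy Ω p v ≠ ⊤ := by
  refine and_congr_right fun hv => ?_
  have hm : AEMeasurable v (volume.restrict Ω) :=
    ContinuousOn.aemeasurable (fun x hx => (hv x hx).continuousAt.continuousWithinAt)
      hΩo.measurableSet
  rw [sobolevEnergy_eq, ENNReal.add_ne_top]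
  refine and_congr ?_ (integrable_matNorm_rpow_iff hp.le (measurable_Dmat v))
  rw [IntegrableOn, Integrable, and_iff_right (hm.norm.pow_const p).aestronglyMeasurable,
    HasFiniteIntegral, lt_top_iff_ne_top]
  refine Iff.of_eq (congrArg (· ≠ ⊤) (lintegral_congr fun x => ?_))
  rw [Real.enorm_rpow_of_nonneg (norm_nonneg _) hp.le, enorm_norm]

lemma ofReal_LpNorm_rpow {n : ℕ} {Ω : Set (Euc n)} {p : ℝ} (hp : 0 < p) {v : Euc n → Euc n}
    (hv : memW1p Ω p v) : ENNReal.ofReal (LpNorm Ω p v) ^ p = ∫⁻ x in Ω, ‖v x‖ₑ ^ p := by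
  have h0 : 0 ≤ ∫ x in Ω, ‖v x‖ ^ p := integral_nonneg fun x => by positivity
  rw [LpNorm, ENNReal.ofReal_rpow_of_nonneg (Real.rpow_nonneg h0 _) hp.le, ← Real.rpow_mul h0,
    one_div_mul_cancel hp.ne', Real.rpow_one,
    ofReal_integral_eq_lintegral_ofReal hv.2.1 (Filter.Eventually.of_forall fun x => by positivity)]
  refine lintegral_congr fun x => ?_
  rw [← ENNReal.ofReal_rpow_of_nonneg (norm_nonneg _) hp.le, ofReal_norm]

lemma ofReal_W1pNorm_rpow {n : ℕ} {Ω : Set (Euc n)} {p : ℝ} (hp : 0 < p) {v : Euc n → Euc n}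
    (hv : memW1p Ω p v) : ENNReal.ofReal (W1pNorm Ω p v) ^ p = sobolevEnergy Ω p v := by
  have h0 : 0 ≤ ∫ x in Ω, ‖v x‖ ^ p := integral_nonneg fun x => by positivity
  have h1 : 0 ≤ ∫ x in Ω, matNorm (Dmat v x) ^ p :=
    integral_nonneg fun x => Real.rpow_nonneg (matNorm_nonneg _) _
  rw [sobolevEnergy_eq, ← ofReal_LpNorm_rpow hp hv, ← ofReal_integral_matNorm_rpow hp.le hv.2.2,
    W1pNorm, LpNorm, ENNReal.ofReal_rpow_of_nonneg (Real.rpow_nonneg (add_nonneg h0 h1) _) hp.le,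
    ENNReal.ofReal_rpow_of_nonneg (Real.rpow_nonneg h0 _) hp.le, ← Real.rpow_mul h0,
    ← Real.rpow_mul (add_nonneg h0 h1), one_div_mul_cancel hp.ne', Real.rpow_one, Real.rpow_one,
    ENNReal.ofReal_add h0 h1]

lemma sobolevEnergy_congr {n : ℕ} {Ω : Set (Euc n)} (hΩo : IsOpen Ω) (p : ℝ) {u v : Euc n → Euc n}
    (h : ∀ x ∈ Ω, u x = v x) : sobolevEnergy Ω p u = sobolevEnergy Ω p v := by
  refine setLIntegral_congr_fun hΩo.measurableSet fun x hx => ?_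
  have he : u =ᶠ[nhds x] v := Filter.eventually_of_mem (hΩo.mem_nhds hx) h
  have hD : Dmat u x = Dmat v x := Dmat_congr he
  simp only [h x hx, hD]

lemma lintegral_enorm_le_add {n : ℕ} {Ω : Set (Euc n)} (hΩo : IsOpen Ω) {p : ℝ} (hp1 : 1 ≤ p)
    {u v : Euc n → Euc n} (hv : ∀ x ∈ Ω, DifferentiableAt ℝ v x) :
    ∫⁻ x in Ω, ‖u x‖ₑ ^ p ≤
      2 ^ p * ((∫⁻ x in Ω, ‖u x - v x‖ₑ ^ p) + ∫⁻ x in Ω, ‖v x‖ₑ ^ p) := by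
  have hp0 : 0 ≤ p := by linarith
  have hvm : AEMeasurable v (volume.restrict Ω) :=
    ContinuousOn.aemeasurable (fun x hx => (hv x hx).continuousAt.continuousWithinAt)
      hΩo.measurableSet
  rw [← lintegral_add_right' _ (hvm.enorm.pow_const p), ← lintegral_const_mul' _ _ (two_rpow_ne_top p)]
  refine lintegral_mono fun x => (ENNReal.rpow_le_rpow ?_ hp0).trans (rpow_add_le_const_mul hp1 _ _)
  conv_lhs => rw [← sub_add_cancel (u x) (v x)]
  exact enorm_add_le _ _

lemma sobolevEnergy_le_add {n : ℕ} {Ω : Set (Euc n)} (hΩo : IsOpen Ω) {p : ℝ} (hp1 : 1 ≤ p)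
    {u v : Euc n → Euc n} (hu : ∀ x ∈ Ω, DifferentiableAt ℝ u x)
    (hv : ∀ x ∈ Ω, DifferentiableAt ℝ v x) :
    sobolevEnergy Ω p u ≤
      2 ^ p * (sobolevEnergy Ω p (fun x => u x - v x) + sobolevEnergy Ω p v) := by
  have hp0 : 0 ≤ p := by linarith
  simp only [sobolevEnergy_eq]
  refine (add_le_add (lintegral_enorm_le_add hΩo hp1 hv) ?_ :
    _ ≤ _ + 2 ^ p * ((∫⁻ x in Ω, ENNReal.ofReal (matNorm (Dmat (fun x => u x - v x) x)) ^ p) +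
      ∫⁻ x in Ω, ENNReal.ofReal (matNorm (Dmat v x)) ^ p)).trans_eq (by ring)
  rw [← lintegral_add_right _ (measurable_ofReal_matNorm_Dmat_rpow v p),
    ← lintegral_const_mul' _ _ (two_rpow_ne_top p)]
  refine setLIntegral_mono' hΩo.measurableSet fun x hx =>
    (ENNReal.rpow_le_rpow ?_ hp0).trans (rpow_add_le_const_mul hp1 _ _)
  rw [Dmat_sub (hu x hx) (hv x hx), ← ENNReal.ofReal_add (matNorm_nonneg _) (matNorm_nonneg _)]
  refine ENNReal.ofReal_le_ofReal ?_
  conv_lhs => rw [← sub_add_cancel (Dmat u x) (Dmat v x)]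
  exact matNorm_add_le _ _

lemma sobolevEnergy_sub_le {n : ℕ} {Ω : Set (Euc n)} (hΩo : IsOpen Ω) {p : ℝ} (hp1 : 1 ≤ p)
    {u v : Euc n → Euc n} (hu : ∀ x ∈ Ω, DifferentiableAt ℝ u x)
    (hv : ∀ x ∈ Ω, DifferentiableAt ℝ v x) :
    sobolevEnergy Ω p (fun x => u x - v x) ≤
      2 ^ p * (sobolevEnergy Ω p u + sobolevEnergy Ω p v) := by
  have hp0 : 0 < p := by linarith
  have h := sobolevEnergy_le_add hΩo hp1 (u := fun x => u x - v x) (v := fun x => -v x)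
    (fun x hx => (hu x hx).sub (hv x hx)) (fun x hx => (hv x hx).neg)
  have hneg : sobolevEnergy Ω p (fun x => -v x) = sobolevEnergy Ω p v := by
    refine lintegral_congr fun x => ?_
    have : matNorm (Dmat (fun x => -v x) x) = matNorm (Dmat v x) := by
      simp only [matNorm, Dmat, fderiv_fun_neg]
      simp
    rw [enorm_neg, this]
  rw [hneg] at h
  simpa using h

lemma le_of_forall_le_mul_rpow_add {a A B : ℝ≥0∞} (hA : A ≠ ⊤) {p : ℝ} (hp : 0 < p)
    (h : ∀ δ : ℝ, 0 < δ → a ≤ A * ENNReal.ofReal δ ^ p + B) : a ≤ B := by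
  have hlim : Filter.Tendsto (fun δ : ℝ => A * ENNReal.ofReal δ ^ p + B) (nhdsWithin 0 (Ioi 0))
      (nhds (A * ENNReal.ofReal 0 ^ p + B)) := by
    refine Filter.Tendsto.add_const _ (ENNReal.Tendsto.const_mul ?_ (Or.inr hA))
    exact ((ENNReal.continuous_rpow_const.comp ENNReal.continuous_ofReal).tendsto 0).mono_left
      nhdsWithin_le_nhds
  have := ge_of_tendsto hlim (Filter.eventually_of_mem self_mem_nhdsWithin h)
  simpa [ENNReal.zero_rpow_of_pos hp] using this

lemma IsConf.sobolevEnergy_ne_top {n : ℕ} {w : Euc n → Euc n} (hw : IsConf w) {Ω : Set (Euc n)}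
    (hΩb : Bornology.IsBounded Ω) {p : ℝ} (hp : 0 ≤ p) : sobolevEnergy Ω p w ≠ ⊤ := by
  have hK := hΩb.isCompact_closure
  rw [sobolevEnergy_eq]
  refine ENNReal.add_ne_top.2 ⟨?_, ne_top_of_le_ne_top (setLIntegral_rpow_ne_top_of_continuousOn hp
    hK hw.continuous_matNorm_Dmat.continuousOn) (lintegral_mono_set subset_closure)⟩
  have := setLIntegral_rpow_ne_top_of_continuousOn hp hK hw.continuous.norm.continuousOn
  simp only [ofReal_norm] at this
  exact ne_top_of_le_ne_top this (lintegral_mono_set subset_closure)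

/-- Equivalence of norms on the kernel of `lMat`. -/
lemma exists_isConf_sobolevEnergy_le {n : ℕ} {Ω : Set (Euc n)} (hΩo : IsOpen Ω)
    (hne : Ω.Nonempty) (hΩb : Bornology.IsBounded Ω) {p : ℝ} (hp1 : 1 < p) :
    ∃ C : ℝ≥0∞, C ≠ ⊤ ∧ ∀ w, IsConf w → sobolevEnergy Ω p w ≤ C * ∫⁻ x in Ω, ‖w x‖ₑ ^ p := by
  have hp0 : 0 < p := by linarith
  have hvol : volume Ω ≠ ⊤ := hΩb.measure_lt_top.ne
  obtain ⟨x₀, hx₀⟩ := hne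
  obtain ⟨r, hr, hball⟩ := Metric.isOpen_iff.1 hΩo x₀ hx₀
  obtain ⟨D, hD⟩ := hΩb.subset_closedBall x₀
  have hD0 : 0 ≤ D := by simpa using hD hx₀
  obtain ⟨C, hC, h⟩ := exists_isConf_jet_le n (Λ := D / r) (by positivity) r
  set ρ := ENNReal.ofReal (r ^ (n + 1))
  have hρ : ρ ≠ 0 := by simpa [ρ] using pow_pos hr (n + 1)
  have hρt : ρ ≠ ⊤ := ENNReal.ofReal_ne_top
  set A := ρ⁻¹ * C
  have hA : A ≠ ⊤ := ENNReal.mul_ne_top (ENNReal.inv_ne_top.2 hρ) hC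
  refine ⟨2 * A ^ p * volume Ω ^ (p - 1) * volume Ω, ENNReal.mul_ne_top (ENNReal.mul_ne_top
    (ENNReal.mul_ne_top (by simp) (ENNReal.rpow_ne_top_of_nonneg hp0.le hA))
    (ENNReal.rpow_ne_top_of_nonneg (by linarith) hvol)) hvol, fun w hw => ?_⟩
  set I := ∫⁻ x in Ω, ‖w x‖ₑ
  have hpt : ∀ y ∈ Ω, ‖w y‖ₑ + ENNReal.ofReal (matNorm (Dmat w y)) ≤ A * I := by
    intro y hy
    have := h w hw x₀ r hr le_rfl y (by rw [div_mul_cancel₀ _ hr.ne']; exact hD hy)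
    calc ‖w y‖ₑ + ENNReal.ofReal (matNorm (Dmat w y))
        = ρ⁻¹ * ((‖w y‖ₑ + ENNReal.ofReal (matNorm (Dmat w y))) * ρ) := by
          rw [mul_comm _ ρ, ← mul_assoc, ENNReal.inv_mul_cancel hρ hρt, one_mul]
      _ ≤ ρ⁻¹ * (C * I) :=
          mul_le_mul' le_rfl (this.trans (mul_le_mul' le_rfl (lintegral_mono_set hball)))
      _ = A * I := (mul_assoc _ _ _).symm
  have hI : I ^ p ≤ volume Ω ^ (p - 1) * ∫⁻ x in Ω, ‖w x‖ₑ ^ p := by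
    simpa using lintegral_rpow_le (volume.restrict Ω) hp1.le hw.continuous.enorm.measurable.aemeasurable
  calc sobolevEnergy Ω p w ≤ ∫⁻ _ in Ω, 2 * (A * I) ^ p :=
        setLIntegral_mono' hΩo.measurableSet fun y hy => by
          rw [two_mul]
          exact add_le_add (ENNReal.rpow_le_rpow (le_self_add.trans (hpt y hy)) hp0.le)
            (ENNReal.rpow_le_rpow (le_add_self.trans (hpt y hy)) hp0.le)
    _ = 2 * (A ^ p * I ^ p) * volume Ω := by
        rw [setLIntegral_const, ENNReal.mul_rpow_of_nonneg _ _ hp0.le]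
    _ ≤ 2 * (A ^ p * (volume Ω ^ (p - 1) * ∫⁻ x in Ω, ‖w x‖ₑ ^ p)) * volume Ω :=
        mul_le_mul' (mul_le_mul' le_rfl (mul_le_mul' le_rfl hI)) le_rfl
    _ = _ := by ring

lemma exists_sobolevEnergy_sub_isConf_le {n : ℕ} (hn : 3 ≤ n) {p : ℝ} (hp1 : 1 < p)
    {Ω : Set (Euc n)} (hΩo : IsOpen Ω) (hΩ : Ω ≠ univ) (hΩb : Bornology.IsBounded Ω)
    (hJ : IsJohnDomain Ω) :
    ∃ C : ℝ≥0∞, C ≠ ⊤ ∧ ∀ v : Euc n → Euc n, memW1p Ω p v → ∀ δ : ℝ, 0 < δ →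
      ∃ w, IsConf w ∧ sobolevEnergy Ω p (fun x => v x - w x) ≤
        C * ((∫⁻ x in Ω, ENNReal.ofReal (matNorm (lMat v x)) ^ p) + ENNReal.ofReal δ ^ p) := by
  have hp0 : 0 < p := by linarith
  have hvol : volume Ω ≠ ⊤ := hΩb.measure_lt_top.ne
  obtain ⟨C, hC, h⟩ := exists_isConf_korn_john hn hp1 hΩo hΩ hΩb hJ
  refine ⟨C * (2 ^ p * (1 + volume Ω)), ENNReal.mul_ne_top hC (ENNReal.mul_ne_top (two_rpow_ne_top p)
    (ENNReal.add_ne_top.2 ⟨by simp, hvol⟩)), fun v hv δ hδ => ?_⟩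
  have hfin := ((memW1p_iff hΩo hp0).1 hv).2
  rw [sobolevEnergy_eq, ENNReal.add_ne_top] at hfin
  obtain ⟨w, hw, hle⟩ := h v hv.1 hfin.2 δ hδ
  refine ⟨w, hw, ?_⟩
  have heq : sobolevEnergy Ω p (fun x => v x - w x) = ∫⁻ x in Ω, (‖v x - w x‖ₑ ^ p +
      ENNReal.ofReal (matNorm (Dmat v x - Dmat w x)) ^ p) :=
    setLIntegral_congr_fun hΩo.measurableSet fun x hx => by
      simp only [Dmat_sub (hv.1 x hx) (hw.differentiable x)]
  rw [heq]
  refine hle.trans ?_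
  set L := ∫⁻ x in Ω, ENNReal.ofReal (matNorm (lMat v x)) ^ p
  rw [mul_assoc, mul_assoc]
  refine mul_le_mul' le_rfl ?_
  calc ∫⁻ x in Ω, devDensity v δ x ^ p
      ≤ ∫⁻ x in Ω, 2 ^ p * (ENNReal.ofReal (matNorm (lMat v x)) ^ p + ENNReal.ofReal δ ^ p) :=
        lintegral_mono fun x => by
          rw [devDensity, ENNReal.ofReal_add (matNorm_nonneg _) hδ.le]
          exact rpow_add_le_const_mul hp1.le _ _
    _ = 2 ^ p * (1 * L + volume Ω * ENNReal.ofReal δ ^ p) := by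
        rw [lintegral_const_mul' _ _ (two_rpow_ne_top p), lintegral_add_right _ measurable_const,
          setLIntegral_const, one_mul, mul_comm (volume Ω)]
    _ ≤ 2 ^ p * ((1 + volume Ω) * L + (1 + volume Ω) * ENNReal.ofReal δ ^ p) :=
        mul_le_mul' le_rfl (add_le_add (mul_le_mul' le_self_add le_rfl)
          (mul_le_mul' le_add_self le_rfl))
    _ = _ := by ring

lemma exists_memSigma_sobolevEnergy_le {n : ℕ} (hn : 3 ≤ n) {p : ℝ} (hp1 : 1 < p)
    {Ω : Set (Euc n)} (hΩo : IsOpen Ω) (hne : Ω.Nonempty) (hΩ : Ω ≠ univ)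
    (hΩb : Bornology.IsBounded Ω) (hJ : IsJohnDomain Ω) :
    ∃ C : ℝ≥0∞, C ≠ ⊤ ∧ ∀ w, memSigma Ω p w →
      sobolevEnergy Ω p w ≤ C * ∫⁻ x in Ω, ‖w x‖ₑ ^ p := by
  have hp0 : 0 < p := by linarith
  obtain ⟨C₀, hC₀, h₀⟩ := exists_sobolevEnergy_sub_isConf_le hn hp1 hΩo hΩ hΩb hJ
  obtain ⟨C₁, hC₁, h₁⟩ := exists_isConf_sobolevEnergy_le hΩo hne hΩb hp1
  refine ⟨2 ^ p * (C₁ * 2 ^ p), ENNReal.mul_ne_top (two_rpow_ne_top p)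
    (ENNReal.mul_ne_top hC₁ (two_rpow_ne_top p)), fun w hw => ?_⟩
  refine le_of_forall_le_mul_rpow_add (A := 2 ^ p * (1 + C₁ * 2 ^ p) * C₀) (ENNReal.mul_ne_top
    (ENNReal.mul_ne_top (two_rpow_ne_top p) (ENNReal.add_ne_top.2 ⟨by simp,
      ENNReal.mul_ne_top hC₁ (two_rpow_ne_top p)⟩)) hC₀) hp0 fun δ hδ => ?_
  obtain ⟨q, hq, hle⟩ := h₀ w hw.1 δ hδ
  have hL : ∫⁻ x in Ω, ENNReal.ofReal (matNorm (lMat w x)) ^ p = 0 := by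
    rw [setLIntegral_congr_fun hΩo.measurableSet (g := fun _ => 0) fun x hx => ?_, lintegral_zero]
    simp only [hw.2 x hx]
    simp [matNorm, hp0]
  rw [hL, zero_add] at hle
  set ε := sobolevEnergy Ω p (fun x => w x - q x) with hε
  have hqw : ∫⁻ x in Ω, ‖q x‖ₑ ^ p ≤ 2 ^ p * (ε + ∫⁻ x in Ω, ‖w x‖ₑ ^ p) := by
    refine (lintegral_enorm_le_add hΩo hp1.le hw.1.1).trans
      (mul_le_mul' le_rfl (add_le_add ?_ le_rfl))
    simp only [← enorm_neg (q _ - w _), neg_sub]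
    exact lintegral_mono fun x => le_self_add
  calc sobolevEnergy Ω p w ≤ 2 ^ p * (ε + sobolevEnergy Ω p q) :=
        sobolevEnergy_le_add hΩo hp1.le hw.1.1 fun x _ => hq.differentiable x
    _ ≤ 2 ^ p * (ε + C₁ * (2 ^ p * (ε + ∫⁻ x in Ω, ‖w x‖ₑ ^ p))) :=
        mul_le_mul' le_rfl (add_le_add le_rfl ((h₁ q hq).trans (mul_le_mul' le_rfl hqw)))
    _ = 2 ^ p * (1 + C₁ * 2 ^ p) * ε + 2 ^ p * (C₁ * 2 ^ p) * ∫⁻ x in Ω, ‖w x‖ₑ ^ p := by ring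
    _ ≤ _ := add_le_add ((mul_le_mul' le_rfl hle).trans_eq (by ring)) le_rfl

lemma integrableOn_matNorm_lMat_rpow {n : ℕ} {Ω : Set (Euc n)} {p : ℝ} (hp : 0 ≤ p)
    {v : Euc n → Euc n} (hv : memW1p Ω p v) :
    IntegrableOn (fun x => matNorm (lMat v x) ^ p) Ω := by
  refine Integrable.mono' (hv.2.2.const_mul ((2 * n * n : ℝ) ^ p))
    ((measurable_matNorm (measurable_lMat v)).pow_const p).aestronglyMeasurable
    (Filter.Eventually.of_forall fun x => ?_)
  rw [Real.norm_of_nonneg (Real.rpow_nonneg (matNorm_nonneg _) _),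
    ← Real.mul_rpow (by positivity) (matNorm_nonneg _)]
  exact Real.rpow_le_rpow (matNorm_nonneg _) (matNorm_lMat_le v x) hp

end

/-- Reshetnyak's generalized Korn inequality on bounded John domains:
`‖v − P(v)‖_{W^{1,p}(Ω)} ≤ C ‖l(v)‖_{L^p(Ω)}` for any projection `P : W^{1,p} → Σ`
that is continuous with `Σ` endowed with the `L^p` topology. -/
theorem reshetnyak_korn_on_john_domains
    {n : ℕ} (hn : 3 ≤ n) (Ω : Set (Euc n)) (hΩo : IsOpen Ω) (hΩc : IsConnected Ω)
    (hΩb : Bornology.IsBounded Ω) (hJ : IsJohnDomain Ω) (p : ℝ) (hp1 : 1 < p)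
    (P : (Euc n → Euc n) → Euc n → Euc n)
    (hPmem : ∀ v, memW1p Ω p v → memSigma Ω p (P v))
    (hPadd : ∀ v w, memW1p Ω p v → memW1p Ω p w → ∀ x ∈ Ω, P (v + w) x = P v x + P w x)
    (hPsmul : ∀ (c : ℝ) v, memW1p Ω p v → ∀ x ∈ Ω, P (c • v) x = c • P v x)
    (hPproj : ∀ w, memSigma Ω p w → ∀ x ∈ Ω, P w x = w x)
    (hPcont : ∃ M : ℝ, ∀ v, memW1p Ω p v → LpNorm Ω p (P v) ≤ M * W1pNorm Ω p v) :
    ∃ C : ℝ, ∀ v, memW1p Ω p v →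
      W1pNorm Ω p (fun x => v x - P v x) ≤
        C * (∫ x in Ω, matNorm (lMat v x) ^ p) ^ (1 / p) := by
  have hp0 : 0 < p := by linarith
  have hΩ : Ω ≠ univ := by
    rintro rfl
    have : Nonempty (Fin n) := ⟨⟨0, by omega⟩⟩
    exact NormedSpace.unbounded_univ ℝ (Euc n) hΩb
  obtain ⟨M, hM⟩ := hPcont
  obtain ⟨C₀, hC₀, h₀⟩ := exists_sobolevEnergy_sub_isConf_le hn hp1 hΩo hΩ hΩb hJ
  obtain ⟨C₁, hC₁, h₁⟩ :=
    exists_memSigma_sobolevEnergy_le hn hp1 hΩo hΩc.nonempty hΩ hΩb hJ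
  set B : ℝ≥0∞ := 2 ^ p * (1 + C₁ * ENNReal.ofReal M ^ p) * C₀
  have hB : B ≠ ⊤ := ENNReal.mul_ne_top (ENNReal.mul_ne_top (two_rpow_ne_top p)
    (ENNReal.add_ne_top.2 ⟨by simp, ENNReal.mul_ne_top hC₁
      (ENNReal.rpow_ne_top_of_nonneg hp0.le ENNReal.ofReal_ne_top)⟩)) hC₀
  have hproj : ∀ u, memW1p Ω p u → sobolevEnergy Ω p (fun x => u x - P u x) ≤
      2 ^ p * (1 + C₁ * ENNReal.ofReal M ^ p) * sobolevEnergy Ω p u := by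
    intro u hu
    have hPu := hPmem u hu
    have hle : ∫⁻ x in Ω, ‖P u x‖ₑ ^ p ≤ ENNReal.ofReal M ^ p * sobolevEnergy Ω p u := by
      rw [← ofReal_LpNorm_rpow hp0 hPu.1, ← ofReal_W1pNorm_rpow hp0 hu,
        ← ENNReal.mul_rpow_of_nonneg _ _ hp0.le]
      refine ENNReal.rpow_le_rpow ((ENNReal.ofReal_le_ofReal (hM u hu)).trans_eq ?_) hp0.le
      refine ENNReal.ofReal_mul' (Real.rpow_nonneg (add_nonneg (integral_nonneg fun x => ?_)
        (integral_nonneg fun x => Real.rpow_nonneg (matNorm_nonneg _) _)) _)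
      exact Real.rpow_nonneg (norm_nonneg _) _
    calc sobolevEnergy Ω p (fun x => u x - P u x)
        ≤ 2 ^ p * (sobolevEnergy Ω p u + sobolevEnergy Ω p (P u)) :=
          sobolevEnergy_sub_le hΩo hp1.le hu.1 hPu.1.1
      _ ≤ 2 ^ p * (sobolevEnergy Ω p u + C₁ * (ENNReal.ofReal M ^ p * sobolevEnergy Ω p u)) :=
          mul_le_mul' le_rfl (add_le_add le_rfl ((h₁ _ hPu).trans (mul_le_mul' le_rfl hle)))
      _ = _ := by ring
  refine ⟨B.toReal ^ (1 / p), fun v hv => ?_⟩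
  have hPv := hPmem v hv
  have key : sobolevEnergy Ω p (fun x => v x - P v x) ≤
      B * ∫⁻ x in Ω, ENNReal.ofReal (matNorm (lMat v x)) ^ p := by
    refine le_of_forall_le_mul_rpow_add hB hp0 fun δ hδ => ?_
    obtain ⟨w, hw, hle⟩ := h₀ v hv δ hδ
    have hwS : memSigma Ω p w := ⟨(memW1p_iff hΩo hp0).2 ⟨fun x _ => hw.differentiable x,
      hw.sobolevEnergy_ne_top hΩb hp0.le⟩, fun x _ => hw.lMat_eq x⟩
    have hu : memW1p Ω p (v - w) := (memW1p_iff hΩo hp0).2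
      ⟨fun x hx => (hv.1 x hx).sub (hw.differentiable x), ne_top_of_le_ne_top
        (ENNReal.mul_ne_top (two_rpow_ne_top p) (ENNReal.add_ne_top.2
          ⟨((memW1p_iff hΩo hp0).1 hv).2, hw.sobolevEnergy_ne_top hΩb hp0.le⟩))
        (sobolevEnergy_sub_le hΩo hp1.le hv.1 fun x _ => hw.differentiable x)⟩
    have heq : ∀ x ∈ Ω, v x - P v x = (v - w) x - P (v - w) x := fun x hx => by
      have h := hPadd (v - w) w hu hwS.1 x hx
      rw [sub_add_cancel, hPproj w hwS x hx] at h
      rw [h, Pi.sub_apply]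
      abel
    rw [sobolevEnergy_congr hΩo p heq]
    refine ((hproj _ hu).trans (mul_le_mul' le_rfl hle)).trans_eq ?_
    ring
  have hmem : memW1p Ω p fun x => v x - P v x := (memW1p_iff hΩo hp0).2
    ⟨fun x hx => (hv.1 x hx).sub (hPv.1.1 x hx), ne_top_of_le_ne_top
      (ENNReal.mul_ne_top (two_rpow_ne_top p) (ENNReal.add_ne_top.2
        ⟨((memW1p_iff hΩo hp0).1 hv).2, ((memW1p_iff hΩo hp0).1 hPv.1).2⟩))
      (sobolevEnergy_sub_le hΩo hp1.le hv.1 hPv.1.1)⟩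
  have hL : 0 ≤ ∫ x in Ω, matNorm (lMat v x) ^ p :=
    integral_nonneg fun x => Real.rpow_nonneg (matNorm_nonneg _) _
  rw [← ofReal_integral_matNorm_rpow hp0.le (integrableOn_matNorm_lMat_rpow hp0.le hv),
    ← ofReal_W1pNorm_rpow hp0 hmem, ← ENNReal.ofReal_toReal hB,
    ← ENNReal.ofReal_mul ENNReal.toReal_nonneg] at key
  have hW : 0 ≤ W1pNorm Ω p fun x => v x - P v x :=
    Real.rpow_nonneg (add_nonneg (integral_nonneg fun x => Real.rpow_nonneg (norm_nonneg _) _)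
      (integral_nonneg fun x => Real.rpow_nonneg (matNorm_nonneg _) _)) _
  rw [ENNReal.ofReal_rpow_of_nonneg hW hp0.le, ENNReal.ofReal_le_ofReal_iff
    (mul_nonneg ENNReal.toReal_nonneg hL)] at key
  rw [← Real.mul_rpow ENNReal.toReal_nonneg hL, one_div]
  exact (Real.le_rpow_inv_iff_of_pos hW (mul_nonneg ENNReal.toReal_nonneg hL) hp0).2 key


end
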